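/- Let G=(V,E,I,T) be an inner Eulerian grapht. Then there exist a system 𝒫 of pairwise edge-disjoint T-paths and a family {X_t : t∈T} of pairwise disjoint vertex sets with t∈X_t for each t∈T, such that for every t∈T the cut δ_G(X_t) separates t and T−t and consists of exactly one edge from each path in 𝒫 having t as an endpoint (i.e., the witnessing cuts can be chosen to form a nested family). -/

import Mathlib

/-! Common definitions: graphts (multigraphs with terminals), walks, paths, cycles,
edge cuts, inner Eulerian graphts, path systems, linkages, Erdős–Menger cuts,
restriction (edge deletion) and contraction. -/

universe u v

/-- A *grapht*: a multigraph (no loops, parallel edges allowed) given by an incidence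
function `I : E → Sym2 V`, together with a set `T` of at least two terminal vertices. -/
structure Grapht (V : Type u) (E : Type v) where
  I : E → Sym2 V
  loopless : ∀ e : E, ¬ (I e).IsDiag
  T : Set V
  T_nontrivial : T.Nontrivial

namespace Grapht

variable {V : Type u} {E : Type v}

/-- `G.IsWalk vs es` holds when `vs` is the vertex sequence and `es` the edge sequence
of a walk in `G`. -/
inductive IsWalk (G : Grapht V E) : List V → List E → Prop
  | nil (v : V) : IsWalk G [v] []
  | cons {u w : V} {vs : List V} {e : E} {es : List E} :
      G.I e = s(u, w) → IsWalk G (w :: vs) es → IsWalk G (u :: w :: vs) (e :: es)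

/-- A finite path in the grapht `G` (no repeated vertices), with endpoints `first`, `last`. -/
structure Path (G : Grapht V E) where
  first : V
  last : V
  verts : List V
  edges : List E
  isWalk : G.IsWalk verts edges
  nodup : verts.Nodup
  head_eq : verts.head? = some first
  getLast_eq : verts.getLast? = some last

/-- A finite cycle in the grapht `G`. -/
structure Cycle (G : Grapht V E) where
  verts : List V
  edges : List E
  isWalk : G.IsWalk verts edges
  closed : verts.head? = verts.getLast?
  nontrivial : edges ≠ []
  edges_nodup : edges.Nodup
  tail_nodup : verts.tail.Nodup

variable {G : Grapht V E}

/-- The internal (inner) vertices of a path. -/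
def Path.inner (P : G.Path) : List V := (P.verts.drop 1).dropLast

/-- The edge set of a path. -/
def Path.edgeSet (P : G.Path) : Set E := {e | e ∈ P.edges}

/-- The edge set of a cycle. -/
def Cycle.edgeSet (C : G.Cycle) : Set E := {e | e ∈ C.edges}

variable (G)

/-- `δ_G(X)`: the set of edges with exactly one endpoint in `X`. -/
def edgeCut (X : Set V) : Set E :=
  {e | ∃ u w, G.I e = s(u, w) ∧ u ∈ X ∧ w ∉ X}

/-- A grapht is *inner Eulerian* if there is no `X ⊆ V ∖ T` whose cut `δ(X)` is a
finite set of odd size. -/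
def InnerEulerian : Prop :=
  ∀ X : Set V, Disjoint X G.T → ¬ ((G.edgeCut X).Finite ∧ Odd (G.edgeCut X).ncard)

/-- An `AB`-path: a path with first vertex in `A`, last vertex in `B` and no internal
vertex in `A ∪ B`. -/
def IsABPath (A B : Set V) (P : G.Path) : Prop :=
  P.first ∈ A ∧ P.last ∈ B ∧ ∀ v ∈ P.inner, v ∉ A ∪ B

/-- A `T`-path: a path between two distinct terminal vertices without internal
terminal vertices. -/
def IsTPath (P : G.Path) : Prop :=
  P.first ∈ G.T ∧ P.last ∈ G.T ∧ P.first ≠ P.last ∧ ∀ v ∈ P.inner, v ∉ G.T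

/-- A system of pairwise edge-disjoint paths. -/
def EdgeDisjoint (Ps : Set G.Path) : Prop :=
  Ps.Pairwise fun P Q => ∀ e, e ∈ P.edges → e ∉ Q.edges

/-- A system of pairwise edge-disjoint `T`-paths. -/
def IsTPathSystem (Ps : Set G.Path) : Prop :=
  G.EdgeDisjoint Ps ∧ ∀ P ∈ Ps, G.IsTPath P

/-- The set of edges used by a path system. -/
def sysEdges (Ps : Set G.Path) : Set E := ⋃ P ∈ Ps, P.edgeSet

/-- `C` is *orthogonal* to the path system `Ps`: `C` consists of exactly one edge from
each path of `Ps`. -/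
def Orthogonal (C : Set E) (Ps : Set G.Path) : Prop :=
  (∀ P ∈ Ps, ∃! e, e ∈ C ∧ e ∈ P.edges) ∧ ∀ e ∈ C, ∃ P ∈ Ps, e ∈ P.edges

/-- `C` separates `A` and `B`: every `AB`-path meets `C` (i.e. `G − C` has no `AB`-path). -/
def Separates (C : Set E) (A B : Set V) : Prop :=
  ∀ P : G.Path, G.IsABPath A B P → ∃ e ∈ C, e ∈ P.edges

/-- An `AB`-cut. -/
def IsABCut (A B : Set V) (C : Set E) : Prop :=
  ∀ P : G.Path, G.IsABPath A B P → ∃ e ∈ C, e ∈ P.edges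

/-- An Erdős–Menger `AB`-cut: an `AB`-cut orthogonal to some system of pairwise
edge-disjoint `AB`-paths. -/
def IsEMABCut (A B : Set V) (C : Set E) : Prop :=
  G.IsABCut A B C ∧
    ∃ Ps : Set G.Path, G.EdgeDisjoint Ps ∧ (∀ P ∈ Ps, G.IsABPath A B P) ∧ G.Orthogonal C Ps

/-- The order `⊴` on (Erdős–Menger) `AB`-cuts: on every `AB`-path the first edge of `C`
comes no later than the first edge of `C'`. -/
def ABCutLE (A B : Set V) (C C' : Set E) : Prop :=
  ∀ P : G.Path, G.IsABPath A B P →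
    ∀ i : Fin P.edges.length, P.edges.get i ∈ C' →
      ∃ j : Fin P.edges.length, (j : ℕ) ≤ (i : ℕ) ∧ P.edges.get j ∈ C

/-- `C` is the `⊴`-largest Erdős–Menger `AB`-cut. -/
def IsLargestEMABCut (A B : Set V) (C : Set E) : Prop :=
  G.IsEMABCut A B C ∧ ∀ C', G.IsEMABCut A B C' → G.ABCutLE A B C' C

/-- A system `Ps` of pairwise edge-disjoint `T`-paths *links* the terminal `t`:
it covers `δ(t)`. -/
def Links (Ps : Set G.Path) (t : V) : Prop :=
  G.IsTPathSystem Ps ∧ ∀ e ∈ G.edgeCut {t}, ∃ P ∈ Ps, e ∈ P.edges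

/-- The terminal `t` is linked. -/
def Linked (t : V) : Prop := ∃ Ps : Set G.Path, G.Links Ps t

/-- The linkability condition: every terminal is linked. -/
def LinkabilityCondition : Prop := ∀ t ∈ G.T, G.Linked t

/-- A perfect linkage: a system of pairwise edge-disjoint `T`-paths linking every
terminal. -/
def IsPerfectLinkage (Ps : Set G.Path) : Prop :=
  G.IsTPathSystem Ps ∧ ∀ t ∈ G.T, ∀ e ∈ G.edgeCut {t}, ∃ P ∈ Ps, e ∈ P.edges

/-- In the two-terminal setting: a system of pairwise edge-disjoint `st`-paths
covering `δ(s)` (a linkage of `s`). -/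
def IsStLinkage (s t : V) (Ps : Set G.Path) : Prop :=
  G.EdgeDisjoint Ps ∧ (∀ P ∈ Ps, G.IsABPath {s} {t} P) ∧
    ∀ e ∈ G.edgeCut {s}, ∃ P ∈ Ps, e ∈ P.edges

/-- `s` is linked (two-terminal setting). -/
def StLinked (s t : V) : Prop := ∃ Ps : Set G.Path, G.IsStLinkage s t Ps

/-- `λ_G(A,B)`: the maximal number of pairwise edge-disjoint `AB`-paths. -/
noncomputable def lambda (A B : Set V) : ℕ :=
  sSup {n : ℕ | ∃ Ps : Set G.Path, G.EdgeDisjoint Ps ∧ (∀ P ∈ Ps, G.IsABPath A B P) ∧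
    Ps.Finite ∧ Ps.ncard = n}

/-- The grapht obtained by deleting all edges outside `F`. -/
def restrict (F : Set E) : Grapht V F where
  I e := G.I e.1
  loopless e := G.loopless e.1
  T := G.T
  T_nontrivial := G.T_nontrivial

/-- The map sending every vertex of a contracted set `X t` (`t ∈ T`) to `t`. -/
noncomputable def contractMap (X : V → Set V) : V → V := fun v =>
  letI := Classical.dec (∃ u ∈ G.T, v ∈ X u)
  if h : ∃ u ∈ G.T, v ∈ X u then h.choose else v

/-- The contraction `G/ℱ` of the family `ℱ = {X t : t ∈ T}`: each `X t` is contracted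
to `t` and the arising loops are deleted. -/
noncomputable def contract (X : V → Set V) :
    Grapht V {e : E // ¬ ((G.I e).map (G.contractMap X)).IsDiag} where
  I e := (G.I e.1).map (G.contractMap X)
  loopless e := e.2
  T := G.T
  T_nontrivial := G.T_nontrivial

end Grapht


namespace LC
open Classical
universe w
variable {V : Type u} {E : Type v} {ι : Type w}

/-- edges of `F` with exactly one end in `S` -/
def cut (I : E → Sym2 V) (F : Set E) (S : Set V) : Set E :=
  {e | e ∈ F ∧ ∃ a b, I e = s(a, b) ∧ a ∈ S ∧ b ∉ S}

/-- edges of `F` with both ends in `S` -/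
def Ins (I : E → Sym2 V) (F : Set E) (S : Set V) : Set E :=
  {e | e ∈ F ∧ ∀ v ∈ I e, v ∈ S}

def Conn (I : E → Sym2 V) (F : Set E) (a b : V) : Prop :=
  Relation.ReflTransGen (fun x y => ∃ e ∈ F, I e = s(x, y)) a b

def DReach (D : Set (E × V × V)) (a b : V) : Prop :=
  Relation.ReflTransGen (fun x y => ∃ e, (e, x, y) ∈ D) a b

def ed (p : Finset (E × V × V)) : Set E := {e | ∃ d ∈ p, d.1 = e}

structure Flow (I : E → Sym2 V) (F : Set E) (p : Finset (E × V × V)) (a b : V) : Prop where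
  mem : ∀ d ∈ p, d.1 ∈ F
  inc : ∀ d ∈ p, I d.1 = s(d.2.1, d.2.2)
  inj : ∀ d ∈ p, ∀ d' ∈ p, d.1 = d'.1 → d = d'
  pot : ∀ g : V → ℤ, ∑ d ∈ p, (g d.2.1 - g d.2.2) = g a - g b

structure Clean (p : Finset (E × V × V)) (a b : V) : Prop where
  no_tgt : ∀ d ∈ p, d.2.2 ≠ a
  src_uniq : ∀ d ∈ p, ∀ d' ∈ p, d.2.1 = a → d'.2.1 = a → d = d'
  no_src : ∀ d ∈ p, d.2.1 ≠ b
  reach : ∀ d ∈ p, DReach (p : Set (E × V × V)) a d.2.1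

structure Link (I : E → Sym2 V) (J : Set E) (t : V) (B : Set ι) (v : ι → V)
    (p : ι → Finset (E × V × V)) : Prop where
  flow : ∀ i ∈ B, Flow I J (p i) t (v i)
  disj : ∀ i ∈ B, ∀ j ∈ B, i ≠ j → Disjoint (ed (p i)) (ed (p j))

theorem mem_ed {p : Finset (E × V × V)} {d : E × V × V} (h : d ∈ p) : d.1 ∈ ed p := ⟨d, h, rfl⟩

theorem ed_mono {p q : Finset (E × V × V)} (h : p ⊆ q) : ed p ⊆ ed q := by
  rintro e ⟨d, hd, rfl⟩; exact ⟨d, h hd, rfl⟩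

theorem ed_union {p q : Finset (E × V × V)} : ed (p ∪ q) = ed p ∪ ed q := by
  ext e; simp only [ed, Finset.mem_union, Set.mem_ofPred_eq, Set.mem_union]
  constructor
  · rintro ⟨d, h | h, rfl⟩
    · exact Or.inl ⟨d, h, rfl⟩
    · exact Or.inr ⟨d, h, rfl⟩
  · rintro (⟨d, h, rfl⟩ | ⟨d, h, rfl⟩)
    · exact ⟨d, Or.inl h, rfl⟩
    · exact ⟨d, Or.inr h, rfl⟩

theorem ed_empty : ed (∅ : Finset (E × V × V)) = ∅ := by
  ext e; simp [ed]

theorem ed_singleton (d : E × V × V) : ed ({d} : Finset (E × V × V)) = {d.1} := by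
  ext e; simp [ed, eq_comm]

theorem ed_finite (p : Finset (E × V × V)) : (ed p).Finite := by
  have : ed p = ((p.image Prod.fst : Finset E) : Set E) := by
    ext e; simp [ed]
  rw [this]; exact Finset.finite_toSet _

theorem rtg_mono {α : Type*} {r s : α → α → Prop} (h : ∀ x y, r x y → s x y) {a b : α}
    (hr : Relation.ReflTransGen r a b) : Relation.ReflTransGen s a b := by
  induction hr with
  | refl => exact .refl
  | tail _ h1 ih => exact ih.tail (h _ _ h1)

theorem DReach.mono {D D' : Set (E × V × V)} (h : D ⊆ D') {a b : V} (hr : DReach D a b) :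
    DReach D' a b := by
  refine rtg_mono ?_ hr
  rintro x y ⟨e, he⟩; exact ⟨e, h he⟩

theorem DReach.tail {D : Set (E × V × V)} {a b c : V} {e : E} (h : DReach D a b)
    (hd : (e, b, c) ∈ D) : DReach D a c := Relation.ReflTransGen.tail h ⟨e, hd⟩

theorem Conn.mono {I : E → Sym2 V} {F F' : Set E} (h : F ⊆ F') {a b : V} (hr : Conn I F a b) :
    Conn I F' a b := by
  refine rtg_mono ?_ hr
  rintro x y ⟨e, he, hx⟩; exact ⟨e, h he, hx⟩

theorem Conn.refl {I : E → Sym2 V} {F : Set E} (a : V) : Conn I F a a := Relation.ReflTransGen.refl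

theorem Conn.symm {I : E → Sym2 V} {F : Set E} {a b : V} (h : Conn I F a b) : Conn I F b a := by
  induction h with
  | refl => exact Relation.ReflTransGen.refl
  | tail _ h1 ih =>
    obtain ⟨e, he, hx⟩ := h1
    exact Relation.ReflTransGen.head ⟨e, he, by rw [hx, Sym2.eq_swap]⟩ ih

theorem Conn.trans {I : E → Sym2 V} {F : Set E} {a b c : V} (h : Conn I F a b)
    (h' : Conn I F b c) : Conn I F a c := Relation.ReflTransGen.trans h h'

theorem Conn.single {I : E → Sym2 V} {F : Set E} {a b : V} {e : E} (he : e ∈ F)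
    (h : I e = s(a, b)) : Conn I F a b := Relation.ReflTransGen.single ⟨e, he, h⟩

/-- induction: a set closed under the edges contains the whole component -/
theorem Conn.closed {I : E → Sym2 V} {F : Set E} {a b : V} (h : Conn I F a b) (S : Set V)
    (ha : a ∈ S) (hS : ∀ e ∈ F, ∀ x y, I e = s(x, y) → x ∈ S → y ∈ S) : b ∈ S := by
  induction h with
  | refl => exact ha
  | tail _ h ih => obtain ⟨e, he, hx⟩ := h; exact hS e he _ _ hx ih

theorem DReach.closed {D : Set (E × V × V)} {a b : V} (h : DReach D a b) (S : Set V)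
    (ha : a ∈ S) (hS : ∀ d ∈ D, d.2.1 ∈ S → d.2.2 ∈ S) : b ∈ S := by
  induction h with
  | refl => exact ha
  | tail _ h ih => obtain ⟨e, he⟩ := h; exact hS _ he ih

theorem DReach.conn {I : E → Sym2 V} {F : Set E} {D : Set (E × V × V)} {a b : V}
    (h : DReach D a b) (hD : ∀ d ∈ D, d.1 ∈ F ∧ I d.1 = s(d.2.1, d.2.2)) : Conn I F a b := by
  refine rtg_mono ?_ h
  rintro x y ⟨e, he⟩; exact ⟨e, hD _ he⟩

/-- reach set of `a` closed under darts; used with potentials -/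
theorem pot_reach {p : Finset (E × V × V)} {a : V} :
    ∑ d ∈ p, ((if DReach (p : Set (E × V × V)) a d.2.1 then (1 : ℤ) else 0)
      - (if DReach (p : Set (E × V × V)) a d.2.2 then (1 : ℤ) else 0)) ≤ 0 := by
  apply Finset.sum_nonpos
  rintro ⟨e, x, y⟩ hd
  by_cases hx : DReach (p : Set (E × V × V)) a x
  · have : DReach (p : Set (E × V × V)) a y := hx.tail hd
    simp [hx, this]
  · simp only [hx, if_false]; split_ifs <;> simp

theorem reach_of_pot {p : Finset (E × V × V)} {a b : V}
    (h : ∀ g : V → ℤ, ∑ d ∈ p, (g d.2.1 - g d.2.2) = g a - g b) :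
    DReach (p : Set (E × V × V)) a b := by
  by_contra hb
  have h1 := h (fun x => if DReach (p : Set (E × V × V)) a x then (1 : ℤ) else 0)
  have h2 := pot_reach (p := p) (a := a)
  have h3 : DReach (p : Set (E × V × V)) a a := Relation.ReflTransGen.refl
  simp only [h3, hb, if_true, if_false] at h1
  omega

namespace Flow
variable {I : E → Sym2 V} {F F' : Set E} {p q : Finset (E × V × V)} {a b c : V}

theorem reach (h : Flow I F p a b) : DReach (p : Set (E × V × V)) a b := reach_of_pot h.pot

theorem ed_sub (h : Flow I F p a b) : ed p ⊆ F := by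
  rintro e ⟨d, hd, rfl⟩; exact h.mem d hd

theorem conn (h : Flow I F p a b) : Conn I F a b :=
  h.reach.conn (fun d hd => ⟨h.mem d hd, h.inc d hd⟩)

theorem of_ed (h : Flow I F p a b) (h' : ed p ⊆ F') : Flow I F' p a b :=
  ⟨fun d hd => h' (mem_ed hd), h.inc, h.inj, h.pot⟩

theorem mono (h : Flow I F p a b) (h' : F ⊆ F') : Flow I F' p a b := h.of_ed (h.ed_sub.trans h')

theorem nil (a : V) : Flow I F ∅ a a := ⟨by simp, by simp, by simp, by simp⟩

theorem single {e : E} (he : e ∈ F) (h : I e = s(a, b)) : Flow I F {(e, a, b)} a b :=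
  ⟨by simpa using he, by simpa using h, by simp, by simp⟩

theorem append (h : Flow I F p a b) (h' : Flow I F q b c) (hd : Disjoint (ed p) (ed q)) :
    Flow I F (p ∪ q) a c := by
  have hdj : Disjoint p q := by
    rw [Finset.disjoint_left]; intro d h1 h2
    exact Set.disjoint_left.1 hd (mem_ed h1) (mem_ed h2)
  refine ⟨?_, ?_, ?_, ?_⟩
  · intro d hd; rcases Finset.mem_union.1 hd with h1 | h1
    exacts [h.mem d h1, h'.mem d h1]
  · intro d hd; rcases Finset.mem_union.1 hd with h1 | h1
    exacts [h.inc d h1, h'.inc d h1]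
  · intro d h1 d' h2 he
    rcases Finset.mem_union.1 h1 with h1 | h1 <;> rcases Finset.mem_union.1 h2 with h2 | h2
    · exact h.inj d h1 d' h2 he
    · exact absurd (mem_ed h2) (he ▸ Set.disjoint_left.1 hd (mem_ed h1))
    · exact absurd (mem_ed h1) (he ▸ Set.disjoint_left.1 hd (mem_ed h2))
    · exact h'.inj d h1 d' h2 he
  · intro g; rw [Finset.sum_union hdj, h.pot, h'.pot]; ring

theorem sdiff (h : Flow I F p a b) (h' : Flow I F' q a c) (hs : q ⊆ p) :
    Flow I F (p \ q) c b := by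
  refine ⟨fun d hd => h.mem d (Finset.mem_sdiff.1 hd).1, fun d hd => h.inc d (Finset.mem_sdiff.1 hd).1,
    fun d hd d' hd' => h.inj d (Finset.mem_sdiff.1 hd).1 d' (Finset.mem_sdiff.1 hd').1, ?_⟩
  intro g
  have := Finset.sum_sdiff (f := fun d : E × V × V => g d.2.1 - g d.2.2) hs
  rw [h.pot, h'.pot] at this; linarith

theorem ed_sdiff_disj (h : Flow I F p a b) (hs : q ⊆ p) : Disjoint (ed (p \ q)) (ed q) := by
  rw [Set.disjoint_left]
  rintro e ⟨d, hd, rfl⟩ ⟨d', hd', he⟩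
  rw [Finset.mem_sdiff] at hd
  have := h.inj d hd.1 d' (hs hd') he.symm
  subst this; exact hd.2 hd'

end Flow

noncomputable def rev (p : Finset (E × V × V)) : Finset (E × V × V) := p.image (fun d => (d.1, d.2.2, d.2.1))

theorem mem_rev {p : Finset (E × V × V)} {e : E} {x y : V} : (e, x, y) ∈ rev p ↔ (e, y, x) ∈ p := by
  simp only [rev, Finset.mem_image, Prod.mk.injEq, Prod.exists]
  constructor
  · rintro ⟨e', x', y', h, rfl, rfl, rfl⟩; exact h
  · intro h; exact ⟨e, y, x, h, rfl, rfl, rfl⟩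

theorem ed_rev (p : Finset (E × V × V)) : ed (rev p) = ed p := by
  ext e; constructor
  · rintro ⟨⟨e, x, y⟩, hd, rfl⟩; exact ⟨_, mem_rev.1 hd, rfl⟩
  · rintro ⟨⟨e, x, y⟩, hd, rfl⟩; exact ⟨_, mem_rev.2 hd, rfl⟩

theorem sum_rev (p : Finset (E × V × V)) (g : V → ℤ) :
    ∑ d ∈ rev p, (g d.2.1 - g d.2.2) = - ∑ d ∈ p, (g d.2.1 - g d.2.2) := by
  rw [rev, Finset.sum_image, ← Finset.sum_neg_distrib]
  · refine Finset.sum_congr rfl (fun d _ => ?_); simp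
  · rintro ⟨e, x, y⟩ _ ⟨e', x', y'⟩ _ h
    simp only [Prod.mk.injEq] at h ⊢; tauto

theorem Flow.rev {I : E → Sym2 V} {F : Set E} {p : Finset (E × V × V)} {a b : V}
    (h : Flow I F p a b) : Flow I F (LC.rev p) b a := by
  refine ⟨?_, ?_, ?_, ?_⟩
  · rintro ⟨e, x, y⟩ hd; exact h.mem (e, y, x) (mem_rev.1 hd)
  · rintro ⟨e, x, y⟩ hd; have h1 := h.inc (e, y, x) (mem_rev.1 hd); exact h1.trans Sym2.eq_swap
  · rintro ⟨e, x, y⟩ hd ⟨e', x', y'⟩ hd' he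
    have := h.inj _ (mem_rev.1 hd) _ (mem_rev.1 hd') he
    simp only [Prod.mk.injEq] at this ⊢; tauto
  · intro g; rw [sum_rev, h.pot]; ring

/-- distance layered paths -/
theorem reach_flow {I : E → Sym2 V} {F : Set E} {D : Set (E × V × V)} {a b : V}
    (hD : ∀ d ∈ D, d.1 ∈ F ∧ I d.1 = s(d.2.1, d.2.2)) (h : DReach D a b) :
    ∃ p : Finset (E × V × V), (p : Set (E × V × V)) ⊆ D ∧ Flow I F p a b ∧ Clean p a b := by
  -- `L n x`: a walk of length `n`
  let L : ℕ → V → Prop := fun n => Nat.rec (fun x => x = a)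
    (fun _ P y => ∃ e x, (e, x, y) ∈ D ∧ P x) n
  have hL0 : ∀ x, L 0 x ↔ x = a := fun x => Iff.rfl
  have hLs : ∀ n y, L (n+1) y ↔ ∃ e x, (e, x, y) ∈ D ∧ L n x := fun n y => Iff.rfl
  let M : ℕ → V → Prop := fun n x => L n x ∧ ∀ m < n, ¬ L m x
  have Muniq : ∀ z k m, M k z → M m z → k = m := by
    intro z k m h1 h2
    rcases lt_trichotomy k m with h | h | h
    · exact absurd h1.1 (h2.2 k h)
    · exact h
    · exact absurd h2.1 (h1.2 m h)
  have key : ∀ n x, M n x → ∃ p : Finset (E × V × V), (p : Set (E × V × V)) ⊆ D ∧ Flow I F p a x ∧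
      (∀ d ∈ p, DReach (p : Set (E × V × V)) a d.2.1) ∧
      (∀ d ∈ p, ∃ k < n, M k d.2.1 ∧ M (k+1) d.2.2) ∧
      (∀ d ∈ p, ∀ d' ∈ p, ∀ k, M k d.2.1 → M k d'.2.1 → d = d') := by
    intro n
    induction n with
    | zero =>
      intro x hx
      have : x = a := (hL0 x).1 hx.1
      subst this
      exact ⟨∅, by simp, Flow.nil _, by simp, by simp, by simp⟩
    | succ n ih =>
      intro y hy
      obtain ⟨e, x, hd, hx⟩ := (hLs n y).1 hy.1
      have hMx : M n x := ⟨hx, fun m hm hlm => hy.2 (m+1) (by omega) ((hLs m y).2 ⟨e, x, hd, hlm⟩)⟩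
      obtain ⟨p, hpD, hpf, hpr, hpk, hpu⟩ := ih x hMx
      have hne : ∀ d ∈ p, d.1 ≠ e := by
        rintro ⟨e', x', y'⟩ hd' he'
        simp only at he'; subst he'
        obtain ⟨k, hk, h1, h2⟩ := hpk _ hd'
        have h3 := hpf.inc _ hd'
        have h4 := (hD _ hd).2
        simp only at h1 h2 h3 h4
        have h4 := Sym2.eq_iff.1 (h3.symm.trans h4)
        rcases h4 with ⟨rfl, rfl⟩ | ⟨rfl, rfl⟩
        · have := Muniq y' (k+1) (n+1) h2 hy; exact absurd this (by omega)
        · have := Muniq x' k (n+1) h1 hy; exact absurd this (by omega)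
      have hsing : Flow I F {(e, x, y)} x y := Flow.single (hD _ hd).1 (hD _ hd).2
      refine ⟨p ∪ {(e, x, y)}, ?_, ?_, ?_, ?_, ?_⟩
      · intro d hd'
        simp only [Finset.coe_union, Finset.coe_singleton, Set.union_singleton, Set.mem_insert_iff, Finset.mem_coe] at hd'
        rcases hd' with rfl | h
        exacts [hd, hpD h]
      · refine hpf.append hsing ?_
        rw [ed_singleton, Set.disjoint_singleton_right]
        rintro ⟨d, h1, h2⟩; exact hne d h1 h2
      · intro d hd'
        rcases Finset.mem_union.1 hd' with h1 | h1
        · exact (hpr d h1).mono (by simp)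
        · rw [Finset.mem_singleton] at h1; subst h1
          exact hpf.reach.mono (by simp)
      · intro d hd'
        rcases Finset.mem_union.1 hd' with h1 | h1
        · obtain ⟨k, hk, h⟩ := hpk d h1; exact ⟨k, by omega, h⟩
        · rw [Finset.mem_singleton] at h1; subst h1
          exact ⟨n, by omega, hMx, hy⟩
      · have aux : ∀ d ∈ p, ∀ k, M k d.2.1 → M k x → False := by
          intro d hd' k h1 h2
          obtain ⟨k', hk', h3, h4⟩ := hpk d hd'
          have := Muniq _ _ _ h1 h3
          have := Muniq _ _ _ h2 hMx
          omega
        intro d hd1 d' hd2 k h1 h2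
        rcases Finset.mem_union.1 hd1 with h3 | h3 <;> rcases Finset.mem_union.1 hd2 with h4 | h4
        · exact hpu d h3 d' h4 k h1 h2
        · rw [Finset.mem_singleton] at h4; subst h4; exact (aux d h3 k h1 h2).elim
        · rw [Finset.mem_singleton] at h3; subst h3; exact (aux d' h4 k h2 h1).elim
        · rw [Finset.mem_singleton] at h3 h4; rw [h3, h4]
  have hex : ∃ n, L n b := by
    induction h with
    | refl => exact ⟨0, rfl⟩
    | tail _ h ih => obtain ⟨e, he⟩ := h; obtain ⟨n, hn⟩ := ih; exact ⟨n+1, e, _, he, hn⟩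
  obtain ⟨nb, hMb⟩ : ∃ n, M n b := by
    have := Classical.decPred (fun n => L n b)
    exact ⟨Nat.find hex, Nat.find_spec hex, fun m hm => Nat.find_min hex hm⟩
  obtain ⟨p, hpD, hpf, hpr, hpk, hpu⟩ := key nb b hMb
  have hMa : M 0 a := ⟨rfl, by simp⟩
  refine ⟨p, hpD, hpf, ⟨?_, ?_, ?_, hpr⟩⟩
  · intro d hd h; obtain ⟨k, hk, h1, h2⟩ := hpk d hd
    rw [h] at h2; exact h2.2 0 (by omega) rfl
  · intro d hd d' hd' h h'
    exact hpu d hd d' hd' 0 (h ▸ hMa) (h' ▸ hMa)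
  · intro d hd h; obtain ⟨k, hk, h1, h2⟩ := hpk d hd
    rw [h] at h1; exact hMb.2 k hk h1.1

theorem Flow.clean {I : E → Sym2 V} {F : Set E} {p : Finset (E × V × V)} {a b : V}
    (h : Flow I F p a b) : ∃ p' ⊆ p, Flow I F p' a b ∧ Clean p' a b := by
  obtain ⟨p', h1, h2, h3⟩ := reach_flow (I := I) (F := F) (D := (p : Set (E × V × V)))
    (fun d hd => ⟨h.mem d hd, h.inc d hd⟩) h.reach
  exact ⟨p', by exact_mod_cast h1, h2, h3⟩

theorem Conn.flow {I : E → Sym2 V} {F : Set E} {a b : V} (h : Conn I F a b) :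
    ∃ p, Flow I F p a b ∧ Clean p a b := by
  obtain ⟨p', h1, h2, h3⟩ := reach_flow (I := I) (F := F)
    (D := {d : E × V × V | d.1 ∈ F ∧ I d.1 = s(d.2.1, d.2.2)}) (fun d hd => hd)
    (rtg_mono (fun x y ⟨e, he, hx⟩ => ⟨e, he, hx⟩) h)
  exact ⟨p', h2, h3⟩

/-- decomposition of a finite dart set into flows -/
theorem decomp {I : E → Sym2 V} {F : Set E} {t : V} (v : ι → V) (s : Finset ι) :
    ∀ Φ : Finset (E × V × V), (∀ d ∈ Φ, d.1 ∈ F) → (∀ d ∈ Φ, I d.1 = s(d.2.1, d.2.2)) →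
    (∀ d ∈ Φ, ∀ d' ∈ Φ, d.1 = d'.1 → d = d') →
    (∀ g : V → ℤ, ∑ d ∈ Φ, (g d.2.1 - g d.2.2) = ∑ i ∈ s, (g t - g (v i))) →
    ∃ p : ι → Finset (E × V × V), Link I F t (s : Set ι) v p ∧ ∀ i ∈ s, p i ⊆ Φ := by
  induction s using Finset.induction_on with
  | empty => intro Φ _ _ _ _; exact ⟨fun _ => ∅, ⟨by simp, by simp⟩, by simp⟩
  | insert i s his ih =>
    intro Φ hF hI hinj hpot
    have hr : DReach (Φ : Set (E × V × V)) t (v i) := by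
      by_contra hb
      have h1 := hpot (fun x => if DReach (Φ : Set (E × V × V)) t x then (1 : ℤ) else 0)
      have h2 := pot_reach (p := Φ) (a := t)
      have h3 : DReach (Φ : Set (E × V × V)) t t := Relation.ReflTransGen.refl
      rw [Finset.sum_insert his] at h1
      have h4 : 0 ≤ ∑ j ∈ s, ((if DReach (Φ : Set (E × V × V)) t t then (1 : ℤ) else 0)
        - (if DReach (Φ : Set (E × V × V)) t (v j) then (1 : ℤ) else 0)) := by
        apply Finset.sum_nonneg; intro j _
        simp only [h3, if_true]; split_ifs <;> simp
      simp only [h3, hb, if_true, if_false] at h1 h4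
      omega
    obtain ⟨q, hq, hqf, -⟩ := reach_flow (I := I) (F := F) (fun d hd => ⟨hF d hd, hI d hd⟩) hr
    have hq' : q ⊆ Φ := by exact_mod_cast hq
    obtain ⟨p, hp, hps⟩ := ih (Φ \ q) (fun d hd => hF d (Finset.mem_sdiff.1 hd).1)
      (fun d hd => hI d (Finset.mem_sdiff.1 hd).1)
      (fun d hd d' hd' => hinj d (Finset.mem_sdiff.1 hd).1 d' (Finset.mem_sdiff.1 hd').1)
      (by
        intro g
        have h1 := Finset.sum_sdiff (f := fun d : E × V × V => g d.2.1 - g d.2.2) hq'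
        rw [hpot, hqf.pot, Finset.sum_insert his] at h1; linarith)
    have hdq : ∀ j ∈ s, Disjoint (ed (p j)) (ed q) := by
      intro j hj
      rw [Set.disjoint_left]
      rintro e ⟨d, hd, rfl⟩ ⟨d', hd', he⟩
      have h1 := Finset.mem_sdiff.1 (hps j hj hd)
      have := hinj d h1.1 d' (hq' hd') he.symm
      subst this; exact h1.2 hd'
    have hne : ∀ j ∈ s, j ≠ i := fun j hj h => his (h ▸ hj)
    refine ⟨Function.update p i q, ⟨?_, ?_⟩, ?_⟩
    · intro j hj
      rcases Finset.mem_insert.1 (Finset.mem_coe.1 hj) with rfl | hj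
      · simpa using hqf
      · rw [Function.update_of_ne (hne j hj)]; exact hp.flow j hj
    · intro j hj0 k hk0 hjk
      rcases Finset.mem_insert.1 (Finset.mem_coe.1 hj0) with rfl | hj <;>
        rcases Finset.mem_insert.1 (Finset.mem_coe.1 hk0) with rfl | hk
      · exact absurd rfl hjk
      · rw [Function.update_self, Function.update_of_ne (hne k hk)]; exact (hdq k hk).symm
      · rw [Function.update_self, Function.update_of_ne (hne j hj)]; exact (hdq j hj)
      · rw [Function.update_of_ne (hne j hj), Function.update_of_ne (hne k hk)]
        exact hp.disj j hj k hk hjk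
    · intro j hj
      rcases Finset.mem_insert.1 hj with rfl | hj
      · simpa using hq'
      · rw [Function.update_of_ne (hne j hj)]; exact (hps j hj).trans Finset.sdiff_subset

end LC

set_option linter.unusedVariables false

namespace LC
open Classical
universe w
variable {V : Type u} {E : Type v} {ι : Type w}

theorem Link.mono {I : E → Sym2 V} {J J' : Set E} {t : V} {B : Set ι} {v : ι → V}
    {p : ι → Finset (E × V × V)} (h : Link I J t B v p) (hJ : J ⊆ J') : Link I J' t B v p :=
  ⟨fun i hi => (h.flow i hi).mono hJ, h.disj⟩

theorem Link.subset {I : E → Sym2 V} {J : Set E} {t : V} {B B' : Set ι} {v : ι → V}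
    {p : ι → Finset (E × V × V)} (h : Link I J t B v p) (hB : B' ⊆ B) : Link I J t B' v p :=
  ⟨fun i hi => h.flow i (hB hi), fun i hi j hj => h.disj i (hB hi) j (hB hj)⟩

/-- pass to sub-dart-sets -/
theorem Link.clean {I : E → Sym2 V} {J : Set E} {t : V} {B : Set ι} {v : ι → V}
    {p : ι → Finset (E × V × V)} (h : Link I J t B v p) :
    ∃ p', Link I J t B v p' ∧ ∀ i ∈ B, p' i ⊆ p i ∧ Clean (p' i) t (v i) := by
  have : ∀ i, ∃ q, i ∈ B → q ⊆ p i ∧ Flow I J q t (v i) ∧ Clean q t (v i) := by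
    intro i
    by_cases hi : i ∈ B
    · obtain ⟨q, h1, h2, h3⟩ := (h.flow i hi).clean
      exact ⟨q, fun _ => ⟨h1, h2, h3⟩⟩
    · exact ⟨∅, fun h => absurd h hi⟩
  choose q hq using this
  exact ⟨q, ⟨fun i hi => (hq i hi).2.1, fun i hi j hj hij =>
    (h.disj i hi j hj hij).mono (ed_mono (hq i hi).1) (ed_mono (hq j hj).1)⟩,
    fun i hi => ⟨(hq i hi).1, (hq i hi).2.2⟩⟩

theorem Link.uniq {I : E → Sym2 V} {J : Set E} {t : V} {B : Set ι} {v : ι → V}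
    {p : ι → Finset (E × V × V)} (h : Link I J t B v p) {i j : ι} (hi : i ∈ B) (hj : j ∈ B) {e : E}
    (h1 : e ∈ ed (p i)) (h2 : e ∈ ed (p j)) : i = j := by
  by_contra hne; exact Set.disjoint_left.1 (h.disj i hi j hj hne) h1 h2

theorem Link.same {I : E → Sym2 V} {J : Set E} {t : V} {B : Set ι} {v : ι → V}
    {p : ι → Finset (E × V × V)} (h : Link I J t B v p) {i j : ι} (hi : i ∈ B) (hj : j ∈ B)
    {d d' : E × V × V} (h1 : d ∈ p i) (h2 : d' ∈ p j) (he : d.1 = d'.1) : i = j ∧ d = d' := by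
  have hij := h.uniq hi hj (mem_ed h1) (he ▸ mem_ed h2)
  subst hij; exact ⟨rfl, (h.flow i hi).inj d h1 d' h2 he⟩

/-- augmentation -/
theorem aug {I : E → Sym2 V} {J : Set E} {t : V} {B : Set ι} {v : ι → V}
    {p : ι → Finset (E × V × V)} (hL : Link I J t B v p) (r : V) :
    (∃ p' : Option ι → Finset (E × V × V),
      Link I J t (insert none (some '' B)) (fun o => o.elim r v) p' ∧
      ∃ G0 : Set E, G0.Subsingleton ∧ ∀ i ∈ (insert none (some '' B) : Set (Option ι)),
        ∀ e ∈ ed (p' i), t ∈ I e → (∃ j ∈ B, e ∈ ed (p j)) ∨ e ∈ G0) ∨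
    (∃ S0 : Set V, t ∈ S0 ∧ r ∉ S0 ∧ (∀ x ∈ S0, Conn I J t x) ∧
      (∀ e ∈ J, ∀ a b, I e = s(a, b) → a ∈ S0 → b ∉ S0 → ∃ i ∈ B, (e, a, b) ∈ p i) ∧
      ∀ i ∈ B, ∀ d ∈ p i, d.2.2 ∈ S0 → d.2.1 ∈ S0) := by
  let D : Set (E × V × V) := {d | d.1 ∈ J ∧ I d.1 = s(d.2.1, d.2.2) ∧
    ((∀ i ∈ B, d.1 ∉ ed (p i)) ∨ ∃ i ∈ B, (d.1, d.2.2, d.2.1) ∈ p i)}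
  by_cases hr : DReach D t r
  · left
    obtain ⟨ρ, hρD, hρf, hρc⟩ := reach_flow (I := I) (F := J) (fun d hd => ⟨hd.1, hd.2.1⟩) hr
    -- touched indices
    let T0 : Set ι := {i | i ∈ B ∧ ∃ e ∈ ed ρ, e ∈ ed (p i)}
    have hT0 : T0.Finite := by
      have hch : ∀ i : T0, ∃ e : ed ρ, (e : E) ∈ ed (p i) := by
        rintro ⟨i, hi, e, he, h⟩; exact ⟨⟨e, he⟩, h⟩
      choose f hf using hch
      have hfin := (ed_finite ρ).to_subtype
      have : Finite T0 := Finite.of_injective f (by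
        intro i j hij
        apply Subtype.ext
        exact hL.uniq i.2.1 j.2.1 (hf i) (hij ▸ hf j))
      exact Set.toFinite _
    let s := hT0.toFinset
    have hs : ∀ i, i ∈ s ↔ i ∈ T0 := fun i => Set.Finite.mem_toFinset _
    have hsB : ∀ i ∈ s, i ∈ B := fun i hi => ((hs i).1 hi).1
    let P := s.biUnion p
    have hP : ∀ d, d ∈ P ↔ ∃ i ∈ s, d ∈ p i := fun d => Finset.mem_biUnion
    let Φ := (P \ rev ρ) ∪ (ρ \ rev P)
    -- darts of rho not reversing P have unused edges
    have hunused : ∀ d ∈ ρ \ rev P, ∀ i ∈ B, d.1 ∉ ed (p i) := by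
      rintro ⟨e, x, y⟩ hd i hi hed
      rw [Finset.mem_sdiff, mem_rev] at hd
      rcases (hρD hd.1).2.2 with h | ⟨j, hj, h⟩
      · exact h i hi hed
      · exact hd.2 ((hP _).2 ⟨j, (hs j).2 ⟨hj, e, mem_ed hd.1, mem_ed h⟩, h⟩)
    have hPpot : ∀ g : V → ℤ, ∑ d ∈ P, (g d.2.1 - g d.2.2) = ∑ i ∈ s, (g t - g (v i)) := by
      intro g
      rw [Finset.sum_biUnion]
      · exact Finset.sum_congr rfl (fun i hi => (hL.flow i (hsB i hi)).pot g)
      · intro i hi j hj hij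
        rw [Function.onFun, Finset.disjoint_left]
        intro d h1 h2
        exact hij (hL.uniq (hsB i hi) (hsB j hj) (mem_ed h1) (mem_ed h2))
    have hdj : Disjoint (P \ rev ρ) (ρ \ rev P) := by
      rw [Finset.disjoint_left]; intro d h1 h2
      obtain ⟨i, hi, hd⟩ := (hP d).1 (Finset.mem_sdiff.1 h1).1
      exact hunused d h2 i (hsB i hi) (mem_ed hd)
    have hpot : ∀ g : V → ℤ, ∑ d ∈ Φ, (g d.2.1 - g d.2.2) =
        ∑ i ∈ insert none (s.map Function.Embedding.some), (g t - g ((fun o : Option ι => o.elim r v) i)) := by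
      intro g
      rw [Finset.sum_insert (by simp), Finset.sum_map, Finset.sum_union hdj]
      have h1 := Finset.sum_inter_add_sum_sdiff P (rev ρ) (fun d : E × V × V => g d.2.1 - g d.2.2)
      have h2 := Finset.sum_inter_add_sum_sdiff ρ (rev P) (fun d : E × V × V => g d.2.1 - g d.2.2)
      have h3 : ρ ∩ rev P = rev (P ∩ rev ρ) := by
        ext ⟨e, x, y⟩; simp only [Finset.mem_inter, mem_rev]; tauto
      rw [h3, sum_rev, hρf.pot] at h2
      rw [hPpot] at h1
      simp only [Option.elim, Function.Embedding.some_apply]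
      linarith
    have hPinj : ∀ d ∈ P, ∀ d' ∈ P, d.1 = d'.1 → d = d' := by
      intro d hd d' hd' he
      obtain ⟨i, hi, h1⟩ := (hP d).1 hd
      obtain ⟨j, hj, h2⟩ := (hP d').1 hd'
      exact (hL.same (hsB i hi) (hsB j hj) h1 h2 he).2
    have hΦ : ∀ d, d ∈ Φ → (d ∈ P ∧ d ∉ rev ρ) ∨ (d ∈ ρ \ rev P) := by
      intro d hd
      rcases Finset.mem_union.1 hd with h | h
      · exact Or.inl (Finset.mem_sdiff.1 h)
      · exact Or.inr h
    have hΦd : ∀ d ∈ Φ, (∃ i ∈ s, d ∈ p i) ∨ (d ∈ ρ ∧ ∀ i ∈ B, d.1 ∉ ed (p i)) := by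
      intro d hd
      rcases hΦ d hd with h | h
      · exact Or.inl ((hP d).1 h.1)
      · exact Or.inr ⟨(Finset.mem_sdiff.1 h).1, hunused d h⟩
    obtain ⟨q, hq, hqs⟩ := decomp (I := I) (F := J) (t := t) (fun o : Option ι => o.elim r v)
      (insert none (s.map Function.Embedding.some)) Φ
      (by
        intro d hd
        rcases hΦd d hd with ⟨i, hi, h⟩ | h
        · exact (hL.flow i (hsB i hi)).mem d h
        · exact hρf.mem d h.1)
      (by
        intro d hd
        rcases hΦd d hd with ⟨i, hi, h⟩ | h
        · exact (hL.flow i (hsB i hi)).inc d h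
        · exact hρf.inc d h.1)
      (by
        intro d hd d' hd' he
        rcases hΦd d hd with ⟨i, hi, h⟩ | h <;> rcases hΦd d' hd' with ⟨j, hj, h'⟩ | h'
        · exact (hL.same (hsB i hi) (hsB j hj) h h' he).2
        · exact absurd (mem_ed h) (he ▸ h'.2 i (hsB i hi))
        · exact absurd (mem_ed h') (he ▸ h.2 j (hsB j hj))
        · exact hρf.inj d h.1 d' h'.1 he) hpot
    let p' : Option ι → Finset (E × V × V) := fun o => match o with
      | none => q none
      | some i => if i ∈ s then q (some i) else p i
    have hcase : ∀ o ∈ (insert none (some '' B) : Set (Option ι)),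
        (o ∈ insert none (s.map Function.Embedding.some) ∧ p' o = q o) ∨
        (∃ i ∈ B, o = some i ∧ i ∉ s ∧ p' o = p i) := by
      rintro o ho
      rcases o with _ | i
      · left; exact ⟨by simp, rfl⟩
      · have hi : i ∈ B := by simpa using ho
        by_cases his : i ∈ s
        · left; exact ⟨by simp [his], by simp [p', his]⟩
        · right; exact ⟨i, hi, rfl, his, by simp [p', his]⟩
    have hcross : ∀ o ∈ insert none (s.map Function.Embedding.some), ∀ i ∈ B, i ∉ s →
        Disjoint (ed (q o)) (ed (p i)) := by
      intro o ho i hi his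
      rw [Set.disjoint_left]
      rintro e ⟨d, hd, rfl⟩ he
      rcases hΦd d (hqs o ho hd) with ⟨j, hj, h⟩ | h
      · have := hL.uniq (hsB j hj) hi (mem_ed h) he
        subst this; exact his hj
      · exact h.2 i hi he
    refine ⟨p', ⟨?_, ?_⟩, ?_⟩
    · intro o ho
      rcases hcase o ho with ⟨h1, h2⟩ | ⟨i, hi, rfl, his, h2⟩
      · rw [h2]; exact hq.flow o h1
      · rw [h2]; exact hL.flow i hi
    · intro o ho o' ho' hne
      rcases hcase o ho with ⟨h1, h2⟩ | ⟨i, hi, rfl, his, h2⟩ <;>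
        rcases hcase o' ho' with ⟨h1', h2'⟩ | ⟨i', hi', rfl, his', h2'⟩
      · rw [h2, h2']; exact hq.disj o h1 o' h1' hne
      · rw [h2, h2']; exact hcross o h1 i' hi' his'
      · rw [h2, h2']; exact (hcross o' h1' i hi his).symm
      · rw [h2, h2']; exact hL.disj i hi i' hi' (fun h => hne (by rw [h]))
    · refine ⟨{e | ∃ d ∈ ρ, d.1 = e ∧ d.2.1 = t}, ?_, ?_⟩
      · rintro e ⟨d, hd, rfl, h1⟩ e' ⟨d', hd', rfl, h1'⟩
        rw [hρc.src_uniq d hd d' hd' h1 h1']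
      · intro o ho e he ht
        rcases hcase o ho with ⟨h1, h2⟩ | ⟨i, hi, rfl, his, h2⟩
        · rw [h2] at he
          obtain ⟨d, hd, rfl⟩ := he
          rcases hΦd d (hqs o h1 hd) with ⟨j, hj, h⟩ | h
          · exact Or.inl ⟨j, hsB j hj, mem_ed h⟩
          · right
            refine ⟨d, h.1, rfl, ?_⟩
            rw [hρf.inc d h.1, Sym2.mem_iff] at ht
            rcases ht with ht | ht
            · exact ht.symm
            · exact absurd ht.symm (hρc.no_tgt d h.1)
        · rw [h2] at he; exact Or.inl ⟨i, hi, he⟩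
  · right
    refine ⟨{x | DReach D t x}, Relation.ReflTransGen.refl, hr, ?_, ?_, ?_⟩
    · intro x hx
      exact DReach.conn hx (fun d hd => ⟨hd.1, hd.2.1⟩)
    · intro e he a b hab ha hb
      by_contra hcon
      push Not at hcon
      apply hb
      refine DReach.tail ha (e := e) ⟨he, hab, ?_⟩
      by_contra h2
      push Not at h2
      obtain ⟨⟨i, hi, ⟨⟨e', x, y⟩, hd, he'⟩⟩, h3⟩ := h2
      simp only at he'; subst he'
      have h4 : I e' = s(x, y) := (hL.flow i hi).inc _ hd
      rcases Sym2.eq_iff.1 (hab.symm.trans h4) with ⟨rfl, rfl⟩ | ⟨rfl, rfl⟩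
      · exact hcon i hi hd
      · exact h3 i hi hd
    · rintro i hi ⟨e, x, y⟩ hd hy
      refine DReach.tail (e := e) hy ⟨(hL.flow i hi).mem (e, x, y) hd, ?_, Or.inr ⟨i, hi, hd⟩⟩
      exact ((hL.flow i hi).inc (e, x, y) hd).trans Sym2.eq_swap

/-- truncation of a flow by a set which no dart enters -/
theorem trunc {I : E → Sym2 V} {F : Set E} {p : Finset (E × V × V)} {t z : V} {S : Set V}
    (h : Flow I F p t z) (ht : t ∈ S) (hn : ∀ d ∈ p, d.2.2 ∈ S → d.2.1 ∈ S) :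
    (z ∈ S → (∀ d ∈ p, d.2.1 ∈ S → d.2.2 ∈ S) ∧
      Flow I (Ins I F S) (p.filter (fun d => d.2.1 ∈ S ∧ d.2.2 ∈ S)) t z) ∧
    (z ∉ S → ∃ d ∈ p, d.2.1 ∈ S ∧ d.2.2 ∉ S ∧ (∀ d' ∈ p, d'.2.1 ∈ S → d'.2.2 ∉ S → d' = d) ∧
      Flow I (Ins I F S) (p.filter (fun d => d.2.1 ∈ S ∧ d.2.2 ∈ S)) t d.2.1) := by
  set q := p.filter (fun d => d.2.1 ∈ S ∧ d.2.2 ∈ S) with hq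
  set L := p.filter (fun d => d.2.1 ∈ S ∧ d.2.2 ∉ S) with hLdef
  -- number of leaving darts
  have hcard : ((L.card : ℕ) : ℤ) = 1 - (if z ∈ S then 1 else 0) := by
    have h1 := h.pot (fun x => if x ∈ S then (1 : ℤ) else 0)
    simp only [ht, if_true] at h1
    rw [← h1, hLdef, Finset.card_filter]
    push_cast
    refine Finset.sum_congr rfl (fun d hd => ?_)
    by_cases h2 : d.2.2 ∈ S
    · simp [h2, hn d hd h2]
    · by_cases h3 : d.2.1 ∈ S <;> simp [h2, h3]
  have hgen : ∀ g : V → ℤ, ∑ d ∈ q, (g d.2.1 - g d.2.2) + ∑ d ∈ L, g d.2.1 =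
      g t - (if z ∈ S then g z else 0) := by
    intro g
    have h1 := h.pot (fun x => if x ∈ S then g x else 0)
    simp only [ht, if_true] at h1
    rw [← h1, hq, hLdef, Finset.sum_filter, Finset.sum_filter, ← Finset.sum_add_distrib]
    refine Finset.sum_congr rfl (fun d hd => ?_)
    by_cases h2 : d.2.2 ∈ S
    · simp [h2, hn d hd h2]
    · by_cases h3 : d.2.1 ∈ S <;> simp [h2, h3]
  have hfl : ∀ y, (∀ g : V → ℤ, ∑ d ∈ q, (g d.2.1 - g d.2.2) = g t - g y) →
      Flow I (Ins I F S) q t y := by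
    intro y hy
    refine ⟨?_, fun d hd => h.inc d (Finset.mem_filter.1 hd).1, fun d hd d' hd' =>
      h.inj d (Finset.mem_filter.1 hd).1 d' (Finset.mem_filter.1 hd').1, hy⟩
    intro d hd
    rw [hq, Finset.mem_filter] at hd
    refine ⟨h.mem d hd.1, ?_⟩
    intro x hx
    rw [h.inc d hd.1, Sym2.mem_iff] at hx
    rcases hx with rfl | rfl
    exacts [hd.2.1, hd.2.2]
  constructor
  · intro hz
    simp only [hz, if_true, sub_self] at hcard
    have hL0 : L = ∅ := Finset.card_eq_zero.1 (by exact_mod_cast hcard)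
    refine ⟨?_, hfl z ?_⟩
    · intro d hd h1
      by_contra h2
      have : d ∈ L := Finset.mem_filter.2 ⟨hd, h1, h2⟩
      rw [hL0] at this; simp at this
    · intro g; have := hgen g; rw [hL0] at this; simpa [hz] using this
  · intro hz
    simp only [hz, if_false, sub_zero] at hcard
    obtain ⟨d, hd⟩ := Finset.card_eq_one.1 (show L.card = 1 by exact_mod_cast hcard)
    have hdL : d ∈ L := by rw [hd]; simp
    rw [hLdef, Finset.mem_filter] at hdL
    refine ⟨d, hdL.1, hdL.2.1, hdL.2.2, ?_, hfl d.2.1 ?_⟩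
    · intro d' hd' h1 h2
      have : d' ∈ L := Finset.mem_filter.2 ⟨hd', h1, h2⟩
      rw [hd] at this; simpa using this
    · intro g; have := hgen g; rw [hd, Finset.sum_singleton, if_neg hz] at this; linarith

/-- the end of an edge in a set -/
noncomputable def inE (I : E → Sym2 V) (S : Set V) (e : E) : V :=
  if h : ∃ a, a ∈ S ∧ a ∈ I e then h.choose else (Quot.out (I e)).1

theorem inE_eq {I : E → Sym2 V} {S : Set V} {e : E} {a b : V} (h : I e = s(a, b)) (ha : a ∈ S)
    (hb : b ∉ S) : inE I S e = a := by
  have hex : ∃ a, a ∈ S ∧ a ∈ I e := ⟨a, ha, by rw [h]; simp⟩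
  rw [inE, dif_pos hex]
  obtain ⟨h1, h2⟩ := hex.choose_spec
  generalize hex.choose = c at h1 h2
  rw [h, Sym2.mem_iff] at h2
  rcases h2 with h2 | h2
  · exact h2
  · rw [h2] at h1; exact absurd h1 hb

theorem mem_cut {I : E → Sym2 V} {F : Set E} {S : Set V} {e : E} : e ∈ cut I F S ↔
    e ∈ F ∧ ∃ a b, I e = s(a, b) ∧ a ∈ S ∧ b ∉ S := Iff.rfl

theorem mem_Ins {I : E → Sym2 V} {F : Set E} {S : Set V} {e : E} {a b : V} (h : I e = s(a, b)) :
    e ∈ Ins I F S ↔ e ∈ F ∧ a ∈ S ∧ b ∈ S := by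
  simp [Ins, h, Sym2.mem_iff]

theorem Ins_sub {I : E → Sym2 V} {F : Set E} {S : Set V} : Ins I F S ⊆ F := fun _ h => h.1

theorem cut_sub {I : E → Sym2 V} {F : Set E} {S : Set V} : cut I F S ⊆ F := fun _ h => h.1

theorem cut_mono {I : E → Sym2 V} {F F' : Set E} {S : Set V} (h : F ⊆ F') :
    cut I F S ⊆ cut I F' S := fun _ he => ⟨h he.1, he.2⟩

theorem Ins_mono {I : E → Sym2 V} {F F' : Set E} {S S' : Set V} (h : F ⊆ F') (h' : S ⊆ S') :
    Ins I F S ⊆ Ins I F' S' := fun _ he => ⟨h he.1, fun v hv => h' (he.2 v hv)⟩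

theorem cut_Ins {I : E → Sym2 V} {F F' : Set E} {S : Set V} {e : E} (h : e ∈ cut I F S) :
    e ∉ Ins I F' S := by
  obtain ⟨-, a, b, hab, ha, hb⟩ := h
  intro h'; exact hb (h'.2 b (by rw [hab]; simp))

theorem Sym2_ex (z : Sym2 V) : ∃ a b, z = s(a, b) := by
  induction z using Sym2.ind with
  | _ a b => exact ⟨a, b, rfl⟩

theorem inE_mem {I : E → Sym2 V} {F : Set E} {S : Set V} {e : E} (h : e ∈ cut I F S) :
    inE I S e ∈ S ∧ ∃ b, I e = s(inE I S e, b) ∧ b ∉ S := by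
  obtain ⟨-, a, b, hab, ha, hb⟩ := h
  rw [inE_eq hab ha hb]; exact ⟨ha, b, hab, hb⟩

/-- the link obtained by truncation in the second alternative of `aug` -/
theorem aug_exit {I : E → Sym2 V} {F : Set E} {S S0 : Set V} {t : V} {B : Set ι} {v : ι → V}
    {p : ι → Finset (E × V × V)} (hL : Link I (Ins I F S) t B v p) (hS : S0 ⊆ S) (ht : t ∈ S0)
    (h1 : ∀ e ∈ Ins I F S, ∀ a b, I e = s(a, b) → a ∈ S0 → b ∉ S0 → ∃ i ∈ B, (e, a, b) ∈ p i)
    (h2 : ∀ i ∈ B, ∀ d ∈ p i, d.2.2 ∈ S0 → d.2.1 ∈ S0)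
    (ex : E → ι) (hex : ∀ e ∈ cut I F S0, e ∉ Ins I F S → ex e ∈ B ∧ v (ex e) = inE I S0 e)
    (hexi : ∀ e ∈ cut I F S0, e ∉ Ins I F S → ∀ e' ∈ cut I F S0, e' ∉ Ins I F S →
      ex e = ex e' → e = e') :
    ∃ p', Link I (Ins I F S0) t (cut I F S0) (inE I S0) p' ∧
      ∀ e ∈ cut I F S0, (∃ i ∈ B, p' e ⊆ p i) ∧ (e ∈ Ins I F S → ∃ i ∈ B, e ∈ ed (p i)) := by
  have hch : ∀ e, ∃ i, e ∈ cut I F S0 → i ∈ B ∧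
      ((e ∈ Ins I F S ∧ v i ∉ S0 ∧ (e, inE I S0 e) ∈ (p i).image (fun d => (d.1, d.2.1)) ∧
        ∃ d ∈ p i, d.1 = e ∧ d.2.1 ∈ S0 ∧ d.2.2 ∉ S0) ∨
      (e ∉ Ins I F S ∧ i = ex e ∧ v i = inE I S0 e)) := by
    intro e
    by_cases he : e ∈ cut I F S0
    · by_cases hI : e ∈ Ins I F S
      · obtain ⟨-, a, b, hab, ha, hb⟩ := he
        obtain ⟨i, hi, hd⟩ := h1 e hI a b hab ha hb
        refine ⟨i, fun _ => ⟨hi, Or.inl ⟨hI, ?_, ?_, _, hd, rfl, ha, hb⟩⟩⟩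
        · intro hvi
          exact hb (((trunc (hL.flow i hi) ht (h2 i hi)).1 hvi).1 _ hd ha)
        · rw [inE_eq hab ha hb, Finset.mem_image]; exact ⟨_, hd, rfl⟩
      · exact ⟨ex e, fun _ => ⟨(hex e he hI).1, Or.inr ⟨hI, rfl, (hex e he hI).2⟩⟩⟩
    · exact ⟨ex e, fun h => absurd h he⟩
  choose f hf using hch
  have hsub : Ins I (Ins I F S) S0 ⊆ Ins I F S0 := Ins_mono Ins_sub le_rfl
  have hvS : ∀ e ∈ cut I F S0, inE I S0 e ∈ S0 := fun e he => (inE_mem he).1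
  refine ⟨fun e => (p (f e)).filter (fun d => d.2.1 ∈ S0 ∧ d.2.2 ∈ S0), ⟨?_, ?_⟩, ?_⟩
  · intro e he
    obtain ⟨hB, h | h⟩ := hf e he
    · obtain ⟨hI, hv, him, d', hd', rfl, h3, h4⟩ := h
      obtain ⟨d, hd, h5, h6, h7, h8⟩ := (trunc (hL.flow _ hB) ht (h2 _ hB)).2 hv
      have := h7 d' hd' h3 h4
      subst this
      have h9 := (hL.flow _ hB).inc d' hd'
      rw [inE_eq h9 h3 h4]
      exact h8.mono hsub
    · obtain ⟨hI, h3, h4⟩ := h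
      have h5 := (trunc (hL.flow _ hB) ht (h2 _ hB)).1 (by rw [h4]; exact hvS e he)
      rw [h4] at h5
      exact h5.2.mono hsub
  · intro e he e' he' hne
    have hfe : f e ≠ f e' := by
      intro hff
      obtain ⟨hB, h | h⟩ := hf e he <;> obtain ⟨hB', h' | h'⟩ := hf e' he'
      · obtain ⟨hI, hv, -, d, hd, rfl, h3, h4⟩ := h
        obtain ⟨hI', hv', -, d', hd', rfl, h3', h4'⟩ := h'
        rw [← hff] at hd'
        obtain ⟨d0, hd0, -, -, h7, -⟩ := (trunc (hL.flow _ hB) ht (h2 _ hB)).2 hv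
        exact hne (by rw [h7 d hd h3 h4, h7 d' hd' h3' h4'])
      · apply h.2.1; rw [hff, h'.2.2]; exact hvS e' he'
      · apply h'.2.1; rw [← hff, h.2.2]; exact hvS e he
      · exact hne (hexi e he h.1 e' he' h'.1 (by rw [← h.2.1, ← h'.2.1, hff]))
    exact (hL.disj _ (hf e he).1 _ (hf e' he').1 hfe).mono (ed_mono (Finset.filter_subset _ _))
      (ed_mono (Finset.filter_subset _ _))
  · intro e he
    refine ⟨⟨f e, (hf e he).1, Finset.filter_subset _ _⟩, fun hI => ?_⟩
    obtain ⟨hB, h | h⟩ := hf e he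
    · obtain ⟨-, -, -, d, hd, rfl, -⟩ := h; exact ⟨f d.1, hB, mem_ed hd⟩
    · exact absurd hI h.1

end LC

set_option linter.unusedVariables false

namespace LC
open Classical
universe w
variable {V : Type u} {E : Type v} {ι : Type w}

structure Wave (I : E → Sym2 V) (F : Set E) (T : Set V) (t : V) (S : Set V)
    (p : E → Finset (E × V × V)) : Prop where
  mem : t ∈ S
  term : ∀ x ∈ S, x ∈ T → x = t
  link : Link I (Ins I F S) t (cut I F S) (inE I S) p

def Used (I : E → Sym2 V) (F : Set E) (S : Set V) (p : E → Finset (E × V × V)) (b : E) : Prop :=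
  b ∈ cut I F S ∨ ∃ h ∈ cut I F S, b ∈ ed (p h)

def Unh (I : E → Sym2 V) (F : Set E) (T : Set V) (t : V) : Prop :=
  ∀ S p, Wave I F T t S p → ∀ b ∈ F, ∀ b', I b = s(t, b') → b' ≠ t → Used I F S p b

def WF (I : E → Sym2 V) (F : Set E) (T : Set V) : Prop :=
  ∀ t ∈ T, ∀ S p, Wave I F T t S p → ∀ v ∈ S, v ≠ t → ∀ τ ∈ T, ¬ Conn I F v τ

def Par (I : E → Sym2 V) (F : Set E) (T : Set V) : Prop :=
  ∀ D : Set V, Disjoint D T → (cut I F D).Finite → Even (cut I F D).ncard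

theorem Wave.change {I : E → Sym2 V} {F F' : Set E} {T : Set V} {t : V} {S : Set V}
    {p : E → Finset (E × V × V)} (h : Wave I F T t S p) (hc : cut I F' S ⊆ cut I F S)
    (he : ∀ e ∈ cut I F' S, ed (p e) ⊆ F') : Wave I F' T t S p := by
  refine ⟨h.mem, h.term, ⟨fun e h1 => (h.link.flow e (hc h1)).of_ed ?_, fun i hi j hj =>
    h.link.disj i (hc hi) j (hc hj)⟩⟩
  intro b hb
  exact ⟨he e h1 hb, ((h.link.flow e (hc h1)).ed_sub hb).2⟩

/-- only the edges matter for connectivity inside a set -/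
theorem Conn.ins {I : E → Sym2 V} {F : Set E} {S : Set V} {a b : V} (h : Conn I (Ins I F S) a b)
    (ha : a ∈ S) : b ∈ S :=
  h.closed S ha (fun e he x y hxy _ => ((mem_Ins hxy).1 he).2.2)

theorem cut_ex {I : E → Sym2 V} {F : Set E} {S S0 : Set V} (hS : S0 ⊆ S) {e : E}
    (he : e ∈ cut I F S0) (hI : e ∉ Ins I F S) :
    e ∈ cut I F S ∧ inE I S e = inE I S0 e := by
  obtain ⟨hF, a, b, hab, ha, hb⟩ := he
  have hbS : b ∉ S := fun hbS => hI ((mem_Ins hab).2 ⟨hF, hS ha, hbS⟩)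
  exact ⟨⟨hF, a, b, hab, hS ha, hbS⟩, by rw [inE_eq hab ha hb, inE_eq hab (hS ha) hbS]⟩

theorem Rm {I : E → Sym2 V} {F : Set E} {T : Set V} {t : V} {S : Set V} {f : E}
    {p : E → Finset (E × V × V)} (hU : Unh I F T t) (hW : Wave I (F \ {f}) T t S p) {a c : V}
    (hf : I f = s(a, c)) (ha : a ∈ S) (hc : c ∉ S) :
    (∃ p', Wave I F T t S p') ∨
    (∀ b ∈ F \ {f}, ∀ b', I b = s(t, b') → b' ≠ t → Used I (F \ {f}) S p b) := by
  by_cases hfF : f ∈ F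
  swap
  · left; rw [Set.sdiff_singleton_eq_self hfF] at hW; exact ⟨p, hW⟩
  have hIns : Ins I (F \ {f}) S = Ins I F S := by
    ext e; constructor
    · intro h; exact ⟨h.1.1, h.2⟩
    · intro h; refine ⟨⟨h.1, ?_⟩, h.2⟩
      rintro rfl; exact hc (h.2 c (by rw [hf]; simp))
  have hcut : cut I F S = insert f (cut I (F \ {f}) S) := by
    ext e; constructor
    · intro h
      by_cases he : e = f
      · exact Or.inl he
      · exact Or.inr ⟨⟨h.1, he⟩, h.2⟩
    · rintro (rfl | h)
      · exact ⟨hfF, a, c, hf, ha, hc⟩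
      · exact ⟨h.1.1, h.2⟩
  have hLk : Link I (Ins I F S) t (cut I (F \ {f}) S) (inE I S) p := by
    have := hW.link; rwa [hIns] at this
  rcases aug hLk a with ⟨p', hp', -⟩ | ⟨S0, ht0, hr0, hconn, h1, h2⟩
  · left
    have hmem : ∀ h ∈ cut I F S, (if h = f then none else some h) ∈
        (insert none (some '' (cut I (F \ {f}) S)) : Set (Option E)) := by
      intro h hh
      by_cases hhf : h = f
      · simp [hhf]
      · rw [hcut] at hh
        rcases hh with hh | hh
        · exact absurd hh hhf
        · simp [hhf, hh]
    refine ⟨fun h => p' (if h = f then none else some h), hW.mem, hW.term, ?_, ?_⟩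
    · intro h hh
      have h3 := hp'.flow _ (hmem h hh)
      by_cases hhf : h = f
      · subst hhf
        simp only [if_true, Option.elim] at h3 ⊢
        rw [inE_eq hf ha hc]; exact h3
      · simp only [hhf, if_false, Option.elim] at h3 ⊢; exact h3
    · intro h hh h' hh' hne
      refine hp'.disj _ (hmem h hh) _ (hmem h' hh') ?_
      by_cases h3 : h = f <;> by_cases h4 : h' = f <;> simp [h3, h4] <;> grind
  · right
    have hS0 : S0 ⊆ S := fun x hx => (hconn x hx).ins hW.mem
    obtain ⟨p', hp', hp''⟩ := aug_exit hLk hS0 ht0 h1 h2 id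
      (by
        intro e he hI
        obtain ⟨h3, h4⟩ := cut_ex hS0 he hI
        refine ⟨?_, h4⟩
        rw [hcut] at h3
        rcases h3 with rfl | h3
        · rw [inE_eq hf ha hc] at h4
          exact absurd (h4 ▸ (inE_mem he).1) hr0
        · exact h3)
      (by intro e _ _ e' _ _ h; exact h)
    have hW' : Wave I F T t S0 p' := ⟨ht0, fun x hx => hW.term x (hS0 hx), hp'⟩
    intro b hb b' hbb hb'
    have key : ∀ e ∈ cut I F S0, e ≠ f → Used I (F \ {f}) S p e := by
      intro e he hef
      by_cases hI : e ∈ Ins I F S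
      · obtain ⟨i, hi, h⟩ := (hp'' e he).2 hI
        exact Or.inr ⟨i, hi, h⟩
      · have := (cut_ex hS0 he hI).1
        exact Or.inl ⟨⟨this.1, hef⟩, this.2⟩
    rcases hU S0 p' hW' b hb.1 b' hbb hb' with h | ⟨h, hh, hbh⟩
    · exact key b h hb.2
    · obtain ⟨⟨i, hi, hs⟩, -⟩ := hp'' h hh
      exact Or.inr ⟨i, hi, ed_mono hs hbh⟩

/-- a flow leaving `t` uses a non-loop `t`-edge -/
theorem Flow.first {I : E → Sym2 V} {F : Set E} {p : Finset (E × V × V)} {a b : V}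
    (h : Flow I F p a b) (hab : a ≠ b) : ∃ d ∈ p, d.2.1 = a ∧ d.2.2 ≠ a := by
  by_contra hcon
  push Not at hcon
  have h1 := h.pot (fun x => if x = a then 1 else 0)
  have h2 : ∑ d ∈ p, ((if d.2.1 = a then (1:ℤ) else 0) - (if d.2.2 = a then 1 else 0)) ≤ 0 := by
    apply Finset.sum_nonpos
    intro d hd
    by_cases h3 : d.2.1 = a
    · simp [h3, hcon d hd h3]
    · simp only [h3, if_false]; split_ifs <;> simp
  rw [h1] at h2
  simp [hab.symm] at h2

theorem Add {I : E → Sym2 V} {F : Set E} {T : Set V} {t : V} {f : E}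
    (hU : Unh I (F \ {f}) T t) (hf : t ∉ I f) : Unh I F T t := by
  intro S p hW b hb b' hbb hb'
  have hbf : b ≠ f := by rintro rfl; exact hf (by rw [hbb]; simp)
  have hb1 : b ∈ F \ {f} := ⟨hb, hbf⟩
  by_contra hnu
  have hcut : cut I (F \ {f}) S ⊆ cut I F S := cut_mono Set.sdiff_subset
  -- smaller systems
  have hsmall : ∀ q : E → Finset (E × V × V), Wave I (F \ {f}) T t S q →
      (∀ e ∈ cut I F S, q e ⊆ p e) → False := by
    intro q hq hs
    rcases hU S q hq b hb1 b' hbb hb' with h | ⟨h, hh, hbh⟩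
    · exact hnu (Or.inl (hcut h))
    · exact hnu (Or.inr ⟨h, hcut hh, ed_mono (hs h (hcut hh)) hbh⟩)
  by_cases h3 : ∃ h0 ∈ cut I F S, f ∈ ed (p h0)
  swap
  · push Not at h3
    refine hsmall p (hW.change hcut ?_) (fun _ _ => subset_rfl)
    intro e he x hx
    refine ⟨((hW.link.flow e (hcut he)).ed_sub hx).1, ?_⟩
    rintro rfl; exact h3 e (hcut he) hx
  obtain ⟨h0, hh0, hf0⟩ := h3
  have hfI : f ∈ Ins I F S := (hW.link.flow h0 hh0).ed_sub hf0
  have hcut' : ∀ e ∈ cut I F S, e ≠ f := by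
    rintro e he rfl; exact cut_Ins he hfI
  have hcuteq : cut I (F \ {f}) S = cut I F S :=
    Set.Subset.antisymm hcut (fun e he => ⟨⟨he.1, hcut' e he⟩, he.2⟩)
  have hav : ∀ e ∈ cut I F S, e ≠ h0 → ed (p e) ⊆ F \ {f} := by
    intro e he hne x hx
    refine ⟨((hW.link.flow e he).ed_sub hx).1, ?_⟩
    rintro rfl; exact hne (hW.link.uniq he hh0 hx hf0)
  by_cases hv0 : inE I S h0 = t
  · refine hsmall (Function.update p h0 ∅) ⟨hW.mem, hW.term, ?_, ?_⟩ ?_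
    · intro e he
      by_cases hne : e = h0
      · subst hne; rw [Function.update_self, hv0]; exact Flow.nil _
      · rw [Function.update_of_ne hne]
        exact (hW.link.flow e (hcut he)).of_ed
          (fun x hx => ⟨hav e (hcut he) hne hx, ((hW.link.flow e (hcut he)).ed_sub hx).2⟩)
    · intro e he e' he' hne
      by_cases h1 : e = h0
      · subst h1; rw [Function.update_self, ed_empty]; simp
      by_cases h2 : e' = h0
      · subst h2; rw [Function.update_self, ed_empty]; simp
      rw [Function.update_of_ne h1, Function.update_of_ne h2]
      exact hW.link.disj e (hcut he) e' (hcut he') hne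
    · intro e he
      by_cases h1 : e = h0
      · subst h1; rw [Function.update_self]; simp
      · rw [Function.update_of_ne h1]
  obtain ⟨⟨g0, x0, y0⟩, hd0, hx0, hy0⟩ := (hW.link.flow h0 hh0).first (fun h => hv0 h.symm)
  simp only at hx0 hy0
  subst hx0
  have hg0I := (hW.link.flow h0 hh0).inc _ hd0
  have hg0f : g0 ≠ f := by rintro rfl; exact hf (by rw [hg0I]; simp)
  have hg0In : g0 ∈ Ins I F S := (hW.link.flow h0 hh0).ed_sub (mem_ed hd0)
  let B : Set E := cut I F S \ {h0}
  have hLk : Link I (Ins I (F \ {f}) S) x0 B (inE I S) p := by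
    refine ⟨fun e he => (hW.link.flow e he.1).of_ed
      (fun x hx => ⟨hav e he.1 he.2 hx, ((hW.link.flow e he.1).ed_sub hx).2⟩), ?_⟩
    exact (hW.link.subset Set.sdiff_subset).disj
  rcases aug hLk (inE I S h0) with ⟨p', hp', G0, hG0, hnew⟩ | ⟨S0, ht0, hr0, hconn, h1, h2⟩
  · have hmem : ∀ h ∈ cut I F S, (if h = h0 then none else some h) ∈
        (insert none (some '' B) : Set (Option E)) := by
      intro h hh
      by_cases hhf : h = h0
      · simp [hhf]
      · simp only [hhf, if_false]; right; exact ⟨h, ⟨hh, hhf⟩, rfl⟩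
    have hW' : Wave I (F \ {f}) T x0 S (fun h => p' (if h = h0 then none else some h)) := by
      refine ⟨hW.mem, hW.term, ?_, ?_⟩
      · intro h hh
        have h3 := hp'.flow _ (hmem h (hcut hh))
        by_cases hhf : h = h0
        · subst hhf
          simp only [if_true, Option.elim] at h3 ⊢
          exact h3
        · simp only [hhf, if_false, Option.elim] at h3 ⊢; exact h3
      · intro h hh h' hh' hne
        refine hp'.disj _ (hmem h (hcut hh)) _ (hmem h' (hcut hh')) ?_
        by_cases h3 : h = h0 <;> by_cases h4 : h' = h0 <;> simp [h3, h4] <;> grind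
    have hbG : b ∈ G0 := by
      rcases hU S _ hW' b hb1 b' hbb hb' with h | ⟨h, hh, hbh⟩
      · exact absurd (Or.inl (hcut h)) hnu
      · rcases hnew _ (hmem h (hcut hh)) b hbh (by rw [hbb]; simp) with ⟨j, hj, hbj⟩ | h
        · exact absurd (Or.inr ⟨j, hj.1, hbj⟩) hnu
        · exact h
    have hgG : g0 ∈ G0 := by
      rcases hU S _ hW' g0 ⟨hg0In.1, hg0f⟩ y0 hg0I hy0 with h | ⟨h, hh, hbh⟩
      · exact absurd hg0In (cut_Ins h)
      · rcases hnew _ (hmem h (hcut hh)) g0 hbh (by rw [hg0I]; simp) with ⟨j, hj, hbj⟩ | h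
        · exact absurd (hW.link.uniq hj.1 hh0 hbj (mem_ed hd0)) hj.2
        · exact h
    have := hG0 hbG hgG
    subst this
    exact hnu (Or.inr ⟨h0, hh0, mem_ed hd0⟩)
  · have hS0 : S0 ⊆ S := fun x hx => (hconn x hx).ins hW.mem
    obtain ⟨p', hp', hp''⟩ := aug_exit hLk hS0 ht0 h1 h2 id
      (by
        intro e he hI
        obtain ⟨h3, h4⟩ := cut_ex hS0 he hI
        refine ⟨⟨hcut h3, ?_⟩, h4⟩
        rintro rfl
        exact hr0 (h4 ▸ (inE_mem he).1))
      (by intro e _ _ e' _ _ h; exact h)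
    have hW' : Wave I (F \ {f}) T x0 S0 p' := ⟨ht0, fun x hx => hW.term x (hS0 hx), hp'⟩
    rcases hU S0 p' hW' b hb1 b' hbb hb' with h | ⟨h, hh, hbh⟩
    · by_cases hI : b ∈ Ins I (F \ {f}) S
      · obtain ⟨i, hi, h⟩ := (hp'' b h).2 hI
        exact hnu (Or.inr ⟨i, hi.1, h⟩)
      · exact hnu (Or.inl (hcut (cut_ex hS0 h hI).1))
    · obtain ⟨⟨i, hi, hs⟩, -⟩ := hp'' h hh
      exact hnu (Or.inr ⟨i, hi.1, ed_mono hs hbh⟩)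

/-- iterated version of `Add` -/
theorem Add_finite {I : E → Sym2 V} {T : Set V} {t : V} {C : Set E} (hC : C.Finite) :
    ∀ {F : Set E}, Unh I (F \ C) T t → (∀ f ∈ C, t ∉ I f) → Unh I F T t := by
  induction C, hC using Set.Finite.induction_on with
  | empty => intro F h _; simpa using h
  | insert ha hs ih =>
    rename_i a s
    intro F h hC
    refine ih (Add (f := a) ?_ (hC a (by simp))) (fun f hf => hC f (by simp [hf]))
    have : (F \ s) \ {a} = F \ insert a s := by ext x; simp; tauto
    rw [this]; exact h

end LC

set_option linter.unusedVariables false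

namespace LC
open Classical
universe w
variable {V : Type u} {E : Type v} {ι : Type w}

def con (I : E → Sym2 V) (φ : V → V) : E → Sym2 V := fun e => (I e).map φ

theorem con_eq {I : E → Sym2 V} {φ : V → V} {e : E} {a b : V} (h : I e = s(a, b)) :
    con I φ e = s(φ a, φ b) := by simp [con, h]

theorem con_ex {I : E → Sym2 V} {φ : V → V} {e : E} {x y : V} (h : con I φ e = s(x, y)) :
    ∃ a b, I e = s(a, b) ∧ φ a = x ∧ φ b = y := by
  obtain ⟨a, b, hab⟩ := Sym2_ex (I e)
  rw [con_eq hab] at h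
  rcases Sym2.eq_iff.1 h with ⟨h1, h2⟩ | ⟨h1, h2⟩
  · exact ⟨a, b, hab, h1, h2⟩
  · exact ⟨b, a, by rw [hab, Sym2.eq_swap], h2, h1⟩

theorem con_con (I : E → Sym2 V) (φ ψ : V → V) : con (con I φ) ψ = con I (ψ ∘ φ) := by
  ext1 e; simp [con, Sym2.map_map]

theorem con_id (I : E → Sym2 V) : con I id = I := by
  ext1 e; simp [con]

theorem cut_con {I : E → Sym2 V} {φ : V → V} {F : Set E} {S : Set V} :
    cut (con I φ) F S = cut I F {v | φ v ∈ S} := by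
  ext e; constructor
  · rintro ⟨hF, x, y, hxy, hx, hy⟩
    obtain ⟨a, b, hab, rfl, rfl⟩ := con_ex hxy
    exact ⟨hF, a, b, hab, hx, hy⟩
  · rintro ⟨hF, a, b, hab, ha, hb⟩
    exact ⟨hF, _, _, con_eq hab, ha, hb⟩

theorem inE_con {I : E → Sym2 V} {φ : V → V} {F : Set E} {S : Set V} {e : E}
    (he : e ∈ cut I F {v | φ v ∈ S}) : inE (con I φ) S e = φ (inE I {v | φ v ∈ S} e) := by
  obtain ⟨hF, a, b, hab, ha, hb⟩ := he
  rw [inE_eq (S := {v | φ v ∈ S}) hab ha hb]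
  exact inE_eq (S := S) (con_eq hab) ha hb

/-- the image of a dart set, loops dropped -/
noncomputable def pushf (φ : V → V) (p : Finset (E × V × V)) : Finset (E × V × V) :=
  (p.image (fun d => (d.1, φ d.2.1, φ d.2.2))).filter (fun d => d.2.1 ≠ d.2.2)

theorem mem_pushf {φ : V → V} {p : Finset (E × V × V)} {e : E} {x y : V} :
    (e, x, y) ∈ pushf φ p ↔ ∃ a b, (e, a, b) ∈ p ∧ φ a = x ∧ φ b = y ∧ x ≠ y := by
  simp only [pushf, Finset.mem_filter, Finset.mem_image, Prod.mk.injEq, Prod.exists]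
  constructor
  · rintro ⟨⟨e', a, b, h, rfl, rfl, rfl⟩, h2⟩; exact ⟨a, b, h, rfl, rfl, h2⟩
  · rintro ⟨a, b, h, rfl, rfl, h2⟩; exact ⟨⟨e, a, b, h, rfl, rfl, rfl⟩, h2⟩

theorem ed_pushf {φ : V → V} {p : Finset (E × V × V)} : ed (pushf φ p) ⊆ ed p := by
  rintro e ⟨⟨e, x, y⟩, h, rfl⟩
  obtain ⟨a, b, h, -⟩ := mem_pushf.1 h
  exact ⟨_, h, rfl⟩

theorem Flow.push {I : E → Sym2 V} {F F' : Set E} {p : Finset (E × V × V)} {a b : V}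
    (h : Flow I F p a b) (φ : V → V)
    (hF : ∀ e ∈ ed p, ∀ x y, I e = s(x, y) → φ x ≠ φ y → e ∈ F') :
    Flow (con I φ) F' (pushf φ p) (φ a) (φ b) := by
  refine ⟨?_, ?_, ?_, ?_⟩
  · rintro ⟨e, x, y⟩ hd
    obtain ⟨x', y', h1, rfl, rfl, h2⟩ := mem_pushf.1 hd
    exact hF e (mem_ed h1) x' y' (h.inc _ h1) h2
  · rintro ⟨e, x, y⟩ hd
    obtain ⟨x', y', h1, rfl, rfl, h2⟩ := mem_pushf.1 hd
    exact con_eq (h.inc _ h1)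
  · rintro ⟨e, x, y⟩ hd ⟨e', x', y'⟩ hd' he
    simp only at he; subst he
    obtain ⟨a, b, h1, rfl, rfl, h2⟩ := mem_pushf.1 hd
    obtain ⟨a', b', h1', rfl, rfl, h2'⟩ := mem_pushf.1 hd'
    have := h.inj _ h1 _ h1' rfl
    simp only [Prod.mk.injEq, true_and] at this
    rw [this.1, this.2]
  · intro g
    have h1 := h.pot (g ∘ φ)
    simp only [Function.comp] at h1
    rw [← h1, pushf, Finset.sum_filter_of_ne, Finset.sum_image]
    · intro d hd d' hd' he
      simp only [Prod.mk.injEq] at he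
      exact h.inj d hd d' hd' he.1
    · intro d hd h2 h3; apply h2; rw [h3, sub_self]

structure IsCon (T : Set V) (φ : V → V) : Prop where
  alt : ∀ v, φ v = v ∨ φ v ∈ T
  fix : ∀ t ∈ T, φ t = t

noncomputable def colX (X : Set V) (t : V) : V → V := fun v => if v ∈ X then t else v

theorem Wave.isCon {I : E → Sym2 V} {F : Set E} {T : Set V} {t : V} {S : Set V}
    {p : E → Finset (E × V × V)} (h : Wave I F T t S p) (ht : t ∈ T) : IsCon T (colX S t) := by
  refine ⟨fun v => ?_, fun x hx => ?_⟩
  · by_cases hv : v ∈ S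
    · right; simp [colX, hv, ht]
    · left; simp [colX, hv]
  · by_cases hv : x ∈ S
    · simp [colX, hv, h.term x hv hx]
    · simp [colX, hv]

theorem colX_pre {X : Set V} {t : V} (ht : t ∈ X) : {v | colX X t v = t} = X := by
  ext v
  simp only [colX, Set.mem_ofPred_eq]
  by_cases hv : v ∈ X
  · simp [hv]
  · simp only [hv, if_false, iff_false]; rintro rfl; exact hv ht

/-- pushing a wave into a contraction -/
theorem Push {I : E → Sym2 V} {F1 F2 : Set E} {T1 T2 : Set V} {t : V} {S X : Set V}
    {p : E → Finset (E × V × V)} (h : Wave I F1 T1 t S p) (htX : t ∈ X)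
    (hT : ∀ x ∈ S, x ∉ X → x ∉ T2)
    (h12 : ∀ e ∈ F2, ∀ a b, I e = s(a, b) → a ∈ S → a ∉ X → b ∉ S → b ∉ X → e ∈ F1)
    (h21 : ∀ e ∈ F1, ∀ a b, I e = s(a, b) → a ∈ S → b ∈ S → b ∉ X → e ∈ F2) :
    ∃ p', Wave (con I (colX X t)) F2 T2 t (insert t (S \ X)) p' ∧
      ∀ e ∈ cut (con I (colX X t)) F2 (insert t (S \ X)),
        (inE (con I (colX X t)) (insert t (S \ X)) e = t ∧ p' e = ∅) ∨
        (e ∈ cut I F1 S ∧ inE I S e ∉ X ∧ p' e = pushf (colX X t) (p e)) := by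
  set φ := colX X t with hφ
  set S' := insert t (S \ X) with hS'
  have φX : ∀ x ∈ X, φ x = t := fun x hx => by simp [hφ, colX, hx]
  have φn : ∀ x, x ∉ X → φ x = x := fun x hx => by simp [hφ, colX, hx]
  have hcase : ∀ e ∈ cut (con I φ) F2 S', inE (con I φ) S' e ≠ t →
      e ∈ cut I F1 S ∧ inE I S e ∉ X ∧ inE (con I φ) S' e = inE I S e := by
    rintro e ⟨hF, x, y, hxy, hx, hy⟩ hne
    rw [inE_eq hxy hx hy] at hne ⊢
    obtain ⟨a, b, hab, rfl, rfl⟩ := con_ex hxy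
    have haX : a ∉ X := fun h => hne (φX a h)
    have hbX : b ∉ X := fun h => hy (by rw [φX b h]; exact Or.inl rfl)
    rw [φn a haX] at hx hne ⊢
    rw [φn b hbX] at hy
    have haS : a ∈ S := by
      rcases hx with hx | hx
      · exact absurd hx hne
      · exact hx.1
    have hbS : b ∉ S := fun h => hy (Or.inr ⟨h, hbX⟩)
    rw [inE_eq hab haS hbS]
    exact ⟨⟨h12 e hF a b hab haS haX hbS hbX, a, b, hab, haS, hbS⟩, haX, rfl⟩
  have hins : ∀ e ∈ Ins I F1 S, ∀ x y, I e = s(x, y) → φ x ≠ φ y → e ∈ Ins (con I φ) F2 S' := by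
    intro e he x y hxy hne
    obtain ⟨h1, h2, h3⟩ := (mem_Ins hxy).1 he
    have hm : ∀ x ∈ S, φ x ∈ S' := by
      intro x hx
      by_cases hxX : x ∈ X
      · rw [φX x hxX]; exact Or.inl rfl
      · rw [φn x hxX]; exact Or.inr ⟨hx, hxX⟩
    refine (mem_Ins (con_eq hxy)).2 ⟨?_, hm x h2, hm y h3⟩
    by_cases hy : y ∈ X
    · by_cases hx : x ∈ X
      · exact absurd (by rw [φX x hx, φX y hy]) hne
      · exact h21 e h1 y x (by rw [hxy, Sym2.eq_swap]) h3 h2 hx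
    · exact h21 e h1 x y hxy h2 h3 hy
  refine ⟨fun e => if inE (con I φ) S' e = t then ∅ else pushf φ (p e), ⟨Or.inl rfl, ?_, ?_, ?_⟩, ?_⟩
  · rintro x (hx | hx) hxT
    · exact hx
    · exact absurd hxT (hT x hx.1 hx.2)
  · intro e he
    by_cases h1 : inE (con I φ) S' e = t
    · simp only [h1, if_true]; exact Flow.nil _
    · simp only [h1, if_false]
      obtain ⟨h2, h3, h4⟩ := hcase e he h1
      have h5 := (h.link.flow e h2).push φ
        (fun e' he' x y hxy hne => hins e' ((h.link.flow e h2).ed_sub he') x y hxy hne)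
      rw [φX t htX, φn _ h3] at h5
      rw [h4]; exact h5
  · intro e he e' he' hne
    by_cases h1 : inE (con I φ) S' e = t
    · simp [h1, ed_empty]
    by_cases h2 : inE (con I φ) S' e' = t
    · simp [h2, ed_empty]
    simp only [h1, h2, if_false]
    exact (h.link.disj e (hcase e he h1).1 e' (hcase e' he' h2).1 hne).mono ed_pushf ed_pushf
  · intro e he
    by_cases h1 : inE (con I φ) S' e = t
    · left; simp [h1]
    · right; simp only [h1, if_false]
      exact ⟨(hcase e he h1).1, (hcase e he h1).2.1, trivial⟩

/-- lifting a wave of a contraction -/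
theorem Lift {I : E → Sym2 V} {F : Set E} {T : Set V} {t : V} {S : Set V} {φ : V → V}
    {pX q : E → Finset (E × V × V)} (hφ : IsCon T φ) (ht : t ∈ T)
    (hX : Wave I F T t {v | φ v = t} pX) (hS : Wave (con I φ) F T t S q)
    (hq : ∀ e ∈ cut (con I φ) F S, Clean (q e) t (inE (con I φ) S e)) :
    ∃ p', Wave I F T t {v | φ v ∈ S} p' ∧
      (∀ e ∈ cut I F {v | φ v = t}, e ∈ cut I F {v | φ v ∈ S} → p' e = pX e) ∧
      (∀ h ∈ cut I F {v | φ v = t}, Used (con I φ) F S q h →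
        (h ∈ cut I F {v | φ v ∈ S} ∧ p' h = pX h) ∨
        (∃ e ∈ cut I F {v | φ v ∈ S}, h ∈ ed (p' e) ∧ pX h ⊆ p' e)) ∧
      (∀ e ∈ cut I F {v | φ v ∈ S}, ∀ d ∈ p' e, φ d.2.2 = t → ∃ h ∈ cut I F {v | φ v = t}, d ∈ pX h) := by
  set X : Set V := {v | φ v = t} with hXdef
  set S' : Set V := {v | φ v ∈ S} with hS'
  have hcut : cut (con I φ) F S = cut I F S' := cut_con
  have hXS : X ⊆ S' := by intro v hv; show φ v ∈ S; rw [show φ v = t from hv]; exact hS.mem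
  have hfix : ∀ v, φ v ∈ S → φ v ≠ t → φ v = v := by
    intro v hv hne
    rcases hφ.alt v with h | h
    · exact h
    · exact absurd (hS.term _ hv h) hne
  -- darts away from `t`
  have hdart : ∀ e ∈ cut I F S', ∀ d ∈ q e, d.2.1 ≠ t →
      I d.1 = s(d.2.1, d.2.2) ∧ d.1 ∈ Ins I F S' ∧ d.1 ∉ Ins I F X ∧ d.1 ∉ cut I F X := by
    intro e he d hd hne
    rw [← hcut] at he
    have h1 := hS.link.flow e he
    have h2 := (hq e he).no_tgt d hd
    obtain ⟨a, b, hab, h3, h4⟩ := con_ex (h1.inc d hd)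
    have h5 := (mem_Ins (h1.inc d hd)).1 (h1.mem d hd)
    rw [← h3] at hne h5; rw [← h4] at h2 h5
    have ha := hfix a h5.2.1 hne
    have hb := hfix b h5.2.2 h2
    have haX : a ∉ X := hne
    have hbX : b ∉ X := h2
    refine ⟨by rw [← h3, ← h4, ha, hb]; exact hab, (mem_Ins hab).2 ⟨h5.1, h5.2.1, h5.2.2⟩, ?_, ?_⟩
    · intro h; exact hbX ((mem_Ins hab).1 h).2.2
    · rintro ⟨-, x, y, hxy, hx, hy⟩
      rcases Sym2.eq_iff.1 (hab.symm.trans hxy) with ⟨rfl, rfl⟩ | ⟨rfl, rfl⟩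
      · exact haX hx
      · exact hbX hx
  have hstart : ∀ e ∈ cut I F S', ∀ d ∈ q e, d.2.1 = t →
      ∃ m, I d.1 = s(m, d.2.2) ∧ m ∈ X ∧ d.2.2 ∉ X ∧ d.2.2 ∈ S' ∧ d.1 ∈ cut I F X ∧
        d.1 ∈ Ins I F S' ∧ inE I X d.1 = m := by
    intro e he d hd hne
    rw [← hcut] at he
    have h1 := hS.link.flow e he
    have h2 := (hq e he).no_tgt d hd
    obtain ⟨a, b, hab, h3, h4⟩ := con_ex (h1.inc d hd)
    have h5 := (mem_Ins (h1.inc d hd)).1 (h1.mem d hd)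
    rw [← h4] at h2 h5
    have hb := hfix b h5.2.2 h2
    have haX : a ∈ X := by show φ a = t; rw [h3, hne]
    have hbX : b ∉ X := h2
    have h6 : d.2.2 = b := by rw [← h4, hb]
    rw [h6]
    exact ⟨a, hab, haX, hbX, h5.2.2, ⟨h5.1, a, b, hab, haX, hbX⟩,
      (mem_Ins hab).2 ⟨h5.1, hXS haX, h5.2.2⟩, inE_eq hab haX hbX⟩
  have hInX : Ins I F X ⊆ Ins I F S' := Ins_mono le_rfl hXS
  -- choice of flows
  have hch : ∀ e, ∃ P : Finset (E × V × V), (e ∈ cut I F S' →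
        ∀ d ∈ P, φ d.2.2 = t → ∃ h ∈ cut I F X, d ∈ pX h) ∧ (e ∈ cut I F S' →
      (inE I S' e ∈ X ∧ e ∈ cut I F X ∧ P = pX e ∧ Flow I (Ins I F S') P t (inE I S' e)) ∨
      (inE I S' e ∉ X ∧ ∃ d ∈ q e, d.2.1 = t ∧ d.1 ∈ cut I F X ∧
        ed P = ed (pX d.1) ∪ ed (q e) ∧ pX d.1 ⊆ P ∧ Flow I (Ins I F S') P t (inE I S' e))) := by
    intro e
    by_cases he : e ∈ cut I F S'
    swap
    · exact ⟨∅, fun h => absurd h he, fun h => absurd h he⟩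
    by_cases hm : inE I S' e ∈ X
    · obtain ⟨-, b, hb, hbS⟩ := inE_mem he
      have hbX : b ∉ X := fun h => hbS (hXS h)
      have heX : e ∈ cut I F X := ⟨he.1, _, b, hb, hm, hbX⟩
      refine ⟨pX e, fun _ d hd _ => ⟨e, heX, hd⟩, fun _ => Or.inl ?_⟩
      refine ⟨hm, heX, rfl, ?_⟩
      have h1 := hX.link.flow e heX
      rw [inE_eq hb hm hbX] at h1
      exact h1.mono hInX
    · have he' := he
      rw [← hcut] at he'
      have h1 := hS.link.flow e he'
      have h2 : inE (con I φ) S e = inE I S' e := by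
        rw [inE_con he]; exact hfix _ (inE_mem he).1 hm
      have hne : t ≠ inE (con I φ) S e := by
        rw [h2]; intro h; apply hm; rw [← h]; exact hφ.fix t ht
      obtain ⟨d, hd, hdt, hdt'⟩ := h1.first hne
      obtain ⟨m, h3, h4, h5, h6, h7, h8, h9⟩ := hstart e he d hd hdt
      have hsub : ({d} : Finset (E × V × V)) ⊆ q e := by simpa using hd
      have hsing : Flow (con I φ) (Ins (con I φ) F S) {d} t d.2.2 := by
        have h10 := Flow.single (h1.mem d hd) (h1.inc d hd)
        rw [hdt] at h10
        have : d = (d.1, t, d.2.2) := by rw [← hdt]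
        rw [this]; exact h10
      have hrest := h1.sdiff hsing hsub
      have hrest' : Flow I (Ins I F S') (q e \ {d}) d.2.2 (inE I S' e) := by
        have hnt : ∀ d' ∈ q e \ {d}, d'.2.1 ≠ t := by
          intro d' hd' h
          rw [Finset.mem_sdiff, Finset.mem_singleton] at hd'
          exact hd'.2 ((hq e he').src_uniq d' hd'.1 d hd h hdt)
        refine ⟨?_, ?_, hrest.inj, ?_⟩
        · intro d' hd'; exact (hdart e he d' (Finset.mem_sdiff.1 hd').1 (hnt d' hd')).2.1
        · intro d' hd'; exact (hdart e he d' (Finset.mem_sdiff.1 hd').1 (hnt d' hd')).1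
        · rw [← h2]; exact hrest.pot
      have hrestX : ∀ x ∈ ed (q e \ {d}), x ∉ Ins I F X ∧ x ∉ cut I F X := by
        rintro x ⟨d', hd', rfl⟩
        have hd'2 := Finset.mem_sdiff.1 hd'
        refine (hdart e he d' hd'2.1 ?_).2.2
        intro h
        exact hd'2.2 (Finset.mem_singleton.2 ((hq e he').src_uniq d' hd'2.1 d hd h hdt))
      have hm0 : Flow I (Ins I F S') {(d.1, m, d.2.2)} m d.2.2 := Flow.single h8 h3
      have hp0 : Flow I (Ins I F S') (pX d.1) t m := by
        have := hX.link.flow d.1 h7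
        rw [h9] at this; exact this.mono hInX
      have hA := hm0.append hrest' (by
        rw [ed_singleton, Set.disjoint_left]
        rintro x hx hx2
        rw [Set.mem_singleton_iff] at hx; subst hx
        exact (hrestX _ hx2).2 h7)
      have hAed : ed ({(d.1, m, d.2.2)} ∪ (q e \ {d})) = ed (q e) := by
        have : q e = {d} ∪ (q e \ {d}) := by
          rw [Finset.union_sdiff_of_subset hsub]
        conv_rhs => rw [this]
        rw [ed_union, ed_union, ed_singleton, ed_singleton]
      have hB := hp0.append hA (by
        rw [Set.disjoint_left]
        intro x hx hx2
        have hxX := (hX.link.flow d.1 h7).ed_sub hx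
        rw [ed_union, ed_singleton] at hx2
        rcases hx2 with hx2 | hx2
        · rw [Set.mem_singleton_iff] at hx2; subst hx2; exact cut_Ins h7 hxX
        · exact (hrestX _ hx2).1 hxX)
      refine ⟨_, fun _ d' hd' hdX => ?_, fun _ => Or.inr ⟨hm, d, hd, hdt, h7, ?_, Finset.subset_union_left, hB⟩⟩
      · rcases Finset.mem_union.1 hd' with hd' | hd'
        · exact ⟨d.1, h7, hd'⟩
        exfalso
        rcases Finset.mem_union.1 hd' with hd' | hd'
        · rw [Finset.mem_singleton.1 hd'] at hdX
          exact h5 hdX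
        · have h11 := hrestX _ (mem_ed hd')
          have h12 := hrest'.inc d' hd'
          have h13 := (hrest'.mem d' hd').1
          by_cases h14 : d'.2.1 ∈ X
          · exact h11.1 ((mem_Ins h12).2 ⟨h13, h14, hdX⟩)
          · exact h11.2 ⟨h13, _, _, h12.trans Sym2.eq_swap, hdX, h14⟩
      · rw [ed_union, hAed]
  choose P hPX hP using hch
  have hqX : ∀ e ∈ cut I F S', ∀ x ∈ ed (q e), x ∉ Ins I F X := by
    rintro e he x ⟨d, hd, rfl⟩
    by_cases h : d.2.1 = t
    · obtain ⟨m, -, -, -, -, h7, -⟩ := hstart e he d hd h; exact cut_Ins h7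
    · exact (hdart e he d hd h).2.2.1
  have hqS : ∀ e ∈ cut I F S', ∀ x ∈ ed (q e), x ∈ Ins I F S' := by
    rintro e he x ⟨d, hd, rfl⟩
    by_cases h : d.2.1 = t
    · obtain ⟨m, -, -, -, -, h7, h8, -⟩ := hstart e he d hd h; exact h8
    · exact (hdart e he d hd h).2.1
  refine ⟨P, ⟨hXS hX.mem, ?_, ?_, ?_⟩, ?_, ?_, fun e he => hPX e he⟩
  · intro x hx hxT
    have h1 : φ x = x := hφ.fix x hxT
    exact hS.term x (h1 ▸ hx) hxT
  · intro e he
    rcases hP e he with h | ⟨-, d, -, -, -, -, -, h⟩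
    exacts [h.2.2.2, h]
  · intro e he e' he' hne
    have key : ∀ e ∈ cut I F S', ∀ e' ∈ cut I F S', e ≠ e' →
        (inE I S' e ∈ X ∧ e ∈ cut I F X ∧ P e = pX e ∧ Flow I (Ins I F S') (P e) t (inE I S' e)) →
        (inE I S' e' ∉ X ∧ ∃ d ∈ q e', d.2.1 = t ∧ d.1 ∈ cut I F X ∧
        ed (P e') = ed (pX d.1) ∪ ed (q e') ∧ pX d.1 ⊆ P e' ∧
        Flow I (Ins I F S') (P e') t (inE I S' e')) →
        Disjoint (ed (P e)) (ed (P e')) := by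
      rintro e he e' he' hne ⟨-, h1, h2, -⟩ ⟨-, d, hd, -, h3, h4, -, -⟩
      rw [h2, h4, Set.disjoint_union_right]
      constructor
      · refine hX.link.disj e h1 d.1 h3 ?_
        rintro rfl; exact cut_Ins he (hqS e' he' _ (mem_ed hd))
      · rw [Set.disjoint_left]; intro x hx hx2
        exact hqX e' he' x hx2 ((hX.link.flow e h1).ed_sub hx)
    rcases hP e he with h | h <;> rcases hP e' he' with h' | h'
    · rw [h.2.2.1, h'.2.2.1]; exact hX.link.disj e h.2.1 e' h'.2.1 hne
    · exact key e he e' he' hne h h'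
    · exact (key e' he' e he (Ne.symm hne) h' h).symm
    · obtain ⟨-, d, hd, -, h3, h4, -, -⟩ := h
      obtain ⟨-, d', hd', -, h3', h4', -, -⟩ := h'
      have hqd : Disjoint (ed (q e)) (ed (q e')) :=
        hS.link.disj e (hcut ▸ he) e' (hcut ▸ he') hne
      rw [h4, h4', Set.disjoint_union_right, Set.disjoint_union_left, Set.disjoint_union_left]
      refine ⟨⟨?_, ?_⟩, ?_, hqd⟩
      · refine hX.link.disj _ h3 _ h3' ?_
        intro h; exact Set.disjoint_left.1 hqd (mem_ed hd) (h ▸ mem_ed hd')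
      · rw [Set.disjoint_left]; intro x hx hx2
        exact hqX e he x hx ((hX.link.flow _ h3').ed_sub hx2)
      · rw [Set.disjoint_left]; intro x hx hx2
        exact hqX e' he' x hx2 ((hX.link.flow _ h3).ed_sub hx)
  · have haux : ∀ e ∈ cut I F X, e ∈ cut I F S' → inE I S' e ∈ X := by
      intro e heX he
      obtain ⟨-, a, b, hab, ha, hb⟩ := heX
      obtain ⟨-, x, y, hxy, hx, hy⟩ := he
      rw [inE_eq hxy hx hy]
      rcases Sym2.eq_iff.1 (hab.symm.trans hxy) with ⟨rfl, rfl⟩ | ⟨rfl, rfl⟩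
      · exact ha
      · exact absurd (hXS ha) hy
    intro e heX he
    rcases hP e he with h | h
    · exact h.2.2.1
    · exact absurd (haux e heX he) h.1
  · have haux : ∀ e ∈ cut I F X, e ∈ cut I F S' → inE I S' e ∈ X := by
      intro e heX he
      obtain ⟨-, a, b, hab, ha, hb⟩ := heX
      obtain ⟨-, x, y, hxy, hx, hy⟩ := he
      rw [inE_eq hxy hx hy]
      rcases Sym2.eq_iff.1 (hab.symm.trans hxy) with ⟨rfl, rfl⟩ | ⟨rfl, rfl⟩
      · exact ha
      · exact absurd (hXS ha) hy
    rintro h hh (h1 | ⟨e, he, hhe⟩)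
    · left
      rw [hcut] at h1
      refine ⟨h1, ?_⟩
      rcases hP h h1 with h2 | h2
      · exact h2.2.2.1
      · exact absurd (haux h hh h1) h2.1
    · right
      rw [hcut] at he
      obtain ⟨d, hd, rfl⟩ := hhe
      have hdt : d.2.1 = t := by
        by_contra hne; exact (hdart e he d hd hne).2.2.2 hh
      rcases hP e he with h2 | ⟨-, d', hd', hdt', h3, h4, h5, -⟩
      · exfalso
        have h1 := hS.link.flow e (hcut ▸ he)
        have hc := hq e (hcut ▸ he)
        rw [inE_con he] at hc
        exact hc.no_src d hd (by rw [hdt]; exact (show φ _ = t from h2.1).symm)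
      · have hc := hq e (hcut ▸ he)
        have := hc.src_uniq d hd d' hd' hdt hdt'
        subst this
        exact ⟨e, he, by rw [h4]; exact Or.inr (mem_ed hd), h5⟩

end LC

set_option linter.unusedVariables false

namespace LC
open Classical
universe w
variable {V : Type u} {E : Type v} {ι : Type w}

/-- one wave extends another one -/
def Ext (I : E → Sym2 V) (F : Set E) (S : Set V) (p : E → Finset (E × V × V)) (S' : Set V)
    (p' : E → Finset (E × V × V)) : Prop :=
  S ⊆ S' ∧ ∀ e ∈ cut I F S, e ∈ cut I F S' → p' e = p e

theorem cut_between {I : E → Sym2 V} {F : Set E} {S S' S'' : Set V} (h : S ⊆ S') (h' : S' ⊆ S'')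
    {e : E} (he : e ∈ cut I F S) (he' : e ∈ cut I F S'') : e ∈ cut I F S' := by
  obtain ⟨hF, a, b, hab, ha, hb⟩ := he
  obtain ⟨_, c, d, hcd, hc, hd⟩ := he'
  rw [hab] at hcd
  rcases Sym2.eq_iff.1 hcd with ⟨rfl, rfl⟩ | ⟨rfl, rfl⟩
  · exact ⟨hF, a, b, hab, h ha, fun h1 => hd (h' h1)⟩
  · exact absurd (h' (h ha)) hd

theorem Ext.refl {I : E → Sym2 V} {F : Set E} {S : Set V} {p : E → Finset (E × V × V)} :
    Ext I F S p S p := ⟨subset_rfl, fun _ _ _ => rfl⟩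

theorem Ext.trans {I : E → Sym2 V} {F : Set E} {S S' S'' : Set V}
    {p p' p'' : E → Finset (E × V × V)} (h : Ext I F S p S' p') (h' : Ext I F S' p' S'' p'') :
    Ext I F S p S'' p'' := by
  refine ⟨h.1.trans h'.1, fun e he he' => ?_⟩
  have := cut_between h.1 h'.1 he he'
  rw [h'.2 e this he', h.2 e he this]

theorem wave_union {κ : Type*} [Nonempty κ] {I : E → Sym2 V} {F : Set E} {T : Set V} {t : V}
    (Sf : κ → Set V) (pf : κ → E → Finset (E × V × V))
    (hw : ∀ i, Wave I F T t (Sf i) (pf i))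
    (hc : ∀ i j, Ext I F (Sf i) (pf i) (Sf j) (pf j) ∨ Ext I F (Sf j) (pf j) (Sf i) (pf i)) :
    ∃ p, Wave I F T t (⋃ i, Sf i) p ∧ ∀ i, Ext I F (Sf i) (pf i) (⋃ i, Sf i) p := by
  let p : E → Finset (E × V × V) := fun e =>
    if h : ∃ i, e ∈ cut I F (Sf i) then pf h.choose e else ∅
  have hsub : ∀ i, Sf i ⊆ ⋃ i, Sf i := fun i => Set.subset_iUnion Sf i
  have key : ∀ i e, e ∈ cut I F (Sf i) → e ∈ cut I F (⋃ i, Sf i) → p e = pf i e := by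
    intro i e he heU
    have h : ∃ i, e ∈ cut I F (Sf i) := ⟨i, he⟩
    have h1 : p e = pf h.choose e := by simp only [p]; rw [dif_pos h]
    have h2 := h.choose_spec
    rw [h1]
    rcases hc h.choose i with h3 | h3
    · exact (h3.2 e h2 he).symm
    · exact h3.2 e he h2
  have hex : ∀ e ∈ cut I F (⋃ i, Sf i), ∃ i, ∀ j, Sf i ⊆ Sf j →
      e ∈ cut I F (Sf j) ∧ inE I (Sf j) e = inE I (⋃ i, Sf i) e := by
    rintro e ⟨hF, a, b, hab, ha, hb⟩
    obtain ⟨i, hi⟩ := Set.mem_iUnion.1 ha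
    refine ⟨i, fun j hj => ?_⟩
    have hbj : b ∉ Sf j := fun h => hb (hsub j h)
    exact ⟨⟨hF, a, b, hab, hj hi, hbj⟩, by rw [inE_eq hab ha hb, inE_eq hab (hj hi) hbj]⟩
  refine ⟨p, ⟨hsub (Classical.arbitrary κ) (hw _).mem, ?_, ?_, ?_⟩, fun i => ⟨hsub i, fun e he he' => key i e he he'⟩⟩
  · intro x hx hxT
    obtain ⟨i, hi⟩ := Set.mem_iUnion.1 hx
    exact (hw i).term x hi hxT
  · intro e he
    obtain ⟨i, hi⟩ := hex e he
    obtain ⟨h1, h2⟩ := hi i subset_rfl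
    rw [key i e h1 he, ← h2]
    exact ((hw i).link.flow e h1).mono (Ins_mono subset_rfl (hsub i))
  · intro e he e' he' hne
    obtain ⟨i, hi⟩ := hex e he
    obtain ⟨j, hj⟩ := hex e' he'
    rcases hc i j with h | h
    · have h1 := (hi j h.1).1
      have h2 := (hj j subset_rfl).1
      rw [key j e h1 he, key j e' h2 he']
      exact (hw j).link.disj e h1 e' h2 hne
    · have h1 := (hi i subset_rfl).1
      have h2 := (hj i h.1).1
      rw [key i e h1 he, key i e' h2 he']
      exact (hw i).link.disj e h1 e' h2 hne

theorem Wave.triv (I : E → Sym2 V) (F : Set E) (T : Set V) (t : V) :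
    Wave I F T t {t} (fun _ => ∅) := by
  refine ⟨rfl, fun x hx _ => hx, fun e he => ?_, fun i _ j _ _ => by simp [ed_empty]⟩
  have : inE I {t} e = t := (inE_mem he).1
  rw [this]; exact Flow.nil t

theorem Wave.clean {I : E → Sym2 V} {F : Set E} {T : Set V} {t : V} {S : Set V}
    {p : E → Finset (E × V × V)} (h : Wave I F T t S p) :
    ∃ p', Wave I F T t S p' ∧ ∀ e ∈ cut I F S, p' e ⊆ p e ∧ Clean (p' e) t (inE I S e) := by
  obtain ⟨p', h1, h2⟩ := h.link.clean
  exact ⟨p', ⟨h.mem, h.term, h1⟩, h2⟩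

/-- there is a largest wave -/
theorem max_wave (I : E → Sym2 V) (F : Set E) {T : Set V} {t : V} (ht : t ∈ T) :
    ∃ X p, Wave I F T t X p ∧ ∀ S q, Wave I F T t S q → S ⊆ X := by
  let α := {x : Set V × (E → Finset (E × V × V)) // Wave I F T t x.1 x.2}
  have : Nonempty α := ⟨⟨(_, _), Wave.triv I F T t⟩⟩
  obtain ⟨⟨⟨X, p⟩, hX⟩, hmax⟩ := exists_maximal_of_nonempty_chains_bounded
    (r := fun a b : α => Ext I F a.1.1 a.1.2 b.1.1 b.1.2) (by
      intro c hc hne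
      have : Nonempty c := hne.to_subtype
      obtain ⟨p, hp, hu⟩ := wave_union (κ := c) (I := I) (F := F) (T := T) (t := t)
        (fun i => i.1.1.1) (fun i => i.1.1.2) (fun i => i.1.2) (by
          intro i j
          by_cases hij : i.1 = j.1
          · left; rw [hij]; exact Ext.refl
          · exact hc i.2 j.2 hij)
      exact ⟨⟨(_, p), hp⟩, fun a ha => hu ⟨a, ha⟩⟩) (fun h h' => h.trans h')
  refine ⟨X, p, hX, fun S q hS => ?_⟩
  obtain ⟨q', hq', -⟩ := Push (F2 := F) (T2 := T) hS hX.mem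
    (by intro x hx hxX hxT; exact hxX (hS.term x hx hxT ▸ hX.mem))
    (by intro e he; intros; exact he) (by intro e he; intros; exact he)
  obtain ⟨q2, hq2, hcl⟩ := hq'.clean
  have hX' : Wave I F T t {v | colX X t v = t} p := by rw [colX_pre hX.mem]; exact hX
  obtain ⟨p', h1, h2, -⟩ := Lift (hX.isCon ht) ht hX' hq2 (fun e he => (hcl e he).2)
  have h3 := hmax ⟨(_, p'), h1⟩ (by
    refine ⟨?_, ?_⟩
    · intro v hv
      show colX X t v ∈ insert t (S \ X)
      rw [show colX X t v = t by simp only [colX]; exact if_pos hv]; exact Or.inl rfl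
    · rw [colX_pre hX.mem] at h2; exact h2)
  intro v hv
  by_contra hvX
  apply hvX
  apply h3.1
  show colX X t v ∈ insert t (S \ X)
  rw [show colX X t v = v by simp only [colX]; exact if_neg hvX]
  exact Or.inr ⟨hv, hvX⟩

/-- contraction systems -/
structure CS (I : E → Sym2 V) (F : Set E) (T : Set V) (φ : V → V)
    (p : V → E → Finset (E × V × V)) : Prop where
  con : IsCon T φ
  wave : ∀ t ∈ T, Wave I F T t {v | φ v = t} (p t)

theorem CS.triv (I : E → Sym2 V) (F : Set E) (T : Set V) : CS I F T id (fun _ _ => ∅) :=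
  ⟨⟨fun _ => Or.inl rfl, fun _ _ => rfl⟩, fun t _ => by
    have : {v : V | id v = t} = {t} := by ext; simp
    rw [this]; exact Wave.triv I F T t⟩

theorem CS.comp {I : E → Sym2 V} {F : Set E} {T : Set V} {φ ψ : V → V}
    {p q : V → E → Finset (E × V × V)} (h : CS I F T φ p) (h' : CS (LC.con I φ) F T ψ q)
    (hcl : ∀ t ∈ T, ∀ e ∈ cut (LC.con I φ) F {v | ψ v = t},
      Clean (q t e) t (inE (LC.con I φ) {v | ψ v = t} e)) :
    ∃ p', CS I F T (ψ ∘ φ) p' ∧ ∀ t ∈ T,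
      Ext I F {v | φ v = t} (p t) {v | ψ (φ v) = t} (p' t) ∧
      (∀ h ∈ cut I F {v | φ v = t}, Used (LC.con I φ) F {v | ψ v = t} (q t) h →
        (h ∈ cut I F {v | ψ (φ v) = t} ∧ p' t h = p t h) ∨
        (∃ e ∈ cut I F {v | ψ (φ v) = t}, h ∈ ed (p' t e) ∧ p t h ⊆ p' t e))  ∧
      (∀ e ∈ cut I F {v | ψ (φ v) = t}, ∀ d ∈ p' t e, φ d.2.2 = t → ∃ h ∈ cut I F {v | φ v = t}, d ∈ p t h) := by
  have h1 : ∀ t : V, ∃ p' : E → Finset (E × V × V), t ∈ T →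
      Wave I F T t {v | ψ (φ v) = t} p' ∧ Ext I F {v | φ v = t} (p t) {v | ψ (φ v) = t} p' ∧
      (∀ h ∈ cut I F {v | φ v = t}, Used (LC.con I φ) F {v | ψ v = t} (q t) h →
        (h ∈ cut I F {v | ψ (φ v) = t} ∧ p' h = p t h) ∨
        (∃ e ∈ cut I F {v | ψ (φ v) = t}, h ∈ ed (p' e) ∧ p t h ⊆ p' e))  ∧
      (∀ e ∈ cut I F {v | ψ (φ v) = t}, ∀ d ∈ p' e, φ d.2.2 = t → ∃ h ∈ cut I F {v | φ v = t}, d ∈ p t h) := by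
    intro t
    by_cases ht : t ∈ T
    · obtain ⟨p', h1, h2, h3⟩ := Lift h.con ht (h.wave t ht) (h'.wave t ht) (hcl t ht)
      refine ⟨p', fun _ => ⟨h1, ⟨?_, h2⟩, h3⟩⟩
      intro v hv
      have hv : φ v = t := hv
      show ψ (φ v) = t
      rw [hv, h'.con.fix t ht]
    · exact ⟨fun _ => ∅, fun h => absurd h ht⟩
  choose p' hp' using h1
  refine ⟨p', ⟨⟨fun v => ?_, fun t ht => ?_⟩, fun t ht => (hp' t ht).1⟩, fun t ht => (hp' t ht).2⟩
  · rcases h'.con.alt (φ v) with h1 | h1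
    · rcases h.con.alt v with h2 | h2
      · left; show ψ (φ v) = v; rw [h1, h2]
      · right; show ψ (φ v) ∈ T; rw [h1]; exact h2
    · exact Or.inr h1
  · show ψ (φ t) = t
    rw [h.con.fix t ht, h'.con.fix t ht]

theorem CS.clean {I : E → Sym2 V} {F : Set E} {T : Set V} {φ : V → V}
    {p : V → E → Finset (E × V × V)} (h : CS I F T φ p) : ∃ p', CS I F T φ p' ∧
      ∀ t ∈ T, ∀ e ∈ cut I F {v | φ v = t}, p' t e ⊆ p t e ∧ Clean (p' t e) t (inE I {v | φ v = t} e) := by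
  have h1 : ∀ t : V, ∃ p' : E → Finset (E × V × V), t ∈ T → Wave I F T t {v | φ v = t} p' ∧
      ∀ e ∈ cut I F {v | φ v = t}, p' e ⊆ p t e ∧ Clean (p' e) t (inE I {v | φ v = t} e) := by
    intro t
    by_cases ht : t ∈ T
    · obtain ⟨p', h1, h2⟩ := (h.wave t ht).clean
      exact ⟨p', fun _ => ⟨h1, h2⟩⟩
    · exact ⟨fun _ => ∅, fun h => absurd h ht⟩
  choose p' hp' using h1
  exact ⟨p', ⟨h.con, fun t ht => (hp' t ht).1⟩, fun t ht => (hp' t ht).2⟩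

theorem IsCon.idem {T : Set V} {φ : V → V} (h : IsCon T φ) (v : V) : φ (φ v) = φ v := by
  rcases h.alt v with h1 | h1
  · rw [h1, h1]
  · exact h.fix _ h1

/-- contraction of a single wave as a contraction system -/
theorem Wave.cs {I : E → Sym2 V} {F : Set E} {T : Set V} {t : V} {S : Set V}
    {p : E → Finset (E × V × V)} (h : Wave I F T t S p) (ht : t ∈ T) :
    CS I F T (colX S t) (fun x => if x = t then p else fun _ => ∅) := by
  refine ⟨h.isCon ht, fun x hx => ?_⟩
  by_cases hxt : x = t
  · subst hxt; simp only [if_true]; rw [colX_pre h.mem]; exact h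
  · simp only [hxt, if_false]
    have : {v | colX S t v = x} = {x} := by
      ext v; simp only [colX, Set.mem_ofPred_eq, Set.mem_singleton_iff]
      by_cases hv : v ∈ S
      · simp only [hv, if_true]; constructor
        · intro h; exact absurd h.symm hxt
        · intro h1; subst h1; exact absurd (h.term v hv hx) hxt
      · simp [hv]
    rw [this]; exact Wave.triv I F T x

/-- simultaneous maximal contraction -/
theorem max_CS (I : E → Sym2 V) (F : Set E) (T : Set V) :
    ∃ φ p, CS I F T φ p ∧ WF (con I φ) F T := by
  let α := {x : (V → V) × (V → E → Finset (E × V × V)) // CS I F T x.1 x.2}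
  have : Nonempty α := ⟨⟨(_, _), CS.triv I F T⟩⟩
  obtain ⟨⟨⟨φ, p⟩, hX⟩, hmax⟩ := exists_maximal_of_nonempty_chains_bounded
    (r := fun a b : α => ∀ t ∈ T, Ext I F {v | a.1.1 v = t} (a.1.2 t) {v | b.1.1 v = t} (b.1.2 t))
    (by
      intro c hc hne
      have : Nonempty c := hne.to_subtype
      have hcomp : ∀ i j : c, (∀ t ∈ T, Ext I F {v | i.1.1.1 v = t} (i.1.1.2 t) {v | j.1.1.1 v = t} (j.1.1.2 t)) ∨
          (∀ t ∈ T, Ext I F {v | j.1.1.1 v = t} (j.1.1.2 t) {v | i.1.1.1 v = t} (i.1.1.2 t)) := by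
        intro i j
        by_cases hij : i.1 = j.1
        · left; intro t ht; rw [hij]; exact Ext.refl
        · exact hc i.2 j.2 hij
      let φ : V → V := fun v => if h : ∃ i : c, i.1.1.1 v ∈ T then h.choose.1.1.1 v else v
      have huniq : ∀ (i j : c) v, i.1.1.1 v ∈ T → j.1.1.1 v ∈ T → i.1.1.1 v = j.1.1.1 v := by
        intro i j v hi hj
        rcases hcomp i j with h | h
        · exact ((h _ hi).1 (show v ∈ {x | i.1.1.1 x = i.1.1.1 v} from rfl) : j.1.1.1 v = _).symm
        · exact ((h _ hj).1 (show v ∈ {x | j.1.1.1 x = j.1.1.1 v} from rfl) : i.1.1.1 v = _)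
      have hφ : ∀ (i : c) v, i.1.1.1 v ∈ T → φ v = i.1.1.1 v := by
        intro i v hi
        have h : ∃ i : c, i.1.1.1 v ∈ T := ⟨i, hi⟩
        have : φ v = h.choose.1.1.1 v := by simp only [φ]; rw [dif_pos h]
        rw [this]; exact huniq _ _ _ h.choose_spec hi
      have hpre : ∀ t ∈ T, (⋃ i : c, {v | i.1.1.1 v = t}) = {v | φ v = t} := by
        intro t ht
        ext v; simp only [Set.mem_iUnion, Set.mem_ofPred_eq]
        constructor
        · rintro ⟨i, rfl⟩; exact hφ i v ht
        · intro h
          by_cases hv : ∃ i : c, i.1.1.1 v ∈ T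
          · obtain ⟨i, hi⟩ := hv
            exact ⟨i, by rw [← hφ i v hi]; exact h⟩
          · have h2 : φ v = v := by simp only [φ]; rw [dif_neg hv]
            rw [h2] at h; subst h
            exact ⟨Classical.arbitrary c, (Classical.arbitrary c).1.2.con.fix v ht⟩
      have hw : ∀ t, ∃ p, t ∈ T → Wave I F T t {v | φ v = t} p ∧ ∀ i : c,
          Ext I F {v | i.1.1.1 v = t} (i.1.1.2 t) {v | φ v = t} p := by
        intro t
        by_cases ht : t ∈ T
        · obtain ⟨p, hp, hu⟩ := wave_union (κ := c) (I := I) (F := F) (T := T) (t := t)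
            (fun i => {v | i.1.1.1 v = t}) (fun i => i.1.1.2 t) (fun i => i.1.2.wave t ht) (by
              intro i j
              rcases hcomp i j with h | h
              · exact Or.inl (h t ht)
              · exact Or.inr (h t ht))
          rw [hpre t ht] at hp hu
          exact ⟨p, fun _ => ⟨hp, hu⟩⟩
        · exact ⟨fun _ => ∅, fun h => absurd h ht⟩
      choose p hp using hw
      refine ⟨⟨(φ, p), ⟨⟨fun v => ?_, fun t ht => ?_⟩, fun t ht => (hp t ht).1⟩⟩,
        fun a ha t ht => (hp t ht).2 ⟨a, ha⟩⟩
      · by_cases hv : ∃ i : c, i.1.1.1 v ∈ T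
        · obtain ⟨i, hi⟩ := hv
          right; show φ v ∈ T; rw [hφ i v hi]; exact hi
        · left; simp only [φ]; rw [dif_neg hv]
      · have h1 := (Classical.arbitrary c).1.2.con.fix t ht
        show φ t = t
        rw [hφ (Classical.arbitrary c) t (by rw [h1]; exact ht), h1])
    (fun h h' t ht => (h t ht).trans (h' t ht))
  refine ⟨φ, p, hX, ?_⟩
  intro t ht S q hS v hv hvt τ hτ hconn
  have hfix : φ v = v → v = t := by
    intro hvv
    obtain ⟨q', h1, h2⟩ := (hS.cs ht).clean
    obtain ⟨p', h3, h4⟩ := hX.comp h1 (fun t ht e he => (h2 t ht e he).2)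
    have h5 := hmax ⟨(_, p'), h3⟩ (fun t ht => (h4 t ht).1)
    have h6 : φ v = t := (h5 t ht).1 (show colX S t (φ v) = t by
      rw [hvv]; simp only [colX]; rw [if_pos hv])
    rw [hvv] at h6; exact h6
  have hne : φ v ≠ v := fun h => hvt (hfix h)
  have : τ ∈ ({v} : Set V) := hconn.closed {v} rfl (by
    rintro e he x y hxy rfl
    obtain ⟨a, b, hab, hax, hby⟩ := con_ex hxy
    exact absurd (by rw [← hax]; exact hX.con.idem a) hne)
  have : τ = v := this
  subst this
  exact hvt (hS.term τ hv hτ)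

end LC

set_option linter.unusedVariables false

namespace LC
open Classical
universe w
variable {V : Type u} {E : Type v} {ι : Type w}

/-- number of cut edges of a flow, modulo two -/
theorem Flow.parity {I : E → Sym2 V} {F : Set E} {p : Finset (E × V × V)} {a b : V}
    (h : Flow I F p a b) (F0 : Set E) (hF : F ⊆ F0) (D : Set V) :
    ((ed p ∩ cut I F0 D).ncard : ZMod 2) =
      (if a ∈ D then 1 else 0) + (if b ∈ D then 1 else 0) := by
  have h1 : ed p ∩ cut I F0 D =
      (((p.filter (fun d => ¬ (d.2.1 ∈ D ↔ d.2.2 ∈ D))).image Prod.fst : Finset E) : Set E) := by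
    ext e
    simp only [Finset.coe_image, Set.mem_image, Finset.mem_coe, Finset.mem_filter, Set.mem_inter_iff]
    constructor
    · rintro ⟨⟨d, hd, rfl⟩, hF, x, y, hxy, hx, hy⟩
      refine ⟨d, ⟨hd, ?_⟩, rfl⟩
      have := h.inc d hd
      rw [hxy] at this
      rcases Sym2.eq_iff.1 this with ⟨h1, h2⟩ | ⟨h1, h2⟩
      · rw [← h1, ← h2]; simp [hx, hy]
      · rw [← h1, ← h2]; simp [hx, hy]
    · rintro ⟨d, ⟨hd, hn⟩, rfl⟩
      refine ⟨⟨d, hd, rfl⟩, hF (h.mem d hd), ?_⟩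
      by_cases h1 : d.2.1 ∈ D
      · exact ⟨d.2.1, d.2.2, h.inc d hd, h1, fun h2 => hn ⟨fun _ => h2, fun _ => h1⟩⟩
      · refine ⟨d.2.2, d.2.1, by rw [h.inc d hd, Sym2.eq_swap], ?_, h1⟩
        by_contra h2; exact hn ⟨fun h3 => absurd h3 h1, fun h3 => absurd h3 h2⟩
  rw [h1, Set.ncard_coe_finset, Finset.card_image_of_injOn]
  · have h2 := congrArg (Int.cast : ℤ → ZMod 2) (h.pot (fun x => if x ∈ D then 1 else 0))
    push_cast at h2
    rw [Finset.card_eq_sum_ones, Finset.sum_filter]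
    push_cast
    have h3 : ∀ x y : ZMod 2, x - y = x + y := by decide
    rw [h3] at h2
    rw [← h2]
    apply Finset.sum_congr rfl
    intro d hd
    by_cases h1 : d.2.1 ∈ D <;> by_cases h2 : d.2.2 ∈ D <;> simp [h1, h2]
  · intro d hd d' hd' he
    exact h.inj d (Finset.mem_filter.1 hd).1 d' (Finset.mem_filter.1 hd').1 he

structure StSt (V : Type u) (E : Type v) where
  h : Option E
  v : V
  q : Option E → Finset (E × V × V)
  U : Finset (Option E)

/-- the target function with an additional demand -/
noncomputable def opt (x : V) (v : ι → V) : Option ι → V := fun o => o.elim x v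

theorem lemC {I : E → Sym2 V} {F : Set E} {S : Set V} {t x : V} {p : E → Finset (E × V × V)}
    (hL : Link I (Ins I F S) t (cut I F S) (inE I S) p) (hx : x ∈ S)
    (hpar : ∀ D ⊆ S, t ∉ D → (cut I F D).Finite → (Odd (cut I F D).ncard ↔ x ∈ D)) :
    ∃ p' : Option E → Finset (E × V × V),
      Link I (Ins I F S) t (insert none (some '' cut I F S)) (opt x (inE I S)) p' := by
  obtain ⟨p1, hL1, hcl⟩ := hL.clean
  set J := Ins I F S with hJ
  set B : Set (Option E) := insert none (some '' cut I F S) with hB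
  set w : Option E → V := opt x (inE I S) with hw
  let P1 : Option E → Finset (E × V × V) := fun o => o.elim ∅ p1
  by_contra hno
  push Not at hno
  have hnB : none ∈ B := Or.inl rfl
  have hBs : ∀ i ∈ B, i ≠ none → ∃ h ∈ cut I F S, some h = i := by
    rintro i (rfl | ⟨h, hh, rfl⟩) hi
    · exact absurd rfl hi
    · exact ⟨h, hh, rfl⟩
  let src : StSt V E → Option E → V := fun s i => if i = s.h then s.v else t
  let Valid : StSt V E → Prop := fun s => s.v ∈ S ∧ s.h ∈ s.U ∧ none ∈ s.U ∧ (∀ i ∈ s.U, i ∈ B) ∧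
    (∀ i ∈ B, Flow I J (s.q i) (src s i) (w i)) ∧
    (∀ i ∈ B, ∀ j ∈ B, i ≠ j → Disjoint (ed (s.q i)) (ed (s.q j))) ∧
    (∀ i ∈ B, i ∉ s.U → s.q i = P1 i)
  let s0 : StSt V E := ⟨none, x, P1, {none}⟩
  have hs0 : Valid s0 := by
    refine ⟨hx, by simp [s0], by simp [s0], ?_, ?_, ?_, ?_⟩
    · intro i hi; simp only [s0, Finset.mem_singleton] at hi; rw [hi]; exact hnB
    · rintro i (rfl | ⟨h, hh, rfl⟩)
      · simpa [s0, src, P1, hw, opt] using Flow.nil (I := I) (F := J) x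
      · simpa [s0, src, P1, hw, opt] using hL1.flow h hh
    · rintro i (rfl | ⟨h, hh, rfl⟩) j (rfl | ⟨h', hh', rfl⟩) hij
      · exact absurd rfl hij
      · simp [s0, P1, ed_empty]
      · simp [s0, P1, ed_empty]
      · exact hL1.disj h hh h' hh' (fun h => hij (by rw [h]))
    · intro i _ _; rfl
  have hstep : ∀ s, Valid s → ∃ s', Valid s' ∧ s'.h ∉ s.U ∧ s'.U = insert s'.h s.U ∧
      ∀ i, i ≠ s.h → i ≠ s'.h → s'.q i = s.q i := by
    rintro ⟨hc, vc, q, U⟩ ⟨hvS, hcU, hnU, hUB, hfl, hdj, hfr⟩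
    simp only at hvS hcU hnU hUB hfl hdj hfr
    have hcB := hUB hc hcU
    have hflc : Flow I J (q hc) vc (w hc) := by have := hfl hc hcB; simpa [src] using this
    have hfli : ∀ i ∈ B, i ≠ hc → Flow I J (q i) t (w i) := by
      intro i hi hic; have := hfl i hi; simpa [src, hic] using this
    set J0 : Set E := {e | e ∈ J ∧ ∀ i ∈ B, e ∉ ed (q i)} with hJ0
    have hJ0J : J0 ⊆ J := fun e he => he.1
    set D : Set V := {y | Conn I J0 vc y} with hD
    have hvD : vc ∈ D := Conn.refl vc
    have hDS : D ⊆ S := fun y hy => (hy.mono hJ0J).ins hvS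
    have hdJ0 : ∀ {r : Finset (E × V × V)}, ed r ⊆ J0 → ∀ i ∈ B, Disjoint (ed r) (ed (q i)) := by
      intro r hr i hi
      rw [Set.disjoint_left]; intro e he; exact (hr he).2 i hi
    -- the source is not reachable
    have htD : t ∉ D := by
      intro htD
      obtain ⟨r, hr, -⟩ := (Conn.symm htD).flow
      refine hno (fun i => if i = hc then r ∪ q hc else q i) ⟨fun i hi => ?_, fun i hi j hj hij => ?_⟩
      · by_cases hic : i = hc
        · subst hic; simp only [if_true]
          exact (hr.mono hJ0J).append hflc (hdJ0 hr.ed_sub i hi)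
        · simp only [hic, if_false]; exact hfli i hi hic
      · by_cases hic : i = hc
        · have hjc : j ≠ hc := fun h => hij (hic.trans h.symm)
          simp only [hic, hjc, if_true, if_false, ed_union]
          rw [Set.disjoint_union_left]
          exact ⟨hdJ0 hr.ed_sub j hj, hdj hc hcB j hj (Ne.symm hjc)⟩
        · by_cases hjc : j = hc
          · simp only [hic, hjc, if_true, if_false, ed_union]
            rw [Set.disjoint_union_right]
            exact ⟨(hdJ0 hr.ed_sub i hi).symm, hdj i hi hc hcB hic⟩
          · simp only [hic, hjc, if_false]; exact hdj i hi j hj hij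
    -- a fresh path must touch the component
    have htouch : ∃ h ∈ cut I F S, some h ∉ U ∧ ∃ y ∈ D, ∃ q1 ⊆ p1 h, Flow I J q1 t y := by
      by_contra hnt
      push Not at hnt
      have hnt' : ∀ h ∈ cut I F S, some h ∉ U → inE I S h ∉ D ∧ ∀ d ∈ p1 h, d.2.1 ∉ D ∧ d.2.2 ∉ D := by
        intro h hh hhU
        refine ⟨fun hd => hnt h hh hhU _ hd (p1 h) subset_rfl (hL1.flow h hh), ?_⟩
        have hfl := hL1.flow h hh
        have hreach : ∀ y, DReach (p1 h : Set (E × V × V)) t y → y ∉ D := by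
          intro y hy hyD
          obtain ⟨q1, h1, h2, -⟩ := reach_flow (I := I) (F := J) (fun d hd => ⟨hfl.mem d hd, hfl.inc d hd⟩) hy
          exact hnt h hh hhU y hyD q1 (by exact_mod_cast h1) h2
        rintro ⟨e, a, b⟩ hd
        have := ((hcl h hh).2).reach _ hd
        exact ⟨hreach _ this, hreach _ (this.tail hd)⟩
      -- the finite covering family
      let A : Option E → Set E := fun i => ed (q i) ∪ {h | some h = i}
      have hAfin : ∀ i, (A i ∩ cut I F D).Finite := by
        intro i
        refine Set.Finite.inter_of_left ?_ _
        refine (ed_finite _).union ?_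
        refine Set.Subsingleton.finite ?_
        intro a ha b hb
        exact Option.some.inj (ha.trans hb.symm)
      have hcov : cut I F D = ⋃ i ∈ U, (A i ∩ cut I F D) := by
        ext e
        simp only [Set.mem_iUnion, Set.mem_inter_iff, exists_prop]
        constructor
        · intro he
          have he' := he
          obtain ⟨heF, a, b, hab, ha, hb⟩ := he
          by_cases hbS : b ∈ S
          · have heJ : e ∈ J := (mem_Ins hab).2 ⟨heF, hDS ha, hbS⟩
            have : ∃ i ∈ B, e ∈ ed (q i) := by
              by_contra hn
              push Not at hn
              exact hb (Conn.trans (b := a) ha (Conn.single ⟨heJ, hn⟩ hab))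
            obtain ⟨i, hi, hei⟩ := this
            refine ⟨i, ?_, Or.inl hei, he'⟩
            by_contra hiU
            have hin : i ≠ none := fun h => hiU (h ▸ hnU)
            obtain ⟨h, hh, rfl⟩ := hBs i hi hin
            rw [hfr _ hi hiU] at hei
            obtain ⟨d, hd, rfl⟩ := hei
            have h1 := (hnt' h hh hiU).2 d hd
            have h2 := (hL1.flow h hh).inc d hd
            rw [hab] at h2
            rcases Sym2.eq_iff.1 h2 with ⟨h3, h4⟩ | ⟨h3, h4⟩
            · exact h1.1 (h3 ▸ ha)
            · exact h1.2 (h3 ▸ ha)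
          · have hc : e ∈ cut I F S := ⟨heF, a, b, hab, hDS ha, hbS⟩
            refine ⟨some e, ?_, Or.inr rfl, he'⟩
            by_contra hU
            apply (hnt' e hc hU).1
            rw [inE_eq hab (hDS ha) hbS]; exact ha
        · rintro ⟨i, _, _, h⟩; exact h
      have hfin : (cut I F D).Finite := by
        rw [hcov]; exact Set.Finite.biUnion U.finite_toSet (fun i _ => hAfin i)
      have hAdj : ∀ i ∈ U, ∀ j ∈ U, i ≠ j → Disjoint (A i ∩ cut I F D) (A j ∩ cut I F D) := by
        intro i hi j hj hij
        rw [Set.disjoint_left]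
        rintro e ⟨h1, -⟩ ⟨h2, -⟩
        have hexit : ∀ i ∈ B, ∀ j ∈ B, some e = j → e ∉ ed (q i) := by
          intro i hi j hj hj' he
          obtain ⟨h, hh, hhj⟩ := hBs j hj (by rw [← hj']; simp)
          have : h = e := Option.some.inj (hhj.trans hj'.symm)
          subst this
          exact cut_Ins hh ((hfl i hi).ed_sub he)
        rcases h1 with h1 | h1 <;> rcases h2 with h2 | h2
        · exact Set.disjoint_left.1 (hdj i (hUB i hi) j (hUB j hj) hij) h1 h2
        · exact hexit i (hUB i hi) j (hUB j hj) h2 h1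
        · exact hexit j (hUB j hj) i (hUB i hi) h1 h2
        · exact hij (h1.symm.trans h2)
      have hcard : ((cut I F D).ncard : ZMod 2) = ∑ i ∈ U, ((A i ∩ cut I F D).ncard : ZMod 2) := by
        conv_lhs => rw [hcov]
        have : (⋃ i ∈ U, (A i ∩ cut I F D)).ncard = ∑ i ∈ U, (A i ∩ cut I F D).ncard := by
          let f : Option E → Finset E := fun i => (hAfin i).toFinset
          have h1 : (⋃ i ∈ U, (A i ∩ cut I F D)) = ((U.biUnion f : Finset E) : Set E) := by
            ext e; simp [f]
          rw [h1, Set.ncard_coe_finset, Finset.card_biUnion]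
          · apply Finset.sum_congr rfl
            intro i _
            exact (Set.ncard_eq_toFinset_card _ (hAfin i)).symm
          · intro i hi j hj hij
            show Disjoint (f i) (f j)
            rw [← Finset.disjoint_coe]; simpa [f] using hAdj i hi j hj hij
        rw [this]; push_cast; rfl
      have hZ2 : ∀ a : ZMod 2, a + a = 0 := by decide
      have hAi : ∀ i ∈ U, ((A i ∩ cut I F D).ncard : ZMod 2) =
          (if i = hc then 1 else 0) + (if i = none then (if x ∈ D then 1 else 0) else 0) := by
        intro i hi
        have hiB := hUB i hi
        have h1 := (hfl i hiB).parity F Ins_sub D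
        have h2 : (if src ⟨hc, vc, q, U⟩ i ∈ D then (1 : ZMod 2) else 0) = if i = hc then 1 else 0 := by
          by_cases hic : i = hc
          · simp [src, hic, hvD]
          · simp [src, hic, htD]
        rw [h2] at h1
        by_cases hin : i = none
        · subst hin
          have h3 : A none = ed (q none) := by ext e; simp [A]
          rw [h3, h1]; simp [hw, opt]
        · obtain ⟨h, hh, rfl⟩ := hBs i hiB hin
          have h3 : A (some h) = insert h (ed (q (some h))) := by
            ext e; simp [A, or_comm]
          have hnot : h ∉ ed (q (some h)) := fun he => cut_Ins hh ((hfl _ hiB).ed_sub he)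
          obtain ⟨h4, b, h5, h6⟩ := inE_mem hh
          have hw' : w (some h) = inE I S h := rfl
          have hbD : b ∉ D := fun h => h6 (hDS h)
          simp only [hin, if_false, add_zero]
          by_cases hwD : inE I S h ∈ D
          · have hcD : h ∈ cut I F D := ⟨hh.1, _, _, h5, hwD, hbD⟩
            rw [h3, Set.insert_inter_of_mem hcD, Set.ncard_insert_of_notMem (fun h => hnot h.1)
              ((ed_finite _).inter_of_left _)]
            push_cast
            rw [h1, hw', if_pos hwD]
            have : ∀ a : ZMod 2, a + 1 + 1 = a := by decide
            rw [this]
          · have hcD : h ∉ cut I F D := by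
              rintro ⟨_, c, d, hcd, hc1, hd1⟩
              rw [h5] at hcd
              rcases Sym2.eq_iff.1 hcd with ⟨rfl, rfl⟩ | ⟨rfl, rfl⟩
              · exact hwD hc1
              · exact hbD hc1
            rw [h3, Set.insert_inter_of_notMem hcD, h1, hw', if_neg hwD, add_zero]
      have hsum : ((cut I F D).ncard : ZMod 2) = 1 + (if x ∈ D then 1 else 0) := by
        rw [hcard, Finset.sum_congr rfl hAi, Finset.sum_add_distrib, Finset.sum_ite_eq' U hc,
          Finset.sum_ite_eq' U none, if_pos hcU, if_pos hnU]
      have hp := hpar D hDS htD hfin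
      rw [← ZMod.natCast_eq_one_iff_odd] at hp
      rw [hsum] at hp
      by_cases hxD : x ∈ D
      · simp only [hxD, if_true, iff_true] at hp; exact absurd hp (by decide)
      · simp only [hxD, if_false, iff_false] at hp; exact hp (by decide)
    obtain ⟨h, hh, hhU, y, hyD, q1, hq1, hf1⟩ := htouch
    obtain ⟨r, hr, -⟩ := (Conn.symm hyD).flow
    have hhB : some h ∈ B := Or.inr ⟨h, hh, rfl⟩
    have hqh : q (some h) = p1 h := hfr _ hhB hhU
    have hne : some h ≠ hc := fun h' => hhU (h' ▸ hcU)
    have hp1 := hL1.flow h hh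
    have hf2 : Flow I J (p1 h \ q1) y (inE I S h) := hp1.sdiff hf1 hq1
    have hd12 : Disjoint (ed (p1 h \ q1)) (ed q1) := hp1.ed_sdiff_disj hq1
    have hq1e : ed q1 ⊆ ed (q (some h)) := by rw [hqh]; exact ed_mono hq1
    have hq2e : ed (p1 h \ q1) ⊆ ed (q (some h)) := by
      rw [hqh]; exact ed_mono Finset.sdiff_subset
    have hnew : Flow I J (q1 ∪ r ∪ q hc) t (w hc) := by
      refine (hf1.append (hr.mono hJ0J) ?_).append hflc ?_
      · exact (Set.disjoint_of_subset_right hq1e (hdJ0 hr.ed_sub _ hhB)).symm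
      · rw [ed_union, Set.disjoint_union_left]
        exact ⟨Set.disjoint_of_subset_left hq1e (hdj _ hhB _ hcB hne), hdJ0 hr.ed_sub _ hcB⟩
    let q' : Option E → Finset (E × V × V) := fun i =>
      if i = hc then q1 ∪ r ∪ q hc else if i = some h then p1 h \ q1 else q i
    have hq'c : q' hc = q1 ∪ r ∪ q hc := by simp [q']
    have hq'h : q' (some h) = p1 h \ q1 := by simp [q', hne]
    have hq'o : ∀ i, i ≠ hc → i ≠ some h → q' i = q i := by
      intro i h1 h2; simp [q', h1, h2]
    have hdc : ∀ j ∈ B, j ≠ hc → Disjoint (ed (q' hc)) (ed (q' j)) := by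
      intro j hj hjc
      rw [hq'c, ed_union, ed_union, Set.disjoint_union_left, Set.disjoint_union_left]
      by_cases hjh : j = some h
      · subst hjh
        rw [hq'h]
        exact ⟨⟨hd12.symm, Set.disjoint_of_subset_right hq2e (hdJ0 hr.ed_sub _ hhB)⟩,
          Set.disjoint_of_subset_right hq2e (hdj _ hcB _ hhB (Ne.symm hne))⟩
      · rw [hq'o j hjc hjh]
        exact ⟨⟨Set.disjoint_of_subset_left hq1e (hdj _ hhB _ hj (Ne.symm hjh)), hdJ0 hr.ed_sub _ hj⟩,
          hdj _ hcB _ hj (Ne.symm hjc)⟩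
    have hsubq : ∀ j, j ≠ hc → ed (q' j) ⊆ ed (q j) := by
      intro j hjc
      by_cases hjh : j = some h
      · rw [hjh, hq'h]; exact hq2e
      · rw [hq'o j hjc hjh]
    refine ⟨⟨some h, y, q', insert (some h) U⟩, ⟨hDS hyD, by simp, by simp [hnU], ?_, ?_, ?_, ?_⟩, hhU, rfl, ?_⟩
    · intro i hi
      rcases Finset.mem_insert.1 hi with rfl | hi
      · exact hhB
      · exact hUB i hi
    · intro i hi
      by_cases hic : i = hc
      · subst hic
        have : i ≠ some h := Ne.symm hne
        simp only [src, this, if_false]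
        rw [hq'c]; exact hnew
      · by_cases hih : i = some h
        · subst hih; simp only [src, if_true]; rw [hq'h]; exact hf2
        · simp only [src, hih, if_false]; rw [hq'o i hic hih]; exact hfli i hi hic
    · intro i hi j hj hij
      by_cases hic : i = hc
      · subst hic; exact hdc j hj (Ne.symm hij)
      · by_cases hjc : j = hc
        · subst hjc; exact (hdc i hi hij).symm
        · exact Set.disjoint_of_subset (hsubq i hic) (hsubq j hjc) (hdj i hi j hj hij)
    · intro i hi hiU
      simp only [Finset.mem_insert, not_or] at hiU
      rw [← hfr i hi hiU.2]
      exact hq'o i (fun h => hiU.2 (h ▸ hcU)) hiU.1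
    · intro i h1 h2; exact hq'o i h1 h2
  choose! nx hnx1 hnx2 hnx3 hnx4 using hstep
  let st : ℕ → StSt V E := fun n => Nat.rec s0 (fun _ s => nx s) n
  have hst : ∀ n, Valid (st n) := by
    intro n
    induction n with
    | zero => exact hs0
    | succ n ih => exact hnx1 _ ih
  have hsucc : ∀ n, st (n + 1) = nx (st n) := fun n => rfl
  have hUmono : Monotone (fun n => (st n).U) := by
    apply monotone_nat_of_le_succ
    intro n
    show (st n).U ⊆ (st (n+1)).U
    rw [hsucc, hnx3 _ (hst n)]; exact Finset.subset_insert _ _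
  have hdist : ∀ m n, m < n → (st m).h ≠ (st n).h := by
    intro m n hmn heq
    obtain ⟨k, rfl⟩ : ∃ k, n = k + 1 := ⟨n - 1, by omega⟩
    have h1 := hnx2 _ (hst k)
    rw [← hsucc, ← heq] at h1
    exact h1 (hUmono (show m ≤ k by omega) (hst m).2.1)
  have hev : ∀ i, ∃ N, ∀ n ≥ N, (st n).h ≠ i := by
    intro i
    by_cases hi : ∃ n, (st n).h = i
    · obtain ⟨n, hn⟩ := hi
      refine ⟨n + 1, fun m hm => ?_⟩
      rw [← hn]; exact (hdist n m hm).symm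
    · push Not at hi; exact ⟨0, fun n _ => hi n⟩
  choose N hN using hev
  have hconst : ∀ i n, N i ≤ n → (st n).q i = (st (N i)).q i := by
    intro i n hn
    induction n, hn using Nat.le_induction with
    | base => rfl
    | succ n hn ih =>
      rw [← ih, hsucc]
      refine hnx4 _ (hst n) i (hN i n hn).symm ?_
      rw [← hsucc]; exact (hN i (n+1) (by omega)).symm
  refine hno (fun i => (st (N i)).q i) ⟨fun i hi => ?_, fun i hi j hj hij => ?_⟩
  · have h1 := (hst (N i)).2.2.2.2.1 i hi
    have h2 : i ≠ (st (N i)).h := (hN i (N i) le_rfl).symm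
    simpa only [src, h2, if_false] using h1
  · have h1 := hconst i (max (N i) (N j)) (le_max_left _ _)
    have h2 := hconst j (max (N i) (N j)) (le_max_right _ _)
    rw [← h1, ← h2]
    exact (hst _).2.2.2.2.2.1 i hi j hj hij

end LC

set_option linter.unusedVariables false

namespace LC
open Classical Cardinal
universe w

theorem mk_iUn {α ι : Type v} (f : ι → Set α) {κ : Cardinal.{v}} (hκ : ℵ₀ ≤ κ) (hι : #ι ≤ κ)
    (hf : ∀ i, #(f i) ≤ κ) : #(⋃ i, f i) ≤ κ := by
  refine (Cardinal.mk_iUnion_le f).trans ?_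
  calc _ ≤ κ * κ := mul_le_mul' hι (ciSup_le' hf)
    _ = κ := Cardinal.mul_eq_self hκ

theorem mk_biUn {α ι : Type v} (s : Set ι) (f : ι → Set α) {κ : Cardinal.{v}} (hκ : ℵ₀ ≤ κ) (hι : #s ≤ κ)
    (hf : ∀ i ∈ s, #(f i) ≤ κ) : #(⋃ i ∈ s, f i : Set α) ≤ κ := by
  rw [Set.biUnion_eq_iUnion]
  exact mk_iUn _ hκ hι (fun i => hf i.1 i.2)

theorem mk_un {α : Type v} {s t : Set α} {κ : Cardinal.{v}} (hκ : ℵ₀ ≤ κ) (hs : #s ≤ κ)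
    (ht : #t ≤ κ) : #(s ∪ t : Set α) ≤ κ :=
  (Cardinal.mk_union_le s t).trans ((add_le_add hs ht).trans_eq (Cardinal.add_eq_self hκ))

theorem mk_cnt {α : Type v} {s : Set α} {κ : Cardinal.{v}} (hκ : ℵ₀ ≤ κ) (hs : s.Countable) :
    #s ≤ κ := (Cardinal.le_aleph0_iff_set_countable.2 hs).trans hκ

/-- enumeration of a set by an initial ordinal -/
theorem ord_enum {α : Type v} (s : Set α) : ∃ g : α → Ordinal.{v},
    (∀ a ∈ s, g a < (#s).ord) ∧ ∀ β : Ordinal.{v}, #({a ∈ s | g a < β} : Set α) ≤ β.card := by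
  obtain ⟨f⟩ := Cardinal.eq.1 (Cardinal.mk_ord_toType #s).symm
  let g : α → Ordinal.{v} := fun a => if h : a ∈ s then ((Ordinal.ToType.mk.symm (f ⟨a, h⟩)) : Set.Iio _).1 else 0
  have hg : ∀ a (h : a ∈ s), g a = ((Ordinal.ToType.mk.symm (f ⟨a, h⟩)) : Set.Iio _).1 := fun a h => by
    simp only [g]; rw [dif_pos h]
  refine ⟨g, fun a h => ?_, fun β => ?_⟩
  · rw [hg a h]; exact (Ordinal.ToType.mk.symm (f ⟨a, h⟩)).2
  · have h1 : Cardinal.lift.{v+1} #({a ∈ s | g a < β} : Set α) ≤ Cardinal.lift.{v} #(Set.Iio β) := by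
      refine Cardinal.lift_mk_le.2 ⟨⟨fun a => ⟨g a.1, a.2.2⟩, ?_⟩⟩
      rintro ⟨a, ha, ha'⟩ ⟨b, hb, hb'⟩ hab
      have hab : g a = g b := congrArg Subtype.val hab
      rw [hg a ha, hg b hb] at hab
      have := f.injective (Ordinal.ToType.mk.symm.injective (Subtype.ext hab))
      have h3 : a = b := congrArg Subtype.val this
      exact Subtype.ext h3
    rw [Cardinal.mk_Iio_ordinal, Cardinal.lift_lift] at h1
    exact Cardinal.lift_le.1 h1

section chain
variable {E : Type v}

noncomputable def Rseq (B : Set E) (stp : Ordinal.{v} → Set E → Set E) (α : Ordinal.{v}) : Set E :=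
  B ∪ ⋃ β : Set.Iio α, stp β.1 (Rseq B stp β.1)
termination_by α
decreasing_by exact β.2

theorem mem_Rseq {B : Set E} {stp : Ordinal.{v} → Set E → Set E} {α : Ordinal.{v}} {e : E} :
    e ∈ Rseq B stp α ↔ e ∈ B ∨ ∃ β < α, e ∈ stp β (Rseq B stp β) := by
  rw [Rseq]; simp

theorem chain_step (Good D : Set E → Prop)
    (hD : ∀ 𝒮 : Set (Set E), 𝒮.PairwiseDisjoint id → (∀ X ∈ 𝒮, D X) → D (⋃₀ 𝒮))
    (hH : ∀ B, Good B → ∃ 𝒜 : E → E → ℕ → Set (Set E), (∀ e e' n, ∀ a ∈ 𝒜 e e' n, a.Countable) ∧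
      ∀ Q, B ⊆ Q → (∀ e ∈ Q \ B, ∀ e' ∈ Q \ B, ∀ n, (∀ a ∈ 𝒜 e e' n, a ⊆ Q) ∨
        (#(Q \ B : Set E) < #(𝒜 e e' n) ∧ ℵ₀ < #(𝒜 e e' n))) → Good Q)
    (hC : ∀ B Z, Good B → Z.Countable → ∃ R, B ∪ Z ⊆ R ∧ (R \ B).Countable ∧ D (R \ B) ∧ Good R)
    (μ : Cardinal.{v}) (hμ : ℵ₀ ≤ μ) :
    ∀ (B Z : Set E), Good B → #Z ≤ μ → ∃ R, B ∪ Z ⊆ R ∧ #(R \ B : Set E) ≤ μ ∧ D (R \ B) ∧ Good R := by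
  induction μ using WellFoundedLT.induction with
  | ind μ ih =>
  intro B Z hB hZ
  rcases eq_or_lt_of_le hμ with hμ0 | hμ0
  · subst hμ0
    obtain ⟨R, h1, h2, h3, h4⟩ := hC B Z hB (Cardinal.le_aleph0_iff_set_countable.1 hZ)
    exact ⟨R, h1, Cardinal.le_aleph0_iff_set_countable.2 h2, h3, h4⟩
  obtain ⟨𝒜, hcnt, hgood⟩ := hH B hB
  choose g hg1 hg2 using fun e e' n => ord_enum (𝒜 e e' n)
  obtain ⟨gZ, hgZ1, hgZ2⟩ := ord_enum Z
  let Zf : Ordinal.{v} → Set E → Set E := fun β X => {z ∈ Z | gZ z < β} ∪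
    ⋃ e ∈ X \ B, ⋃ e' ∈ X \ B, ⋃ n : ULift.{v} ℕ, ⋃ a ∈ {a ∈ 𝒜 e e' n.down | g e e' n.down a < β}, a
  let κ : Ordinal.{v} → Cardinal.{v} := fun β => max β.card ℵ₀
  have hκ : ∀ β, ℵ₀ ≤ κ β := fun β => le_max_right _ _
  have hκm : ∀ {β γ}, β ≤ γ → κ β ≤ κ γ := fun h => max_le_max (Ordinal.card_le_card h) le_rfl
  have hDe : D ∅ := by simpa using hD ∅ (by simp) (by simp)
  have hstp : ∀ β X, ∃ R, X ⊆ R ∧ #(R \ X : Set E) ≤ κ β ∧ D (R \ X) ∧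
      (Good X → κ β < μ → #(Zf β X) ≤ κ β → Good R ∧ Zf β X ⊆ R) := by
    intro β X
    by_cases h : Good X ∧ κ β < μ ∧ #(Zf β X) ≤ κ β
    · obtain ⟨R, h1, h2, h3, h4⟩ := ih (κ β) h.2.1 (hκ β) X (Zf β X) h.1 h.2.2
      exact ⟨R, (Set.union_subset_iff.1 h1).1, h2, h3, fun _ _ _ => ⟨h4, (Set.union_subset_iff.1 h1).2⟩⟩
    · refine ⟨X, subset_rfl, by simp, by simpa using hDe, fun h1 h2 h3 => absurd ⟨h1, h2, h3⟩ h⟩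
  choose stp hs1 hs2 hs3 hs4 using hstp
  set R := Rseq B stp with hR
  have hBR : ∀ α, B ⊆ R α := fun α e he => mem_Rseq.2 (Or.inl he)
  have hmono : ∀ {α β}, α ≤ β → R α ⊆ R β := by
    intro α β h e he
    rcases mem_Rseq.1 he with h1 | ⟨γ, h1, h2⟩
    · exact hBR _ h1
    · exact mem_Rseq.2 (Or.inr ⟨γ, h1.trans_le h, h2⟩)
  have hstpR : ∀ {α β}, α < β → stp α (R α) ⊆ R β := fun h e he => mem_Rseq.2 (Or.inr ⟨_, h, he⟩)
  have hleast : ∀ α e, e ∈ R α → e ∉ B → ∃ β < α, e ∈ stp β (R β) \ R β := by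
    intro α e he heB
    rcases mem_Rseq.1 he with h1 | ⟨γ, h1, h2⟩
    · exact absurd h1 heB
    · have hne : {β | e ∈ stp β (R β)}.Nonempty := ⟨γ, h2⟩
      obtain ⟨δ0, h3, h4⟩ := WellFounded.has_min (wellFounded_lt (α := Ordinal.{v})) _ hne
      refine ⟨δ0, (not_lt.1 (h4 γ h2)).trans_lt h1, h3, fun h5 => ?_⟩
      rcases mem_Rseq.1 h5 with h6 | ⟨δ, h6, h7⟩
      · exact heB h6
      · exact h4 δ h7 h6
  have hcard : ∀ α, #(R α \ B : Set E) ≤ κ α := by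
    intro α
    have h1 : R α \ B ⊆ ⋃ β < α, (stp β (R β) \ R β) := by
      rintro e ⟨he, heB⟩
      obtain ⟨β, h1, h2⟩ := hleast α e he heB
      exact Set.mem_iUnion₂.2 ⟨β, h1, h2⟩
    refine (Cardinal.mk_le_mk_of_subset h1).trans ?_
    refine Cardinal.mk_biUnion_le_of_le (le_max_left _ _) (hκ α) _ ?_
    intro β hβ
    exact (hs2 β (R β)).trans (hκm hβ.le)
  have hZf : ∀ β, #(Zf β (R β)) ≤ κ β := by
    intro β
    refine mk_un (hκ β) ((hgZ2 β).trans (le_max_left _ _)) ?_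
    refine mk_biUn _ _ (hκ β) (hcard β) fun e _ => ?_
    refine mk_biUn _ _ (hκ β) (hcard β) fun e' _ => ?_
    refine mk_iUn _ (hκ β) (by simpa using hκ β) fun n => ?_
    refine mk_biUn _ _ (hκ β) ((hg2 e e' n.down β).trans (le_max_left _ _)) fun a ha => ?_
    exact mk_cnt (hκ β) (hcnt e e' n.down a ha.1)
  have hκμ : ∀ β < μ.ord, κ β < μ := fun β hβ => max_lt (Cardinal.lt_ord.1 hβ) hμ0
  have hRsucc : ∀ β, R (Order.succ β) = stp β (R β) := by
    intro β
    apply Set.Subset.antisymm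
    · intro e he
      rcases mem_Rseq.1 he with h1 | ⟨γ, h1, h2⟩
      · exact hs1 _ _ (hBR _ h1)
      · rcases (Order.lt_succ_iff.1 h1).eq_or_lt with rfl | h3
        · exact h2
        · exact hs1 _ _ (hstpR h3 h2)
    · exact hstpR (Order.lt_succ β)
  have hG : ∀ α, α ≤ μ.ord → Good (R α) := by
    intro α
    induction α using Ordinal.limitRecOn with
    | zero =>
      intro _
      have : R 0 = B := by
        ext e; rw [hR, mem_Rseq]; simp
      rw [this]; exact hB
    | add_one β ihβ =>
      intro h
      have hlt : β < μ.ord := (Order.lt_succ β).trans_le h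
      rw [show R (β + 1) = stp β (R β) from hRsucc β]
      exact (hs4 β (R β) (ihβ hlt.le) (hκμ β hlt) (hZf β)).1
    | limit α hα ihα =>
      intro hle
      refine hgood _ (hBR α) ?_
      intro e he e' he' n
      obtain ⟨β, hβ, h1⟩ := hleast α e he.1 he.2
      obtain ⟨β', hβ', h1'⟩ := hleast α e' he'.1 he'.2
      rcases le_or_gt (#(𝒜 e e' n)).ord α with h2 | h2
      · left
        intro a ha
        have h3 : g e e' n a < α := (hg1 e e' n a ha).trans_le h2
        set γ := Order.succ (max (max β β') (g e e' n a)) with hγ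
        have hγα : γ < α := hα.succ_lt (max_lt (max_lt hβ hβ') h3)
        have hγμ := hγα.trans_le hle
        have h4 := (hs4 γ (R γ) (ihα γ hγα hγμ.le) (hκμ γ hγμ) (hZf γ)).2
        refine Set.Subset.trans ?_ (h4.trans (hstpR hγα))
        intro x hx
        refine Or.inr ?_
        have hb1 : β < γ := Order.lt_succ_iff.2 ((le_max_left _ _).trans (le_max_left _ _))
        have hb2 : β' < γ := Order.lt_succ_iff.2 ((le_max_right _ _).trans (le_max_left _ _))
        have hb3 : g e e' n a < γ := Order.lt_succ_iff.2 (le_max_right _ _)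
        refine Set.mem_iUnion₂.2 ⟨e, ⟨hstpR hb1 h1.1, he.2⟩, ?_⟩
        refine Set.mem_iUnion₂.2 ⟨e', ⟨hstpR hb2 h1'.1, he'.2⟩, ?_⟩
        refine Set.mem_iUnion.2 ⟨⟨n⟩, ?_⟩
        exact Set.mem_iUnion₂.2 ⟨a, ⟨ha, hb3⟩, hx⟩
      · right
        have hω : ℵ₀ ≤ α.card := Ordinal.aleph0_le_card.2 (Ordinal.omega0_le_of_isSuccLimit hα)
        have h3 : α.card < #(𝒜 e e' n) := Cardinal.lt_ord.1 h2
        refine ⟨(hcard α).trans_lt ?_, hω.trans_lt h3⟩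
        exact (max_eq_left hω).trans_lt h3
  have hlim : Order.IsSuccLimit μ.ord := Cardinal.isSuccLimit_ord hμ
  refine ⟨R μ.ord, Set.union_subset (hBR _) ?_, ?_, ?_, hG _ le_rfl⟩
  · intro z hz
    have h1 : gZ z < μ.ord := (hgZ1 z hz).trans_le (Cardinal.ord_le_ord.2 hZ)
    have h2 := hlim.succ_lt h1
    have h4 := (hs4 _ (R _) (hG _ h2.le) (hκμ _ h2) (hZf _)).2
    exact hstpR h2 (h4 (Or.inl ⟨hz, Order.lt_succ _⟩))
  · refine (hcard _).trans ?_
    simp only [κ, Cardinal.card_ord]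
    exact max_le le_rfl hμ
  · have h1 : R μ.ord \ B = ⋃₀ ((fun β => stp β (R β) \ R β) '' Set.Iio μ.ord) := by
      ext e
      simp only [Set.sUnion_image, Set.mem_iUnion, Set.mem_Iio]
      constructor
      · rintro ⟨he, heB⟩
        obtain ⟨β, h1, h2⟩ := hleast _ e he heB
        exact ⟨β, h1, h2⟩
      · rintro ⟨β, h1, h2⟩
        exact ⟨hstpR h1 h2.1, fun h => h2.2 (hBR _ h)⟩
    rw [h1]
    apply hD
    · rintro _ ⟨β, hβ, rfl⟩ _ ⟨γ, hγ, rfl⟩ hne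
      show Disjoint (stp β (R β) \ R β) (stp γ (R γ) \ R γ)
      rw [Set.disjoint_left]
      rintro e ⟨h1, h2⟩ ⟨h3, h4⟩
      rcases lt_trichotomy β γ with h | rfl | h
      · exact h4 (hstpR h h1)
      · exact hne rfl
      · exact h2 (hstpR h h3)
    · rintro _ ⟨β, hβ, rfl⟩
      exact hs3 _ _

theorem chain (Good D : Set E → Prop)
    (hD : ∀ 𝒮 : Set (Set E), 𝒮.PairwiseDisjoint id → (∀ X ∈ 𝒮, D X) → D (⋃₀ 𝒮))
    (hH : ∀ B, Good B → ∃ 𝒜 : E → E → ℕ → Set (Set E), (∀ e e' n, ∀ a ∈ 𝒜 e e' n, a.Countable) ∧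
      ∀ Q, B ⊆ Q → (∀ e ∈ Q \ B, ∀ e' ∈ Q \ B, ∀ n, (∀ a ∈ 𝒜 e e' n, a ⊆ Q) ∨
        (#(Q \ B : Set E) < #(𝒜 e e' n) ∧ ℵ₀ < #(𝒜 e e' n))) → Good Q)
    (hC : ∀ B Z, Good B → Z.Countable → ∃ R, B ∪ Z ⊆ R ∧ (R \ B).Countable ∧ D (R \ B) ∧ Good R)
    {B : Set E} (hB : Good B) : D Bᶜ := by
  obtain ⟨R, h1, -, h3, -⟩ := chain_step Good D hD hH hC (max #E ℵ₀) (le_max_right _ _) B Set.univ hB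
    (by rw [Cardinal.mk_univ]; exact le_max_left _ _)
  have : R = Set.univ := Set.univ_subset_iff.1 ((Set.union_subset_iff.1 h1).2)
  rw [this] at h3
  rwa [Set.compl_eq_univ_sdiff]

end chain
end LC

set_option linter.unusedVariables false

namespace LC
open Classical Cardinal
universe w
variable {V : Type u} {E : Type v} {ι : Type w}

theorem clos (f : Finset E → Set E) (hf : ∀ s, (f s).Countable) {Z : Set E} (hZ : Z.Countable) :
    ∃ K, Z ⊆ K ∧ K.Countable ∧ ∀ s : Finset E, (s : Set E) ⊆ K → f s ⊆ K := by
  let st : Set E → Set E := fun K => K ∪ ⋃ s : Finset K, f (s.map (Function.Embedding.subtype _))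
  let Kn : ℕ → Set E := fun n => st^[n] Z
  have hs : ∀ n, Kn (n+1) = st (Kn n) := fun n => Function.iterate_succ_apply' _ _ _
  have hm : Monotone Kn := monotone_nat_of_le_succ fun n => by
    rw [hs]; exact Set.subset_union_left
  have hc : ∀ n, (Kn n).Countable := by
    intro n
    induction n with
    | zero => exact hZ
    | succ n ih =>
      rw [hs]
      have : Countable (Kn n) := ih
      exact ih.union (Set.countable_iUnion fun s => hf _)
  refine ⟨⋃ n, Kn n, Set.subset_iUnion Kn 0, Set.countable_iUnion hc, fun s hsK => ?_⟩
  have : ∃ n, (s : Set E) ⊆ Kn n := by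
    have := Set.Finite.subset (s.finite_toSet) subset_rfl
    obtain ⟨n, hn⟩ := DirectedOn.exists_mem_subset_of_finset_subset_biUnion (ι := ℕ) (c := Set.univ)
      (f := Kn) ⟨0, trivial⟩ (fun i _ j _ => ⟨max i j, trivial, hm (le_max_left _ _), hm (le_max_right _ _)⟩)
      (s := s) (by simpa using hsK)
    exact ⟨n, hn.2⟩
  obtain ⟨n, hn⟩ := this
  refine Set.Subset.trans ?_ (Set.subset_iUnion Kn (n+1))
  rw [hs]
  refine Set.Subset.trans ?_ Set.subset_union_right
  refine Set.Subset.trans ?_ (Set.subset_iUnion _ (s.subtype (· ∈ Kn n)))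
  have : (s.subtype (· ∈ Kn n)).map (Function.Embedding.subtype _) = s := by
    rw [Finset.subtype_map, Finset.filter_true_of_mem]
    exact fun x hx => hn hx
  rw [this]

theorem max_fam (P : Set E → Prop) : ∃ 𝒬 : Set (Set E), (∀ a ∈ 𝒬, P a) ∧ 𝒬.PairwiseDisjoint id ∧
    ∀ a, P a → a.Nonempty → ∃ b ∈ 𝒬, ¬ Disjoint a b := by
  obtain ⟨M, hM⟩ := zorn_subset {𝒬 : Set (Set E) | (∀ a ∈ 𝒬, P a) ∧ 𝒬.PairwiseDisjoint id} (by
    intro c hc hch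
    refine ⟨⋃₀ c, ⟨?_, ?_⟩, fun s hs => Set.subset_sUnion_of_mem hs⟩
    · rintro a ⟨s, hs, ha⟩
      exact (hc hs).1 a ha
    · exact (Set.pairwiseDisjoint_sUnion hch.directedOn).2 fun s hs => (hc hs).2)
  refine ⟨M, hM.prop.1, hM.prop.2, fun a ha hne => ?_⟩
  by_contra hcon
  push Not at hcon
  have h1 : insert a M ∈ {𝒬 : Set (Set E) | (∀ a ∈ 𝒬, P a) ∧ 𝒬.PairwiseDisjoint id} := by
    refine ⟨?_, ?_⟩
    · rintro b (rfl | hb)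
      · exact ha
      · exact hM.prop.1 b hb
    · exact hM.prop.2.insert fun b hb _ => hcon b hb
  have h2 : a ∈ M := hM.le_of_ge h1 (Set.subset_insert _ _) (Set.mem_insert _ _)
  have h3 := hcon a h2
  rw [disjoint_self] at h3
  exact hne.ne_empty h3

theorem disj_card {𝒬 : Set (Set E)} (hd : 𝒬.PairwiseDisjoint id) {K C : Set E} (hC : C.Countable)
    (h : ∀ a ∈ 𝒬, (a ∩ (K ∪ C)).Nonempty) : #𝒬 ≤ max #K ℵ₀ := by
  choose f hf using h
  have h1 : #𝒬 ≤ #(K ∪ C : Set E) := by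
    refine Cardinal.mk_le_of_injective (f := fun a => (⟨f a.1 a.2, (hf a.1 a.2).2⟩ : (K ∪ C : Set E))) ?_
    rintro ⟨a, ha⟩ ⟨b, hb⟩ hab
    have h2 : f a ha = f b hb := congrArg Subtype.val hab
    by_contra hne
    have h3 : a ≠ b := fun h => hne (Subtype.ext h)
    have h4 : Disjoint a b := hd ha hb h3
    exact Set.disjoint_left.1 h4 (hf a ha).1 (h2 ▸ (hf b hb).1)
  exact h1.trans (mk_un (le_max_right _ _) (le_max_left _ _) (mk_cnt (le_max_right _ _) hC))

theorem Conn.cross {I : E → Sym2 V} {F : Set E} {a b : V} (h : Conn I F a b) {X : Set V}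
    (ha : a ∈ X) (hb : b ∉ X) : (cut I F X).Nonempty := by
  by_contra hne
  exact hb (h.closed X ha fun e he x y hxy hx => by
    by_contra hy
    exact hne ⟨e, he, x, y, hxy, hx, hy⟩)

theorem cut_compl {I : E → Sym2 V} {F : Set E} {X : Set V} : cut I F Xᶜ = cut I F X := by
  ext e
  constructor
  · rintro ⟨he, a, b, h, ha, hb⟩
    exact ⟨he, b, a, h.trans Sym2.eq_swap, not_not.1 hb, ha⟩
  · rintro ⟨he, a, b, h, ha, hb⟩
    exact ⟨he, b, a, h.trans Sym2.eq_swap, hb, not_not.2 ha⟩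

def Ev (I : E → Sym2 V) (F : Set E) : Prop := ∀ X, (cut I F X).Finite → Even (cut I F X).ncard

theorem ncard_split {C A B : Set E} (hC : C.Finite) (h : C = A ∪ B) (hd : Disjoint A B) :
    C.ncard = A.ncard + B.ncard := by
  subst h
  exact Set.ncard_union_eq hd (hC.subset Set.subset_union_left) (hC.subset Set.subset_union_right)

/-- a graph with an odd finite cut has one inside a component -/
theorem Ev.of_comp {I : E → Sym2 V} {F : Set E}
    (h : ∀ X, (∀ x ∈ X, ∀ y ∈ X, Conn I F x y) → (∀ e ∈ cut I F X, ∀ z ∈ I e, ∀ x ∈ X, Conn I F x z) →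
      (cut I F X).Finite → Even (cut I F X).ncard) : Ev I F := by
  have key : ∀ n, ∀ X, (cut I F X).Finite → (cut I F X).ncard = n → Even n := by
    intro n
    induction n using Nat.strong_induction_on with
    | _ n ih =>
    intro X hX hn
    rcases Set.eq_empty_or_nonempty (cut I F X) with h0 | ⟨e, he, a, b, hab, ha, hb⟩
    · rw [h0, Set.ncard_empty] at hn; rw [← hn]; exact Even.zero
    let W : Set V := {v | Conn I F a v}
    have hW : ∀ e ∈ F, ∀ x y, I e = s(x, y) → (x ∈ W ↔ y ∈ W) := fun e he x y hxy =>
      ⟨fun h => Conn.trans h (Conn.single he hxy), fun h => Conn.trans h (Conn.single he (hxy.trans Sym2.eq_swap))⟩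
    have h1 : cut I F (X ∩ W) ⊆ cut I F X := by
      rintro e ⟨he, x, y, hxy, hx, hy⟩
      exact ⟨he, x, y, hxy, hx.1, fun h => hy ⟨h, (hW e he x y hxy).1 hx.2⟩⟩
    have h2 : cut I F (X \ W) ⊆ cut I F X := by
      rintro e ⟨he, x, y, hxy, hx, hy⟩
      exact ⟨he, x, y, hxy, hx.1, fun h => hy ⟨h, fun h' => hx.2 ((hW e he x y hxy).2 h')⟩⟩
    have h3 : cut I F X = cut I F (X ∩ W) ∪ cut I F (X \ W) := by
      apply Set.Subset.antisymm
      · rintro e ⟨he, x, y, hxy, hx, hy⟩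
        by_cases hxW : x ∈ W
        · exact Or.inl ⟨he, x, y, hxy, ⟨hx, hxW⟩, fun h => hy h.1⟩
        · exact Or.inr ⟨he, x, y, hxy, ⟨hx, hxW⟩, fun h => hy h.1⟩
      · exact Set.union_subset h1 h2
    have h4 : Disjoint (cut I F (X ∩ W)) (cut I F (X \ W)) := by
      rw [Set.disjoint_left]
      rintro e ⟨he, x, y, hxy, hx, hy⟩ ⟨he', x', y', hxy', hx', hy'⟩
      have := hxy.symm.trans hxy'
      rw [Sym2.eq_iff] at this
      rcases this with ⟨rfl, rfl⟩ | ⟨rfl, rfl⟩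
      · exact hx'.2 hx.2
      · exact hx'.2 ((hW e he _ _ hxy).1 hx.2)
    have h5 := ncard_split hX h3 h4
    have h6 : 0 < (cut I F (X ∩ W)).ncard := by
      rw [Set.ncard_pos (hX.subset h1)]
      exact ⟨e, he, a, b, hab, ⟨ha, Conn.refl a⟩, fun h => hb h.1⟩
    have h7 : Even (cut I F (X \ W)).ncard := ih _ (by omega) _ (hX.subset h2) rfl
    have h8 : Even (cut I F (X ∩ W)).ncard := by
      apply h _ _ _ (hX.subset h1)
      · rintro x ⟨-, hx⟩ y ⟨-, hy⟩
        exact Conn.trans (Conn.symm hx) hy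
      · rintro e ⟨he, x, y, hxy, hx, hy⟩ z hz x' hx'
        have hz' : z ∈ W := by
          rw [hxy, Sym2.mem_iff] at hz
          rcases hz with rfl | rfl
          · exact hx.2
          · exact (hW e he _ _ hxy).1 hx.2
        exact Conn.trans (Conn.symm hx'.2) hz'
    rw [← hn, h5]; exact h8.add h7
  exact fun X hX => key _ X hX rfl

theorem even_part {C : Set E} (hC : C.Finite) {α : Type*} (c : E → α)
    (h : ∀ e ∈ C, Even ({x ∈ C | c x = c e} : Set E).ncard) : Even C.ncard := by
  have := hC.fintype
  rw [Set.ncard_eq_toFinset_card C hC, Finset.card_eq_sum_card_image c]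
  refine Finset.even_sum _ fun b hb => ?_
  obtain ⟨e, he, rfl⟩ := Finset.mem_image.1 hb
  have h1 := h e (by simpa using he)
  rw [← Set.ncard_coe_finset]
  have h2 : (((hC.toFinset).filter (fun x => c x = c e) : Finset E) : Set E) = {x ∈ C | c x = c e} := by
    ext x; simp
  rw [h2]; exact h1

noncomputable def en (I : E → Sym2 V) (e : E) (n : ℕ) : V :=
  if n = 0 then (Sym2_ex (I e)).choose else (Sym2_ex (I e)).choose_spec.choose

theorem en_ex {I : E → Sym2 V} {e : E} {v : V} (h : v ∈ I e) : ∃ n, en I e n = v := by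
  have h1 := (Sym2_ex (I e)).choose_spec.choose_spec
  rw [h1, Sym2.mem_iff] at h
  rcases h with rfl | rfl
  · exact ⟨0, by simp [en]⟩
  · exact ⟨1, by simp [en]⟩

theorem en_mem {I : E → Sym2 V} {e : E} (n : ℕ) : en I e n ∈ I e := by
  have h1 := (Sym2_ex (I e)).choose_spec.choose_spec
  rw [h1, Sym2.mem_iff]
  unfold en
  split_ifs
  · exact Or.inl rfl
  · exact Or.inr rfl

theorem NW_H {I : E → Sym2 V} {F B : Set E} (hB : Ev I (F \ B)) :
    ∃ 𝒜 : E → E → ℕ → Set (Set E), (∀ e e' n, ∀ a ∈ 𝒜 e e' n, a.Countable) ∧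
      ∀ Q, B ⊆ Q → (∀ e ∈ Q \ B, ∀ e' ∈ Q \ B, ∀ n, (∀ a ∈ 𝒜 e e' n, a ⊆ Q) ∨
        (#(Q \ B : Set E) < #(𝒜 e e' n) ∧ ℵ₀ < #(𝒜 e e' n))) → Ev I (F \ Q) := by
  have hfam := fun u v : V => max_fam (fun a : Set E => ∃ p, Flow I (F \ B) p u v ∧ ed p = a)
  choose 𝒬 hfm1 hfm2 hfm3 using hfam
  refine ⟨fun e e' n => 𝒬 (en I e n.unpair.1) (en I e' n.unpair.2), ?_, ?_⟩
  · intro e e' n a ha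
    obtain ⟨p, -, rfl⟩ := hfm1 _ _ a ha
    exact (ed_finite p).countable
  intro Q hBQ hQ
  apply Ev.of_comp
  intro X hX1 hX2 hfin
  have hsub : F \ Q ⊆ F \ B := fun e he => ⟨he.1, fun h => he.2 (hBQ h)⟩
  by_cases hc1 : ∃ e ∈ Q \ B, e ∈ F ∧ ∃ u ∈ I e, u ∈ X
  swap
  · have : cut I (F \ Q) X = cut I (F \ B) X := by
      refine Set.Subset.antisymm (cut_mono hsub) ?_
      rintro e ⟨he, x, y, hxy, hx, hy⟩
      refine ⟨⟨he.1, fun h => hc1 ⟨e, ⟨h, he.2⟩, he.1, x, ?_, hx⟩⟩, x, y, hxy, hx, hy⟩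
      rw [hxy]; exact Sym2.mem_mk_left _ _
    rw [this] at hfin ⊢; exact hB _ hfin
  obtain ⟨e, heK, heF, u, hue, huX⟩ := hc1
  let Y : Set V := {v | Conn I (F \ Q) u v ∧ v ∉ X}
  have hcutY : cut I (F \ Q) Y = cut I (F \ Q) X := by
    apply Set.Subset.antisymm
    · rintro e ⟨he, x, y, hxy, hx, hy⟩
      refine ⟨he, y, x, hxy.trans Sym2.eq_swap, ?_, hx.2⟩
      by_contra hyX
      exact hy ⟨hx.1.trans (Conn.single he hxy), hyX⟩
    · rintro e ⟨he, x, y, hxy, hx, hy⟩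
      refine ⟨he, y, x, hxy.trans Sym2.eq_swap, ⟨?_, hy⟩, fun h => h.2 hx⟩
      exact hX2 e ⟨he, x, y, hxy, hx, hy⟩ y (by rw [hxy]; exact Sym2.mem_mk_right _ _) u huX
  by_cases hc2 : ∃ e ∈ Q \ B, e ∈ F ∧ ∃ v ∈ I e, v ∈ Y
  swap
  · have : cut I (F \ Q) Y = cut I (F \ B) Y := by
      refine Set.Subset.antisymm (cut_mono hsub) ?_
      rintro e ⟨he, x, y, hxy, hx, hy⟩
      refine ⟨⟨he.1, fun h => hc2 ⟨e, ⟨h, he.2⟩, he.1, x, ?_, hx⟩⟩, x, y, hxy, hx, hy⟩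
      rw [hxy]; exact Sym2.mem_mk_left _ _
    rw [← hcutY] at hfin ⊢
    rw [this] at hfin ⊢; exact hB _ hfin
  obtain ⟨e', heK', heF', v, hve, hvY⟩ := hc2
  exfalso
  obtain ⟨n, hn⟩ := en_ex hue
  obtain ⟨n', hn'⟩ := en_ex hve
  have h1 := hQ e heK e' heK' (Nat.pair n n')
  simp only [Nat.unpair_pair, hn, hn'] at h1
  rcases h1 with h1 | ⟨h1, h1'⟩
  · obtain ⟨p, hp, -⟩ := Conn.flow hvY.1
    obtain ⟨f, hf⟩ := (hp.conn).cross huX hvY.2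
    have hne : (ed p).Nonempty := by
      obtain ⟨d, hd, -⟩ := hp.first (fun h => hvY.2 (h ▸ huX))
      exact ⟨_, mem_ed hd⟩
    obtain ⟨b, hb, hnd⟩ := hfm3 u v (ed p) ⟨p, hp.mono hsub, rfl⟩ hne
    exact hnd (Set.disjoint_left.2 fun x hx hxb => (hp.ed_sub hx).2 (h1 b hb hxb))
  · have h2 : #(𝒬 u v) ≤ max #(Q \ B : Set E) ℵ₀ := by
      refine disj_card (hfm2 u v) hfin.countable ?_
      intro a ha
      obtain ⟨p, hp, rfl⟩ := hfm1 u v a ha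
      by_cases hq : (ed p ∩ (Q \ B)).Nonempty
      · exact hq.mono (Set.inter_subset_inter_right _ Set.subset_union_left)
      · have h3 : Flow I (ed p ∩ (F \ Q)) p u v := hp.of_ed fun x hx => by
          refine ⟨hx, (hp.ed_sub hx).1, fun hxQ => hq ⟨x, hx, hxQ, (hp.ed_sub hx).2⟩⟩
        obtain ⟨f, hf⟩ := h3.conn.cross huX hvY.2
        exact ⟨f, hf.1.1, Or.inr ⟨hf.1.2, hf.2⟩⟩
    exact absurd h2 (not_le.2 (max_lt h1 h1'))

theorem NW_C {I : E → Sym2 V} {F B Z : Set E} (hB : Ev I (F \ B)) (hZ : Z.Countable) :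
    ∃ R, B ∪ Z ⊆ R ∧ (R \ B).Countable ∧ Ev I ((R \ B) ∩ F) ∧ Ev I (F \ R) := by
  obtain ⟨𝒜, h𝒜, hgood⟩ := NW_H hB
  have hP : ∀ (C : Finset E) (u v : V), ∃ P : Set E, P.Countable ∧ P ⊆ F \ B ∧
      (Conn I ((F \ B) \ C) u v → Conn I (P \ C) u v) := by
    intro C u v
    by_cases h : Conn I ((F \ B) \ C) u v
    · obtain ⟨p, hp, -⟩ := h.flow
      refine ⟨ed p, (ed_finite p).countable, fun x hx => (hp.ed_sub hx).1, fun _ => ?_⟩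
      exact (hp.of_ed (F' := ed p \ C) fun x hx => ⟨hx, (hp.ed_sub hx).2⟩).conn
    · exact ⟨∅, Set.countable_empty, Set.empty_subset _, fun h' => absurd h' h⟩
  choose P hP1 hP2 hP3 using hP
  let f : Finset E → Set E := fun s => (⋃ C ∈ s.powerset, ⋃ e ∈ s, ⋃ e' ∈ s, ⋃ n : ℕ, ⋃ n' : ℕ,
    P C (en I e n) (en I e' n')) ∪ ⋃ e ∈ s, ⋃ e' ∈ s, ⋃ n : ℕ, (if (𝒜 e e' n).Countable then ⋃₀ 𝒜 e e' n else ∅)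
  have hf : ∀ s, (f s).Countable := by
    intro s
    refine Set.Countable.union ?_ ?_
    · refine Set.Countable.biUnion (Finset.countable_toSet _) fun C _ => ?_
      refine Set.Countable.biUnion (Finset.countable_toSet _) fun e _ => ?_
      refine Set.Countable.biUnion (Finset.countable_toSet _) fun e' _ => ?_
      exact Set.countable_iUnion fun n => Set.countable_iUnion fun n' => hP1 _ _ _
    · refine Set.Countable.biUnion (Finset.countable_toSet _) fun e _ => ?_
      refine Set.Countable.biUnion (Finset.countable_toSet _) fun e' _ => ?_
      refine Set.countable_iUnion fun n => ?_
      split_ifs with h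
      · exact h.sUnion fun a ha => h𝒜 _ _ _ a ha
      · exact Set.countable_empty
  obtain ⟨K, hZK, hKc, hKf⟩ := clos f hf hZ
  have hKB : (B ∪ K) \ B ⊆ K := fun x hx => hx.1.resolve_left hx.2
  refine ⟨B ∪ K, Set.union_subset_union_right _ hZK, hKc.mono hKB, ?_, ?_⟩
  · set H' := ((B ∪ K) \ B) ∩ F with hH'
    have hH1 : H' ⊆ F \ B := fun x hx => ⟨hx.2, hx.1.2⟩
    have hH2 : ∀ x, x ∈ K → x ∈ F \ B → x ∈ H' := fun x h1 h2 => ⟨⟨Or.inr h1, h2.2⟩, h2.1⟩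
    have hconn : ∀ (C : Finset E), (C : Set E) ⊆ H' → ∀ e ∈ H', ∀ e' ∈ H', ∀ u ∈ I e, ∀ v ∈ I e',
        Conn I ((F \ B) \ C) u v → Conn I (H' \ C) u v := by
      intro C hC e he e' he' u hu v hv h
      obtain ⟨n, rfl⟩ := en_ex hu
      obtain ⟨n', rfl⟩ := en_ex hv
      refine Conn.mono ?_ (hP3 C _ _ h)
      intro x hx
      refine ⟨hH2 x ?_ (hP2 _ _ _ hx.1), hx.2⟩
      have hs : ((C ∪ {e, e'} : Finset E) : Set E) ⊆ K := by
        intro y hy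
        simp only [Finset.coe_union, Finset.coe_insert, Finset.coe_singleton, Set.mem_union, Finset.mem_coe,
          Set.mem_insert_iff, Set.mem_singleton_iff] at hy
        rcases hy with hy | rfl | rfl
        · exact hKB (hC hy).1
        · exact hKB he.1
        · exact hKB he'.1
      refine hKf _ hs (Or.inl ?_)
      simp only [Set.mem_iUnion]
      exact ⟨C, Finset.mem_powerset.2 Finset.subset_union_left, e, by simp, e', by simp, n, n', hx.1⟩
    intro X hfin
    let C := hfin.toFinset
    have hCc : (C : Set E) = cut I H' X := hfin.coe_toFinset
    let X' : Set V := {v | ∃ x ∈ X, (∃ e ∈ H', x ∈ I e) ∧ Conn I ((F \ B) \ C) x v}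
    have : cut I (F \ B) X' = cut I H' X := by
      apply Set.Subset.antisymm
      · rintro e ⟨he, a, b, hab, ⟨x, hx1, hx2, hx3⟩, hb⟩
        by_contra hne
        refine hb ⟨x, hx1, hx2, hx3.trans (Conn.single ⟨he, ?_⟩ hab)⟩
        rwa [hCc]
      · rintro e ⟨he, a, b, hab, ha, hb⟩
        have hae : a ∈ I e := by rw [hab]; exact Sym2.mem_mk_left _ _
        have hbe : b ∈ I e := by rw [hab]; exact Sym2.mem_mk_right _ _
        refine ⟨hH1 he, a, b, hab, ⟨a, ha, ⟨e, he, hae⟩, Conn.refl _⟩, ?_⟩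
        rintro ⟨x, hx, ⟨e', he', hxe'⟩, hx2⟩
        have h1 := hconn C (by rw [hCc]; exact cut_sub) e' he' e he x hxe' b hbe hx2
        refine hb (h1.closed X hx fun g hg y z hyz hy => ?_)
        by_contra hz
        apply hg.2
        rw [hCc]
        exact ⟨hg.1, y, z, hyz, hy, hz⟩
    rw [← this] at hfin ⊢
    exact hB _ hfin
  · apply hgood _ Set.subset_union_left
    intro e he e' he' n
    by_cases hcn : (𝒜 e e' n).Countable
    · left
      have hs : (({e, e'} : Finset E) : Set E) ⊆ K := by
        intro y hy
        simp only [Finset.coe_insert, Finset.coe_singleton, Set.mem_insert_iff, Set.mem_singleton_iff] at hy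
        rcases hy with rfl | rfl
        · exact hKB he
        · exact hKB he'
      intro a ha
      refine Set.Subset.trans ?_ (Set.subset_union_right (s := B))
      refine Set.Subset.trans ?_ (hKf _ hs)
      intro x hx
      refine Or.inr ?_
      simp only [Set.mem_iUnion]
      refine ⟨e, by simp, e', by simp, n, ?_⟩
      rw [if_pos hcn]
      exact ⟨a, ha, hx⟩
    · right
      have h1 : ℵ₀ < #(𝒜 e e' n) := not_le.1 fun h => hcn (Cardinal.le_aleph0_iff_set_countable.1 h)
      exact ⟨(Cardinal.le_aleph0_iff_set_countable.2 (hKc.mono hKB)).trans_lt h1, h1⟩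

theorem NW {I : E → Sym2 V} {F : Set E} (hF : Ev I F) : ∃ c : E → Set E,
    (∀ e ∈ F, e ∈ c e ∧ c e ⊆ F) ∧ (∀ e, (c e).Countable) ∧ (∀ e ∈ F, ∀ e' ∈ c e, c e' = c e) ∧
    ∀ Q ⊆ F, (∀ e ∈ Q, c e ⊆ Q) → Ev I Q := by
  have h := chain (fun Q => Ev I (F \ Q)) (fun X => ∃ 𝒮 : Set (Set E), 𝒮.PairwiseDisjoint id ∧
      (∀ s ∈ 𝒮, s.Countable ∧ Ev I s) ∧ ⋃₀ 𝒮 = X ∩ F) ?_ (fun B hB => NW_H hB) ?_ (B := ∅) (by simpa using hF)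
  · obtain ⟨𝒮, h1, h2, h3⟩ := h
    rw [Set.compl_empty, Set.univ_inter] at h3
    have hex : ∀ e, ∃ s : Set E, s.Countable ∧ (e ∈ F → s ∈ 𝒮 ∧ e ∈ s) := by
      intro e
      by_cases he : e ∈ F
      · rw [← h3] at he
        obtain ⟨s, hs, hes⟩ := he
        exact ⟨s, (h2 s hs).1, fun _ => ⟨hs, hes⟩⟩
      · exact ⟨∅, Set.countable_empty, fun h => absurd h he⟩
    choose c hc1 hc2 using hex
    have hcF : ∀ e ∈ F, c e ⊆ F := fun e he => h3 ▸ Set.subset_sUnion_of_mem (hc2 e he).1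
    have hceq : ∀ e ∈ F, ∀ e' ∈ c e, c e' = c e := by
      intro e he e' he'
      have he'F := hcF e he he'
      by_contra hne
      have h5 : Disjoint (c e') (c e) := h1 (hc2 e' he'F).1 (hc2 e he).1 hne
      exact Set.disjoint_left.1 h5 (hc2 e' he'F).2 he'
    refine ⟨c, fun e he => ⟨(hc2 e he).2, hcF e he⟩, hc1, hceq, ?_⟩
    intro Q hQF hQ X hfin
    refine even_part hfin c fun e he => ?_
    have heF := hQF he.1
    have : ({x ∈ cut I Q X | c x = c e} : Set E) = cut I (c e) X := by
      ext x
      constructor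
      · rintro ⟨hx, hxe⟩
        exact ⟨hxe ▸ (hc2 x (hQF hx.1)).2, hx.2⟩
      · rintro ⟨hx, hx2⟩
        exact ⟨⟨hQ e he.1 hx, hx2⟩, hceq e heF x hx⟩
    rw [this]
    refine (h2 _ (hc2 e heF).1).2 X (this ▸ hfin.subset fun x hx => hx.1)
  · intro 𝒯 hd hT
    choose! 𝒮 h1 h2 h3 using hT
    refine ⟨⋃ X ∈ 𝒯, 𝒮 X, ?_, ?_, ?_⟩
    · intro s hs s' hs' hne
      obtain ⟨X, hX, hsX⟩ := Set.mem_iUnion₂.1 hs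
      obtain ⟨X', hX', hsX'⟩ := Set.mem_iUnion₂.1 hs'
      by_cases hXX : X = X'
      · subst hXX; exact h1 X hX hsX hsX' hne
      · have h4 : s ⊆ X := fun x hx => ((h3 X hX).subset ⟨s, hsX, hx⟩).1
        have h5 : s' ⊆ X' := fun x hx => ((h3 X' hX').subset ⟨s', hsX', hx⟩).1
        exact Disjoint.mono h4 h5 (hd hX hX' hXX)
    · intro s hs
      obtain ⟨X, hX, hsX⟩ := Set.mem_iUnion₂.1 hs
      exact h2 X hX s hsX
    · ext x
      constructor
      · rintro ⟨s, hs, hx⟩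
        obtain ⟨X, hX, hsX⟩ := Set.mem_iUnion₂.1 hs
        have h4 := (h3 X hX).subset ⟨s, hsX, hx⟩
        exact ⟨⟨X, hX, h4.1⟩, h4.2⟩
      · rintro ⟨⟨X, hX, hx⟩, hxF⟩
        obtain ⟨s, hs, hxs⟩ := (h3 X hX).superset ⟨hx, hxF⟩
        exact ⟨s, Set.mem_iUnion₂.2 ⟨X, hX, hs⟩, hxs⟩
  · intro B Z hB hZ
    obtain ⟨R, h1, h2, h3, h4⟩ := NW_C hB hZ
    refine ⟨R, h1, h2, ⟨{(R \ B) ∩ F}, by simp, ?_, by simp⟩, h4⟩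
    rintro s rfl
    exact ⟨h2.mono Set.inter_subset_left, h3⟩

/-- partition into countable inner Eulerian classes -/
theorem NWT {I : E → Sym2 V} {F : Set E} {T : Set V} {t : V} (ht : t ∈ T) (hF : Par I F T) :
    ∃ c : E → Set E,
    (∀ e ∈ F, e ∈ c e ∧ c e ⊆ F) ∧ (∀ e, (c e).Countable) ∧ (∀ e ∈ F, ∀ e' ∈ c e, c e' = c e) ∧
    ∀ Q ⊆ F, (∀ e ∈ Q, c e ⊆ Q) → Par I Q T := by
  have h1 : Ev (con I (colX T t)) F := by
    intro X hfin
    rw [cut_con] at hfin ⊢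
    by_cases htX : t ∈ X
    · rw [← cut_compl] at hfin ⊢
      refine hF _ (Set.disjoint_left.2 fun x hx hxT => hx ?_) hfin
      show colX T t x ∈ X
      rw [colX, if_pos hxT]; exact htX
    · refine hF _ (Set.disjoint_left.2 fun x hx hxT => htX ?_) hfin
      have : colX T t x ∈ X := hx
      rwa [colX, if_pos hxT] at this
  obtain ⟨c, hc1, hc2, hc3, hc4⟩ := NW h1
  refine ⟨c, hc1, hc2, hc3, fun Q hQ hQc D hD hfin => ?_⟩
  have h2 := hc4 Q hQ hQc D
  have h3 : {v | colX T t v ∈ D} = D := by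
    ext v
    show colX T t v ∈ D ↔ v ∈ D
    unfold colX
    split_ifs with h
    · exact ⟨fun h' => absurd ht (Set.disjoint_left.1 hD h'), fun h' => absurd h (Set.disjoint_left.1 hD h')⟩
    · rfl
  rw [cut_con, h3] at h2
  exact h2 hfin

end LC

set_option linter.unusedVariables false

namespace LC
open Classical Cardinal
universe w
variable {V : Type u} {E : Type v} {ι : Type w}

def Cl (r : E → E → Prop) (A : Set E) : Set E := {e' | ∃ e ∈ A, Relation.ReflTransGen r e e'}

theorem Cl_sub {r : E → E → Prop} {A : Set E} : A ⊆ Cl r A := fun e he => ⟨e, he, .refl⟩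

theorem Cl_closed {r : E → E → Prop} {A : Set E} {e e' : E} (he : e ∈ Cl r A) (h : r e e') : e' ∈ Cl r A := by
  obtain ⟨a, ha, h1⟩ := he
  exact ⟨a, ha, h1.tail h⟩

theorem cl_count {r : E → E → Prop} (hr : ∀ e, {e' | r e e'}.Countable) (e : E) :
    {e' | Relation.ReflTransGen r e e'}.Countable := by
  obtain ⟨K, h1, h2, h3⟩ := clos (fun s => ⋃ e ∈ s, {e' | r e e'})
    (fun s => Set.Countable.biUnion (Finset.countable_toSet _) fun e _ => hr e) (Set.countable_singleton e)
  refine h2.mono ?_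
  intro e' he'
  replace he' : Relation.ReflTransGen r e e' := he'
  induction he' with
  | refl => exact h1 rfl
  | tail _ h ih => exact h3 {_} (by simpa using ih) (by simpa using h)

theorem mk_Cl {r : E → E → Prop} (hr : ∀ e, {e' | r e e'}.Countable) {A : Set E} {μ : Cardinal.{v}}
    (hμ : ℵ₀ ≤ μ) (hA : #A ≤ μ) : #(Cl r A) ≤ μ := by
  have : Cl r A = ⋃ e ∈ A, {e' | Relation.ReflTransGen r e e'} := by
    ext x; simp [Cl]
  rw [this]
  exact mk_biUn _ _ hμ hA fun e _ => mk_cnt hμ (cl_count hr e)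

theorem Cl_disj {r : E → E → Prop} (hs : ∀ e e', r e e' → r e' e) {A C : Set E}
    (hC : ∀ e ∈ C, ∀ e', r e e' → e' ∈ C) (hAC : Disjoint A C) : Disjoint (Cl r A) C := by
  rw [Set.disjoint_left]
  rintro e ⟨a, ha, h⟩ heC
  refine Set.disjoint_left.1 hAC ha ?_
  clear ha
  induction h using Relation.ReflTransGen.head_induction_on with
  | refl => exact heC
  | head h _ ih => exact hC _ ih _ (hs _ _ h)

theorem Cl_F {r : E → E → Prop} {F : Set E} (hF : ∀ e e', r e e' → e' ∈ F) {A : Set E} (hA : A ⊆ F) :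
    Cl r A ⊆ F := by
  rintro e ⟨a, ha, h⟩
  rcases h with _ | ⟨_, h⟩
  · exact hA ha
  · exact hF _ _ h

theorem package {r : E → E → Prop} (hs : ∀ e e', r e e' → r e' e) (hr : ∀ e, {e' | r e e'}.Countable)
    {I : E → Sym2 V} {F : Set E} {T : Set V} (hF : ∀ e e', r e e' → e' ∈ F) {x : V} {μ : Cardinal.{v}}
    (hμ : ℵ₀ ≤ μ) (hrich : ∀ C : Set E, #C ≤ μ → ∃ s ∈ T, Conn I (F \ C) x s) {C : Set E}
    (hC : ∀ e ∈ C, ∀ e', r e e' → e' ∈ C) (hCμ : #C ≤ μ) :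
    ∃ Z : Set E, Z.Countable ∧ (∀ e ∈ Z, ∀ e', r e e' → e' ∈ Z) ∧ Z ⊆ F ∧ Disjoint Z C ∧
      ∀ C' : Set E, C'.Finite → ∃ s ∈ T, Conn I (Z \ C') x s := by
  by_cases hxT : x ∈ T
  · exact ⟨∅, Set.countable_empty, by simp, by simp, by simp, fun _ _ => ⟨x, hxT, Conn.refl x⟩⟩
  obtain ⟨𝒬, h1, h2, h3⟩ := max_fam (fun a : Set E => ∃ s ∈ T, ∃ p, Flow I (F \ C) p x s ∧ a = Cl r (ed p))
  have hcnt : ∀ a ∈ 𝒬, a.Countable := by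
    intro a ha
    obtain ⟨s, -, p, -, rfl⟩ := h1 a ha
    exact Cardinal.le_aleph0_iff_set_countable.1 (mk_Cl hr le_rfl (mk_cnt le_rfl (ed_finite p).countable))
  have hcl : ∀ a ∈ 𝒬, ∀ e ∈ a, ∀ e', r e e' → e' ∈ a := by
    intro a ha e he e' h
    obtain ⟨s, -, p, -, rfl⟩ := h1 a ha
    exact Cl_closed he h
  have hinf : 𝒬.Infinite := by
    intro hfin
    have h4 : #(⋃₀ 𝒬 : Set E) ≤ μ := mk_cnt hμ (hfin.countable.sUnion hcnt)
    obtain ⟨s, hs', h5⟩ := hrich (C ∪ ⋃₀ 𝒬) (mk_un hμ hCμ h4)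
    obtain ⟨p, hp, -⟩ := h5.flow
    obtain ⟨d, hd, -⟩ := hp.first (fun h => hxT (h ▸ hs'))
    obtain ⟨b, hb, hnd⟩ := h3 (Cl r (ed p)) ⟨s, hs', p, hp.mono (fun y hy => ⟨hy.1, fun h => hy.2 (Or.inl h)⟩), rfl⟩
      ⟨_, Cl_sub (mem_ed hd)⟩
    refine hnd (Cl_disj hs (hcl b hb) ?_)
    exact Set.disjoint_left.2 fun y hy hyb => (hp.ed_sub hy).2 (Or.inr ⟨b, hb, hyb⟩)
  let f := hinf.natEmbedding
  refine ⟨⋃ n, (f n).1, Set.countable_iUnion fun n => hcnt _ (f n).2, ?_, ?_, ?_, ?_⟩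
  · intro e he e' h
    obtain ⟨n, hn⟩ := Set.mem_iUnion.1 he
    exact Set.mem_iUnion.2 ⟨n, hcl _ (f n).2 e hn e' h⟩
  · refine Set.iUnion_subset fun n => ?_
    obtain ⟨s, -, p, hp, h⟩ := h1 _ (f n).2
    rw [h]
    exact Cl_F hF (hp.ed_sub.trans Set.sdiff_subset)
  · rw [Set.disjoint_iUnion_left]
    intro n
    obtain ⟨s, -, p, hp, h⟩ := h1 _ (f n).2
    rw [h]
    exact Cl_disj hs hC (Set.disjoint_left.2 fun y hy => (hp.ed_sub hy).2)
  · intro C' hC'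
    have : ∃ n, Disjoint (f n).1 C' := by
      by_contra hcon
      push Not at hcon
      have h5 : ∀ n, ∃ e, e ∈ (f n).1 ∧ e ∈ C' := fun n => Set.not_disjoint_iff.1 (hcon n)
      choose g hg1 hg2 using h5
      have hinj : Function.Injective g := by
        intro m n hmn
        by_contra hne
        have h6 : (f m).1 ≠ (f n).1 := fun h => hne (f.injective (Subtype.ext h))
        have h7 : Disjoint (f m).1 (f n).1 := h2 (f m).2 (f n).2 h6
        exact Set.disjoint_left.1 h7 (hg1 m) (hmn ▸ hg1 n)
      exact Set.infinite_of_injective_forall_mem hinj hg2 hC'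
    obtain ⟨n, hn⟩ := this
    obtain ⟨s, hs', p, hp, h⟩ := h1 _ (f n).2
    refine ⟨s, hs', (hp.of_ed fun y hy => ?_).conn⟩
    have hy1 : y ∈ (f n).1 := by rw [h]; exact Cl_sub hy
    exact ⟨Set.mem_iUnion.2 ⟨n, hy1⟩, Set.disjoint_left.1 hn hy1⟩

theorem packages {r : E → E → Prop} (hs : ∀ e e', r e e' → r e' e) (hr : ∀ e, {e' | r e e'}.Countable)
    {I : E → Sym2 V} {F : Set E} {T : Set V} (hF : ∀ e e', r e e' → e' ∈ F) {Dm : Set E} {x : E → V}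
    {μ : Cardinal.{v}} (hμ : ℵ₀ ≤ μ) (hDm : #Dm ≤ μ)
    (hrich : ∀ k ∈ Dm, ∀ C : Set E, #C ≤ μ → ∃ s ∈ T, Conn I (F \ C) (x k) s) {Zs : Set E} (hZs : #Zs ≤ μ) :
    ∃ Z : E → Set E, ∀ k ∈ Dm, (∀ e ∈ Z k, ∀ e', r e e' → e' ∈ Z k) ∧ Z k ⊆ F ∧ Disjoint (Z k) Zs ∧
      (∀ C' : Set E, C'.Finite → ∃ s ∈ T, Conn I (Z k \ C') (x k) s) ∧
      ∀ k' ∈ Dm, k ≠ k' → Disjoint (Z k) (Z k') := by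
  let Pk : E × Set E → Prop := fun z => z.1 ∈ Dm ∧ z.2.Countable ∧ (∀ e ∈ z.2, ∀ e', r e e' → e' ∈ z.2) ∧ z.2 ⊆ F ∧
    Disjoint z.2 Zs ∧ (∀ C' : Set E, C'.Finite → ∃ s ∈ T, Conn I (z.2 \ C') (x z.1) s)
  obtain ⟨M, hM⟩ := zorn_subset {𝒟 : Set (E × Set E) | (∀ z ∈ 𝒟, Pk z) ∧
      𝒟.Pairwise (fun z z' => z.1 ≠ z'.1 ∧ Disjoint z.2 z'.2)} (by
    intro c hc hch
    refine ⟨⋃₀ c, ⟨?_, ?_⟩, fun s hs => Set.subset_sUnion_of_mem hs⟩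
    · rintro a ⟨s, hs, ha⟩
      exact (hc hs).1 a ha
    · exact (Set.pairwise_sUnion hch.directedOn).2 fun s hs => (hc hs).2)
  have hall : ∀ k ∈ Dm, ∃ Z, (k, Z) ∈ M := by
    intro k hk
    by_contra hcon
    push Not at hcon
    have hinj : #M ≤ μ := by
      refine le_trans (Cardinal.mk_le_of_injective (f := fun z : M => (⟨z.1.1, (hM.prop.1 z.1 z.2).1⟩ : Dm)) ?_) hDm
      rintro ⟨z, hz⟩ ⟨z', hz'⟩ h
      have h' : z.1 = z'.1 := congrArg Subtype.val h
      by_contra hne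
      exact (hM.prop.2 hz hz' (fun h => hne (Subtype.ext h))).1 h'
    have hU : #(⋃ z : M, z.1.2 : Set E) ≤ μ := by
      exact mk_iUn (fun z : M => z.1.2) hμ hinj fun z => mk_cnt hμ (hM.prop.1 z.1 z.2).2.1
    obtain ⟨Z, h1, h2, h3, h4, h5⟩ := package hs hr hF hμ (hrich k hk) (C := Cl r Zs ∪ ⋃ z : M, z.1.2)
      (by
        rintro e (he | he) e' h
        · exact Or.inl (Cl_closed he h)
        · obtain ⟨z, hz⟩ := Set.mem_iUnion.1 he
          exact Or.inr (Set.mem_iUnion.2 ⟨z, (hM.prop.1 z.1 z.2).2.2.1 e hz e' h⟩))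
      (mk_un hμ (mk_Cl hr hμ hZs) hU)
    rw [Set.disjoint_union_right] at h4
    refine hcon Z (hM.le_of_ge (y := insert (k, Z) M) ⟨?_, ?_⟩ (Set.subset_insert _ _) (Set.mem_insert _ _))
    · rintro z (rfl | hz)
      · exact ⟨hk, h1, h2, h3, h4.1.mono_right Cl_sub, h5⟩
      · exact hM.prop.1 z hz
    · refine hM.prop.2.insert fun z hz hne => ?_
      have h6 : k ≠ z.1 := by
        rintro rfl
        exact hcon z.2 hz
      have h7 : Disjoint Z z.2 := h4.2.mono_right (Set.subset_iUnion (fun z : M => z.1.2) ⟨z, hz⟩)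
      exact ⟨⟨h6, h7⟩, h6.symm, h7.symm⟩
  choose! Z hZ using hall
  refine ⟨Z, fun k hk => ?_⟩
  obtain ⟨-, -, h2, h3, h4, h5⟩ := hM.prop.1 _ (hZ k hk)
  refine ⟨h2, h3, h4, h5, fun k' hk' hne => ?_⟩
  exact (hM.prop.2 (hZ k hk) (hZ k' hk') (fun h => hne (congrArg Prod.fst h))).2

theorem Absorb {I : E → Sym2 V} {F : Set E} {T : Set V} {t : V} {S : Set V} (ht : t ∈ T) (hpar : Par I F T)
    (hST : ∀ x ∈ S, x ∈ T → x = t) {B0 Dm Zs : Set E} {v : E → V} {p : E → Finset (E × V × V)}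
    {μ : Cardinal.{v}} (hμ : ℵ₀ ≤ μ) (hB0 : B0 ⊆ cut I F S) (hv : ∀ h ∈ B0, v h = inE I S h)
    (hp : Link I (Ins I F S) t B0 v p) (hZs : #Zs ≤ μ) (hcut : ∀ h ∈ cut I F S, h ∉ B0 → h ∈ Zs)
    (hDm : #Dm ≤ μ) (hDmS : ∀ k ∈ Dm, v k ∈ S) (hdis : Disjoint B0 Dm)
    (hrich : ∀ k ∈ Dm, ∀ C : Set E, #C ≤ μ → ∃ s ∈ T, Conn I (F \ C) (v k) s) :
    ∃ q, Link I (Ins I F S) t (B0 ∪ Dm) v q ∧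
      ∀ i ∈ B0 ∪ Dm, ∀ e ∈ ed (q i), e ∉ Zs ∨ ∃ h ∈ B0, e ∈ ed (p h) := by
  obtain ⟨c, hc1, hc2, hc3, hc4⟩ := NWT ht hpar
  let A : E → Set E := fun h => insert h (ed (p h))
  have hAu : ∀ h ∈ B0, ∀ h' ∈ B0, ∀ e, e ∈ A h → e ∈ A h' → h = h' := by
    rintro h hh h' hh' e (rfl | he) (rfl | he')
    · rfl
    · exact absurd ((hp.flow h' hh').ed_sub he') (cut_Ins (hB0 hh))
    · exact absurd ((hp.flow h hh).ed_sub he) (cut_Ins (hB0 hh'))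
    · exact hp.uniq hh hh' he he'
  let r : E → E → Prop := fun e e' => e ∈ F ∧ e' ∈ F ∧ (c e = c e' ∨ ∃ h ∈ B0, e ∈ A h ∧ e' ∈ A h)
  have hs : ∀ e e', r e e' → r e' e := by
    rintro e e' ⟨h1, h2, h3⟩
    refine ⟨h2, h1, ?_⟩
    rcases h3 with h3 | ⟨h, hh, h4, h5⟩
    · exact Or.inl h3.symm
    · exact Or.inr ⟨h, hh, h5, h4⟩
  have hr : ∀ e, {e' | r e e'}.Countable := by
    intro e
    have h1 : {h | h ∈ B0 ∧ e ∈ A h}.Subsingleton := fun h hh h' hh' => hAu h hh.1 h' hh'.1 e hh.2 hh'.2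
    have h2 : (⋃ h ∈ {h | h ∈ B0 ∧ e ∈ A h}, A h).Countable :=
      h1.countable.biUnion fun h _ => ((ed_finite _).insert h).countable
    refine ((hc2 e).union h2).mono ?_
    rintro e' ⟨he, he', h3 | ⟨h, hh, h4, h5⟩⟩
    · left; rw [h3]; exact (hc1 e' he').1
    · exact Or.inr (Set.mem_iUnion₂.2 ⟨h, ⟨hh, h4⟩, h5⟩)
  obtain ⟨Z, hZ⟩ := packages hs hr (I := I) (F := F) (T := T) (fun e e' h => h.2.1) hμ hDm hrich hZs
  have hAF : ∀ h ∈ B0, A h ⊆ F := by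
    rintro h hh e (rfl | he)
    · exact (hB0 hh).1
    · exact ((hp.flow h hh).ed_sub he).1
  have hAZ : ∀ k ∈ Dm, ∀ h ∈ B0, ∀ e ∈ A h, e ∈ Z k → A h ⊆ Z k := by
    intro k hk h hh e he heZ e' he'
    exact (hZ k hk).1 e heZ e' ⟨hAF h hh he, hAF h hh he', Or.inr ⟨h, hh, he, he'⟩⟩
  have hcutZ : ∀ k ∈ Dm, ∀ h ∈ cut I (Z k) S, h ∈ B0 := by
    intro k hk h hh
    by_contra hB
    exact Set.disjoint_left.1 (hZ k hk).2.2.1 hh.1 (hcut h (cut_mono (hZ k hk).2.1 hh) hB)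
  have hC : ∀ k ∈ Dm, ∃ p' : Option E → Finset (E × V × V),
      Link I (Ins I (Z k) S) t (insert none (some '' cut I (Z k) S)) (opt (v k) (inE I S)) p' := by
    intro k hk
    obtain ⟨h1, h2, h3, h4, h5⟩ := hZ k hk
    refine lemC (p := p) ⟨fun h hh => ?_, fun h hh h' hh' hne => ?_⟩ (hDmS k hk) ?_
    · have hB := hcutZ k hk h hh
      rw [← hv h hB]
      refine (hp.flow h hB).of_ed fun e he => ?_
      exact ⟨hAZ k hk h hB h (Set.mem_insert _ _) hh.1 (Set.mem_insert_of_mem _ he), ((hp.flow h hB).ed_sub he).2⟩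
    · exact hp.disj h (hcutZ k hk h hh) h' (hcutZ k hk h' hh') hne
    · intro D hD htD hfin
      have hDT : Disjoint D T := Set.disjoint_left.2 fun y hy hyT => htD (hST y (hD hy) hyT ▸ hy)
      have hev : Even (cut I (Z k) D).ncard := by
        refine hc4 (Z k) h2 (fun e he e' he' => ?_) D hDT hfin
        exact h1 e he e' ⟨h2 he, (hc1 e (h2 he)).2 he', Or.inl (hc3 e (h2 he) e' he').symm⟩
      refine iff_of_false (Nat.not_odd_iff_even.2 hev) fun hx => ?_
      obtain ⟨s, hs', hconn⟩ := h4 _ hfin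
      obtain ⟨e, he⟩ := hconn.cross hx (fun h => Set.disjoint_left.1 hDT h hs')
      exact he.1.2 ⟨he.1.1, he.2⟩
  choose! p' hp' using hC
  have hnk : ∀ b ∈ B0, ∀ k ∈ Dm, b ≠ k := fun b hb k hk h => Set.disjoint_left.1 hdis hb (h ▸ hk)
  let q : E → Finset (E × V × V) := fun e => if e ∈ Dm then p' e none else
    if h : ∃ k ∈ Dm, e ∈ Z k then p' h.choose (some e) else p e
  have hq1 : ∀ k ∈ Dm, q k = p' k none := fun k hk => if_pos hk
  have hkk : ∀ k ∈ Dm, ∀ k' ∈ Dm, ∀ e, e ∈ Z k → e ∈ Z k' → k = k' := by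
    intro k hk k' hk' e h1 h2
    by_contra hne
    exact Set.disjoint_left.1 ((hZ k hk).2.2.2.2 k' hk' hne) h1 h2
  have hq2 : ∀ b ∈ B0, ∀ k ∈ Dm, b ∈ Z k → q b = p' k (some b) := by
    intro b hb k hk hbk
    have h : ∃ k ∈ Dm, b ∈ Z k := ⟨k, hk, hbk⟩
    simp only [q]
    rw [if_neg (Set.disjoint_left.1 hdis hb), dif_pos h, hkk _ h.choose_spec.1 k hk b h.choose_spec.2 hbk]
  have hq3 : ∀ b ∈ B0, (¬ ∃ k ∈ Dm, b ∈ Z k) → q b = p b := by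
    intro b hb h
    simp only [q]
    rw [if_neg (Set.disjoint_left.1 hdis hb), dif_neg h]
  -- each index is either base or belongs to a package
  have hcase : ∀ i ∈ B0 ∪ Dm, (i ∈ B0 ∧ q i = p i ∧ ¬ ∃ k ∈ Dm, i ∈ Z k) ∨
      ∃ k ∈ Dm, ∃ o ∈ (insert none (some '' cut I (Z k) S) : Set (Option E)), q i = p' k o ∧ v i = opt (v k) (inE I S) o ∧
        i = o.elim k id := by
    rintro i (hi | hi)
    · by_cases h : ∃ k ∈ Dm, i ∈ Z k
      · obtain ⟨k, hk, hik⟩ := h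
        refine Or.inr ⟨k, hk, some i, Or.inr ⟨i, ⟨hik, (hB0 hi).2⟩, rfl⟩, hq2 i hi k hk hik, hv i hi, rfl⟩
      · exact Or.inl ⟨hi, hq3 i hi h, h⟩
    · exact Or.inr ⟨i, hi, none, Or.inl rfl, hq1 i hi, rfl, rfl⟩
  have hedZ : ∀ k ∈ Dm, ∀ o ∈ (insert none (some '' cut I (Z k) S) : Set (Option E)), ed (p' k o) ⊆ Ins I (Z k) S :=
    fun k hk o ho => ((hp' k hk).flow o ho).ed_sub
  have hbase : ∀ b ∈ B0, (¬ ∃ k ∈ Dm, b ∈ Z k) → ∀ k ∈ Dm, Disjoint (ed (p b)) (Z k) := by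
    intro b hb h k hk
    rw [Set.disjoint_left]
    intro e he heZ
    exact h ⟨k, hk, hAZ k hk b hb e (Set.mem_insert_of_mem _ he) heZ (Set.mem_insert _ _)⟩
  refine ⟨q, ⟨?_, ?_⟩, ?_⟩
  · intro i hi
    rcases hcase i hi with ⟨h1, h2, -⟩ | ⟨k, hk, o, ho, h2, h3, -⟩
    · rw [h2]; exact hp.flow i h1
    · rw [h2, h3]; exact ((hp' k hk).flow o ho).mono (Ins_mono (hZ k hk).2.1 subset_rfl)
  · intro i hi j hj hne
    rcases hcase i hi with ⟨h1, h2, h0⟩ | ⟨k, hk, o, ho, h2, h3, h0⟩ <;>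
    rcases hcase j hj with ⟨h1', h2', h0'⟩ | ⟨k', hk', o', ho', h2', h3', h0'⟩
    · rw [h2, h2']; exact hp.disj i h1 j h1' hne
    · rw [h2, h2']
      exact (hbase i h1 h0 k' hk').mono_right ((hedZ k' hk' o' ho').trans Ins_sub)
    · rw [h2, h2']
      exact ((hbase j h1' h0' k hk).mono_right ((hedZ k hk o ho).trans Ins_sub)).symm
    · rw [h2, h2']
      by_cases hkk' : k = k'
      · subst hkk'
        refine (hp' k hk).disj o ho o' ho' ?_
        rintro rfl
        exact hne (h0.trans h0'.symm)
      · exact ((hZ k hk).2.2.2.2 k' hk' hkk').mono ((hedZ k hk o ho).trans Ins_sub) ((hedZ k' hk' o' ho').trans Ins_sub)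
  · intro i hi e he
    rcases hcase i hi with ⟨h1, h2, -⟩ | ⟨k, hk, o, ho, h2, h3, -⟩
    · rw [h2] at he; exact Or.inr ⟨i, h1, he⟩
    · rw [h2] at he
      exact Or.inl (Set.disjoint_left.1 (hZ k hk).2.2.1 (Ins_sub (hedZ k hk o ho he)))

end LC

set_option linter.unusedVariables false

namespace LC
open Classical Cardinal
universe w
variable {V : Type u} {E : Type v} {ι : Type w}

theorem GoodH {I : E → Sym2 V} {F0 B : Set E} {T : Set V} {t0 : V} (ht0 : t0 ∈ T)
    (hPar : Par I (F0 \ B) T) (hWF : WF I (F0 \ B) T) :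
    ∃ 𝒜 : E → E → ℕ → Set (Set E), (∀ e e' n, ∀ a ∈ 𝒜 e e' n, a.Countable) ∧
      ∀ Q, B ⊆ Q → (∀ e ∈ Q \ B, ∀ e' ∈ Q \ B, ∀ n, (∀ a ∈ 𝒜 e e' n, a ⊆ Q) ∨
        (#(Q \ B : Set E) < #(𝒜 e e' n) ∧ ℵ₀ < #(𝒜 e e' n))) → Par I (F0 \ Q) T ∧ WF I (F0 \ Q) T := by
  obtain ⟨c, hc1, hc2, hc3, hc4⟩ := NWT ht0 hPar
  have hfam := fun v : V => max_fam (fun a : Set E => ∃ s ∈ T, ∃ p, Flow I (F0 \ B) p v s ∧ ed p = a)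
  choose 𝒬 hQ1 hQ2 hQ3 using hfam
  refine ⟨fun e e' n => if n = 0 then {c e} else 𝒬 (en I e (n - 1)), ?_, ?_⟩
  · intro e e' n a ha
    by_cases hn : n = 0
    · simp only [hn, if_true, Set.mem_singleton_iff] at ha
      rw [ha]; exact hc2 e
    · simp only [hn, if_false] at ha
      obtain ⟨s, -, p, -, rfl⟩ := hQ1 _ a ha
      exact (ed_finite p).countable
  intro Q hBQ hQ
  have hsub : F0 \ Q ⊆ F0 \ B := fun e he => ⟨he.1, fun h => he.2 (hBQ h)⟩
  have hcl : ∀ e ∈ Q \ B, c e ⊆ Q := by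
    intro e he
    rcases hQ e he e he 0 with h | ⟨-, h⟩
    · exact h (c e) (by simp)
    · simp only [if_true, Cardinal.mk_fintype, Fintype.card_unique, Nat.cast_one] at h
      exact absurd h (not_lt.2 Cardinal.one_lt_aleph0.le)
  refine ⟨?_, ?_⟩
  · refine hc4 _ hsub fun e he e' he' => ⟨((hc1 e (hsub he)).2 he').1, fun h => he.2 ?_⟩
    have h1 := hcl e' ⟨h, ((hc1 e (hsub he)).2 he').2⟩
    rw [hc3 e (hsub he) e' he'] at h1
    exact h1 (hc1 e (hsub he)).1
  · intro t ht S p0 hW0 v0 hv0 hv0t s0 hs0 hconn0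
    obtain ⟨p, hW, hpc⟩ := hW0.clean
    let S' : Set V := {v | v ∈ S ∧ ∃ s ∈ T, Conn I (F0 \ Q) v s}
    have htS' : t ∈ S' := ⟨hW.mem, t, ht, Conn.refl t⟩
    have hst : ∀ e ∈ F0 \ Q, ∀ x y, I e = s(x, y) → (∃ s ∈ T, Conn I (F0 \ Q) x s) → ∃ s ∈ T, Conn I (F0 \ Q) y s := by
      rintro e he x y hxy ⟨s, hs, h⟩
      exact ⟨s, hs, (Conn.single he (hxy.trans Sym2.eq_swap)).trans h⟩
    have hcut : ∀ e ∈ cut I (F0 \ Q) S', e ∈ cut I (F0 \ Q) S ∧ inE I S e = inE I S' e := by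
      rintro e ⟨he, x, y, hxy, hx, hy⟩
      have hyS : y ∉ S := fun h => hy ⟨h, hst e he x y hxy hx.2⟩
      exact ⟨⟨he, x, y, hxy, hx.1, hyS⟩, by rw [inE_eq hxy hx.1 hyS, inE_eq hxy hx hy]⟩
    have hlink : Link I (Ins I (F0 \ B) S') t (cut I (F0 \ Q) S') (inE I S') p := by
      refine ⟨fun h hh => ?_, fun h hh h' hh' hne => hW.link.disj h (hcut h hh).1 h' (hcut h' hh').1 hne⟩
      have h1 := hW.link.flow h (hcut h hh).1
      rw [(hcut h hh).2] at h1
      refine h1.of_ed ?_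
      rintro _ ⟨d, hd, rfl⟩
      have h2 := (hpc h (hcut h hh).1).2.reach d hd
      have h3 : Conn I (F0 \ Q) t d.2.1 := h2.conn fun d' hd' => ⟨(h1.mem d' hd').1, h1.inc d' hd'⟩
      have h4 := h1.inc d hd
      have h5 := (mem_Ins h4).1 (h1.mem d hd)
      have h6 : ∃ s ∈ T, Conn I (F0 \ Q) d.2.1 s := ⟨t, ht, h3.symm⟩
      exact (mem_Ins h4).2 ⟨hsub h5.1, ⟨h5.2.1, h6⟩, h5.2.2, hst _ h5.1 _ _ h4 h6⟩
    let Dm : Set E := (Q \ B) ∩ cut I (F0 \ B) S'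
    have hDm : ∀ h ∈ cut I (F0 \ B) S', h ∉ cut I (F0 \ Q) S' → h ∈ Q \ B := by
      intro h hh hn
      refine ⟨?_, hh.1.2⟩
      by_contra hq
      exact hn ⟨⟨hh.1.1, hq⟩, hh.2⟩
    have hrich : ∀ k ∈ Dm, ∀ C : Set E, #C ≤ max #(Q \ B : Set E) ℵ₀ →
        ∃ s ∈ T, Conn I ((F0 \ B) \ C) (inE I S' k) s := by
      intro k hk C hC
      obtain ⟨h1, b, h2, h3⟩ := inE_mem hk.2
      set x := inE I S' k with hx
      by_cases hxT : x ∈ T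
      · exact ⟨x, hxT, Conn.refl x⟩
      have hxk : x ∈ I k := by rw [h2]; exact Sym2.mem_mk_left _ _
      obtain ⟨n, hn⟩ := en_ex hxk
      have h4 := hQ k hk.1 k hk.1 (n+1)
      simp only [Nat.add_eq_zero_iff, one_ne_zero, and_false, if_false, Nat.add_sub_cancel, hn] at h4
      rcases h4 with h4 | ⟨h4, h5⟩
      · obtain ⟨s, hs, h6⟩ := h1.2
        obtain ⟨p, hp, -⟩ := h6.flow
        obtain ⟨d, hd, -⟩ := hp.first (fun h => hxT (h ▸ hs))
        obtain ⟨b, hb, hnd⟩ := hQ3 x (ed p) ⟨s, hs, p, hp.mono hsub, rfl⟩ ⟨_, mem_ed hd⟩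
        exact absurd (Set.disjoint_left.2 fun y hy hyb => (hp.ed_sub hy).2 (h4 b hb hyb)) hnd
      · by_contra hcon
        have h6 : #(𝒬 x) ≤ max #C ℵ₀ := by
          refine disj_card (hQ2 x) Set.countable_empty ?_
          intro a ha
          obtain ⟨s, hs, p, hp, rfl⟩ := hQ1 x a ha
          by_contra hne
          refine hcon ⟨s, hs, (hp.of_ed (F' := (F0 \ B) \ C) fun y hy => ⟨hp.ed_sub hy, fun hyC => hne ⟨y, hy, Or.inl hyC⟩⟩).conn⟩
        exact absurd (h6.trans (max_le hC (le_max_right _ _))) (not_le.2 (max_lt h4 h5))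
    obtain ⟨q, hq, -⟩ := Absorb (S := S') (Zs := Q \ B) (Dm := Dm) (v := inE I S') ht hPar
      (fun x hx hxT => hW.term x hx.1 hxT) (le_max_right #(Q \ B : Set E) ℵ₀) (cut_mono hsub) (fun _ _ => rfl) hlink
      (le_max_left _ _) hDm ((Cardinal.mk_le_mk_of_subset Set.inter_subset_left).trans (le_max_left _ _))
      (fun k hk => (inE_mem hk.2).1) (Set.disjoint_left.2 fun h h1 h2 => h1.1.2 h2.1.1) hrich
    refine hWF t ht S' q ⟨htS', fun x hx hxT => hW.term x hx.1 hxT, hq.subset fun h hh => ?_⟩ v0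
      ⟨hv0, s0, hs0, hconn0⟩ hv0t s0 hs0 (hconn0.mono hsub)
    by_cases h1 : h ∈ cut I (F0 \ Q) S'
    · exact Or.inl h1
    · exact Or.inr ⟨hDm h hh h1, hh⟩

/-- last exit of a flow from `Y ∪ {t}` -/
theorem tail_push {I : E → Sym2 V} {J : Set E} {p : Finset (E × V × V)} {t a : V} (hp : Flow I J p t a) (Y : Set V)
    (htY : t ∈ Y) (haY : a ∉ Y) : ∃ e0 m s0 p', (e0, m, s0) ∈ p ∧ m ∈ Y ∧ s0 ∉ Y ∧ p' ⊆ p ∧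
      Flow I J p' s0 a ∧ Clean p' s0 a ∧ (∀ d ∈ p', d.2.1 ∉ Y ∧ d.2.2 ∉ Y) := by
  let D : Set (E × V × V) := {d | d ∈ p ∧ d.2.1 ∉ Y ∧ d.2.2 ∉ Y}
  let U : Set V := {v | v ∉ Y ∧ DReach D v a}
  have h1 : ∃ d ∈ p, d.2.1 ∉ U ∧ d.2.2 ∈ U := by
    by_contra hcon
    push Not at hcon
    have : a ∈ Uᶜ := hp.reach.closed Uᶜ (fun h => h.1 htY) fun d hd h => hcon d hd h
    exact this ⟨haY, Relation.ReflTransGen.refl⟩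
  obtain ⟨⟨e0, m, s0⟩, hd, hm, hs⟩ := h1
  obtain ⟨p', h2, h3, h4⟩ := reach_flow (I := I) (F := J) (fun d hd => ⟨hp.mem d hd.1, hp.inc d hd.1⟩) hs.2
  refine ⟨e0, m, s0, p', hd, ?_, hs.1, fun d hd => (h2 hd).1, h3, h4, fun d hd => (h2 hd).2⟩
  by_contra hmY
  exact hm ⟨hmY, Relation.ReflTransGen.head ⟨e0, hd, hmY, hs.1⟩ hs.2⟩

def Rich (I : E → Sym2 V) (F : Set E) (T : Set V) (w : V) : Prop :=
  ∀ C : Set E, C.Countable → ∃ s ∈ T, Conn I (F \ C) w s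

theorem Rich.of_mem {I : E → Sym2 V} {F : Set E} {T : Set V} {w : V} (h : w ∈ T) : Rich I F T w :=
  fun _ _ => ⟨w, h, Conn.refl w⟩

theorem ends_count {I : E → Sym2 V} {C : Set E} (hC : C.Countable) : {u | ∃ e ∈ C, u ∈ I e}.Countable := by
  have h : {u | ∃ e ∈ C, u ∈ I e} = ⋃ e ∈ C, {u | u ∈ I e} := by ext u; simp
  rw [h]
  refine hC.biUnion fun e _ => ?_
  obtain ⟨a, b, hab⟩ := Sym2_ex (I e)
  refine Set.Finite.countable (Set.Finite.subset (Set.toFinite {a, b}) ?_)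
  intro u hu
  have hu : u ∈ I e := hu
  rw [hab, Sym2.mem_iff] at hu
  exact hu

/-- a countably cut off region of poor vertices around a countable edge set -/
theorem poor_region (I : E → Sym2 V) (F : Set E) (T : Set V) {σ : Set E} (hσ : σ.Countable) :
    ∃ Y : Set V, (∀ y ∈ Y, ¬ Rich I F T y) ∧ (cut I F Y).Countable ∧
      (∀ e ∈ cut I F Y, ∀ u ∈ I e, u ∉ Y → Rich I F T u) ∧ ∀ e ∈ σ, ∀ u ∈ I e, u ∉ Y → Rich I F T u := by
  have hex : ∀ v, ∃ C : Set E, C.Countable ∧ (¬ Rich I F T v → ∀ s ∈ T, ¬ Conn I (F \ C) v s) := by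
    intro v
    by_cases h : Rich I F T v
    · exact ⟨∅, Set.countable_empty, fun h' => absurd h h'⟩
    · unfold Rich at h; push Not at h
      obtain ⟨C, h1, h2⟩ := h
      exact ⟨C, h1, fun _ => h2⟩
  choose C hC1 hC2 using hex
  obtain ⟨K, hK1, hK2, hK3⟩ := clos (fun s : Finset V => ⋃ v ∈ s, {u | ∃ e ∈ C v, u ∈ I e})
    (fun s => Set.Countable.biUnion (Finset.countable_toSet _) fun v _ => ends_count (hC1 v)) (ends_count (I := I) hσ)
  have hKC : ∀ v ∈ K, ∀ e ∈ C v, ∀ u ∈ I e, u ∈ K := fun v hv e he u hu =>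
    hK3 {v} (by simpa using hv) (by simpa using ⟨e, he, hu⟩)
  let Y : Set V := {y | ∃ v ∈ K, ¬ Rich I F T v ∧ Conn I (F \ C v) v y}
  have hself : ∀ u ∈ K, u ∉ Y → Rich I F T u := by
    intro u hu huY
    by_contra hr
    exact huY ⟨u, hu, hr, Conn.refl u⟩
  have hcut : ∀ e ∈ cut I F Y, ∃ v ∈ K, e ∈ C v := by
    rintro e ⟨he, a, b, hab, ⟨v, hv, hvr, hva⟩, hb⟩
    refine ⟨v, hv, ?_⟩
    by_contra heC
    exact hb ⟨v, hv, hvr, hva.trans (Conn.single ⟨he, heC⟩ hab)⟩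
  refine ⟨Y, ?_, ?_, ?_, ?_⟩
  · rintro y ⟨v, hv, hvr, hvy⟩ hy
    obtain ⟨s, hs, h⟩ := hy (C v) (hC1 v)
    exact hC2 v hvr s hs (hvy.trans h)
  · refine (hK2.biUnion fun v _ => hC1 v).mono fun e he => ?_
    obtain ⟨v, hv, h⟩ := hcut e he
    exact Set.mem_iUnion₂.2 ⟨v, hv, h⟩
  · intro e he u hu huY
    obtain ⟨v, hv, h⟩ := hcut e he
    exact hself u (hKC v hv e h u hu) huY
  · intro e he u hu huY
    exact hself u (hK1 ⟨e, he, hu⟩) huY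

theorem FD {I : E → Sym2 V} {F : Set E} {T : Set V} (hPar : Par I F T) (hWF : WF I F T) {σ : Set E}
    (hσ : σ.Countable) {t : V} (ht : t ∈ T) {S : Set V} {p : E → Finset (E × V × V)}
    (hW : Wave I (F \ σ) T t S p) {a0 : V} (ha0 : a0 ∈ S) (hat : a0 ≠ t) : ¬ Rich I F T a0 := by
  intro hr0
  obtain ⟨Y, hY1, hY2, hY3, hY4⟩ := poor_region I F T hσ
  have htY : t ∉ Y := fun h => hY1 t h (Rich.of_mem ht)
  let S1 : Set V := S \ Y
  have htS1 : t ∈ S1 := ⟨hW.mem, htY⟩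
  have hS1 : S1 ⊆ S := Set.sdiff_subset
  let N : Set E := {h | h ∈ cut I (F \ σ) S ∧ (ed (p h) ∩ cut I F Y).Nonempty}
  have hN : N.Countable := by
    have hch : ∀ h : N, ∃ e, e ∈ ed (p h.1) ∧ e ∈ cut I F Y := fun h => h.2.2
    choose g hg1 hg2 using hch
    have := hY2.to_subtype
    have hinj : Function.Injective (fun h : N => (⟨g h, hg2 h⟩ : cut I F Y)) := by
      intro h h' hh
      have hh : g h = g h' := congrArg Subtype.val hh
      exact Subtype.ext (hW.link.uniq h.2.1 h'.2.1 (hg1 h) (hh ▸ hg1 h'))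
    exact hinj.countable
  have key : ∀ h ∈ cut I F S1,
      (h ∈ cut I (F \ σ) S ∧ ∃ pb, pb ⊆ p h ∧ Flow I (Ins I F S1) pb t (inE I S1 h)) ∨
      (∃ w tl, w ∈ S1 ∧ Rich I F T w ∧ Flow I (Ins I F S1) tl w (inE I S1 h) ∧
        ((tl = ∅ ∧ h ∈ σ ∪ cut I F Y) ∨ (tl ⊆ p h ∧ h ∈ N))) := by
    rintro h ⟨hF, a, b, hab, ha, hb⟩
    rw [inE_eq hab ha hb]
    have hah : a ∈ I h := by rw [hab]; exact Sym2.mem_mk_left _ _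
    by_cases hhσ : h ∈ σ
    · exact Or.inr ⟨a, ∅, ha, hY4 h hhσ a hah ha.2, Flow.nil a, Or.inl ⟨rfl, Or.inl hhσ⟩⟩
    by_cases hbY : b ∈ Y
    · have : h ∈ cut I F Y := ⟨hF, b, a, hab.trans Sym2.eq_swap, hbY, ha.2⟩
      exact Or.inr ⟨a, ∅, ha, hY3 h this a hah ha.2, Flow.nil a, Or.inl ⟨rfl, Or.inr this⟩⟩
    have hbS : b ∉ S := fun h => hb ⟨h, hbY⟩
    have hcS : h ∈ cut I (F \ σ) S := ⟨⟨hF, hhσ⟩, a, b, hab, ha.1, hbS⟩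
    have hfl := hW.link.flow h hcS
    rw [inE_eq hab ha.1 hbS] at hfl
    by_cases hat' : a = t
    · subst hat'
      exact Or.inl ⟨hcS, ∅, Finset.empty_subset _, Flow.nil a⟩
    obtain ⟨e0, m, s0, p', h1, h2, h3, h4, h5, h5c, h6⟩ := tail_push hfl (insert t Y) (Set.mem_insert _ _)
      (fun h => h.elim hat' ha.2)
    rw [Set.mem_insert_iff, not_or] at h3
    have h0inc := hfl.inc _ h1
    have h0mem := (mem_Ins h0inc).1 (hfl.mem _ h1)
    have hs0 : s0 ∈ S1 := ⟨h0mem.2.2, h3.2⟩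
    have h7 : Flow I (Ins I F S1) p' s0 a := by
      refine h5.of_ed ?_
      rintro _ ⟨d, hd, rfl⟩
      have h8 := h5.inc d hd
      have h9 := (mem_Ins h8).1 (h5.mem d hd)
      have h10 := h6 d hd
      simp only [Set.mem_insert_iff, not_or] at h10
      exact (mem_Ins h8).2 ⟨h9.1.1, ⟨h9.2.1, h10.1.2⟩, h9.2.2, h10.2.2⟩
    rcases h2 with rfl | hmY
    · left
      refine ⟨hcS, {(e0, m, s0)} ∪ p', ?_, ?_⟩
      · intro d hd
        rw [Finset.mem_union, Finset.mem_singleton] at hd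
        rcases hd with rfl | hd
        · exact h1
        · exact h4 hd
      · refine Flow.append (Flow.single ((mem_Ins h0inc).2 ⟨h0mem.1.1, htS1, hs0⟩) h0inc) h7 ?_
        rw [ed_singleton, Set.disjoint_singleton_left]
        rintro ⟨d, hd, hde⟩
        have := hfl.inj d (h4 hd) _ h1 hde
        rw [this] at hd
        exact (h6 _ hd).1 (Set.mem_insert _ _)
    · right
      have hcY : e0 ∈ cut I F Y := ⟨h0mem.1.1, m, s0, h0inc, hmY, h3.2⟩
      exact ⟨s0, p', hs0, hY3 e0 hcY s0 (by rw [h0inc]; exact Sym2.mem_mk_right _ _) h3.2, h7,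
        Or.inr ⟨h4, hcS, e0, mem_ed h1, hcY⟩⟩
  let B0 : Set E := {h | h ∈ cut I F S1 ∧ h ∈ cut I (F \ σ) S ∧ ∃ pb, pb ⊆ p h ∧ Flow I (Ins I F S1) pb t (inE I S1 h)}
  have hB0 : ∀ h ∈ B0, ∃ pb, pb ⊆ p h ∧ Flow I (Ins I F S1) pb t (inE I S1 h) := fun h hh => hh.2.2
  let Dm : Set E := cut I F S1 \ B0
  have hDm : ∀ h ∈ Dm, ∃ w tl, w ∈ S1 ∧ Rich I F T w ∧ Flow I (Ins I F S1) tl w (inE I S1 h) ∧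
        ((tl = ∅ ∧ h ∈ σ ∪ cut I F Y) ∨ (tl ⊆ p h ∧ h ∈ N)) := by
    intro h hh
    rcases key h hh.1 with h1 | h1
    · exact absurd ⟨hh.1, h1⟩ hh.2
    · exact h1
  choose! pb hpb1 hpb2 using hB0
  have : Nonempty V := ⟨t⟩
  choose! w tl hw1 hw2 hw3 hw4 using hDm
  let v : E → V := fun h => if h ∈ Dm then w h else inE I S1 h
  let Zs : Set E := (σ ∪ cut I F Y) ∪ (N ∪ ⋃ h ∈ N, ed (p h))
  have hZs : Zs.Countable := (hσ.union hY2).union (hN.union (hN.biUnion fun h _ => (ed_finite _).countable))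
  have hvB : ∀ h ∈ B0, v h = inE I S1 h := fun h hh => if_neg fun h' => h'.2 hh
  have hvD : ∀ h ∈ Dm, v h = w h := fun h hh => if_pos hh
  have hDmZ : Dm ⊆ Zs := by
    intro h hh
    rcases hw4 h hh with ⟨-, h1⟩ | ⟨-, h1⟩
    · exact Or.inl h1
    · exact Or.inr (Or.inl h1)
  have hlink : Link I (Ins I F S1) t B0 v pb := by
    refine ⟨fun h hh => ?_, fun h hh h' hh' hne => ?_⟩
    · rw [hvB h hh]; exact hpb2 h hh
    · exact (hW.link.disj h hh.2.1 h' hh'.2.1 hne).mono (ed_mono (hpb1 h hh)) (ed_mono (hpb1 h' hh'))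
  have hterm : ∀ x ∈ S1, x ∈ T → x = t := fun x hx hxT => hW.term x hx.1 hxT
  obtain ⟨q, hq1, hq2⟩ := Absorb (S := S1) (Zs := Zs) (Dm := Dm) (v := v) ht hPar hterm (le_refl ℵ₀)
    (fun h hh => hh.1) hvB hlink (mk_cnt le_rfl hZs) (fun h hh hB => hDmZ ⟨hh, hB⟩)
    (mk_cnt le_rfl (hZs.mono hDmZ)) (fun k hk => by rw [hvD k hk]; exact hw1 k hk)
    (Set.disjoint_left.2 fun h h1 h2 => h2.2 h1)
    (fun k hk C hC => by rw [hvD k hk]; exact hw2 k hk C (Cardinal.le_aleph0_iff_set_countable.1 hC))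
  let tl' : E → Finset (E × V × V) := fun h => if h ∈ Dm then tl h else ∅
  have htl1 : ∀ h ∈ cut I F S1, Flow I (Ins I F S1) (tl' h) (v h) (inE I S1 h) := by
    intro h hh
    by_cases hD : h ∈ Dm
    · simp only [tl', v, if_pos hD]; exact hw3 h hD
    · simp only [tl', v, if_neg hD]; exact Flow.nil _
  have htl2 : ∀ h e, e ∈ ed (tl' h) → h ∈ Dm ∧ h ∈ N ∧ e ∈ ed (p h) := by
    intro h e he
    by_cases hD : h ∈ Dm
    · simp only [tl', if_pos hD] at he
      rcases hw4 h hD with ⟨h1, -⟩ | ⟨h1, h2⟩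
      · rw [h1, ed_empty] at he; exact absurd he (Set.notMem_empty _)
      · exact ⟨hD, h2, ed_mono h1 he⟩
    · simp only [tl', if_neg hD, ed_empty] at he; exact absurd he (Set.notMem_empty _)
  have hmemU : ∀ h ∈ cut I F S1, h ∈ B0 ∪ Dm := fun h hh => by
    by_cases hB : h ∈ B0
    · exact Or.inl hB
    · exact Or.inr ⟨hh, hB⟩
  have hqt : ∀ h ∈ cut I F S1, ∀ h' ∈ cut I F S1, Disjoint (ed (q h)) (ed (tl' h')) := by
    intro h hh h' hh'
    rw [Set.disjoint_left]
    intro e he he'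
    obtain ⟨h1, h2, h3⟩ := htl2 h' e he'
    rcases hq2 h (hmemU h hh) e he with h4 | ⟨b, hb, h4⟩
    · exact h4 (Or.inr (Or.inr (Set.mem_iUnion₂.2 ⟨h', h2, h3⟩)))
    · have : b = h' := hW.link.uniq hb.2.1 h2.1 (ed_mono (hpb1 b hb) h4) h3
      subst this
      exact h1.2 hb
  obtain ⟨s, hs, hcs⟩ := hr0 ∅ Set.countable_empty
  refine hWF t ht S1 (fun h => q h ∪ tl' h) ⟨htS1, hterm, fun h hh => ?_, fun h hh h' hh' hne => ?_⟩ a0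
    ⟨ha0, fun h => hY1 a0 h hr0⟩ hat s hs (hcs.mono Set.sdiff_subset)
  · exact Flow.append (hq1.flow h (hmemU h hh)) (htl1 h hh) (hqt h hh h hh)
  · rw [ed_union, ed_union, Set.disjoint_union_left, Set.disjoint_union_right, Set.disjoint_union_right]
    refine ⟨⟨hq1.disj h (hmemU h hh) h' (hmemU h' hh') hne, hqt h hh h' hh'⟩, (hqt h' hh' h hh).symm, ?_⟩
    rw [Set.disjoint_left]
    intro e he he'
    obtain ⟨-, h2, h3⟩ := htl2 h e he
    obtain ⟨-, h2', h3'⟩ := htl2 h' e he'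
    exact hne (hW.link.uniq h2.1 h2'.1 h3 h3')

end LC

set_option linter.unusedVariables false

namespace LC
open Classical Cardinal
universe w
variable {V : Type u} {E : Type v} {ι : Type w}

theorem Link.cnt {I : E → Sym2 V} {J : Set E} {t : V} {B : Set ι} {v : ι → V}
    {p : ι → Finset (E × V × V)} (h : Link I J t B v p) {K : Set E} (hK : K.Countable) :
    {i | i ∈ B ∧ (ed (p i) ∩ K).Nonempty}.Countable := by
  have hch : ∀ i : {i | i ∈ B ∧ (ed (p i) ∩ K).Nonempty}, ∃ e, e ∈ ed (p i.1) ∧ e ∈ K := fun i => i.2.2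
  choose g hg1 hg2 using hch
  have : Countable K := hK
  refine Set.countable_coe_iff.1 (Function.Injective.countable (f := fun i => (⟨g i, hg2 i⟩ : K)) ?_)
  intro i j hij
  have hg : g i = g j := congrArg Subtype.val hij
  exact Subtype.ext (h.uniq i.2.1 j.2.1 (hg1 i) (hg ▸ hg1 j))

theorem Resp {I : E → Sym2 V} {F σ : Set E} {T : Set V} {t : V} {S : Set V}
    {p : E → Finset (E × V × V)} (ht : t ∈ T) (hσ : σ.Countable) (hW : Wave I (F \ σ) T t S p) {v v' : V}
    (hv : ¬ Rich I F T v) (hvv : ∀ C : Set E, C.Countable → Conn I (F \ C) v v') : v ∈ S ↔ v' ∈ S := by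
  unfold Rich at hv; push Not at hv
  obtain ⟨C0, hC0, hC1⟩ := hv
  let C : Set E := (σ ∪ C0) ∪ {h | h ∈ cut I (F \ σ) S ∧ (ed (p h) ∩ C0).Nonempty}
  have hC : C.Countable := (hσ.union hC0).union (hW.link.cnt hC0)
  have hconn := hvv C hC
  have key : ∀ a b, Conn I (F \ C) v a → ∀ e ∈ F \ C, I e = s(a, b) → a ∈ S → b ∉ S → False := by
    intro a b hva e he hab ha hb
    have hcut : e ∈ cut I (F \ σ) S := ⟨⟨he.1, fun h => he.2 (Or.inl (Or.inl h))⟩, a, b, hab, ha, hb⟩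
    have hfl := hW.link.flow e hcut
    rw [inE_eq hab ha hb] at hfl
    refine hC1 t ht ?_
    have h1 : Conn I (F \ C0) v a := by
      refine Conn.mono ?_ hva
      intro x hx
      exact ⟨hx.1, fun h => hx.2 (Or.inl (Or.inr h))⟩
    have h2 : Flow I (F \ C0) (p e) t a := hfl.of_ed (F' := F \ C0) fun x hx =>
      ⟨(hfl.ed_sub hx).1.1, fun h => he.2 (Or.inr ⟨hcut, x, hx, h⟩)⟩
    exact h1.trans h2.conn.symm
  constructor
  · intro h
    refine (hconn.closed {x | x ∈ S ∧ Conn I (F \ C) v x} ⟨h, Conn.refl v⟩ ?_).1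
    rintro e he x y hxy ⟨hx, hvx⟩
    refine ⟨?_, hvx.trans (Conn.single he hxy)⟩
    by_contra hy
    exact key x y hvx e he hxy hx hy
  · intro h
    by_contra hn
    refine (hconn.closed {x | x ∉ S ∧ Conn I (F \ C) v x} ⟨hn, Conn.refl v⟩ ?_).1 h
    rintro e he x y hxy ⟨hx, hvx⟩
    refine ⟨fun hy => ?_, hvx.trans (Conn.single he hxy)⟩
    exact key y x (hvx.trans (Conn.single he hxy)) e he (by rw [hxy, Sym2.eq_swap]) hy hx

/-- a countable region `R` with boundary vertex set `K` that respects connectivity -/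
structure Reg (I : E → Sym2 V) (F : Set E) (T : Set V) (R : Set E) (K : Set V) : Prop where
  cnt : R.Countable
  sub : R ⊆ F
  ends : ∀ e ∈ R, ∀ u ∈ I e, u ∈ K
  sep : ∀ u ∈ K, u ∉ T → ∀ s ∈ T, ¬ Conn I (F \ R) u s
  insep : ∀ u ∈ K, ∀ u' ∈ K, Conn I (F \ R) u u' → ∀ C : Set E, C.Countable → Conn I (F \ C) u u'

theorem Reg.ex (I : E → Sym2 V) (F : Set E) {T : Set V} (hT : ∀ v, v ∉ T → ¬ Rich I F T v) (y : V) :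
    ∃ R K, Reg I F T R K ∧ y ∈ K := by
  have hex : ∀ v, ∃ C : Set E, C.Countable ∧ (v ∉ T → ∀ s ∈ T, ¬ Conn I (F \ C) v s) := by
    intro v
    by_cases h : v ∈ T
    · exact ⟨∅, Set.countable_empty, fun h' => absurd h h'⟩
    · have h1 := hT v h
      unfold Rich at h1; push Not at h1
      obtain ⟨C, h1, h2⟩ := h1
      exact ⟨C, h1, fun _ => h2⟩
  choose C hC1 hC2 using hex
  have hex2 : ∀ u u', ∃ C : Set E, C.Countable ∧ ((∃ C : Set E, C.Countable ∧ ¬ Conn I (F \ C) u u') → ¬ Conn I (F \ C) u u') := by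
    intro u u'
    by_cases h : ∃ C : Set E, C.Countable ∧ ¬ Conn I (F \ C) u u'
    · obtain ⟨C, h1, h2⟩ := h
      exact ⟨C, h1, fun _ => h2⟩
    · exact ⟨∅, Set.countable_empty, fun h' => absurd h' h⟩
  choose D hD1 hD2 using hex2
  obtain ⟨K, hK1, hK2, hK3⟩ := clos (fun s : Finset V => (⋃ v ∈ s, {u | ∃ e ∈ C v, u ∈ I e}) ∪
      ⋃ v ∈ s, ⋃ v' ∈ s, {u | ∃ e ∈ D v v', u ∈ I e})
    (fun s => (Set.Countable.biUnion (Finset.countable_toSet _) fun v _ => ends_count (hC1 v)).union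
      (Set.Countable.biUnion (Finset.countable_toSet _) fun v _ =>
        Set.Countable.biUnion (Finset.countable_toSet _) fun v' _ => ends_count (hD1 v v')))
    (Set.countable_singleton y)
  refine ⟨F ∩ ((⋃ v ∈ K, C v) ∪ ⋃ v ∈ K, ⋃ v' ∈ K, D v v'), K, ⟨?_, Set.inter_subset_left, ?_, ?_, ?_⟩, hK1 rfl⟩
  · exact ((hK2.biUnion fun v _ => hC1 v).union (hK2.biUnion fun v _ => hK2.biUnion fun v' _ => hD1 v v')).mono
      Set.inter_subset_right
  · rintro e ⟨-, he | he⟩ u hu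
    · obtain ⟨v, hv, he⟩ := Set.mem_iUnion₂.1 he
      refine hK3 {v} (by simpa using hv) (Or.inl ?_)
      exact Set.mem_iUnion₂.2 ⟨v, by simp, e, he, hu⟩
    · obtain ⟨v, hv, he⟩ := Set.mem_iUnion₂.1 he
      obtain ⟨v', hv', he⟩ := Set.mem_iUnion₂.1 he
      refine hK3 {v, v'} ?_ (Or.inr ?_)
      · intro x hx
        simp only [Finset.coe_insert, Finset.coe_singleton, Set.mem_insert_iff, Set.mem_singleton_iff] at hx
        rcases hx with rfl | rfl <;> assumption
      · exact Set.mem_iUnion₂.2 ⟨v, by simp, Set.mem_iUnion₂.2 ⟨v', by simp, e, he, hu⟩⟩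
  · intro u hu huT s hs hcon
    refine hC2 u huT s hs (Conn.mono ?_ hcon)
    intro x hx
    exact ⟨hx.1, fun h => hx.2 ⟨hx.1, Or.inl (Set.mem_iUnion₂.2 ⟨u, hu, h⟩)⟩⟩
  · intro u hu u' hu' hcon C' hC'
    by_contra hn
    refine hD2 u u' ⟨C', hC', hn⟩ (Conn.mono ?_ hcon)
    intro x hx
    exact ⟨hx.1, fun h => hx.2 ⟨hx.1, Or.inr (Set.mem_iUnion₂.2 ⟨u, hu, Set.mem_iUnion₂.2 ⟨u', hu', h⟩⟩)⟩⟩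

theorem saturate {I : E → Sym2 V} {F : Set E} {T : Set V} {t : V} (ht : t ∈ T)
    (hT : ∀ v, v ∉ T → ¬ Rich I F T v) {R : Set E} {K : Set V} (hR : Reg I F T R K) {σ : Set E} (hσ : σ.Countable)
    (hσR : ∀ e ∈ σ, e ∈ F → e ∉ R → ∀ x ∈ I e, ∃ u ∈ K, u ∉ T ∧ Conn I (F \ R) x u)
    (hU : Unh I (F \ (σ ∩ R)) T t) : Unh I (F \ σ) T t := by
  intro S p0 hW0 b hb b' hbb hbt
  obtain ⟨p, hW, hpc⟩ := hW0.clean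
  let M : V → Prop := fun v => ∃ u ∈ K, u ∉ T ∧ Conn I (F \ R) v u
  let S' : Set V := {v | (M v ∧ ∃ u ∈ K, u ∉ T ∧ u ∈ S ∧ Conn I (F \ R) v u) ∨ (¬ M v ∧ v ∈ S)}
  have hMT : ∀ v ∈ T, ¬ M v := by
    rintro v hv ⟨u, hu, huT, h⟩
    exact hR.sep u hu huT v hv h.symm
  have hK : ∀ v ∈ K, (v ∈ S' ↔ v ∈ S) := by
    intro v hv
    by_cases hvT : v ∈ T
    · have := hMT v hvT
      constructor
      · rintro (h | h)
        · exact absurd h.1 this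
        · exact h.2
      · exact fun h => Or.inr ⟨this, h⟩
    · have hM : M v := ⟨v, hv, hvT, Conn.refl v⟩
      constructor
      · rintro (⟨-, u, hu, huT, huS, h⟩ | h)
        · exact (Resp ht hσ hW (hT v hvT) (hR.insep v hv u hu h)).2 huS
        · exact absurd hM h.1
      · exact fun h => Or.inl ⟨hM, v, hv, hvT, h, Conn.refl v⟩
  have hE : ∀ e ∈ F \ R, ∀ a b, I e = s(a, b) → M a → M b ∧ (a ∈ S' → b ∈ S') := by
    rintro e he a b hab ⟨u, hu, huT, h⟩
    have hba : Conn I (F \ R) b a := (Conn.single he hab).symm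
    have hMb : M b := ⟨u, hu, huT, hba.trans h⟩
    refine ⟨hMb, ?_⟩
    rintro (⟨-, u, hu, huT, huS, h⟩ | h')
    · exact Or.inl ⟨hMb, u, hu, huT, huS, hba.trans h⟩
    · exact absurd ⟨u, hu, huT, h⟩ h'.1
  have hcut : ∀ e ∈ cut I (F \ (σ ∩ R)) S', e ∈ cut I (F \ σ) S ∧ inE I S e = inE I S' e := by
    rintro e ⟨heF, a, b, hab, ha, hb⟩
    by_cases heR : e ∈ R
    · have ha' := (hK a (hR.ends e heR a (by simp [hab]))).1 ha
      have hb' : b ∉ S := fun h => hb ((hK b (hR.ends e heR b (by simp [hab]))).2 h)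
      exact ⟨⟨⟨heF.1, fun h => heF.2 ⟨h, heR⟩⟩, a, b, hab, ha', hb'⟩, by rw [inE_eq hab ha hb, inE_eq hab ha' hb']⟩
    · have hMa : ¬ M a := fun h => hb ((hE e ⟨heF.1, heR⟩ a b hab h).2 ha)
      have hMb : ¬ M b := fun h => hMa (hE e ⟨heF.1, heR⟩ b a (by rw [hab, Sym2.eq_swap]) h).1
      have ha' : a ∈ S := by
        rcases ha with h | h
        · exact absurd h.1 hMa
        · exact h.2
      have hb' : b ∉ S := fun h => hb (Or.inr ⟨hMb, h⟩)
      refine ⟨⟨⟨heF.1, fun h => hMa ?_⟩, a, b, hab, ha', hb'⟩, by rw [inE_eq hab ha hb, inE_eq hab ha' hb']⟩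
      exact hσR e h heF.1 heR a (by simp [hab])
  have htS' : t ∈ S' := Or.inr ⟨hMT t ht, hW.mem⟩
  have hstep : ∀ e ∈ cut I (F \ σ) S, ∀ d ∈ p e, d.2.1 ∈ S' → d.2.2 ∈ S' := by
    rintro e he ⟨f, x, y⟩ hd hx
    have h1 := (hW.link.flow e he).mem _ hd
    have h2 : I f = s(x, y) := (hW.link.flow e he).inc _ hd
    have h3 := (mem_Ins h2).1 h1
    by_cases hfR : f ∈ R
    · exact (hK y (hR.ends f hfR y (by simp [h2]))).2 h3.2.2
    · by_cases hMx : M x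
      · exact (hE f ⟨h3.1.1, hfR⟩ x y h2 hMx).2 hx
      · exact Or.inr ⟨fun h => hMx (hE f ⟨h3.1.1, hfR⟩ y x (by rw [h2, Sym2.eq_swap]) h).1, h3.2.2⟩
  have hW' : Wave I (F \ (σ ∩ R)) T t S' p := by
    refine ⟨htS', ?_, fun e he => ?_, fun e he e' he' => hW.link.disj e (hcut e he).1 e' (hcut e' he').1⟩
    · rintro x (h | h) hxT
      · exact absurd h.1 (hMT x hxT)
      · exact hW.term x h.2 hxT
    · obtain ⟨h1, h2⟩ := hcut e he
      have hfl := hW.link.flow e h1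
      rw [h2] at hfl
      refine hfl.of_ed ?_
      rintro f ⟨⟨f, x, y⟩, hd, rfl⟩
      have hx : x ∈ S' := DReach.closed ((hpc e h1).2.reach _ hd) S' htS' (hstep e h1)
      have hy : y ∈ S' := hstep e h1 _ hd hx
      have h5 := (mem_Ins (hfl.inc _ hd)).1 (hfl.mem _ hd)
      exact (mem_Ins (hfl.inc _ hd)).2 ⟨⟨h5.1.1, fun h => h5.1.2 h.1⟩, hx, hy⟩
  rcases hU S' p hW' b ⟨hb.1, fun h => hb.2 h.1⟩ b' hbb hbt with h | ⟨h, hh, hbp⟩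
  · exact Or.inl (hcut b h).1
  · exact Or.inr ⟨h, (hcut h hh).1, ed_mono (hpc h (hcut h hh).1).1 hbp⟩

theorem Wave.back {I : E → Sym2 V} {F : Set E} {T : Set V} {t : V} {S : Set V} {p : E → Finset (E × V × V)}
    {F' : Set E} (hF : F' ⊆ F) (h : Wave I F' T t S p) (hc : cut I F S ⊆ F') : Wave I F T t S p :=
  ⟨h.mem, h.term, (h.link.mono (Ins_mono hF subset_rfl)).subset fun e he => ⟨hc he, he.2⟩⟩

/-- deleting an edge that avoids all waves -/
theorem Unh.del {I : E → Sym2 V} {F : Set E} {T : Set V} {t : V} (hU : Unh I F T t) {f : E} {a c : V}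
    (hf : I f = s(a, c)) (ha : ∀ S p, Wave I F T t S p → a ∉ S) (hc : ∀ S p, Wave I F T t S p → c ∉ S) :
    Unh I (F \ {f}) T t := by
  intro S p hW b hb b' hbb hbt
  by_cases haS : a ∈ S <;> by_cases hcS : c ∈ S
  rotate_left 1
  · rcases Rm hU hW hf haS hcS with ⟨p', h⟩ | h
    · exact absurd haS (ha S p' h)
    · exact h b hb b' hbb hbt
  · rcases Rm hU hW (by rw [hf, Sym2.eq_swap]) hcS haS with ⟨p', h⟩ | h
    · exact absurd hcS (hc S p' h)
    · exact h b hb b' hbb hbt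
  all_goals
    have hcut : cut I F S ⊆ F \ {f} := by
      rintro e ⟨heF, x, y, hxy, hx, hy⟩
      refine ⟨heF, ?_⟩
      rintro rfl
      rw [hf, Sym2.eq_iff] at hxy
      rcases hxy with ⟨rfl, rfl⟩ | ⟨rfl, rfl⟩ <;> contradiction
    have hW' := hW.back Set.sdiff_subset hcut
    rcases hU S p hW' b hb.1 b' hbb hbt with h | ⟨h, hh, hbp⟩
    · exact Or.inl ⟨hb, h.2⟩
    · exact Or.inr ⟨h, ⟨hcut hh, hh.2⟩, hbp⟩

theorem Wave.shrink {I : E → Sym2 V} {F A B : Set E} {T : Set V} {t : V} {S : Set V} {p : E → Finset (E × V × V)}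
    (h : Wave I (F \ A) T t S p) (hAB : A ⊆ B) (hB : ∀ f ∈ B, f ∉ A → ∀ u ∈ I f, u ∉ S) : Wave I (F \ B) T t S p := by
  have hsub : F \ B ⊆ F \ A := fun e he => ⟨he.1, fun h => he.2 (hAB h)⟩
  refine h.change (cut_mono hsub) ?_
  intro e he f hf
  have h1 := (h.link.flow e (cut_mono hsub he)).ed_sub hf
  refine ⟨h1.1.1, fun hfB => ?_⟩
  obtain ⟨a, b, hab⟩ := Sym2_ex (I f)
  exact hB f hfB h1.1.2 a (by simp [hab]) ((mem_Ins hab).1 h1).2.1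

theorem inf_enum {α : Type*} {D : Set α} (hD : D.Countable) :
    ∃ g : ℕ → Option α, ∀ d ∈ D, ∀ N, ∃ n ≥ N, g n = some d := by
  obtain ⟨f, hf⟩ := Set.countable_iff_exists_subset_range.1 (hD.image some)
  refine ⟨fun n => f (Nat.unpair n).1, fun d hd N => ?_⟩
  obtain ⟨k, hk⟩ := hf ⟨d, hd, rfl⟩
  exact ⟨Nat.pair k N, Nat.right_le_pair k N, by simp [hk]⟩

theorem darts_count {I : E → Sym2 V} {R : Set E} (hR : R.Countable) :
    {d : E × V × V | d.1 ∈ R ∧ I d.1 = s(d.2.1, d.2.2)}.Countable := by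
  refine (hR.prod ((ends_count (I := I) hR).prod (ends_count (I := I) hR))).mono ?_
  rintro ⟨e, a, b⟩ ⟨h1, h2⟩
  exact ⟨h1, ⟨e, h1, by simp only at h2; simp [h2]⟩, ⟨e, h1, by simp only at h2; simp [h2]⟩⟩

theorem rho {I : E → Sym2 V} {F : Set E} {T : Set V} {t : V} (ht : t ∈ T)
    (hT : ∀ v, v ∉ T → ¬ Rich I F T v) (hU : Unh I F T t) {y : V} (hyT : y ∉ T)
    (hy : ∀ S p, Wave I F T t S p → y ∉ S) :
    ∃ ρ z, Flow I F ρ y z ∧ z ∈ T ∧ z ≠ t ∧ (∀ d ∈ ρ, d.2.1 ∉ T ∧ (d.2.2 ∈ T → d.2.2 = z)) ∧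
      Unh I (F \ ed ρ) T t := by
  by_contra hgoal
  obtain ⟨R, K, hR, hyK⟩ := Reg.ex I F hT y
  obtain ⟨g, hg⟩ := inf_enum (darts_count (I := I) hR.cnt)
  let Xw : Set E → Set V := fun Φ => {v | ∃ S p, Wave I (F \ Φ) T t S p ∧ v ∈ S}
  let Ok : Set E → E × V × V → Prop := fun Φ d => d.1 ∈ R ∧ I d.1 = s(d.2.1, d.2.2) ∧
    Conn I (Φ ∪ F \ R) y d.2.1 ∧ ¬ Conn I (Φ ∪ F \ R) y d.2.2 ∧ d.2.1 ∉ Xw Φ ∧ d.2.2 ∉ Xw Φ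
  obtain ⟨Φ, hΦ0, hΦ1⟩ : ∃ Φ : ℕ → Set E, Φ 0 = ∅ ∧
      ∀ n, Φ (n + 1) = Φ n ∪ {f | ∃ d, g n = some d ∧ Ok (Φ n) d ∧ f = d.1} :=
    ⟨fun n => Nat.rec ∅ (fun n P => P ∪ {f | ∃ d, g n = some d ∧ Ok P d ∧ f = d.1}) n, rfl, fun n => rfl⟩
  have hmono : Monotone Φ := monotone_nat_of_le_succ fun n => by rw [hΦ1]; exact Set.subset_union_left
  let M : Set V := {v | ∃ u ∈ K, u ∉ T ∧ Conn I (F \ R) v u}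
  have hMT : ∀ v ∈ M, v ∉ T := by
    rintro v ⟨u, hu, huT, h⟩ hvT
    exact hR.sep u hu huT v hvT h.symm
  have hyM : y ∈ M := ⟨y, hyK, hyT, Conn.refl y⟩
  have hMe : ∀ e ∈ F \ R, ∀ a b, I e = s(a, b) → a ∈ M → b ∈ M := by
    rintro e he a b hab ⟨u, hu, huT, h⟩
    exact ⟨u, hu, huT, (Conn.single he hab).symm.trans h⟩
  have hreach : ∀ P : Set E, P ⊆ R → (∀ f ∈ P, ∀ u ∈ I f, u ∉ T) → ∀ e ∈ P ∪ F \ R, ∀ a b, I e = s(a, b) →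
      a ∈ M → b ∈ M := by
    rintro P hPR hPT e (he | he) a b hab ha
    · have hb : b ∈ I e := by simp [hab]
      exact ⟨b, hR.ends e (hPR he) b hb, hPT e he b hb, Conn.refl b⟩
    · exact hMe e he a b hab ha
  have hInv : ∀ n, (Φ n).Finite ∧ Φ n ⊆ R ∧ Unh I (F \ Φ n) T t ∧ ∀ f ∈ Φ n, ∀ u ∈ I f, u ∉ T := by
    intro n
    induction n with
    | zero => rw [hΦ0]; simp [hU]
    | succ n ih =>
      obtain ⟨h1, h2, h3, h4⟩ := ih
      by_cases hex : ∃ d, g n = some d ∧ Ok (Φ n) d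
      swap
      · have : Φ (n + 1) = Φ n := by
          rw [hΦ1, Set.union_eq_left]
          rintro f ⟨d, hd, hok, -⟩
          exact absurd ⟨d, hd, hok⟩ hex
        rw [this]; exact ⟨h1, h2, h3, h4⟩
      obtain ⟨⟨f, r, x⟩, hd, hok⟩ := hex
      have hsucc : Φ (n + 1) = insert f (Φ n) := by
        rw [hΦ1, Set.union_comm]
        congr 1
        ext f'
        constructor
        · rintro ⟨d, hd', -, rfl⟩
          rw [hd, Option.some.injEq] at hd'
          subst hd'; rfl
        · rintro rfl
          exact ⟨_, hd, hok, rfl⟩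
      obtain ⟨o1, o2, o3, o4, o5, o6⟩ := hok
      simp only at o1 o2 o3 o4 o5 o6
      have hUn : Unh I (F \ Φ (n + 1)) T t := by
        have : F \ Φ (n + 1) = (F \ Φ n) \ {f} := by
          rw [hsucc]; ext e; simp only [Set.mem_sdiff, Set.mem_insert_iff, Set.mem_singleton_iff]; tauto
        rw [this]
        exact h3.del o2 (fun S p hw hr => o5 ⟨S, p, hw, hr⟩) (fun S p hw hr => o6 ⟨S, p, hw, hr⟩)
      have hrM : r ∈ M := o3.closed M hyM (hreach _ h2 h4)
      by_cases hxT : x ∈ T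
      · exfalso
        apply hgoal
        have hxt : x ≠ t := by
          rintro rfl
          exact o6 ⟨_, _, Wave.triv I (F \ Φ n) T x, rfl⟩
        have hfΦ : f ∉ Φ n := fun h => h4 f h x (by simp [o2]) hxT
        obtain ⟨p, hp, hpc⟩ := o3.flow
        have hfp : f ∉ ed p := fun h => by
          rcases hp.ed_sub h with h | h
          · exact hfΦ h
          · exact h.2 o1
        have hpM : ∀ d ∈ p, d.2.1 ∈ M ∧ d.2.2 ∈ M := by
          intro d hd
          have hs : d.2.1 ∈ M := (hpc.reach d hd).closed M hyM fun d' hd' h =>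
            hreach _ h2 h4 d'.1 (hp.mem d' hd') _ _ (hp.inc d' hd') h
          exact ⟨hs, hreach _ h2 h4 d.1 (hp.mem d hd) _ _ (hp.inc d hd) hs⟩
        have hedρ : ed (p ∪ {(f, r, x)}) = ed p ∪ {f} := by rw [ed_union, ed_singleton]
        have hpF : Φ n ∪ F \ R ⊆ F := Set.union_subset (h2.trans hR.sub) Set.sdiff_subset
        refine ⟨p ∪ {(f, r, x)}, x, ?_, hxT, hxt, ?_, ?_⟩
        · refine (hp.mono hpF).append (Flow.single (hR.sub o1) o2) ?_
          rw [ed_singleton, Set.disjoint_singleton_right]; exact hfp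
        · intro d hd
          rcases Finset.mem_union.1 hd with hd | hd
          · exact ⟨hMT _ (hpM d hd).1, fun h => absurd h (hMT _ (hpM d hd).2)⟩
          · rw [Finset.mem_singleton.1 hd]; exact ⟨hMT r hrM, fun _ => rfl⟩
        · refine saturate ht hT hR (ed_finite _).countable ?_ ?_
          · intro e he heF heR z hz
            rw [hedρ] at he
            rcases he with ⟨d, hd, rfl⟩ | rfl
            · rw [hp.inc d hd, Sym2.mem_iff] at hz
              rcases hz with rfl | rfl
              · exact (hpM d hd).1
              · exact (hpM d hd).2
            · exact absurd o1 heR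
          · refine Add_finite (C := Φ n \ ed p) (h1.subset Set.sdiff_subset) ?_ ?_
            · have : (F \ (ed (p ∪ {(f, r, x)}) ∩ R)) \ (Φ n \ ed p) = F \ Φ (n + 1) := by
                rw [hedρ, hsucc]
                ext e
                have h6 : e ∈ ed p → e ∈ R → e ∈ Φ n := fun he heR => by
                  rcases hp.ed_sub he with h | h
                  · exact h
                  · exact absurd heR h.2
                have h7 : e ∈ Φ n → e ∈ R := fun h => h2 h
                have h8 : e = f → e ∈ R := fun h => h ▸ o1
                simp only [Set.mem_sdiff, Set.mem_insert_iff, Set.mem_singleton_iff, Set.mem_inter_iff, Set.mem_union]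
                tauto
              rw [this]; exact hUn
            · intro e he hte
              exact h4 e he.1 t hte ht
      · refine ⟨?_, ?_, hUn, ?_⟩
        · rw [hsucc]; exact h1.insert f
        · rw [hsucc]; exact Set.insert_subset o1 h2
        · rw [hsucc]
          rintro e (rfl | he) u hu
          · rw [o2, Sym2.mem_iff] at hu
            rcases hu with rfl | rfl
            · exact hMT _ hrM
            · exact hxT
          · exact h4 e he u hu
  have hX : ∀ n k, (∀ f ∈ Φ (n + k), f ∉ Φ n → ∀ u ∈ I f, u ∉ Xw (Φ n)) := by
    intro n k
    induction k with
    | zero => intro f hf hf'; exact absurd hf hf'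
    | succ k ih =>
      intro f hf hfn u hu hux
      rw [← add_assoc, hΦ1] at hf
      rcases hf with hf | ⟨d, hd, ⟨o1, o2, o3, o4, o5, o6⟩, rfl⟩
      · exact ih f hf hfn u hu hux
      · have : u ∈ Xw (Φ (n + k)) := by
          obtain ⟨S, p, hw, hu⟩ := hux
          exact ⟨S, p, hw.shrink (hmono (Nat.le_add_right n k)) fun f hf hfn u hu huS => ih f hf hfn u hu ⟨S, p, hw, huS⟩, hu⟩
        rw [o2, Sym2.mem_iff] at hu
        rcases hu with rfl | rfl
        · exact o5 this
        · exact o6 this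
  let Φω : Set E := ⋃ n, Φ n
  obtain ⟨X, pX, hWX, hXmax⟩ := max_wave I (F \ Φω) ht
  have hXn : ∀ n, Xw (Φ n) ⊆ X := by
    rintro n v ⟨S, p, hw, hv⟩
    refine hXmax S p (hw.shrink (Set.subset_iUnion Φ n) ?_) hv
    intro f hf hfn u hu huS
    obtain ⟨m, hm⟩ := Set.mem_iUnion.1 hf
    exact hX n m f (hmono (Nat.le_add_left m n) hm) hfn u hu ⟨S, p, hw, huS⟩
  let Q : Set V := {z | ∃ n, Conn I (Φ n ∪ F \ R) y z}
  have hQT : ∀ z ∈ Q, z ∉ T := by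
    rintro z ⟨n, hn⟩
    exact hMT z (hn.closed M hyM (hreach _ (hInv n).2.1 (hInv n).2.2.2))
  have hQmono : ∀ n m, n ≤ m → ∀ z, Conn I (Φ n ∪ F \ R) y z → Conn I (Φ m ∪ F \ R) y z := by
    intro n m hnm z h
    exact h.mono (Set.union_subset_union_left _ (hmono hnm))
  have hcut : ∀ e ∈ cut I F (X ∪ Q), e ∈ cut I (F \ Φω) X ∧ inE I (X ∪ Q) e = inE I X e := by
    rintro e ⟨heF, a, b, hab, ha, hb⟩
    have heΦ : e ∉ Φω := by
      intro h
      obtain ⟨m, hm⟩ := Set.mem_iUnion.1 h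
      induction m with
      | zero => rw [hΦ0] at hm; exact hm
      | succ m ih =>
        have hm' := hm
        rw [hΦ1] at hm'
        rcases hm' with hm' | ⟨d, hd, ⟨o1, o2, o3, o4, o5, o6⟩, rfl⟩
        · exact ih hm'
        · have hr := hQmono m (m + 1) (Nat.le_succ m) _ o3
          have hb' : b = d.2.1 ∨ b = d.2.2 := by
            have : b ∈ I d.1 := by rw [hab]; simp
            rwa [o2, Sym2.mem_iff] at this
          rcases hb' with rfl | rfl
          · exact hb (Or.inr ⟨_, hr⟩)
          · exact hb (Or.inr ⟨_, hr.trans (Conn.single (Or.inl hm) o2)⟩)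
    have haX : a ∈ X := by
      by_contra haX
      rcases ha with ha | ⟨N, hN⟩
      · exact haX ha
      by_cases heR : e ∈ R
      · obtain ⟨n, hn, hgn⟩ := hg (e, a, b) ⟨heR, hab⟩ N
        have hOk : Ok (Φ n) (e, a, b) := by
          refine ⟨heR, hab, hQmono N n hn _ hN, fun h => hb (Or.inr ⟨n, h⟩), fun h => haX (hXn n h),
            fun h => hb (Or.inl (hXn n h))⟩
        refine heΦ (Set.mem_iUnion.2 ⟨n + 1, ?_⟩)
        rw [hΦ1]
        exact Or.inr ⟨_, hgn, hOk, rfl⟩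
      · exact hb (Or.inr ⟨N, hN.trans (Conn.single (Or.inr ⟨heF, heR⟩) hab)⟩)
    have hbX : b ∉ X := fun h => hb (Or.inl h)
    exact ⟨⟨⟨heF, heΦ⟩, a, b, hab, haX, hbX⟩, by rw [inE_eq hab ha hb, inE_eq hab haX hbX]⟩
  refine hy (X ∪ Q) pX ⟨Or.inl hWX.mem, ?_, fun e he => ?_, fun e he e' he' =>
    hWX.link.disj e (hcut e he).1 e' (hcut e' he').1⟩ (Or.inr ⟨0, Conn.refl y⟩)
  · rintro x (hx | hx) hxT
    · exact hWX.term x hx hxT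
    · exact absurd hxT (hQT x hx)
  · rw [(hcut e he).2]
    exact (hWX.link.flow e (hcut e he).1).mono (Ins_mono Set.sdiff_subset Set.subset_union_left)

end LC

set_option linter.unusedVariables false

namespace LC
open Classical Cardinal
universe w
variable {V : Type u} {E : Type v} {ι : Type w}

theorem max_con {I : E → Sym2 V} {F : Set E} {T : Set V} {t : V} (ht : t ∈ T) {M : Set V}
    {pM : E → Finset (E × V × V)} (hM : Wave I F T t M pM) (hmax : ∀ S q, Wave I F T t S q → S ⊆ M) :
    (∀ S q, Wave (con I (colX M t)) F T t S q → S ⊆ M) ∧ Unh (con I (colX M t)) F T t := by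
  have h1 : ∀ S q, Wave (con I (colX M t)) F T t S q → S ⊆ M := by
    intro S q0 hS0 v hv
    obtain ⟨q, hS, hq⟩ := hS0.clean
    have hX : Wave I F T t {v | colX M t v = t} pM := by rw [colX_pre hM.mem]; exact hM
    obtain ⟨p', hp', -⟩ := Lift (hM.isCon ht) ht hX hS fun e he => (hq e he).2
    by_contra hvM
    refine hvM (hmax _ _ hp' ?_)
    show colX M t v ∈ S
    rw [colX, if_neg hvM]; exact hv
  refine ⟨h1, ?_⟩
  intro S q hS b hb b' hbb hbt
  refine Or.inl ⟨hb, t, b', hbb, hS.mem, fun h => ?_⟩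
  obtain ⟨x, y, hxy, hx, hy⟩ := con_ex hbb
  by_cases hyM : y ∈ M
  · rw [colX, if_pos hyM] at hy; exact hbt hy.symm
  · rw [colX, if_neg hyM] at hy
    subst hy
    exact hyM (h1 S q hS h)

theorem glue {I : E → Sym2 V} {F : Set E} {T TL : Set V} {t : V} {M N : Set V} (htM : t ∈ M)
    (htN : t ∉ N) {σ ρ : Set E}
    (hσ : ∀ e ∈ σ, ∃ u ∈ I e, u ∈ M ∪ N) (hρ : ∀ e ∈ ρ, ∀ u ∈ I e, u ∉ M)
    (hUL : Unh (con I (colX M t)) ({f | f ∈ F ∧ ∀ u ∈ I f, u ∉ N} \ ρ) TL t)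
    (hUσ : Unh I (F \ σ) T t)
    (hFD : ∀ S p, Wave I (F \ (σ ∪ ρ)) T t S p → ∀ x ∈ S, x ≠ t → x ∉ N ∧ x ∉ TL) :
    Unh I (F \ (σ ∪ ρ)) T t := by
  intro S p hW b hb b' hbb hbt
  have hSN : ∀ x ∈ S, x ∉ N := fun x hx => by
    by_cases h : x = t
    · rw [h]; exact htN
    · exact (hFD S p hW x hx h).1
  obtain ⟨p2, hW2, hp2⟩ := Push (F2 := {f | f ∈ F ∧ ∀ u ∈ I f, u ∉ N} \ ρ) (T2 := TL) hW htM
    (fun x hx hxM => (hFD S p hW x hx (fun h => hxM (h ▸ htM))).2)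
    (by
      intro e he a b hab ha haM hb hbM
      refine ⟨he.1.1, ?_⟩
      rintro (h | h)
      · obtain ⟨u, hu, hu'⟩ := hσ e h
        have huN := he.1.2 u hu
        rw [hab, Sym2.mem_iff] at hu
        rcases hu with rfl | rfl
        · exact hu'.elim haM huN
        · exact hu'.elim hbM huN
      · exact he.2 h)
    (by
      intro e he a b hab ha hb hbM
      refine ⟨⟨he.1, fun u hu => ?_⟩, fun h => he.2 (Or.inr h)⟩
      rw [hab, Sym2.mem_iff] at hu
      rcases hu with rfl | rfl
      · exact hSN _ ha
      · exact hSN _ hb)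
  obtain ⟨p3, hW3, hp3⟩ := hW2.clean
  have hh : ∀ f ∈ F \ σ, ∀ a b, I f = s(a, b) → a ∈ S → a ∈ M → b ∈ S → b ∉ M →
      ∃ h, h ∈ cut I (F \ (σ ∪ ρ)) S ∧ inE I S h ∉ M ∧ (f, a, b) ∈ p h ∧
        ∀ d ∈ p h, ∀ a' b', I d.1 = s(a', b') → a' ∈ M → b' ∉ M → d = (f, a, b) := by
    have aux : ∀ f ∈ F \ σ, ∀ a b, I f = s(a, b) → a ∈ S → a ∈ M → b ∈ S → b ∉ M →
      ∃ h, h ∈ cut I (F \ (σ ∪ ρ)) S ∧ inE I S h ∉ M ∧ (f, a, b) ∈ p h ∧ (f, t, b) ∈ p3 h ∧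
        h ∈ cut (con I (colX M t)) ({f | f ∈ F ∧ ∀ u ∈ I f, u ∉ N} \ ρ) (insert t (S \ M)) := by
      intro f hf a b hab haS haM hbS hbM
      have hcon : con I (colX M t) f = s(t, b) := by
        rw [con_eq hab, colX, colX, if_pos haM, if_neg hbM]
      have hbt' : b ≠ t := fun h => hbM (h ▸ htM)
      have hfF : f ∈ {f | f ∈ F ∧ ∀ u ∈ I f, u ∉ N} \ ρ := by
        refine ⟨⟨hf.1, fun u hu => ?_⟩, fun h => hρ f h a (by simp [hab]) haM⟩
        rw [hab, Sym2.mem_iff] at hu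
        rcases hu with rfl | rfl
        · exact hSN _ haS
        · exact hSN _ hbS
      rcases hUL _ p3 hW3 f hfF b hcon hbt' with h | ⟨h, hh, hfp⟩
      · exfalso
        obtain ⟨-, x, y, hxy, hx, hy⟩ := h
        rw [hcon, Sym2.eq_iff] at hxy
        rcases hxy with ⟨rfl, rfl⟩ | ⟨rfl, rfl⟩
        · exact hy (Or.inr ⟨hbS, hbM⟩)
        · exact hy (Or.inl rfl)
      · have hsub := (hp3 h hh).1
        obtain ⟨⟨f', x, y⟩, hd, hf'⟩ := hfp
        simp only at hf'
        subst hf'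
        have hinc := (hW3.link.flow h hh).inc _ hd
        simp only at hinc
        rw [hcon, Sym2.eq_iff] at hinc
        have hno : y ≠ t := (hp3 h hh).2.no_tgt _ hd
        have hxy : x = t ∧ y = b := by
          rcases hinc with ⟨h1, h2⟩ | ⟨h1, h2⟩
          · exact ⟨h1.symm, h2.symm⟩
          · exact absurd h1.symm hno
        obtain ⟨rfl, rfl⟩ := hxy
        rcases hp2 h hh with ⟨-, h2⟩ | ⟨h1, h2, h3⟩
        · rw [h2] at hsub
          exact absurd (hsub hd) (Finset.notMem_empty _)
        · refine ⟨h, h1, h2, ?_, hd, hh⟩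
          have h4 := hsub hd
          rw [h3, mem_pushf] at h4
          obtain ⟨a', b', h5, h6, h7, -⟩ := h4
          have h8 := (hW.link.flow h h1).inc _ h5
          simp only at h8
          rw [hab, Sym2.eq_iff] at h8
          rcases h8 with ⟨rfl, rfl⟩ | ⟨rfl, rfl⟩
          · exact h5
          · rw [colX, if_pos haM] at h7
            exact absurd h7 hno.symm
    intro f hf a b hab haS haM hbS hbM
    obtain ⟨h, h1, h2, h3, h4, h5⟩ := aux f hf a b hab haS haM hbS hbM
    refine ⟨h, h1, h2, h3, ?_⟩
    intro d hd a' b' hab' haM' hbM'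
    have hfl := hW.link.flow h h1
    have h6 := (mem_Ins hab').1 (hfl.mem d hd)
    obtain ⟨h', g1, g2, g3, g4, g5⟩ := aux d.1 ⟨h6.1.1, fun h => h6.1.2 (Or.inl h)⟩ a' b' hab' h6.2.1 haM' h6.2.2 hbM'
    obtain ⟨e1, e2⟩ := hW.link.same h1 g1 hd g3 rfl
    subst e1
    have h7 := (hp3 h h5).2.src_uniq _ h4 _ g4 rfl rfl
    have h8 : d.1 = f := (congrArg Prod.fst h7).symm
    exact hfl.inj d hd _ h3 h8
  have hch : ∀ f ∈ cut I (F \ σ) (S ∩ M), ∃ h pf, h ∈ cut I (F \ (σ ∪ ρ)) S ∧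
      Flow I (Ins I (F \ σ) (S ∩ M)) pf t (inE I (S ∩ M) f) ∧ pf ⊆ p h ∧
      ((h = f ∧ inE I S h ∈ M) ∨ (f ∈ ed (p h) ∧ (∃ b, b ∈ I f ∧ b ∈ S) ∧ inE I S h ∉ M ∧
        ∀ d ∈ p h, ∀ a' b', I d.1 = s(a', b') → a' ∈ M → b' ∉ M → d.1 = f)) := by
    rintro f ⟨hfF, a, b, hab, ⟨haS, haM⟩, hb⟩
    rw [inE_eq (S := S ∩ M) hab ⟨haS, haM⟩ hb]
    have hins : Ins I (Ins I (F \ (σ ∪ ρ)) S) M ⊆ Ins I (F \ σ) (S ∩ M) := fun x hx =>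
      ⟨⟨hx.1.1.1, fun h => hx.1.1.2 (Or.inl h)⟩, fun v hv => ⟨hx.1.2 v hv, hx.2 v hv⟩⟩
    by_cases hbS : b ∈ S
    · have hbM : b ∉ M := fun h => hb ⟨hbS, h⟩
      obtain ⟨h, h1, h2, h3, h4⟩ := hh f hfF a b hab haS haM hbS hbM
      have hfl := hW.link.flow h h1
      obtain ⟨d, hd, hd1, hd2, hd3, hd4⟩ := (trunc hfl htM (by
        intro d hd hd2
        by_contra hd1
        have := h4 d hd d.2.2 d.2.1 (by rw [hfl.inc d hd, Sym2.eq_swap]) hd2 hd1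
        rw [this] at hd1
        exact hd1 haM)).2 h2
      have hda := h4 d hd d.2.1 d.2.2 (hfl.inc d hd) hd1 hd2
      rw [hda] at hd4
      exact ⟨h, _, h1, hd4.mono hins, Finset.filter_subset _ _, Or.inr ⟨mem_ed h3, ⟨b, by simp [hab], hbS⟩, h2,
        fun d hd a' b' h6 h7 h8 => by rw [h4 d hd a' b' h6 h7 h8]⟩⟩
    · have hfρ : f ∉ ρ := fun h => hρ f h a (by simp [hab]) haM
      have hcut : f ∈ cut I (F \ (σ ∪ ρ)) S := ⟨⟨hfF.1, fun h => h.elim hfF.2 hfρ⟩, a, b, hab, haS, hbS⟩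
      have hfl := hW.link.flow f hcut
      rw [inE_eq hab haS hbS] at hfl
      have h4 := ((trunc hfl htM (by
        intro d hd hd2
        by_contra hd1
        have h6 := (mem_Ins (hfl.inc d hd)).1 (hfl.mem d hd)
        obtain ⟨h, h1, h2, h3, -⟩ := hh d.1 ⟨h6.1.1, fun h => h6.1.2 (Or.inl h)⟩ d.2.2 d.2.1
          (by rw [hfl.inc d hd, Sym2.eq_swap]) h6.2.2 hd2 h6.2.1 hd1
        have := (hW.link.same hcut h1 hd h3 rfl).1
        subst this
        rw [inE_eq hab haS hbS] at h2
        exact h2 haM)).1 haM).2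
      exact ⟨f, _, hcut, h4.mono hins, Finset.filter_subset _ _, Or.inl ⟨rfl, by rw [inE_eq hab haS hbS]; exact haM⟩⟩
  choose! hx pf q1 q2 q3 q4 using hch
  have hinj : ∀ f ∈ cut I (F \ σ) (S ∩ M), ∀ f' ∈ cut I (F \ σ) (S ∩ M), hx f = hx f' → f = f' := by
    intro f hf f' hf' hff
    rcases q4 f hf with ⟨h1, h2⟩ | ⟨h1, h2, h3, h4⟩ <;> rcases q4 f' hf' with ⟨g1, g2⟩ | ⟨g1, g2, g3, g4⟩
    · exact h1.symm.trans (hff.trans g1)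
    · rw [hff] at h2; exact absurd h2 g3
    · rw [hff] at h3; exact absurd g2 h3
    · rw [← hff] at g1
      obtain ⟨d, hd, hdf⟩ := g1
      obtain ⟨-, a', b', hab', ha', hb'⟩ := hf'
      have hfl := hW.link.flow _ (q1 f hf)
      have h5 := (mem_Ins (e := d.1) (hdf ▸ hab')).1 (hfl.mem d hd)
      rw [← hdf]
      exact (h4 d hd a' b' (hdf ▸ hab') ha'.2 fun h => hb' ⟨h5.2.2, h⟩).symm
  have hW0 : Wave I (F \ σ) T t (S ∩ M) pf := by
    refine ⟨⟨hW.mem, htM⟩, fun x hx => hW.term x hx.1, q2, fun f hf f' hf' hne => ?_⟩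
    exact (hW.link.disj _ (q1 f hf) _ (q1 f' hf') fun h => hne (hinj f hf f' hf' h)).mono
      (ed_mono (q3 f hf)) (ed_mono (q3 f' hf'))
  rcases hUσ _ pf hW0 b ⟨hb.1, fun h => hb.2 (Or.inl h)⟩ b' hbb hbt with h | ⟨h, hh, hbp⟩
  · rcases q4 b h with ⟨h1, h2⟩ | ⟨h1, -⟩
    · left; rw [← h1]; exact q1 b h
    · exact Or.inr ⟨_, q1 b h, h1⟩
  · exact Or.inr ⟨_, q1 h hh, ed_mono (q3 h hh) hbp⟩

end LC

set_option linter.unusedVariables false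

namespace LC
open Classical Cardinal
universe w
variable {V : Type u} {E : Type v} {ι : Type w}

theorem WF.unh {I : E → Sym2 V} {F : Set E} {T : Set V} {t : V} (ht : t ∈ T) (h : WF I F T) : Unh I F T t := by
  intro S p hW b hb b' hbb hbt
  refine Or.inl ⟨hb, t, b', hbb, hW.mem, fun hS => ?_⟩
  exact h t ht S p hW b' hS hbt t ht (Conn.single hb hbb).symm

theorem WF.unh_del {I : E → Sym2 V} {F : Set E} {T : Set V} {t u : V} (ht : t ∈ T) (h : WF I F T) {e : E}
    (he : e ∈ F) (heI : I e = s(t, u)) (hut : u ≠ t) : Unh I (F \ {e}) T t := by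
  intro S p hW b hb b' hbb hbt
  have key : ∀ p', Wave I F T t S p' → b' ∉ S := fun p' hp' hS =>
    h t ht S p' hp' b' hS hbt t ht (Conn.single hb.1 hbb).symm
  by_cases huS : u ∈ S
  · have hW' := hW.back Set.sdiff_subset (by
      rintro f ⟨hfF, x, y, hxy, hx, hy⟩
      refine ⟨hfF, ?_⟩
      rintro rfl
      rw [heI, Sym2.eq_iff] at hxy
      rcases hxy with ⟨rfl, rfl⟩ | ⟨rfl, rfl⟩
      · exact hy huS
      · exact hy hW.mem)
    exact absurd (Conn.single he heI).symm (h t ht S p hW' u huS hut t ht)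
  · rcases Rm (h.unh ht) hW heI hW.mem huS with ⟨p', hp'⟩ | h'
    · exact Or.inl ⟨hb, t, b', hbb, hW.mem, key p' hp'⟩
    · exact h' b hb b' hbb hbt

/-- separability after contracting the wave `M` in the graph without the hubs in `N` -/
theorem sepL {I : E → Sym2 V} {F : Set E} {T N M : Set V} {t : V} (ht : t ∈ T) {pM : E → Finset (E × V × V)}
    (hM : Wave I {f | f ∈ F ∧ ∀ u ∈ I f, u ∉ N} (T ∪ {v | Rich I F T v ∧ v ∉ N}) t M pM) (v : V)
    (hv : v ∉ T ∪ {v | Rich I F T v ∧ v ∉ N}) :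
    ¬ Rich (con I (colX M t)) {f | f ∈ F ∧ ∀ u ∈ I f, u ∉ N} (T ∪ {v | Rich I F T v ∧ v ∉ N}) v := by
  intro hr
  have hvt : v ≠ t := fun h => hv (Or.inl (h ▸ ht))
  by_cases hvM : v ∈ M
  · obtain ⟨s, hs, h⟩ := hr ∅ Set.countable_empty
    have := h.closed {v} rfl (by
      rintro e he x y hxy rfl
      obtain ⟨a, b, hab, ha, hb⟩ := con_ex hxy
      exfalso
      by_cases haM : a ∈ M
      · rw [colX, if_pos haM] at ha; exact hvt ha.symm
      · rw [colX, if_neg haM] at ha; exact haM (ha ▸ hvM))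
    exact hv (this ▸ hs)
  by_cases hvN : v ∈ N
  · obtain ⟨s, hs, h⟩ := hr ∅ Set.countable_empty
    have := h.closed {v} rfl (by
      rintro e he x y hxy rfl
      obtain ⟨a, b, hab, ha, hb⟩ := con_ex hxy
      exfalso
      by_cases haM : a ∈ M
      · rw [colX, if_pos haM] at ha; exact hvt ha.symm
      · rw [colX, if_neg haM] at ha
        exact he.1.2 a (by simp [hab]) (ha ▸ hvN))
    exact hv (this ▸ hs)
  have hvp : ¬ Rich I F T v := fun h => hv (Or.inr ⟨h, hvN⟩)
  unfold Rich at hvp; push Not at hvp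
  obtain ⟨C, hC, hC'⟩ := hvp
  obtain ⟨s, hs, h⟩ := hr (C ∪ {i | i ∈ cut I {f | f ∈ F ∧ ∀ u ∈ I f, u ∉ N} M ∧ (ed (pM i) ∩ C).Nonempty})
    (hC.union (hM.link.cnt hC))
  have := h.closed {x | x ∉ M ∧ Conn I (F \ C) v x} ⟨hvM, Conn.refl v⟩ (by
    rintro e he x y hxy ⟨hx, hvx⟩
    obtain ⟨a, b, hab, ha, hb⟩ := con_ex hxy
    by_cases haM : a ∈ M
    · rw [colX, if_pos haM] at ha; rw [← ha] at hx; exact absurd hM.mem hx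
    rw [colX, if_neg haM] at ha
    subst ha
    have heC : e ∈ F \ C := ⟨he.1.1, fun h => he.2 (Or.inl h)⟩
    have hvb := hvx.trans (Conn.single heC hab)
    by_cases hbM : b ∈ M
    · exfalso
      have hcut : e ∈ cut I {f | f ∈ F ∧ ∀ u ∈ I f, u ∉ N} M := ⟨he.1, b, a, by rw [hab, Sym2.eq_swap], hbM, haM⟩
      have hfl := hM.link.flow e hcut
      rw [inE_eq (a := b) (b := a) (by rw [hab, Sym2.eq_swap]) hbM haM] at hfl
      have h2 : Flow I (F \ C) (pM e) t b := hfl.of_ed (F' := F \ C) fun x hx =>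
        ⟨(hfl.ed_sub hx).1.1, fun h => he.2 (Or.inr ⟨hcut, x, hx, h⟩)⟩
      exact hC' t ht (hvb.trans h2.conn.symm)
    · rw [colX, if_neg hbM] at hb
      subst hb
      exact ⟨hbM, hvb⟩)
  rcases hs with hs | hs
  · exact hC' s hs this.2
  · obtain ⟨s', hs', h'⟩ := hs.1 C hC
    exact hC' s' hs' (this.2.trans h')

structure Safe (I : E → Sym2 V) (F : Set E) (T : Set V) (t u : V) (e : E) (P : Finset (E × V × V)) (r : V) : Prop where
  flow : Flow I F P t r
  src : ∀ d ∈ P, d.2.1 ∈ T → d = (e, t, u)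
  tgt : ∀ d ∈ P, d.2.2 ∉ T
  unh : Unh I (F \ ed P) T t

theorem Flow.start {I : E → Sym2 V} {F : Set E} {T : Set V} {t u r : V} {e : E} {P : Finset (E × V × V)} (ht : t ∈ T)
    (h : Flow I F P t r) (hs : ∀ d ∈ P, d.2.1 ∈ T → d = (e, t, u)) (hr : r ≠ t) : (e, t, u) ∈ P := by
  obtain ⟨d, hd, h1, -⟩ := h.first hr.symm
  rw [hs d hd (h1 ▸ ht)] at hd
  exact hd

/-- replace a flow by a smaller one, keeping unhinderedness -/
theorem Unh.sub {I : E → Sym2 V} {F : Set E} {T : Set V} {t u r : V} {e : E} {P P' : Finset (E × V × V)} (ht : t ∈ T)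
    (hU : Unh I (F \ ed P) T t) (hinc : ∀ d ∈ P, I d.1 = s(d.2.1, d.2.2))
    (hs : ∀ d ∈ P, d.2.1 ∈ T → d = (e, t, u)) (htg : ∀ d ∈ P, d.2.2 ≠ t)
    (hP : P' ⊆ P) (h : Flow I F P' t r) (hr : r ≠ t) : Unh I (F \ ed P') T t := by
  have he : (e, t, u) ∈ P' := h.start ht (fun d hd => hs d (hP hd)) hr
  refine Add_finite (C := ed P \ ed P') ((ed_finite P).subset Set.sdiff_subset) ?_ ?_
  · have : (F \ ed P') \ (ed P \ ed P') = F \ ed P := by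
      ext x
      have := @ed_mono _ _ _ _ hP x
      simp only [Set.mem_sdiff]
      tauto
    rw [this]; exact hU
  · rintro f ⟨⟨d, hd, rfl⟩, hf⟩ htf
    rw [hinc d hd, Sym2.mem_iff] at htf
    rcases htf with h1 | h1
    · have := hs d hd (h1 ▸ ht)
      rw [this] at hf
      exact hf (mem_ed he)
    · exact htg d hd h1.symm

theorem Safe.sub {I : E → Sym2 V} {F : Set E} {T : Set V} {t u r r' : V} {e : E} {P P' : Finset (E × V × V)} (ht : t ∈ T)
    (h : Safe I F T t u e P r) (hP : P' ⊆ P) {D : Set E} (h' : Flow I D P' t r') (hr : r' ≠ t) : Safe I F T t u e P' r' := by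
  have hf : Flow I F P' t r' := h'.of_ed ((ed_mono hP).trans h.flow.ed_sub)
  exact ⟨hf, fun d hd => h.src d (hP hd), fun d hd => h.tgt d (hP hd),
    h.unh.sub ht h.flow.inc h.src (fun d hd he => h.tgt d hd (he ▸ ht)) hP hf hr⟩

theorem T1 {I : E → Sym2 V} {F : Set E} {T : Set V} (hPar : Par I F T) (hWF : WF I F T) {t u : V} (ht : t ∈ T)
    {e : E} (he : e ∈ F) (heI : I e = s(t, u)) (hu : u ∉ T) :
    ∃ P t', Flow I F P t t' ∧ t' ∈ T ∧ t' ≠ t ∧ (∀ d ∈ P, d.2.1 ∈ T → d = (e, t, u)) ∧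
      (∀ d ∈ P, d.2.2 ∈ T → d.2.2 = t') ∧ Unh I (F \ ed P) T t := by
  by_contra hgoal
  have hut : u ≠ t := fun h => hu (h ▸ ht)
  let N : Set V := {x | x ∉ T ∧ Rich I F T x ∧ ∃ P, Safe I F T t u e P x}
  let FN : Set E := {f | f ∈ F ∧ ∀ u ∈ I f, u ∉ N}
  let TL : Set V := T ∪ {v | Rich I F T v ∧ v ∉ N}
  have htN : t ∉ N := fun h => h.1 ht
  obtain ⟨M, pM, hM, hMmax⟩ := max_wave I FN (T := TL) (t := t) (Or.inl ht)
  obtain ⟨hL1, hL2⟩ := max_con (T := TL) (Or.inl ht) hM hMmax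
  have hL3 := sepL ht hM
  have hFD : ∀ σ : Set E, σ.Countable → ∀ S p, Wave I (F \ σ) T t S p → ∀ x ∈ S, x ≠ t → x ∉ N ∧ x ∉ TL := by
    intro σ hσ S p hW x hx hxt
    have := FD hPar hWF hσ ht hW hx hxt
    refine ⟨fun h => this h.2.1, ?_⟩
    rintro (h | h)
    · exact hxt (hW.term x hx h)
    · exact this h.1
  -- exit claim
  have exit : ∀ P y, Safe I F T t u e P y → y ∉ T → y ∉ M → y ∉ N → (∀ d ∈ P, d.2.1 ∈ M ∪ N) → False := by
    intro P y hP hyT hyM hyN hsrc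
    have hyL : y ∉ TL := by
      rintro (h | h)
      · exact hyT h
      · exact hyN ⟨hyT, h.1, P, hP⟩
    obtain ⟨ρ, z, hρ, hzT, hzt, hρT, hρU⟩ := rho (T := TL) (Or.inl ht) hL3 hL2 hyL (fun S p hw h => hyM (hL1 S p hw h))
    have hρM : ∀ d ∈ ρ, I d.1 = s(d.2.1, d.2.2) ∧ d.2.1 ∉ M ∧ d.2.2 ∉ M := by
      intro d hd
      obtain ⟨a, b, hab, ha, hb⟩ := con_ex (hρ.inc d hd)
      have h1 : a ∉ M := fun h => by
        rw [colX, if_pos h] at ha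
        exact (hρT d hd).1 (ha ▸ Or.inl ht)
      have h2 : b ∉ M := fun h => by
        rw [colX, if_pos h] at hb
        exact hzt (((hρT d hd).2 (hb ▸ Or.inl ht)).symm.trans hb.symm)
      rw [colX, if_neg h1] at ha
      rw [colX, if_neg h2] at hb
      rw [← ha, ← hb]
      exact ⟨hab, h1, h2⟩
    have hρF : Flow I F ρ y z := ⟨fun d hd => (hρ.mem d hd).1, fun d hd => (hρM d hd).1, hρ.inj, hρ.pot⟩
    have hedρ : ∀ f ∈ ed ρ, ∀ u ∈ I f, u ∉ M := by
      rintro f ⟨d, hd, rfl⟩ u hu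
      rw [(hρM d hd).1, Sym2.mem_iff] at hu
      rcases hu with rfl | rfl
      · exact (hρM d hd).2.1
      · exact (hρM d hd).2.2
    have hedP : ∀ f ∈ ed P, ∃ u ∈ I f, u ∈ M ∪ N := by
      rintro f ⟨d, hd, rfl⟩
      exact ⟨d.2.1, by rw [hP.flow.inc d hd]; simp, hsrc d hd⟩
    have hdisj : Disjoint (ed P) (ed ρ) := by
      rw [Set.disjoint_left]
      intro f hf hf'
      obtain ⟨u, hu, huM | huN⟩ := hedP f hf
      · exact hedρ f hf' u hu huM
      · exact (hρ.ed_sub hf').2 u hu huN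
    have hU := glue hM.mem htN hedP hedρ hρU hP.unh
      (fun S p hW => hFD _ ((ed_finite P).union (ed_finite ρ)).countable S p hW)
    rw [← ed_union] at hU
    have hfl := hP.flow.append hρF hdisj
    have hsrc' : ∀ d ∈ P ∪ ρ, d.2.1 ∈ T → d = (e, t, u) := by
      intro d hd hdT
      rcases Finset.mem_union.1 hd with hd | hd
      · exact hP.src d hd hdT
      · exact absurd (Or.inl hdT) (hρT d hd).1
    by_cases hz : z ∈ T
    · refine hgoal ⟨P ∪ ρ, z, hfl, hz, hzt, hsrc', ?_, hU⟩
      intro d hd hdT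
      rcases Finset.mem_union.1 hd with hd | hd
      · exact absurd hdT (hP.tgt d hd)
      · exact (hρT d hd).2 (Or.inl hdT)
    · have hzA : Rich I F T z ∧ z ∉ N := hzT.resolve_left hz
      refine hzA.2 ⟨hz, hzA.1, P ∪ ρ, hfl, hsrc', ?_, hU⟩
      intro d hd hdT
      rcases Finset.mem_union.1 hd with hd | hd
      · exact absurd hdT (hP.tgt d hd)
      · exact hz ((hρT d hd).2 (Or.inl hdT) ▸ hdT)
  -- safe trails stay inside
  have stay : ∀ P r, Safe I F T t u e P r → Clean P t r → ∀ d ∈ P, d.2.1 ∈ M ∪ N ∧ d.2.2 ∈ M ∪ N := by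
    intro P r hP hc
    let D : Set (E × V × V) := {d | d ∈ P ∧ d.2.1 ∈ M ∪ N}
    let W : Set V := {v | v ∈ M ∪ N ∧ DReach D t v}
    have htW : t ∈ W := ⟨Or.inl hM.mem, Relation.ReflTransGen.refl⟩
    have hcl : ∀ d ∈ P, d.2.1 ∈ W → d.2.2 ∈ W := by
      intro d hd hW
      have hr : DReach D t d.2.2 := hW.2.tail (show (d.1, d.2.1, d.2.2) ∈ D from ⟨hd, hW.1⟩)
      refine ⟨?_, hr⟩
      by_contra hn
      obtain ⟨P', hP'1, hP'2, hP'3⟩ := reach_flow (I := I) (F := F) (fun d hd => ⟨hP.flow.mem d hd.1, hP.flow.inc d hd.1⟩) hr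
      refine exit P' d.2.2 (hP.sub ht (fun x hx => (hP'1 hx).1) hP'2 ?_) (hP.tgt d hd) (fun h => hn (Or.inl h))
        (fun h => hn (Or.inr h)) (fun x hx => (hP'1 hx).2)
      intro h
      exact hn (h ▸ Or.inl hM.mem)
    intro d hd
    have h1 : d.2.1 ∈ W := (hc.reach d hd).closed W htW hcl
    exact ⟨h1.1, (hcl d hd h1).1⟩
  -- neighbours of hubs
  have nbr : ∀ x ∈ N, ∀ f ∈ F, ∀ y, I f = s(x, y) → y ∈ M ∪ N := by
    intro x hx f hf y hxy
    by_contra hy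
    have hyM : y ∉ M := fun h => hy (Or.inl h)
    have hyN : y ∉ N := fun h => hy (Or.inr h)
    have hyt : y ≠ t := fun h => hyM (h ▸ hM.mem)
    obtain ⟨hxT, hxR, P0, hP0⟩ := hx
    have hxN : x ∈ N := ⟨hxT, hxR, P0, hP0⟩
    have hxt : x ≠ t := fun h => hxT (h ▸ ht)
    obtain ⟨P, hPs, hPf, hPc⟩ := hP0.flow.clean
    have hP := hP0.sub ht hPs hPf hxt
    have hst := stay P x hP hPc
    have hPv : ∀ g ∈ ed P, ∀ w ∈ I g, w ∈ M ∪ N := by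
      rintro g ⟨d, hd, rfl⟩ w hw
      rw [hPf.inc d hd, Sym2.mem_iff] at hw
      rcases hw with rfl | rfl
      · exact (hst d hd).1
      · exact (hst d hd).2
    have hfP : f ∉ ed P := fun h => hy (hPv f h y (by simp [hxy]))
    have hU : Unh I ((F \ ed P) \ {f}) T t := by
      intro S p hW b hb b' hbb hbt
      have hW' : Wave I (F \ (ed P ∪ {f})) T t S p := by rw [← Set.sdiff_sdiff]; exact hW
      have hxS : x ∉ S := fun h =>
        (hFD _ ((ed_finite P).union (Set.finite_singleton f)).countable S p hW' x h hxt).1 hxN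
      by_cases hyS : y ∈ S
      · rcases Rm hP.unh hW (a := y) (c := x) (by rw [hxy, Sym2.eq_swap]) hyS hxS with ⟨p', hp'⟩ | h
        · exfalso
          have hS := hFD _ (ed_finite P).countable S p' hp'
          have hSN : ∀ x ∈ S, x ∉ N := fun x hx => by
            by_cases h : x = t
            · rw [h]; exact htN
            · exact (hS x hx h).1
          obtain ⟨p2, hp2, -⟩ := Push (F2 := FN) (T2 := TL) hp' hM.mem
            (fun x hx hxM => (hS x hx (fun h => hxM (h ▸ hM.mem))).2)
            (by
              intro g hg a c hac ha haM hc hcM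
              refine ⟨hg.1, fun h => ?_⟩
              rcases hPv g h a (by simp [hac]) with h | h
              · exact haM h
              · exact hSN a ha h)
            (by
              intro g hg a c hac ha hc hcM
              refine ⟨hg.1, fun w hw => ?_⟩
              rw [hac, Sym2.mem_iff] at hw
              rcases hw with rfl | rfl
              · exact hSN _ ha
              · exact hSN _ hc)
          exact hyM (hL1 _ _ hp2 (Or.inr ⟨hyS, hyM⟩))
        · exact h b hb b' hbb hbt
      · have hcut : cut I (F \ ed P) S ⊆ (F \ ed P) \ {f} := by
          rintro g ⟨hg, a, c, hac, ha, hc⟩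
          refine ⟨hg, ?_⟩
          rintro rfl
          rw [hxy, Sym2.eq_iff] at hac
          rcases hac with ⟨rfl, rfl⟩ | ⟨rfl, rfl⟩ <;> contradiction
        rcases hP.unh S p (hW.back Set.sdiff_subset hcut) b hb.1 b' hbb hbt with h | ⟨h, hh, hbp⟩
        · exact Or.inl ⟨hb, h.2⟩
        · exact Or.inr ⟨h, ⟨hcut hh, hh.2⟩, hbp⟩
    have hed : ed (P ∪ {(f, x, y)}) = ed P ∪ {f} := by rw [ed_union, ed_singleton]
    rw [Set.sdiff_sdiff, ← hed] at hU
    have hfl : Flow I F (P ∪ {(f, x, y)}) t y := by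
      refine hP.flow.append (Flow.single hf hxy) ?_
      rw [ed_singleton, Set.disjoint_singleton_right]; exact hfP
    have hsrc : ∀ d ∈ P ∪ {(f, x, y)}, d.2.1 ∈ T → d = (e, t, u) := by
      intro d hd hdT
      rcases Finset.mem_union.1 hd with hd | hd
      · exact hP.src d hd hdT
      · rw [Finset.mem_singleton.1 hd] at hdT; exact absurd hdT hxT
    by_cases hyT : y ∈ T
    · refine hgoal ⟨_, y, hfl, hyT, hyt, hsrc, ?_, hU⟩
      intro d hd hdT
      rcases Finset.mem_union.1 hd with hd | hd
      · exact absurd hdT (hP.tgt d hd)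
      · rw [Finset.mem_singleton.1 hd]
    · refine exit _ y ⟨hfl, hsrc, ?_, hU⟩ hyT hyM hyN ?_
      · intro d hd
        rcases Finset.mem_union.1 hd with hd | hd
        · exact hP.tgt d hd
        · rw [Finset.mem_singleton.1 hd]; exact hyT
      · intro d hd
        rcases Finset.mem_union.1 hd with hd | hd
        · exact (hst d hd).1
        · rw [Finset.mem_singleton.1 hd]; exact Or.inr hxN
  have hcut : ∀ f ∈ cut I F (M ∪ N), f ∈ cut I FN M ∧ inE I (M ∪ N) f = inE I M f := by
    rintro f ⟨hf, a, b, hab, ha, hb⟩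
    have haN : a ∉ N := fun h => hb (nbr a h f hf b hab)
    have haM := ha.resolve_right haN
    have hbM : b ∉ M := fun h => hb (Or.inl h)
    refine ⟨⟨⟨hf, fun w hw => ?_⟩, a, b, hab, haM, hbM⟩, by rw [inE_eq hab ha hb, inE_eq hab haM hbM]⟩
    rw [hab, Sym2.mem_iff] at hw
    rcases hw with rfl | rfl
    · exact haN
    · exact fun h => hb (Or.inr h)
  have hW : Wave I F T t (M ∪ N) pM := by
    refine ⟨Or.inl hM.mem, ?_, fun f hf => ?_, fun f hf f' hf' =>
      hM.link.disj f (hcut f hf).1 f' (hcut f' hf').1⟩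
    · rintro x (hx | hx) hxT
      · exact hM.term x hx (Or.inl hxT)
      · exact absurd hxT hx.1
    · rw [(hcut f hf).2]
      exact (hM.link.flow f (hcut f hf).1).mono (Ins_mono (fun x hx => hx.1) Set.subset_union_left)
  have hsafe : Safe I F T t u e {(e, t, u)} u := by
    refine ⟨Flow.single he heI, ?_, ?_, ?_⟩
    · intro d hd _; exact Finset.mem_singleton.1 hd
    · intro d hd; rw [Finset.mem_singleton.1 hd]; exact hu
    · rw [ed_singleton]; exact hWF.unh_del ht he heI hut
  obtain ⟨P, hPs, hPf, hPc⟩ := hsafe.flow.clean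
  have hP := hsafe.sub ht hPs hPf hut
  have h1 := hP.flow.start ht hP.src hut
  exact hWF t ht _ _ hW u (stay P u hP hPc _ h1).2 hut t ht (Conn.single he heI).symm

end LC

set_option linter.unusedVariables false

namespace LC
open Classical Cardinal
universe w
variable {V : Type u} {E : Type v} {ι : Type w}

theorem Par.cut_con {I : E → Sym2 V} {F : Set E} {T : Set V} (h : Par I F T) {φ : V → V} (hφ : IsCon T φ) :
    Par (con I φ) F T := by
  intro D hD hf
  rw [LC.cut_con] at hf ⊢
  refine h _ ?_ hf
  rw [Set.disjoint_left] at hD ⊢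
  intro v hv hvT
  have : φ v ∈ D := hv
  rw [hφ.fix v hvT] at this
  exact hD this hvT

theorem cut_split {I : E → Sym2 V} {F : Set E} {D : Set V} (C : Set E) :
    cut I F D = (C ∩ cut I F D) ∪ cut I (F \ C) D := by
  ext b
  constructor
  · intro hb
    by_cases h : b ∈ C
    · exact Or.inl ⟨h, hb⟩
    · exact Or.inr ⟨⟨hb.1, h⟩, hb.2⟩
  · rintro (h | h)
    · exact h.2
    · exact ⟨h.1.1, h.2⟩

theorem cut_count {I : E → Sym2 V} {F C : Set E} {D : Set V} (hC : C.Finite) (hf : (cut I (F \ C) D).Finite) :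
    (cut I F D).Finite ∧ (cut I F D).ncard = (C ∩ cut I F D).ncard + (cut I (F \ C) D).ncard := by
  have h1 : (C ∩ cut I F D).Finite := hC.subset Set.inter_subset_left
  refine ⟨by rw [cut_split C]; exact h1.union hf, ?_⟩
  conv_lhs => rw [cut_split C]
  refine Set.ncard_union_eq ?_ h1 hf
  rw [Set.disjoint_left]
  intro b hb hb'
  exact hb'.1.2 hb.1

/-- removing a terminal link keeps parity -/
theorem Par.del {I : E → Sym2 V} {F : Set E} {T : Set V} (hPar : Par I F T) {Q : Finset (E × V × V)} {t t' : V}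
    (hQ : Flow I F Q t t') (ht : t ∈ T) (ht' : t' ∈ T) : Par I (F \ ed Q) T := by
  intro D hD hf
  obtain ⟨h1, h2⟩ := cut_count (ed_finite Q) hf
  have h3 := hPar D hD h1
  have h4 := hQ.parity F subset_rfl D
  have htD : t ∉ D := fun h => Set.disjoint_left.1 hD h ht
  have htD' : t' ∉ D := fun h => Set.disjoint_left.1 hD h ht'
  rw [if_neg htD, if_neg htD', add_zero, ZMod.natCast_eq_zero_iff_even] at h4
  rw [h2] at h3
  exact (Nat.even_add.1 h3).1 h4

theorem demand {I : E → Sym2 V} {F : Set E} {T : Set V} (hPar : Par I F T) {Q : Finset (E × V × V)} {t x τ : V}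
    (hQ : Flow I F Q t x) (ht : t ∈ T) {S : Set V} {p : E → Finset (E × V × V)}
    (hW : Wave I (F \ ed Q) T τ S p) (hτ : τ ≠ t) (hx : x ∈ S) :
    ∃ p' : Option E → Finset (E × V × V),
      Link I (Ins I (F \ ed Q) S) τ (insert none (some '' cut I (F \ ed Q) S)) (opt x (inE I S)) p' := by
  refine lemC hW.link hx ?_
  intro D hDS hτD hf
  have hD : Disjoint D T := by
    rw [Set.disjoint_left]
    intro v hv hvT
    have := hW.term v (hDS hv) hvT
    subst this
    exact hτD hv
  obtain ⟨h1, h2⟩ := cut_count (ed_finite Q) hf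
  have h3 := hPar D hD h1
  have h4 := hQ.parity F subset_rfl D
  have htD : t ∉ D := fun h => Set.disjoint_left.1 hD h ht
  rw [if_neg htD, zero_add] at h4
  rw [h2] at h3
  by_cases hxD : x ∈ D
  · rw [if_pos hxD, ZMod.natCast_eq_one_iff_odd] at h4
    refine ⟨fun _ => hxD, fun _ => ?_⟩
    rcases Nat.even_or_odd (cut I (F \ ed Q) D).ncard with h | h
    · exact absurd h3 (by rw [Nat.not_even_iff_odd]; exact h4.add_even h)
    · exact h
  · rw [if_neg hxD, ZMod.natCast_eq_zero_iff_even] at h4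
    refine ⟨fun h => ?_, fun h => absurd h hxD⟩
    exact absurd h3 (by rw [Nat.not_even_iff_odd]; exact h4.add_odd h)

theorem demand_wave {I : E → Sym2 V} {G : Set E} {T : Set V} {τ x r : V} {S : Set V} {p : E → Finset (E × V × V)} {f : E}
    (hW : Wave I (G \ {f}) T τ S p) (hf : I f = s(r, x)) (hx : x ∈ S) (hr : r ∉ S)
    {p' : Option E → Finset (E × V × V)}
    (hp' : Link I (Ins I (G \ {f}) S) τ (insert none (some '' cut I (G \ {f}) S)) (opt x (inE I S)) p') :
    ∃ p'', Wave I G T τ S p'' := by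
  have hc : ∀ e ∈ cut I G S, e ≠ f → e ∈ cut I (G \ {f}) S := fun e he hne => ⟨⟨he.1, hne⟩, he.2⟩
  have hfx : inE I S f = x := inE_eq (hf.trans Sym2.eq_swap) hx hr
  have hIns : Ins I (G \ {f}) S ⊆ Ins I G S := Ins_mono Set.sdiff_subset subset_rfl
  let g : E → Option E := fun e => if e = f then none else some e
  have hg : ∀ e ∈ cut I G S, g e ∈ insert none (some '' cut I (G \ {f}) S) := by
    intro e he
    by_cases h : e = f
    · simp [g, h]
    · simp only [g, if_neg h]; exact Or.inr ⟨e, hc e he h, rfl⟩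
  refine ⟨fun e => p' (g e), hW.mem, hW.term, ?_, ?_⟩
  · intro e he
    have h1 := (hp'.flow _ (hg e he)).mono hIns
    by_cases h : e = f
    · subst h
      rw [hfx]
      simp only [g, if_true] at h1 ⊢
      exact h1
    · simp only [g, if_neg h] at h1 ⊢
      exact h1
  · intro e he e' he' hne
    refine hp'.disj _ (hg e he) _ (hg e' he') ?_
    by_cases h : e = f <;> by_cases h' : e' = f
    · exact absurd (h.trans h'.symm) hne
    · simp [g, h, h']
    · simp [g, h, h']
    · simp only [g, if_neg h, if_neg h']; intro h2; exact hne (Option.some_injective _ h2)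

theorem del_used {I : E → Sym2 V} {G : Set E} {T : Set V} {τ x r : V} (hU : Unh I G T τ)
    (hr : ∀ S p, Wave I G T τ S p → r ∉ S) {f : E} (hf : I f = s(r, x)) {S : Set V} {p : E → Finset (E × V × V)}
    (hW : Wave I (G \ {f}) T τ S p) (hx : x ∉ S) {b : E} (hb : b ∈ G \ {f}) {b' : V} (hbb : I b = s(τ, b'))
    (hbt : b' ≠ τ) : Used I (G \ {f}) S p b := by
  by_cases hrS : r ∈ S
  · rcases Rm hU hW hf hrS hx with ⟨p', hp'⟩ | h
    · exact absurd hrS (hr _ _ hp')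
    · exact h b hb b' hbb hbt
  · have hcut : cut I G S ⊆ G \ {f} := by
      rintro g ⟨hg, a, c, hac, ha, hc⟩
      refine ⟨hg, ?_⟩
      rintro rfl
      rw [hf, Sym2.eq_iff] at hac
      rcases hac with ⟨rfl, rfl⟩ | ⟨rfl, rfl⟩ <;> contradiction
    rcases hU S p (hW.back Set.sdiff_subset hcut) b hb.1 b' hbb hbt with h | ⟨h, hh, hbp⟩
    · exact Or.inl ⟨hb, h.2⟩
    · exact Or.inr ⟨h, ⟨hcut hh, hh.2⟩, hbp⟩

/-- one step of the token -/
theorem tok_step {I : E → Sym2 V} {F : Set E} {T : Set V} (hPar : Par I F T) {Q : Finset (E × V × V)} {t r x τ : V}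
    {f : E} (hQ : Flow I F (Q ∪ {(f, r, x)}) t x) (ht : t ∈ T) (hτ : τ ≠ t) (hf : I f = s(r, x))
    (hU : Unh I (F \ ed Q) T τ) (hr : ∀ S p, Wave I (F \ ed Q) T τ S p → r ∉ S)
    (hx : ∀ S p, Wave I (F \ ed Q) T τ S p → x ∉ S) :
    Unh I (F \ ed (Q ∪ {(f, r, x)})) T τ ∧ ∀ S p, Wave I (F \ ed (Q ∪ {(f, r, x)})) T τ S p → x ∉ S := by
  have hed : F \ ed (Q ∪ {(f, r, x)}) = (F \ ed Q) \ {f} := by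
    rw [ed_union, ed_singleton, Set.sdiff_sdiff]
  have h2 : ∀ S p, Wave I (F \ ed (Q ∪ {(f, r, x)})) T τ S p → x ∉ S := by
    intro S p hW hxS
    obtain ⟨p', hp'⟩ := demand hPar hQ ht hW hτ hxS
    rw [hed] at hW hp'
    by_cases hrS : r ∈ S
    · refine hr S p (hW.back Set.sdiff_subset ?_) hrS
      rintro g ⟨hg, a, c, hac, ha, hc⟩
      refine ⟨hg, ?_⟩
      rintro rfl
      rw [hf, Sym2.eq_iff] at hac
      rcases hac with ⟨rfl, rfl⟩ | ⟨rfl, rfl⟩ <;> contradiction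
    · obtain ⟨p'', hp''⟩ := demand_wave hW hf hxS hrS hp'
      exact hx _ _ hp'' hxS
  refine ⟨?_, h2⟩
  intro S p hW b hb b' hbb hbt
  have hxS := h2 S p hW
  rw [hed] at hW hb ⊢
  exact del_used hU hr hf hW hxS hb hbb hbt

structure St (I : E → Sym2 V) (F : Set E) (T : Set V) (φ : V → V)
    (p : V → E → Finset (E × V × V)) : Prop where
  cs : CS I F T φ p
  nt : ∀ t ∈ T, ∀ e ∈ cut I F {v | φ v = t}, ∀ d ∈ p t e, d.2.2 ≠ t
  cov : ∀ t ∈ T, ∀ b ∈ F, ∀ b', I b = s(t, b') → b' ≠ t → Used I F {v | φ v = t} (p t) b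

theorem St.triv (I : E → Sym2 V) (F : Set E) (T : Set V) : St I F T id (fun _ _ => ∅) := by
  refine ⟨CS.triv I F T, fun t ht e he d hd => absurd hd (Finset.notMem_empty _), ?_⟩
  intro t ht b hb b' hbb hbt
  exact Or.inl ⟨hb, t, b', hbb, rfl, hbt⟩

theorem St.comp {I : E → Sym2 V} {F : Set E} {T : Set V} {φ : V → V} {p : V → E → Finset (E × V × V)}
    (h : St I F T φ p) (hU : ∀ t ∈ T, Unh (con I φ) F T t) :
    ∃ ψ p', St I F T ψ p' ∧ WF (con I ψ) F T ∧ ∀ t ∈ T, {v | φ v = t} ⊆ {v | ψ v = t} := by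
  obtain ⟨ψ, q0, hq0, hWF⟩ := max_CS (con I φ) F T
  obtain ⟨q, hq, hcl⟩ := hq0.clean
  obtain ⟨p', hp', hp2⟩ := h.cs.comp hq (fun t ht e he => (hcl t ht e he).2)
  refine ⟨ψ ∘ φ, p', ⟨hp', ?_, ?_⟩, by rw [← con_con]; exact hWF, fun t ht => (hp2 t ht).1.1⟩
  · intro t ht e he d hd hdt
    obtain ⟨g, hg, hd'⟩ := (hp2 t ht).2.2 e he d hd (by rw [hdt]; exact h.cs.con.fix t ht)
    exact h.nt t ht g hg d hd' hdt
  · intro t ht b hb b' hbb hbt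
    have key : ∀ g ∈ cut I F {v | φ v = t}, Used (con I φ) F {v | ψ v = t} (q t) g := by
      rintro g ⟨hg, a, c, hac, ha, hc⟩
      have ha : φ a = t := ha
      refine hU t ht _ _ (hq.wave t ht) g hg (φ c) ?_ hc
      rw [con_eq hac, ha]
    rcases h.cov t ht b hb b' hbb hbt with h1 | ⟨g, hg, hbg⟩
    · rcases (hp2 t ht).2.1 b h1 (key b h1) with h2 | ⟨e, he, h2, -⟩
      · exact Or.inl h2.1
      · exact Or.inr ⟨e, he, h2⟩
    · rcases (hp2 t ht).2.1 g hg (key g hg) with h2 | ⟨e, he, -, h2⟩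
      · exact Or.inr ⟨g, h2.1, by rw [h2.2]; exact hbg⟩
      · exact Or.inr ⟨e, he, ed_mono h2 hbg⟩

/-- waves of other terminals in a contraction -/
theorem Wave.uncon {I : E → Sym2 V} {G : Set E} {T : Set V} {τ τ' : V} {Y S : Set V} {q : E → Finset (E × V × V)}
    (hτY : τ' ∈ Y) (hτ' : τ' ∈ T) (hne : τ ≠ τ') (hτ : τ ∉ Y)
    (hW : Wave (con I (colX Y τ')) G T τ S q) : Wave I G T τ {v | colX Y τ' v ∈ S} q := by
  have hfix : ∀ v, colX Y τ' v ∈ S → v ∉ Y ∧ colX Y τ' v = v := by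
    intro v hv
    have h1 : v ∉ Y := by
      intro h
      rw [colX, if_pos h] at hv
      exact hne (hW.term _ hv hτ').symm
    exact ⟨h1, by rw [colX, if_neg h1]⟩
  refine ⟨?_, ?_, ?_, ?_⟩
  · show colX Y τ' τ ∈ S
    rw [colX, if_neg hτ]; exact hW.mem
  · intro x hx hxT
    have h1 : colX Y τ' x ∈ S := hx
    rw [(hfix x hx).2] at h1
    exact hW.term x h1 hxT
  · intro e he
    have h1 := hW.link.flow e (by rw [LC.cut_con]; exact he)
    rw [inE_con he, (hfix _ (inE_mem he).1).2] at h1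
    have key : ∀ d ∈ q e, I d.1 = s(d.2.1, d.2.2) ∧ d.1 ∈ Ins I G {v | colX Y τ' v ∈ S} := by
      intro d hd
      obtain ⟨a, b, hab, ha, hb⟩ := con_ex (h1.inc d hd)
      have h2 := (mem_Ins (h1.inc d hd)).1 (h1.mem d hd)
      rw [← ha, ← hb] at h2
      refine ⟨?_, (mem_Ins hab).2 ⟨h2.1, h2.2.1, h2.2.2⟩⟩
      rw [← ha, ← hb, (hfix a h2.2.1).2, (hfix b h2.2.2).2]; exact hab
    exact ⟨fun d hd => (key d hd).2, fun d hd => (key d hd).1, h1.inj, h1.pot⟩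
  · intro e he e' he'
    exact hW.link.disj e (by rw [LC.cut_con]; exact he) e' (by rw [LC.cut_con]; exact he')

theorem finish {I : E → Sym2 V} {G : Set E} {T : Set V} {τ r x : V} (hτ : τ ∈ T) {Y : Set V} {pY : E → Finset (E × V × V)}
    (hY : Wave I G T τ Y pY) (hmax : ∀ S p, Wave I G T τ S p → S ⊆ Y)
    (hcl : ∀ e ∈ cut I G Y, Clean (pY e) τ (inE I Y e)) {f : E} (hfG : f ∈ G) (hf : I f = s(r, x)) (hx : x ∈ Y)
    (hU : Unh I G T τ) (hr : r ∉ Y)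
    (hO : ∀ σ ∈ T, σ ≠ τ → ∀ S p, Wave I (G \ {f}) T σ S p → x ∉ S → ∀ b ∈ G \ {f}, ∀ b', I b = s(σ, b') → b' ≠ σ →
      Used I (G \ {f}) S p b) :
    ∃ φ p, St I (G \ ({f} ∪ ed (pY f))) T φ p ∧ ∀ σ ∈ T, Unh (con I φ) (G \ ({f} ∪ ed (pY f))) T σ := by
  have hfc : f ∈ cut I G Y := ⟨hfG, x, r, hf.trans Sym2.eq_swap, hx, hr⟩
  have hfl := hY.link.flow f hfc
  set F' := G \ ({f} ∪ ed (pY f)) with hF'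
  have hF'G : F' ⊆ G := Set.sdiff_subset
  have hY' : Wave I F' T τ Y pY := by
    refine hY.change (cut_mono hF'G) ?_
    intro e he b hb
    have hec : e ∈ cut I G Y := cut_mono hF'G he
    have hbI := (hY.link.flow e hec).ed_sub hb
    refine ⟨hbI.1, ?_⟩
    rintro (h | h)
    · rw [Set.mem_singleton_iff] at h; subst h; exact cut_Ins hfc hbI
    · have := hY.link.uniq hec hfc hb h
      subst this
      exact he.1.2 (Or.inl rfl)
  have hTY : ∀ σ ∈ T, σ ≠ τ → σ ∉ Y := fun σ hσ hne h => hne (hY.term σ h hσ)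
  have hpre : ∀ σ ∈ T, σ ≠ τ → {v | colX Y τ v = σ} = {σ} := by
    intro σ hσ hne
    ext v
    simp only [colX, Set.mem_ofPred_eq, Set.mem_singleton_iff]
    by_cases hv : v ∈ Y
    · simp only [hv, if_true]; constructor
      · intro h; exact absurd h.symm hne
      · rintro rfl; exact absurd hv (hTY _ hσ hne)
    · simp [hv]
  refine ⟨colX Y τ, _, ⟨hY'.cs hτ, ?_, ?_⟩, ?_⟩
  · intro σ hσ e he d hd
    by_cases hst : σ = τ
    · subst hst
      simp only [if_true] at hd
      rw [colX_pre hY.mem] at he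
      exact (hcl e (cut_mono hF'G he)).no_tgt d hd
    · simp only [if_neg hst] at hd
      exact absurd hd (Finset.notMem_empty _)
  · intro σ hσ b hb b' hbb hbt
    by_cases hst : σ = τ
    · subst hst
      simp only [if_true]
      rw [colX_pre hY.mem]
      rcases hU Y pY hY b hb.1 b' hbb hbt with h | ⟨h, hh, hbh⟩
      · exact Or.inl ⟨hb, h.2⟩
      · by_cases hhf : h = f
        · subst hhf; exact absurd (Or.inr hbh) hb.2
        · refine Or.inr ⟨h, ⟨⟨hh.1, ?_⟩, hh.2⟩, hbh⟩
          rintro (h1 | h1)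
          · exact hhf h1
          · exact cut_Ins hh (hfl.ed_sub h1)
    · rw [hpre σ hσ hst]
      exact Or.inl ⟨hb, σ, b', hbb, rfl, hbt⟩
  · intro σ hσ S q0 hS0 b hb b' hbb hbt
    by_cases hst : σ = τ
    · subst hst
      obtain ⟨q, hS, hq⟩ := hS0.clean
      have hX : Wave I F' T σ {v | colX Y σ v = σ} pY := by rw [colX_pre hY.mem]; exact hY'
      obtain ⟨p', hp', -⟩ := Lift (hY.isCon hσ) hσ hX hS fun e he => (hq e he).2
      have hYS : Y ⊆ {v | colX Y σ v ∈ S} := by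
        intro v hv
        show colX Y σ v ∈ S
        rw [colX, if_pos hv]; exact hS.mem
      have hsub : {v | colX Y σ v ∈ S} ⊆ Y := by
        have hnl : ∀ g ∈ cut I G {v | colX Y σ v ∈ S}, g ≠ f → g ∈ cut I F' {v | colX Y σ v ∈ S} := by
          intro g hg hgf
          refine ⟨⟨hg.1, ?_⟩, hg.2⟩
          rintro (h1 | h1)
          · exact hgf h1
          · have := hfl.ed_sub h1
            exact cut_Ins hg (F' := G) ⟨this.1, fun v hv => hYS (this.2 v hv)⟩
        by_cases hrS : r ∈ {v | colX Y σ v ∈ S}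
        · refine hmax _ p' (hp'.back hF'G ?_)
          intro g hg
          refine (hnl g hg ?_).1
          rintro rfl
          exact cut_Ins hg ((mem_Ins (F := G) hf).2 ⟨hfG, hrS, hYS hx⟩)
        · refine hmax _ (fun g => if g = f then pY f else p' g) ⟨hp'.mem, hp'.term, ?_, ?_⟩
          · intro g hg
            by_cases hgf : g = f
            · subst hgf
              simp only [if_true]
              rw [inE_eq (hf.trans Sym2.eq_swap) (hYS hx) hrS]
              rw [inE_eq (hf.trans Sym2.eq_swap) hx hr] at hfl
              exact hfl.mono (Ins_mono subset_rfl hYS)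
            · simp only [if_neg hgf]
              exact (hp'.link.flow g (hnl g hg hgf)).mono (Ins_mono hF'G subset_rfl)
          · have key : ∀ g ∈ cut I G {v | colX Y σ v ∈ S}, g ≠ f → Disjoint (ed (pY f)) (ed (p' g)) := by
              intro g hg hgf
              rw [Set.disjoint_left]
              intro a ha ha'
              exact ((hp'.link.flow g (hnl g hg hgf)).ed_sub ha').1.2 (Or.inr ha)
            intro g hg g' hg' hne
            by_cases h1 : g = f <;> by_cases h2 : g' = f
            · exact absurd (h1.trans h2.symm) hne
            · simp only [if_pos h1, if_neg h2]; exact key g' hg' h2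
            · simp only [if_neg h1, if_pos h2]; exact (key g hg h1).symm
            · simp only [if_neg h1, if_neg h2]; exact hp'.link.disj g (hnl g hg h1) g' (hnl g' hg' h2) hne
      obtain ⟨a, c, hac, ha, hc⟩ := con_ex hbb
      left
      refine ⟨hb, σ, b', hbb, hS0.mem, ?_⟩
      intro hbS
      rw [← hc] at hbS hbt
      have hcY := hsub hbS
      rw [colX, if_pos hcY] at hbt
      exact hbt rfl
    · have hcut : cut (con I (colX Y τ)) (G \ {f}) S ⊆ F' := by
        intro g hg
        refine ⟨hg.1.1, ?_⟩
        rintro (h1 | h1)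
        · exact hg.1.2 h1
        · have h2 := hfl.ed_sub h1
          obtain ⟨-, a, c, hac, ha, hc⟩ := hg
          obtain ⟨a', c', hac', ha', hc'⟩ := con_ex hac
          have h3 := (mem_Ins hac').1 h2
          rw [colX, if_pos h3.2.1] at ha'
          rw [colX, if_pos h3.2.2] at hc'
          exact hc (hc' ▸ ha' ▸ ha)
      have hFs : F' ⊆ G \ {f} := fun b hb => ⟨hb.1, fun h => hb.2 (Or.inl h)⟩
      have hS1 := hS0.back hFs hcut
      have hS2 := hS1.uncon hY.mem hτ hst (hTY σ hσ hst)
      obtain ⟨a, c, hac, ha, hc⟩ := con_ex hbb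
      have haσ : a = σ := by
        have h1 : a ∈ {v | colX Y τ v = σ} := ha
        rw [hpre σ hσ hst] at h1; exact h1
      subst haσ
      have hca : c ≠ a := by
        rintro rfl; exact hbt (hc.symm.trans ha)
      have hxS : x ∉ {v | colX Y τ v ∈ S} := by
        intro h
        have h : colX Y τ x ∈ S := h
        rw [colX, if_pos hx] at h
        exact hst (hS0.term τ h hτ).symm
      rcases hO a hσ hst _ _ hS2 hxS b (hFs hb) c hac hca with h | ⟨h, hh, hbh⟩
      · rw [← LC.cut_con] at h; exact Or.inl ⟨hb, h.2⟩
      · rw [← LC.cut_con] at hh; exact Or.inr ⟨h, ⟨hcut hh, hh.2⟩, hbh⟩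

end LC

set_option linter.unusedVariables false

namespace LC
open Classical Cardinal
universe w
variable {V : Type u} {E : Type v} {ι : Type w}

/-- a link between terminals starting with a prescribed edge -/
structure TLink (I : E → Sym2 V) (F : Set E) (T : Set V) (L : Finset (E × V × V)) (t t' : V) : Prop where
  flow : Flow I F L t t'
  mem : t ∈ T
  mem' : t' ∈ T
  ne : t' ≠ t
  src : ∀ d ∈ L, d.2.1 ∈ T → d.2.1 = t
  tgt : ∀ d ∈ L, d.2.2 ∈ T → d.2.2 = t'

theorem K_run {I : E → Sym2 V} {F : Set E} {T : Set V} (hPar : Par I F T) {t t' u : V} (ht : t ∈ T)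
    {e : E} {P : Finset (E × V × V)} (hP : Flow I F P t t') (ht' : t' ∈ T) (htt : t' ≠ t)
    (hs : ∀ d ∈ P, d.2.1 ∈ T → d = (e, t, u)) (htg : ∀ d ∈ P, d.2.2 ∈ T → d.2.2 = t')
    (hUP : Unh I (F \ ed P) T t) (n : ℕ) :
    ∀ (Q : Finset (E × V × V)) (r : V), (P \ Q).card = n → Q ⊆ P → Flow I F Q t r → (e, t, u) ∈ Q → r ∉ T →
      (∀ d ∈ Q, d.2.2 ∉ T) →
      (∀ τ ∈ T, τ ≠ t → Unh I (F \ ed Q) T τ ∧ ∀ S p, Wave I (F \ ed Q) T τ S p → r ∉ S) →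
      ∃ L τ, TLink I F T L t τ ∧ e ∈ ed L ∧ ∃ φ p, St I (F \ ed L) T φ p ∧ ∀ σ ∈ T, Unh (con I φ) (F \ ed L) T σ := by
  induction n using Nat.strong_induction_on with
  | _ n ih =>
  intro Q r hn hQP hQ heQ hrT hQT hinv
  have hrt' : r ≠ t' := fun h => hrT (h ▸ ht')
  have hrest := hP.sdiff hQ hQP
  obtain ⟨⟨f, r', x⟩, hd, hdr, hdx⟩ := hrest.first hrt'
  simp only at hdr hdx
  subst hdr
  rw [Finset.mem_sdiff] at hd
  have hfI : I f = s(r', x) := hP.inc _ hd.1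
  have hfF : f ∈ F := hP.mem _ hd.1
  have hfQ : f ∉ ed Q := by
    rintro ⟨d, hdQ, hdf⟩
    have := hP.inj _ (hQP hdQ) _ hd.1 hdf
    subst this
    exact hd.2 hdQ
  have hdisj : Disjoint (ed Q) (ed {(f, r', x)}) := by
    rw [ed_singleton, Set.disjoint_singleton_right]; exact hfQ
  have hQf : Flow I F (Q ∪ {(f, r', x)}) t x := hQ.append (Flow.single hfF hfI) hdisj
  have hQfP : Q ∪ {(f, r', x)} ⊆ P := by
    intro d hd'
    rcases Finset.mem_union.1 hd' with h | h
    · exact hQP h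
    · rw [Finset.mem_singleton.1 h]; exact hd.1
  have htP : ∀ d ∈ P, d ∉ Q → t ∉ I d.1 := by
    intro d hdP hdQ hti
    rw [hP.inc d hdP, Sym2.mem_iff] at hti
    rcases hti with h | h
    · have := hs d hdP (h ▸ ht)
      subst this; exact hdQ heQ
    · exact htt ((htg d hdP (h ▸ ht)).symm.trans h.symm)
  by_cases hx : ∃ τ ∈ T, τ ≠ t ∧ ∃ S p, Wave I (F \ ed Q) T τ S p ∧ x ∈ S
  · obtain ⟨τ, hτ, hτt, S, pS, hS, hxS⟩ := hx
    obtain ⟨Y, pY0, hY0, hmax⟩ := max_wave I (F \ ed Q) (T := T) hτ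
    obtain ⟨pY, hY, hcl⟩ := hY0.clean
    have hxY : x ∈ Y := hmax _ _ hS hxS
    have hrY : r' ∉ Y := (hinv τ hτ hτt).2 _ _ hY
    have hfG : f ∈ F \ ed Q := ⟨hfF, hfQ⟩
    have hfc : f ∈ cut I (F \ ed Q) Y := ⟨hfG, x, r', hfI.trans Sym2.eq_swap, hxY, hrY⟩
    have hfl := hY.link.flow f hfc
    rw [inE_eq (hfI.trans Sym2.eq_swap) hxY hrY] at hfl
    have hfin := finish hτ hY hmax (fun e he => (hcl e he).2) hfG hfI hxY (hinv τ hτ hτt).1 hrY (by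
      intro σ hσ hστ S p hW hxS b hb b' hbb hbt
      by_cases hσt : σ = t
      · subst hσt
        have hU : Unh I ((F \ ed Q) \ {f}) T σ := by
          refine Add_finite (C := ed (P \ (Q ∪ {(f, r', x)}))) (ed_finite _) ?_ ?_
          · rw [Set.sdiff_sdiff, Set.sdiff_sdiff]
            have : ed Q ∪ ({f} ∪ ed (P \ (Q ∪ {(f, r', x)}))) = ed P := by
              have h1 : P = Q ∪ ({(f, r', x)} ∪ (P \ (Q ∪ {(f, r', x)}))) := by
                rw [← Finset.union_assoc, Finset.union_sdiff_of_subset hQfP]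
              conv_rhs => rw [h1]
              rw [ed_union, ed_union, ed_singleton]
            rw [this]; exact hUP
          · rintro g ⟨d, hd', rfl⟩
            rw [Finset.mem_sdiff] at hd'
            exact htP d hd'.1 (fun h => hd'.2 (Finset.mem_union_left _ h))
        exact hU S p hW b hb b' hbb hbt
      · exact del_used (hinv σ hσ hσt).1 (hinv σ hσ hσt).2 hfI hW hxS hb hbb hbt)
    have hd1 : Disjoint (ed (Q ∪ {(f, r', x)})) (ed (rev (pY f))) := by
      rw [ed_rev, ed_union, ed_singleton, Set.disjoint_left]
      rintro g hg hg'
      have hgI := hfl.ed_sub hg'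
      rcases hg with hg | hg
      · exact hgI.1.2 hg
      · rw [Set.mem_singleton_iff] at hg; subst hg; exact cut_Ins hfc hgI
    have hflow := hQf.append ((hfl.mono (Ins_sub.trans Set.sdiff_subset)).rev) hd1
    have hedL : F \ ed (Q ∪ {(f, r', x)} ∪ rev (pY f)) = (F \ ed Q) \ ({f} ∪ ed (pY f)) := by
      rw [ed_union, ed_union, ed_singleton, ed_rev, Set.sdiff_sdiff, Set.union_assoc]
    have hrevY : ∀ d ∈ rev (pY f), d.2.1 ∈ Y ∧ d.2.2 ∈ Y ∧ d.2.1 ≠ τ := by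
      rintro ⟨g, a, b⟩ hg
      rw [mem_rev] at hg
      have h1 := (mem_Ins (hfl.inc _ hg)).1 (hfl.mem _ hg)
      exact ⟨h1.2.2, h1.2.1, (hcl f hfc).2.no_tgt _ hg⟩
    refine ⟨Q ∪ {(f, r', x)} ∪ rev (pY f), τ, ⟨hflow, ht, hτ, hτt, ?_, ?_⟩, ?_, by rw [hedL]; exact hfin⟩
    · intro d hd' hdT
      rcases Finset.mem_union.1 hd' with h | h
      · rw [hs d (hQfP h) hdT]
      · exact absurd (hY.term _ (hrevY d h).1 hdT) (hrevY d h).2.2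
    · intro d hd' hdT
      rcases Finset.mem_union.1 hd' with h | h
      · rcases Finset.mem_union.1 h with h | h
        · exact absurd hdT (hQT d h)
        · rw [Finset.mem_singleton.1 h] at hdT ⊢
          exact hY.term x hxY hdT
      · exact hY.term _ (hrevY d h).2.1 hdT
    · rw [ed_union, ed_union]; exact Or.inl (Or.inl (mem_ed heQ))
  · have hx' : ∀ τ ∈ T, τ ≠ t → ∀ S p, Wave I (F \ ed Q) T τ S p → x ∉ S :=
      fun τ hτ hne S p hW hxS => hx ⟨τ, hτ, hne, S, p, hW, hxS⟩
    have hxT : x ∉ T := by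
      intro h
      have h1 : x = t' := htg _ hd.1 h
      exact hx' x h (h1 ▸ htt) _ _ (Wave.triv I _ T x) rfl
    refine ih (P \ (Q ∪ {(f, r', x)})).card ?_ (Q ∪ {(f, r', x)}) x rfl hQfP hQf (Finset.mem_union_left _ heQ) hxT ?_ ?_
    · rw [← hn]
      apply Finset.card_lt_card
      refine ⟨Finset.sdiff_subset_sdiff subset_rfl Finset.subset_union_left, fun h => ?_⟩
      exact (Finset.mem_sdiff.1 (h (Finset.mem_sdiff.2 hd))).2 (Finset.mem_union_right _ (Finset.mem_singleton_self _))
    · intro d hd'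
      rcases Finset.mem_union.1 hd' with h | h
      · exact hQT d h
      · rw [Finset.mem_singleton.1 h]; exact hxT
    · intro τ hτ hne
      exact tok_step hPar hQf ht hne hfI (hinv τ hτ hne).1 (hinv τ hτ hne).2 (hx' τ hτ hne)

theorem K {I : E → Sym2 V} {F : Set E} {T : Set V} (hPar : Par I F T) (hWF : WF I F T) {t u : V} (ht : t ∈ T)
    {e : E} (he : e ∈ F) (heI : I e = s(t, u)) (hut : u ≠ t) :
    ∃ L τ, TLink I F T L t τ ∧ e ∈ ed L ∧ ∃ φ p, St I (F \ ed L) T φ p ∧ ∀ σ ∈ T, Unh (con I φ) (F \ ed L) T σ := by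
  by_cases hu : u ∈ T
  · refine ⟨{(e, t, u)}, u, ⟨Flow.single he heI, ht, hu, hut, ?_, ?_⟩, by rw [ed_singleton]; rfl, id, _,
      St.triv I _ T, ?_⟩
    · intro d hd _; rw [Finset.mem_singleton.1 hd]
    · intro d hd _; rw [Finset.mem_singleton.1 hd]
    · intro σ hσ
      rw [con_id, ed_singleton]
      by_cases h1 : σ = t
      · subst h1; exact hWF.unh_del ht he heI hut
      by_cases h2 : σ = u
      · subst h2; exact hWF.unh_del hu he (heI.trans Sym2.eq_swap) hut.symm
      · exact (hWF.unh hσ).del heI (fun S p hW h => h1 (hW.term t h ht).symm) (fun S p hW h => h2 (hW.term u h hu).symm)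
  · obtain ⟨P, t', hP, ht', htt, hs, htg, hUP⟩ := T1 hPar hWF ht he heI hu
    have hst := hP.start ht hs htt
    refine K_run hPar ht hP ht' htt hs htg hUP _ {(e, t, u)} u rfl ?_ (Flow.single he heI)
      (Finset.mem_singleton_self _) hu ?_ ?_
    · intro d hd; rw [Finset.mem_singleton.1 hd]; exact hst
    · intro d hd; rw [Finset.mem_singleton.1 hd]; exact hu
    · intro τ hτ hne
      have h0 : F \ ed (∅ : Finset (E × V × V)) = F := by rw [ed_empty]; simp
      have hu' : ∀ S p, Wave I F T τ S p → u ∉ S := by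
        intro S p hW h
        exact hWF τ hτ S p hW u h (fun h => hu (h ▸ hτ)) t ht (Conn.single he heI).symm
      have := tok_step (Q := ∅) (f := e) (r := t) hPar (by rw [Finset.empty_union]; exact Flow.single he heI) ht hne heI
        (by rw [h0]; exact hWF.unh hτ) (by rw [h0]; intro S p hW h; exact hne (hW.term t h ht).symm)
        (by rw [h0]; exact hu')
      rw [Finset.empty_union] at this
      exact this

end LC

set_option linter.unusedVariables false

namespace LC
open Classical Cardinal
universe w
variable {V : Type u} {E : Type v} {ι : Type w}

theorem Flow.src_one {I : E → Sym2 V} {F : Set E} {p : Finset (E × V × V)} {a b : V} (h : Flow I F p a b)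
    (hn : ∀ d ∈ p, d.2.2 ≠ a) : (p.filter (fun d => d.2.1 = a)).card = if b = a then 0 else 1 := by
  have h1 := h.pot (fun v => if v = a then 1 else 0)
  have h2 : ∑ d ∈ p, ((if d.2.1 = a then (1 : ℤ) else 0) - (if d.2.2 = a then 1 else 0)) =
      ((p.filter (fun d => d.2.1 = a)).card : ℤ) := by
    rw [Finset.card_filter]
    push_cast
    refine Finset.sum_congr rfl fun d hd => ?_
    rw [if_neg (hn d hd), sub_zero]
  rw [h2] at h1
  by_cases hb : b = a
  · simp only [hb, if_true, sub_self] at h1 ⊢; exact_mod_cast h1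
  · simp only [hb, if_true, if_false, sub_zero] at h1 ⊢; exact_mod_cast h1

theorem Flow.src_uniq {I : E → Sym2 V} {F : Set E} {p : Finset (E × V × V)} {a b : V} (h : Flow I F p a b)
    (hn : ∀ d ∈ p, d.2.2 ≠ a) {d d' : E × V × V} (hd : d ∈ p) (hd' : d' ∈ p) (h1 : d.2.1 = a) (h2 : d'.2.1 = a) :
    d = d' ∧ b ≠ a := by
  have h3 := h.src_one hn
  have h4 : d ∈ p.filter (fun d => d.2.1 = a) := Finset.mem_filter.2 ⟨hd, h1⟩
  have h5 : d' ∈ p.filter (fun d => d.2.1 = a) := Finset.mem_filter.2 ⟨hd', h2⟩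
  by_cases hb : b = a
  · rw [if_pos hb, Finset.card_eq_zero] at h3
    rw [h3] at h4; exact absurd h4 (Finset.notMem_empty _)
  · rw [if_neg hb, Finset.card_eq_one] at h3
    obtain ⟨x, hx⟩ := h3
    rw [hx, Finset.mem_singleton] at h4 h5
    exact ⟨h4.trans h5.symm, hb⟩

theorem Ins_disj {I : E → Sym2 V} {F F' : Set E} {S S' : Set V} {e : E} (h : e ∈ Ins I F S) (h' : e ∈ Ins I F' S') :
    ∃ v, v ∈ S ∧ v ∈ S' := by
  obtain ⟨a, b, hab⟩ := Sym2_ex (I e)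
  have : a ∈ I e := by rw [hab]; exact Sym2.mem_mk_left a b
  exact ⟨a, h.2 a this, h'.2 a this⟩

theorem St.clean {I : E → Sym2 V} {F : Set E} {T : Set V} {φ : V → V} {p : V → E → Finset (E × V × V)}
    (h : St I F T φ p) : ∃ p', St I F T φ p' ∧
      ∀ t ∈ T, ∀ e ∈ cut I F {v | φ v = t}, Clean (p' t e) t (inE I {v | φ v = t} e) := by
  obtain ⟨q, hq, hcl⟩ := h.cs.clean
  refine ⟨q, ⟨hq, fun t ht e he d hd => h.nt t ht e he d ((hcl t ht e he).1 hd), ?_⟩,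
    fun t ht e he => (hcl t ht e he).2⟩
  intro t ht b hb b' hbb hbt
  rcases h.cov t ht b hb b' hbb hbt with h1 | ⟨g, hg, d, hd, hdb⟩
  · exact Or.inl h1
  · refine Or.inr ⟨g, hg, ?_⟩
    have hfl := (h.cs.wave t ht).link.flow g hg
    have hfl' := (hq.wave t ht).link.flow g hg
    have hdt : d.2.1 = t := by
      have h2 := hfl.inc d hd
      rw [hdb, hbb, Sym2.eq_iff] at h2
      rcases h2 with h2 | h2
      · exact h2.1.symm
      · exact absurd h2.1.symm (h.nt t ht g hg d hd)
    have hne := (hfl.src_uniq (h.nt t ht g hg) hd hd hdt hdt).2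
    obtain ⟨d0, hd0, hd0t, -⟩ := hfl'.first hne.symm
    have := (hfl.src_uniq (h.nt t ht g hg) hd ((hcl t ht g hg).1 hd0) hdt hd0t).1
    exact ⟨d0, hd0, by rw [← this]; exact hdb⟩

theorem St.compose {I : E → Sym2 V} {F : Set E} {T : Set V} {φ ψ : V → V} {p q0 : V → E → Finset (E × V × V)}
    (h : St I F T φ p) (h' : St (con I φ) F T ψ q0) : ∃ p', St I F T (ψ ∘ φ) p' := by
  obtain ⟨q, hq, hcl⟩ := h'.clean
  obtain ⟨p', hp', hp2⟩ := h.cs.comp hq.cs hcl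
  refine ⟨p', hp', ?_, ?_⟩
  · intro t ht e he d hd hdt
    obtain ⟨g, hg, hd'⟩ := (hp2 t ht).2.2 e he d hd (by rw [hdt]; exact h.cs.con.fix t ht)
    exact h.nt t ht g hg d hd' hdt
  · intro t ht b hb b' hbb hbt
    have key : ∀ g ∈ cut I F {v | φ v = t}, Used (con I φ) F {v | ψ v = t} (q t) g := by
      rintro g ⟨hg, a, c, hac, ha, hc⟩
      have ha : φ a = t := ha
      refine hq.cov t ht g hg (φ c) ?_ hc
      rw [con_eq hac, ha]
    rcases h.cov t ht b hb b' hbb hbt with h1 | ⟨g, hg, hbg⟩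
    · rcases (hp2 t ht).2.1 b h1 (key b h1) with h2 | ⟨e, he, h2, -⟩
      · exact Or.inl h2.1
      · exact Or.inr ⟨e, he, h2⟩
    · rcases (hp2 t ht).2.1 g hg (key g hg) with h2 | ⟨e, he, -, h2⟩
      · exact Or.inr ⟨g, h2.1, by rw [h2.2]; exact hbg⟩
      · exact Or.inr ⟨e, he, ed_mono h2 hbg⟩

/-- removing loops -/
theorem cut_unloop {I : E → Sym2 V} {F1 F2 : Set E} (h12 : F1 ⊆ F2)
    (hl : ∀ e ∈ F2, e ∉ F1 → ∃ x, I e = s(x, x)) (S : Set V) : cut I F2 S = cut I F1 S := by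
  ext e
  refine ⟨fun h => ⟨?_, h.2⟩, fun h => cut_mono h12 h⟩
  by_contra hn
  obtain ⟨x, hx⟩ := hl e h.1 hn
  obtain ⟨-, a, b, hab, ha, hb⟩ := h
  rw [hx, Sym2.eq_iff] at hab
  rcases hab with ⟨rfl, rfl⟩ | ⟨rfl, rfl⟩ <;> exact hb ha

theorem St.unloop {I : E → Sym2 V} {F1 F2 : Set E} {T : Set V} {φ : V → V} {p : V → E → Finset (E × V × V)}
    (h12 : F1 ⊆ F2) (hl : ∀ e ∈ F2, e ∉ F1 → ∃ x, I e = s(x, x)) (h : St I F2 T φ p) :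
    St I F1 T φ (fun t e => (p t e).filter (fun d => d.2.1 ≠ d.2.2)) := by
  have hc := cut_unloop h12 hl
  refine ⟨⟨h.cs.con, fun t ht => ⟨(h.cs.wave t ht).mem, (h.cs.wave t ht).term, ?_, ?_⟩⟩, ?_, ?_⟩
  · intro e he
    rw [← hc] at he
    have hf := (h.cs.wave t ht).link.flow e he
    refine ⟨?_, fun d hd => hf.inc d (Finset.mem_filter.1 hd).1, fun d hd d' hd' => hf.inj d (Finset.mem_filter.1 hd).1 d' (Finset.mem_filter.1 hd').1, ?_⟩
    · intro d hd
      rw [Finset.mem_filter] at hd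
      have h1 := hf.mem d hd.1
      refine ⟨?_, h1.2⟩
      by_contra hn
      obtain ⟨x, hx⟩ := hl _ h1.1 hn
      rw [hf.inc d hd.1, Sym2.eq_iff] at hx
      rcases hx with hx | hx <;> exact hd.2 (hx.1.trans hx.2.symm)
    · intro g
      rw [← hf.pot g]
      refine Finset.sum_filter_of_ne ?_
      intro d hd h1 h2
      rw [h2, sub_self] at h1; exact h1 rfl
  · intro e he e' he' hne
    rw [← hc] at he he'
    exact ((h.cs.wave t ht).link.disj e he e' he' hne).mono (ed_mono (Finset.filter_subset _ _)) (ed_mono (Finset.filter_subset _ _))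
  · intro t ht e he d hd
    rw [← hc] at he
    exact h.nt t ht e he d (Finset.mem_filter.1 hd).1
  · intro t ht b hb b' hbb hbt
    unfold Used
    rw [← hc]
    rcases h.cov t ht b (h12 hb) b' hbb hbt with h1 | ⟨g, hg, d, hd, hdb⟩
    · exact Or.inl h1
    · refine Or.inr ⟨g, hg, d, Finset.mem_filter.2 ⟨hd, ?_⟩, hdb⟩
      intro h1
      have h2 := ((h.cs.wave t ht).link.flow g hg).inc d hd
      rw [hdb, hbb, h1, Sym2.eq_iff] at h2
      rcases h2 with h2 | h2 <;> exact hbt (h2.2.trans h2.1.symm)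

theorem Unh.unloop {I : E → Sym2 V} {F1 F2 : Set E} {T : Set V} {t : V}
    (h12 : F1 ⊆ F2) (hl : ∀ e ∈ F2, e ∉ F1 → ∃ x, I e = s(x, x)) (h : Unh I F2 T t) : Unh I F1 T t := by
  intro S p hW b hb b' hbb hbt
  have hc := cut_unloop h12 hl S
  have h1 := h S p (hW.back h12 (by rw [hc]; exact cut_sub)) b (h12 hb) b' hbb hbt
  unfold Used at h1 ⊢
  rw [hc] at h1; exact h1

theorem lift_link {I : E → Sym2 V} {F : Set E} {T : Set V} {φ : V → V} (hφ : IsCon T φ)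
    {L : Finset (E × V × V)} {t τ : V} (hL : TLink (con I φ) F T L t τ) :
    ∃ (M : Finset (E × V × V)) (h k : E), h ∈ cut I F {v | φ v = t} ∧ k ∈ cut I F {v | φ v = τ} ∧ h ∈ ed L ∧ k ∈ ed L ∧
      Flow I F M (inE I {v | φ v = t} h) (inE I {v | φ v = τ} k) ∧ ed M = ed L ∧
      (∀ d ∈ M, φ d.2.1 ∈ T → φ d.2.1 = t) ∧ (∀ d ∈ M, φ d.2.2 ∈ T → φ d.2.2 = τ) ∧
      (∀ σ ∈ T, ∀ g ∈ ed L, g ∈ cut I F {v | φ v = σ} → (g = h ∧ σ = t) ∨ (g = k ∧ σ = τ)) ∧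
      (∀ σ ∈ T, ∀ g ∈ ed L, g ∉ Ins I F {v | φ v = σ}) := by
  have hnt : ∀ d ∈ L, d.2.2 ≠ t := fun d hd h => hL.ne ((hL.tgt d hd (h ▸ hL.mem)).symm.trans h)
  have hnτ : ∀ d ∈ L, d.2.1 ≠ τ := fun d hd h => hL.ne (h.symm.trans (hL.src d hd (h ▸ hL.mem')))
  obtain ⟨d1, hd1, hd1t, -⟩ := hL.flow.first hL.ne.symm
  have hu1 : ∀ d ∈ L, d.2.1 = t → d = d1 := fun d hd h => (hL.flow.src_uniq hnt hd hd1 h hd1t).1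
  have hrτ : ∀ d ∈ rev L, d.2.2 ≠ τ := by
    rintro ⟨e, x, y⟩ hd
    exact hnτ _ (mem_rev.1 hd)
  obtain ⟨⟨e2, y2, x2⟩, hd2', hd2t, -⟩ := hL.flow.rev.first hL.ne
  have hd2 := mem_rev.1 hd2'
  simp only at hd2t
  subst hd2t
  have hu2 : ∀ d ∈ L, d.2.2 = y2 → d = (e2, x2, y2) := by
    rintro ⟨e, x, y⟩ hd h
    simp only at h; subst h
    have := (hL.flow.rev.src_uniq hrτ (mem_rev.2 hd) hd2' rfl rfl).1
    simp only [Prod.mk.injEq] at this ⊢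
    tauto
  have hne : Nonempty V := ⟨t⟩
  have hex : ∀ d ∈ L, ∃ a b, I d.1 = s(a, b) ∧ φ a = d.2.1 ∧ φ b = d.2.2 := fun d hd => con_ex (hL.flow.inc d hd)
  choose! α β hαβ hα hβ using hex
  have hloop : ∀ d ∈ L, ∀ σ ∈ T, d.1 ∉ Ins I F {v | φ v = σ} := by
    intro d hd σ hσ h
    have h1 := (mem_Ins (hαβ d hd)).1 h
    have h2 : d.2.1 = σ := (hα d hd).symm.trans h1.2.1
    have h3 : d.2.2 = σ := (hβ d hd).symm.trans h1.2.2
    exact hL.ne (((hL.tgt d hd (h3 ▸ hσ)).symm.trans (h3.trans h2.symm)).trans (hL.src d hd (h2 ▸ hσ)))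
  have hcut1 : d1.1 ∈ cut I F {v | φ v = t} := ⟨hL.flow.mem _ hd1, α d1, β d1, hαβ _ hd1, (hα _ hd1).trans hd1t,
    fun h => hnt _ hd1 ((hβ _ hd1).symm.trans h)⟩
  have hcut2 : e2 ∈ cut I F {v | φ v = y2} := ⟨hL.flow.mem _ hd2, β (e2, x2, y2), α (e2, x2, y2),
    (hαβ _ hd2).trans Sym2.eq_swap, hβ _ hd2, fun h => hnτ _ hd2 ((hα _ hd2).symm.trans h)⟩
  have hin1 : inE I {v | φ v = t} d1.1 = α d1 := inE_eq (hαβ _ hd1) ((hα _ hd1).trans hd1t)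
    (fun h => hnt _ hd1 ((hβ _ hd1).symm.trans h))
  have hin2 : inE I {v | φ v = y2} e2 = β (e2, x2, y2) := inE_eq ((hαβ _ hd2).trans Sym2.eq_swap) (hβ _ hd2)
    (fun h => hnτ _ hd2 ((hα _ hd2).symm.trans h))
  set f : E × V × V → E × V × V := fun d => (d.1, α d, β d) with hf
  have hfinj : Set.InjOn f (L : Set (E × V × V)) := by
    intro d hd d' hd' h
    have h' : (f d).1 = (f d').1 := by rw [h]
    exact hL.flow.inj d hd d' hd' h'
  refine ⟨L.image f, d1.1, e2, hcut1, hcut2, mem_ed hd1, mem_ed hd2, ?_, ?_, ?_, ?_, ?_, ?_⟩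
  · rw [hin1, hin2]
    refine ⟨?_, ?_, ?_, ?_⟩
    · intro d hd
      obtain ⟨d', hd', rfl⟩ := Finset.mem_image.1 hd
      exact hL.flow.mem d' hd'
    · intro d hd
      obtain ⟨d', hd', rfl⟩ := Finset.mem_image.1 hd
      exact hαβ d' hd'
    · intro d hd d' hd' h
      obtain ⟨c, hc, rfl⟩ := Finset.mem_image.1 hd
      obtain ⟨c', hc', rfl⟩ := Finset.mem_image.1 hd'
      rw [hL.flow.inj c hc c' hc' h]
    · intro g
      rw [Finset.sum_image hfinj]
      have h1 := hL.flow.pot (fun v => if v = t then g (α d1) else if v = y2 then g (β (e2, x2, y2)) else g v)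
      simp only [if_true, if_neg hL.ne] at h1
      rw [← h1]
      refine Finset.sum_congr rfl fun d hd => ?_
      have h2 : g (α d) = if d.2.1 = t then g (α d1) else if d.2.1 = y2 then g (β (e2, x2, y2)) else g d.2.1 := by
        by_cases h : d.2.1 = t
        · rw [if_pos h, hu1 d hd h]
        · rw [if_neg h, if_neg (hnτ d hd)]
          rcases hφ.alt (α d) with h3 | h3
          · rw [← hα d hd, h3]
          · rw [hα d hd] at h3; exact absurd (hL.src d hd h3) h
      have h3 : g (β d) = if d.2.2 = t then g (α d1) else if d.2.2 = y2 then g (β (e2, x2, y2)) else g d.2.2 := by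
        rw [if_neg (hnt d hd)]
        by_cases h : d.2.2 = y2
        · rw [if_pos h, hu2 d hd h]
        · rw [if_neg h]
          rcases hφ.alt (β d) with h3 | h3
          · rw [← hβ d hd, h3]
          · rw [hβ d hd] at h3; exact absurd (hL.tgt d hd h3) h
      rw [← h2, ← h3]
  · ext e
    constructor
    · rintro ⟨d, hd, rfl⟩
      obtain ⟨d', hd', rfl⟩ := Finset.mem_image.1 hd
      exact ⟨d', hd', rfl⟩
    · rintro ⟨d, hd, rfl⟩
      exact ⟨f d, Finset.mem_image_of_mem f hd, rfl⟩
  · intro d hd hT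
    obtain ⟨d', hd', rfl⟩ := Finset.mem_image.1 hd
    simp only [hf] at hT ⊢
    rw [hα d' hd'] at hT ⊢
    exact hL.src d' hd' hT
  · intro d hd hT
    obtain ⟨d', hd', rfl⟩ := Finset.mem_image.1 hd
    simp only [hf] at hT ⊢
    rw [hβ d' hd'] at hT ⊢
    exact hL.tgt d' hd' hT
  · rintro σ hσ g ⟨d, hd, rfl⟩ ⟨-, a, b, hab, ha, hb⟩
    have ha : φ a = σ := ha
    rw [hαβ d hd, Sym2.eq_iff] at hab
    rcases hab with h | h
    · left
      have h1 : d.2.1 = σ := by rw [← hα d hd, h.1]; exact ha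
      have h2 := hL.src d hd (h1 ▸ hσ)
      exact ⟨by rw [hu1 d hd h2], h1.symm.trans h2⟩
    · right
      have h1 : d.2.2 = σ := by rw [← hβ d hd, h.2]; exact ha
      have h2 := hL.tgt d hd (h1 ▸ hσ)
      exact ⟨by rw [hu2 d hd h2], h1.symm.trans h2⟩
  · rintro σ hσ g ⟨d, hd, rfl⟩
    exact hloop d hd σ hσ

theorem lift_TLink {I : E → Sym2 V} {F : Set E} {T : Set V} {φ : V → V} {p : V → E → Finset (E × V × V)}
    (hcs : CS I F T φ p) (hnt : ∀ t ∈ T, ∀ e ∈ cut I F {v | φ v = t}, ∀ d ∈ p t e, d.2.2 ≠ t)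
    {L : Finset (E × V × V)} {t τ : V} (hL : TLink (con I φ) F T L t τ) :
    ∃ (M : Finset (E × V × V)) (h k : E), TLink I F T M t τ ∧ h ∈ cut I F {v | φ v = t} ∧ k ∈ cut I F {v | φ v = τ} ∧
      h ∈ ed L ∧ k ∈ ed L ∧ ed M = ed (p t h) ∪ ed L ∪ ed (p τ k) ∧
      (∀ σ ∈ T, ∀ g ∈ ed L, g ∈ cut I F {v | φ v = σ} → (g = h ∧ σ = t) ∨ (g = k ∧ σ = τ)) ∧
      (∀ σ ∈ T, ∀ g ∈ ed L, g ∉ Ins I F {v | φ v = σ}) := by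
  obtain ⟨M, h, k, hh, hk, hhL, hkL, hM, hed, hs, htg, huq, hin⟩ := lift_link hcs.con hL
  have hf1 := (hcs.wave t hL.mem).link.flow h hh
  have hf2 := (hcs.wave τ hL.mem').link.flow k hk
  have hfl1 : Flow I F (p t h ∪ M) t (inE I {v | φ v = τ} k) := by
    refine (hf1.mono Ins_sub).append hM ?_
    rw [hed, Set.disjoint_left]
    intro g hg hg'
    exact hin t hL.mem g hg' (hf1.ed_sub hg)
  have hfl : Flow I F (p t h ∪ M ∪ rev (p τ k)) t τ := by
    refine hfl1.append (hf2.mono Ins_sub).rev ?_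
    rw [ed_rev, ed_union, Set.disjoint_left]
    rintro g (hg | hg) hg'
    · obtain ⟨v, h1, h2⟩ := Ins_disj (hf1.ed_sub hg) (hf2.ed_sub hg')
      have h1 : φ v = t := h1
      have h2 : φ v = τ := h2
      exact hL.ne (h2.symm.trans h1)
    · rw [hed] at hg
      exact hin τ hL.mem' g hg (hf2.ed_sub hg')
  have hp1 : ∀ d ∈ p t h, φ d.2.1 = t ∧ φ d.2.2 = t := fun d hd =>
    ((mem_Ins (hf1.inc d hd)).1 (hf1.mem d hd)).2
  have hp2 : ∀ d ∈ p τ k, φ d.2.1 = τ ∧ φ d.2.2 = τ := fun d hd =>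
    ((mem_Ins (hf2.inc d hd)).1 (hf2.mem d hd)).2
  refine ⟨_, h, k, ⟨hfl, hL.mem, hL.mem', hL.ne, ?_, ?_⟩, hh, hk, hhL, hkL, ?_, huq, hin⟩
  · intro d hd hdT
    rw [Finset.mem_union, Finset.mem_union] at hd
    rcases hd with (hd | hd) | hd
    · rw [← hcs.con.fix _ hdT]; exact (hp1 d hd).1
    · have h1 := hcs.con.fix _ hdT
      rw [← h1]; exact hs d hd (by rw [h1]; exact hdT)
    · obtain ⟨g, a, b⟩ := d
      rw [mem_rev] at hd
      have h1 := (hp2 _ hd).2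
      simp only at h1 hdT
      rw [hcs.con.fix _ hdT] at h1
      exact absurd h1 (hnt τ hL.mem' k hk _ hd)
  · intro d hd hdT
    rw [Finset.mem_union, Finset.mem_union] at hd
    rcases hd with (hd | hd) | hd
    · have h1 := (hp1 _ hd).2
      rw [hcs.con.fix _ hdT] at h1
      exact absurd h1 (hnt t hL.mem h hh _ hd)
    · have h1 := hcs.con.fix _ hdT
      rw [← h1]; exact htg d hd (by rw [h1]; exact hdT)
    · obtain ⟨g, a, b⟩ := d
      rw [mem_rev] at hd
      have h1 := (hp2 _ hd).1
      simp only at h1 hdT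
      rw [hcs.con.fix _ hdT] at h1
      exact h1
  · rw [ed_union, ed_union, ed_rev, hed]

theorem SK {I : E → Sym2 V} {F : Set E} {T : Set V} {φ : V → V} {p : V → E → Finset (E × V × V)} (hPar : Par I F T)
    (hSt : St I F T φ p) (hWF : WF (con I φ) F T) {b : E} (hb : b ∈ F) {t b' : V} (ht : t ∈ T) (hbb : I b = s(t, b'))
    (hbt : b' ≠ t) :
    ∃ L τ, TLink I F T L t τ ∧ b ∈ ed L ∧ ∃ ψ q, St I (F \ ed L) T ψ q ∧ WF (con I ψ) (F \ ed L) T := by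
  obtain ⟨h0, hh0, hbh0⟩ : ∃ h ∈ cut I F {v | φ v = t}, b = h ∨ b ∈ ed (p t h) := by
    rcases hSt.cov t ht b hb b' hbb hbt with h1 | ⟨g, hg, h1⟩
    · exact ⟨b, h1, Or.inl rfl⟩
    · exact ⟨g, hg, Or.inr h1⟩
  obtain ⟨L, τ, hL, hhL, φ1, p1, hSt1, hU1⟩ : ∃ L τ, TLink (con I φ) F T L t τ ∧ h0 ∈ ed L ∧ ∃ φ1 p1,
      St (con I φ) (F \ ed L) T φ1 p1 ∧ ∀ σ ∈ T, Unh (con (con I φ) φ1) (F \ ed L) T σ := by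
    obtain ⟨h1, a, c, hac, ha, hc⟩ := hh0
    have ha : φ a = t := ha
    exact K (hPar.cut_con hSt.cs.con) hWF ht h1 (u := φ c) (by rw [con_eq hac, ha]) hc
  obtain ⟨M, h, k, hM, hh, hk, hhL', hkL, hed, huq, hin⟩ := lift_TLink hSt.cs hSt.nt hL
  have hh0h : h0 = h := by
    rcases huq t ht h0 hhL hh0 with h1 | h1
    · exact h1.1
    · exact absurd h1.2.symm hL.ne
  subst hh0h
  have hLM : ed L ⊆ ed M := by rw [hed]; intro g hg; exact Or.inl (Or.inr hg)
  have hf1 := (hSt.cs.wave t ht).link.flow _ hh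
  have hf2 := (hSt.cs.wave τ hL.mem').link.flow k hk
  set F1 := F \ ed M with hF1
  have hF1F : F1 ⊆ F := Set.sdiff_subset
  have hStI : St I F1 T φ p := by
    refine ⟨⟨hSt.cs.con, fun σ hσ => (hSt.cs.wave σ hσ).change (cut_mono hF1F) ?_⟩,
      fun σ hσ e he => hSt.nt σ hσ e (cut_mono hF1F he), ?_⟩
    · intro e he g hg
      have hec := cut_mono hF1F he
      have hgI := ((hSt.cs.wave σ hσ).link.flow e hec).ed_sub hg
      refine ⟨hgI.1, ?_⟩
      rw [hed]
      rintro ((h1 | h1) | h1)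
      · obtain ⟨v, h2, h3⟩ := Ins_disj hgI (hf1.ed_sub h1)
        have h2 : φ v = σ := h2
        have h3 : φ v = t := h3
        have h4 : σ = t := h2.symm.trans h3
        subst h4
        have := (hSt.cs.wave σ hσ).link.uniq hec hh hg h1
        subst this
        exact he.1.2 (hLM hhL)
      · exact hin σ hσ g h1 hgI
      · obtain ⟨v, h2, h3⟩ := Ins_disj hgI (hf2.ed_sub h1)
        have h2 : φ v = σ := h2
        have h3 : φ v = τ := h3
        have h4 : σ = τ := h2.symm.trans h3
        subst h4
        have := (hSt.cs.wave σ hσ).link.uniq hec hk hg h1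
        subst this
        exact he.1.2 (hLM hkL)
    · intro σ hσ c hc c' hcc hct
      rcases hSt.cov σ hσ c hc.1 c' hcc hct with h1 | ⟨g, hg, h1⟩
      · exact Or.inl ⟨hc, h1.2⟩
      · refine Or.inr ⟨g, ⟨⟨hg.1, ?_⟩, hg.2⟩, h1⟩
        have key : ∀ σ', g ∉ Ins I F {v | φ v = σ'} := by
          intro σ' hgI
          obtain ⟨-, x, y, hxy, hx, hy⟩ := hg
          have h2 := (mem_Ins hxy).1 hgI
          have h3 : φ x = σ' := h2.2.1
          have h4 : φ y = σ' := h2.2.2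
          have hx : φ x = σ := hx
          exact hy (h4.trans (h3.symm.trans hx))
        intro hgM
        rw [hed] at hgM
        rcases hgM with (h2 | h2) | h2
        · exact key t (hf1.ed_sub h2)
        · rcases huq σ hσ g h2 hg with ⟨rfl, rfl⟩ | ⟨rfl, rfl⟩
          · exact hc.2 (by rw [hed]; exact Or.inl (Or.inl h1))
          · exact hc.2 (by rw [hed]; exact Or.inr h1)
        · exact key τ (hf2.ed_sub h2)
  have h12 : F1 ⊆ F \ ed L := fun g hg => ⟨hg.1, fun h => hg.2 (hLM h)⟩
  have hl : ∀ e ∈ F \ ed L, e ∉ F1 → ∃ x, con I φ e = s(x, x) := by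
    intro e he he1
    have heM : e ∈ ed M := by
      by_contra h; exact he1 ⟨he.1, h⟩
    obtain ⟨x, y, hxy⟩ := Sym2_ex (I e)
    rw [hed] at heM
    rcases heM with (h2 | h2) | h2
    · have h3 := (mem_Ins hxy).1 (hf1.ed_sub h2)
      have h4 : φ x = t := h3.2.1
      have h5 : φ y = t := h3.2.2
      exact ⟨t, by rw [con_eq hxy, h4, h5]⟩
    · exact absurd h2 he.2
    · have h3 := (mem_Ins hxy).1 (hf2.ed_sub h2)
      have h4 : φ x = τ := h3.2.1
      have h5 : φ y = τ := h3.2.2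
      exact ⟨τ, by rw [con_eq hxy, h4, h5]⟩
  have hSt2 := hSt1.unloop h12 hl
  have hU2 : ∀ σ ∈ T, Unh (con (con I φ) φ1) F1 T σ := by
    intro σ hσ
    refine (hU1 σ hσ).unloop h12 ?_
    intro e he he1
    obtain ⟨x, hx⟩ := hl e he he1
    exact ⟨φ1 x, con_eq hx⟩
  obtain ⟨ψ, q, hq, hWF2, -⟩ := hSt2.comp hU2
  obtain ⟨p', hp'⟩ := hStI.compose hq
  refine ⟨M, τ, hM, ?_, ψ ∘ φ, p', hp', by rw [← con_con]; exact hWF2⟩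
  rcases hbh0 with rfl | h1
  · exact hLM hhL
  · rw [hed]; exact Or.inl (Or.inl h1)

end LC

set_option linter.unusedVariables false

namespace LC
open Classical Cardinal
universe w
variable {V : Type u} {E : Type v} {ι : Type w}

def Qs (I : E → Sym2 V) (F : Set E) (T : Set V) : Prop :=
  Par I F T ∧ ∃ φ p, St I F T φ p ∧ WF (con I φ) F T

/-- non-loop edges at terminals -/
def TE (I : E → Sym2 V) (T : Set V) (b : E) : Prop := ∃ t ∈ T, ∃ b', I b = s(t, b') ∧ b' ≠ t

theorem Qs.start {I : E → Sym2 V} {F : Set E} {T : Set V} (hPar : Par I F T) (hWF : WF I F T) : Qs I F T :=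
  ⟨hPar, id, _, St.triv I F T, by rw [con_id]; exact hWF⟩

theorem Qs.step {I : E → Sym2 V} {F : Set E} {T : Set V} (h : Qs I F T) {b : E} (hb : b ∈ F) (hbT : TE I T b) :
    ∃ L t τ, TLink I F T L t τ ∧ b ∈ ed L ∧ Qs I (F \ ed L) T := by
  obtain ⟨hPar, φ, p, hSt, hWF⟩ := h
  obtain ⟨t, ht, b', hbb, hbt⟩ := hbT
  obtain ⟨L, τ, hL, hbL, ψ, q, hq, hWF'⟩ := SK hPar hSt hWF hb ht hbb hbt
  exact ⟨L, t, τ, hL, hbL, hPar.del hL.flow ht hL.mem', ψ, q, hq, hWF'⟩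

def PL (I : E → Sym2 V) (X : Set E) (T : Set V) : Prop :=
  ∃ 𝓛 : Set (Finset (E × V × V)), (∀ L ∈ 𝓛, ∃ t τ, TLink I X T L t τ) ∧
    (∀ L ∈ 𝓛, ∀ L' ∈ 𝓛, L ≠ L' → Disjoint (ed L) (ed L')) ∧ ∀ b ∈ X, TE I T b → ∃ L ∈ 𝓛, b ∈ ed L

theorem TLink.of_ed {I : E → Sym2 V} {X Y : Set E} {T : Set V} {L : Finset (E × V × V)} {t τ : V}
    (h : TLink I X T L t τ) (h' : ed L ⊆ Y) : TLink I Y T L t τ :=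
  ⟨h.flow.of_ed h', h.mem, h.mem', h.ne, h.src, h.tgt⟩

theorem PL.union {I : E → Sym2 V} {T : Set V} {F0 : Set E} (𝒮 : Set (Set E)) (hd : 𝒮.PairwiseDisjoint id)
    (h : ∀ X ∈ 𝒮, PL I (X ∩ F0) T) : PL I ((⋃₀ 𝒮) ∩ F0) T := by
  choose! 𝓛 h1 h2 h3 using h
  refine ⟨{L | ∃ X ∈ 𝒮, L ∈ 𝓛 X}, ?_, ?_, ?_⟩
  · rintro L ⟨X, hX, hL⟩
    obtain ⟨t, τ, hl⟩ := h1 X hX L hL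
    exact ⟨t, τ, hl.of_ed fun g hg => ⟨⟨X, hX, (hl.flow.ed_sub hg).1⟩, (hl.flow.ed_sub hg).2⟩⟩
  · rintro L ⟨X, hX, hL⟩ L' ⟨X', hX', hL'⟩ hne
    by_cases hXX : X = X'
    · subst hXX; exact h2 X hX L hL L' hL' hne
    · obtain ⟨t, τ, hl⟩ := h1 X hX L hL
      obtain ⟨t', τ', hl'⟩ := h1 X' hX' L' hL'
      exact Set.disjoint_of_subset (fun g hg => (hl.flow.ed_sub hg).1) (fun g hg => (hl'.flow.ed_sub hg).1) (hd hX hX' hXX)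
  · rintro b ⟨⟨X, hX, hbX⟩, hb⟩ hbT
    obtain ⟨L, hL, hbL⟩ := h3 X hX b ⟨hbX, hb⟩ hbT
    exact ⟨L, ⟨X, hX, hL⟩, hbL⟩

theorem coe_fst (L : Finset (E × V × V)) : ((L.image Prod.fst : Finset E) : Set E) = ed L := by
  ext e; simp [ed]

theorem Good_C {I : E → Sym2 V} {F0 B : Set E} {T : Set V} {t0 : V} (ht0 : t0 ∈ T)
    (hPar : Par I (F0 \ B) T) (hWF : WF I (F0 \ B) T) {Z : Set E} (hZ : Z.Countable) :
    ∃ R, B ∪ Z ⊆ R ∧ (R \ B).Countable ∧ PL I ((R \ B) ∩ F0) T ∧ Par I (F0 \ R) T ∧ WF I (F0 \ R) T := by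
  obtain ⟨𝒜, h𝒜, hgood⟩ := GoodH ht0 hPar hWF
  set F := F0 \ B with hF
  have hlk : ∀ (A : Finset E) (b : E), ∃ L : Finset (E × V × V), Qs I (F \ A) T → b ∈ F → b ∉ A → TE I T b →
      (∃ t τ, TLink I (F \ A) T L t τ) ∧ b ∈ ed L ∧ Qs I ((F \ A) \ ed L) T := by
    intro A b
    by_cases h : Qs I (F \ A) T ∧ b ∈ F ∧ b ∉ A ∧ TE I T b
    · obtain ⟨L, t, τ, h1, h2, h3⟩ := h.1.step (b := b) ⟨h.2.1, by simpa using h.2.2.1⟩ h.2.2.2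
      exact ⟨L, fun _ _ _ _ => ⟨⟨t, τ, h1⟩, h2, h3⟩⟩
    · exact ⟨∅, fun h1 h2 h3 h4 => absurd ⟨h1, h2, h3, h4⟩ h⟩
  choose lk hlk using hlk
  let f : Finset E → Set E := fun s => (⋃ A ∈ s.powerset, ⋃ b ∈ s, ed (lk A b)) ∪
    ⋃ e ∈ s, ⋃ e' ∈ s, ⋃ n : ℕ, (if (𝒜 e e' n).Countable then ⋃₀ 𝒜 e e' n else ∅)
  have hf : ∀ s, (f s).Countable := by
    intro s
    refine Set.Countable.union ?_ ?_
    · refine Set.Countable.biUnion (Finset.countable_toSet _) fun C _ => ?_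
      exact Set.Countable.biUnion (Finset.countable_toSet _) fun e _ => (ed_finite _).countable
    · refine Set.Countable.biUnion (Finset.countable_toSet _) fun e _ => ?_
      refine Set.Countable.biUnion (Finset.countable_toSet _) fun e' _ => ?_
      refine Set.countable_iUnion fun n => ?_
      split_ifs with h
      · exact h.sUnion fun a ha => h𝒜 _ _ _ a ha
      · exact Set.countable_empty
  obtain ⟨K, hZK, hKc, hKf⟩ := clos f hf hZ
  have hKB : (B ∪ K) \ B ⊆ K := fun x hx => hx.1.resolve_left hx.2
  have hKlk : ∀ (A : Finset E) (b : E), (A : Set E) ⊆ K → b ∈ K → ed (lk A b) ⊆ K := by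
    intro A b hA hb e he
    refine hKf (insert b A) ?_ (Or.inl ?_)
    · intro x hx
      rw [Finset.coe_insert] at hx
      rcases hx with rfl | hx
      · exact hb
      · exact hA hx
    · simp only [Set.mem_iUnion]
      exact ⟨A, Finset.mem_powerset.2 (Finset.subset_insert _ _), b, Finset.mem_insert_self _ _, he⟩
  refine ⟨B ∪ K, Set.union_subset_union_right _ hZK, hKc.mono hKB, ?_, ?_⟩
  · obtain ⟨g, hg⟩ := inf_enum hKc
    let P : Finset E → E → Prop := fun A b => b ∈ F ∧ b ∉ A ∧ TE I T b ∧ b ∈ K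
    let stp : Finset E → E → Finset E := fun A b => if P A b then A ∪ (lk A b).image Prod.fst else A
    let A : ℕ → Finset E := fun n => Nat.rec (motive := fun _ => Finset E) ∅ (fun n A => (g n).elim A (stp A)) n
    have hA : ∀ n, A (n+1) = (g n).elim (A n) (stp (A n)) := fun n => rfl
    have hA1 : ∀ n b, g n = some b → P (A n) b → A (n+1) = A n ∪ (lk (A n) b).image Prod.fst := by
      intro n b h1 h2
      rw [hA, h1]
      have h3 : stp (A n) b = A n ∪ (lk (A n) b).image Prod.fst := if_pos h2
      exact h3
    have hA2 : ∀ n, (∃ b, g n = some b ∧ P (A n) b) ∨ A (n+1) = A n := by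
      intro n
      rcases hgn : g n with _ | b
      · exact Or.inr (by rw [hA, hgn]; rfl)
      · by_cases h2 : P (A n) b
        · exact Or.inl ⟨b, rfl, h2⟩
        · refine Or.inr ?_
          rw [hA, hgn]
          have h3 : stp (A n) b = A n := if_neg h2
          exact h3
    have hinv : ∀ n, (A n : Set E) ⊆ K ∧ Qs I (F \ (A n : Set E)) T := by
      intro n
      induction n with
      | zero =>
        have h0 : A 0 = ∅ := rfl
        rw [h0, Finset.coe_empty]
        exact ⟨Set.empty_subset _, by simpa using Qs.start hPar hWF⟩
      | succ n ih =>
        rcases hA2 n with ⟨b, h1, h2⟩ | h1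
        · rw [hA1 n b h1 h2, Finset.coe_union, coe_fst]
          refine ⟨Set.union_subset ih.1 (hKlk _ _ ih.1 h2.2.2.2), ?_⟩
          rw [← Set.sdiff_sdiff]
          exact (hlk (A n) b ih.2 h2.1 h2.2.1 h2.2.2.1).2.2
        · rw [h1]; exact ih
    have hmono : Monotone A := monotone_nat_of_le_succ fun n => by
      rcases hA2 n with ⟨b, h1, h2⟩ | h1
      · rw [hA1 n b h1 h2]; exact Finset.subset_union_left
      · rw [h1]
    have hcov : ∀ n, ∀ e ∈ A n, ∃ k b, g k = some b ∧ P (A k) b ∧ e ∈ ed (lk (A k) b) := by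
      intro n
      induction n with
      | zero => intro e he; exact absurd he (Finset.notMem_empty _)
      | succ n ih =>
        intro e he
        rcases hA2 n with ⟨b, h1, h2⟩ | h1
        · rw [hA1 n b h1 h2] at he
          rcases Finset.mem_union.1 he with h | h
          · exact ih e h
          · refine ⟨n, b, h1, h2, ?_⟩
            rw [← coe_fst]; exact h
        · rw [h1] at he; exact ih e he
    have hlink := fun n b (h : P (A n) b) => hlk (A n) b (hinv n).2 h.1 h.2.1 h.2.2.1
    refine ⟨{L | ∃ n b, g n = some b ∧ P (A n) b ∧ L = lk (A n) b}, ?_, ?_, ?_⟩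
    · rintro L ⟨n, b, h1, h2, rfl⟩
      obtain ⟨⟨t, τ, hl⟩, -, -⟩ := hlink n b h2
      refine ⟨t, τ, hl.of_ed fun e he => ?_⟩
      have h3 := hl.flow.ed_sub he
      exact ⟨⟨Or.inr (hKlk _ _ (hinv n).1 h2.2.2.2 he), h3.1.2⟩, h3.1.1⟩
    · have key : ∀ n m b b', n < m → g n = some b → P (A n) b → P (A m) b' →
          Disjoint (ed (lk (A n) b)) (ed (lk (A m) b')) := by
        intro n m b b' hnm h1 h2 h3
        obtain ⟨⟨t, τ, hl⟩, -, -⟩ := hlink m b' h3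
        rw [Set.disjoint_left]
        intro e he he'
        refine (hl.flow.ed_sub he').2 (hmono hnm ?_)
        rw [hA1 n b h1 h2]
        refine Finset.mem_union_right _ ?_
        rw [← coe_fst] at he; exact he
      rintro L ⟨n, b, h1, h2, rfl⟩ L' ⟨m, b', h1', h2', rfl⟩ hne
      rcases lt_trichotomy n m with h | h | h
      · exact key n m b b' h h1 h2 h2'
      · subst h
        rw [h1] at h1'
        cases h1'
        exact absurd rfl hne
      · exact (key m n b' b h h1' h2' h2).symm
    · rintro b ⟨hb, hbF⟩ hbT
      have hbK := hKB hb
      obtain ⟨n, -, hn⟩ := hg b hbK 0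
      by_cases hbA : b ∈ A n
      · obtain ⟨k, c, h1, h2, h3⟩ := hcov n b hbA
        exact ⟨_, ⟨k, c, h1, h2, rfl⟩, h3⟩
      · have h2 : P (A n) b := ⟨⟨hbF, hb.2⟩, hbA, hbT, hbK⟩
        exact ⟨_, ⟨n, b, hn, h2, rfl⟩, (hlink n b h2).2.1⟩
  · refine hgood (B ∪ K) Set.subset_union_left ?_
    intro e he e' he' n
    by_cases hc : (𝒜 e e' n).Countable
    · left
      intro a ha x hx
      right
      refine hKf {e, e'} ?_ (Or.inr ?_)
      · intro y hy
        simp only [Finset.coe_insert, Finset.coe_singleton, Set.mem_insert_iff, Set.mem_singleton_iff] at hy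
        rcases hy with rfl | rfl
        · exact hKB he
        · exact hKB he'
      · simp only [Set.mem_iUnion]
        refine ⟨e, by simp, e', by simp, n, ?_⟩
        rw [if_pos hc]; exact ⟨a, ha, hx⟩
    · right
      have h1 : ℵ₀ < #(𝒜 e e' n) := by
        rw [← not_le]; intro h; exact hc (Cardinal.le_aleph0_iff_set_countable.1 h)
      exact ⟨lt_of_le_of_lt (mk_cnt le_rfl (hKc.mono hKB)) h1, h1⟩

theorem perfect {I : E → Sym2 V} {F0 : Set E} {T : Set V} {t0 : V} (ht0 : t0 ∈ T) (hPar : Par I F0 T)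
    (hWF : WF I F0 T) : PL I F0 T := by
  have h := chain (fun Q => Par I (F0 \ Q) T ∧ WF I (F0 \ Q) T) (fun X => PL I (X ∩ F0) T) PL.union
    (fun B hB => GoodH ht0 hB.1 hB.2) (fun B Z hB hZ => Good_C ht0 hB.1 hB.2 hZ) (B := ∅) (by simpa using ⟨hPar, hWF⟩)
  simpa using h

end LC


namespace LC
open Classical Cardinal

/-- directed walks along darts -/
inductive DW {V : Type u} {E : Type v} (D : Set (E × V × V)) : List V → List E → Prop
  | nil (v : V) : DW D [v] []
  | cons {x y : V} {vs : List V} {e : E} {es : List E} :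
      (e, x, y) ∈ D → DW D (y :: vs) es → DW D (x :: y :: vs) (e :: es)

theorem DW.suffix {V : Type u} {E : Type v} {D : Set (E × V × V)} (a : V) (r : List V) :
    ∀ (l : List V) (es : List E), DW D (l ++ a :: r) es → ∃ es', DW D (a :: r) es' := by
  intro l
  induction l with
  | nil => intro es h; exact ⟨es, h⟩
  | cons x l ih =>
    intro es h
    cases l with
    | nil =>
      cases h with
      | cons h1 h2 => exact ⟨_, h2⟩
    | cons y l =>
      cases h with
      | cons h1 h2 => exact ih _ h2

theorem DReach.walk {V : Type u} {E : Type v} {D : Set (E × V × V)} {a b : V} (h : DReach D a b) :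
    ∃ vs es, DW D (a :: vs) es ∧ (a :: vs).Nodup ∧ (a :: vs).getLast? = some b := by
  unfold DReach at h
  induction h using Relation.ReflTransGen.head_induction_on with
  | refl => exact ⟨[], [], DW.nil _, by simp, by simp⟩
  | head h1 h2 ih =>
    rename_i x y
    obtain ⟨vs, es, hw, hn, hl⟩ := ih
    by_cases hx : x ∈ y :: vs
    · obtain ⟨l, r, hlr⟩ := List.append_of_mem hx
      rw [hlr] at hw hn hl
      obtain ⟨es', hes⟩ := DW.suffix x r l es hw
      refine ⟨r, es', hes, (List.nodup_append.1 hn).2.1, ?_⟩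
      rw [List.getLast?_append] at hl
      simpa using hl
    · obtain ⟨e, he⟩ := h1
      refine ⟨y :: vs, e :: es, DW.cons he hw, List.nodup_cons.2 ⟨hx, hn⟩, ?_⟩
      rw [List.getLast?_cons_cons]; exact hl

theorem DW.isWalk {V : Type u} {E : Type v} {G : Grapht V E} {D : Set (E × V × V)}
    (hD : ∀ d ∈ D, G.I d.1 = s(d.2.1, d.2.2)) {vs : List V} {es : List E} (h : DW D vs es) : G.IsWalk vs es := by
  induction h with
  | nil v => exact Grapht.IsWalk.nil v
  | cons h1 h2 ih => exact Grapht.IsWalk.cons (hD _ h1) ih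

theorem DW.edges {V : Type u} {E : Type v} {D : Set (E × V × V)} {vs : List V} {es : List E} (h : DW D vs es) :
    ∀ e ∈ es, ∃ d ∈ D, d.1 = e := by
  induction h with
  | nil v => intro e he; simp at he
  | cons h1 h2 ih =>
    intro e he
    rcases List.mem_cons.1 he with rfl | he
    · exact ⟨_, h1, rfl⟩
    · exact ih e he

theorem DW.srcs {V : Type u} {E : Type v} {D : Set (E × V × V)} {vs : List V} {es : List E} (h : DW D vs es) :
    ∀ x ∈ vs.dropLast, ∃ d ∈ D, d.2.1 = x := by
  induction h with
  | nil v => intro e he; simp at he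
  | cons h1 h2 ih =>
    intro e he
    rw [List.dropLast_cons_cons] at he
    rcases List.mem_cons.1 he with rfl | he
    · exact ⟨_, h1, rfl⟩
    · exact ih e he

theorem DW.tgts {V : Type u} {E : Type v} {D : Set (E × V × V)} {vs : List V} {es : List E} (h : DW D vs es) :
    ∀ x ∈ vs.tail, ∃ d ∈ D, d.2.2 = x := by
  induction h with
  | nil v => intro e he; simp at he
  | cons h1 h2 ih =>
    intro e he
    rw [List.tail_cons] at he
    rcases List.mem_cons.1 he with rfl | he
    · exact ⟨_, h1, rfl⟩
    · exact ih e he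

theorem walk_cross {V : Type u} {E : Type v} {G : Grapht V E} {S : Set V} {vs : List V} {es : List E}
    (h : G.IsWalk vs es) : ∀ a b, vs.head? = some a → vs.getLast? = some b → ¬ (a ∈ S ↔ b ∈ S) →
      ∃ e ∈ G.edgeCut S, e ∈ es := by
  induction h with
  | nil v =>
    intro a b h1 h2 h3
    simp at h1 h2
    subst h1; subst h2
    exact absurd Iff.rfl h3
  | @cons x y vs e es h1 h2 ih =>
    intro a b ha hb hS
    rw [List.head?_cons] at ha
    cases ha
    rw [List.getLast?_cons_cons] at hb
    by_cases hxy : x ∈ S ↔ y ∈ S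
    · obtain ⟨g, hg, hg'⟩ := ih y b rfl hb (fun h => hS (hxy.trans h))
      exact ⟨g, hg, List.mem_cons_of_mem _ hg'⟩
    · refine ⟨e, ?_, List.mem_cons_self⟩
      by_cases hx : x ∈ S
      · exact ⟨x, y, h1, hx, fun hy => hxy ⟨fun _ => hy, fun _ => hx⟩⟩
      · refine ⟨y, x, by rw [h1, Sym2.eq_swap], ?_, hx⟩
        by_contra hy
        exact hxy ⟨fun h => absurd h hx, fun h => absurd h hy⟩

theorem cut_univ {V : Type u} {E : Type v} (G : Grapht V E) (S : Set V) : cut G.I Set.univ S = G.edgeCut S := by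
  ext e
  constructor
  · rintro ⟨-, a, b, h⟩; exact ⟨a, b, h⟩
  · rintro ⟨a, b, h⟩; exact ⟨trivial, a, b, h⟩

theorem TLink.path {V : Type u} {E : Type v} {G : Grapht V E} {M : Finset (E × V × V)} {t τ : V}
    (h : TLink G.I Set.univ G.T M t τ) :
    ∃ P : G.Path, G.IsTPath P ∧ P.first = t ∧ P.last = τ ∧ ∀ e ∈ P.edges, e ∈ ed M := by
  obtain ⟨vs, es, hw, hn, hl⟩ := h.flow.reach.walk
  refine ⟨⟨t, τ, t :: vs, es, hw.isWalk h.flow.inc, hn, rfl, hl⟩, ⟨h.mem, h.mem', fun h1 => h.ne h1.symm, ?_⟩,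
    rfl, rfl, hw.edges⟩
  intro v hv hvT
  have hv : v ∈ ((t :: vs).drop 1).dropLast := hv
  have h1 : v ∈ (t :: vs).tail := by
    rw [List.drop_one] at hv; exact List.mem_of_mem_dropLast hv
  have h2 : v ∈ (t :: vs).dropLast := by
    rw [List.drop_one, List.tail_cons] at hv
    cases vs with
    | nil => simp at hv
    | cons y vs => rw [List.dropLast_cons_cons]; exact List.mem_cons_of_mem _ hv
  obtain ⟨d, hd, hdv⟩ := hw.tgts v h1
  obtain ⟨d', hd', hdv'⟩ := hw.srcs v h2
  have h3 := h.tgt d hd (by rw [hdv]; exact hvT)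
  have h4 := h.src d' hd' (by rw [hdv']; exact hvT)
  exact h.ne (by rw [← h3, ← h4, hdv, hdv'])

theorem main {V : Type u} {E : Type v} (G : Grapht V E) (hG : G.InnerEulerian) :
    ∃ (Ps : Set G.Path) (X : V → Set V), G.IsTPathSystem Ps ∧
      (∀ t ∈ G.T, t ∈ X t) ∧
      (∀ t ∈ G.T, ∀ t' ∈ G.T, t ≠ t' → Disjoint (X t) (X t')) ∧
      ∀ t ∈ G.T, G.Separates (G.edgeCut (X t)) {t} (G.T \ {t}) ∧
        G.Orthogonal (G.edgeCut (X t)) {P ∈ Ps | P.first = t ∨ P.last = t} := by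
  have hPar : Par G.I Set.univ G.T := by
    intro D hD hf
    rw [cut_univ] at hf ⊢
    rw [← Nat.not_odd_iff_even]
    exact fun h => hG D hD ⟨hf, h⟩
  obtain ⟨t0, ht0⟩ := G.T_nontrivial.nonempty
  obtain ⟨φ, p0, hcs0, hWF⟩ := max_CS G.I Set.univ G.T
  obtain ⟨p, hcs, hcl⟩ := hcs0.clean
  have hnt : ∀ t ∈ G.T, ∀ e ∈ cut G.I Set.univ {v | φ v = t}, ∀ d ∈ p t e, d.2.2 ≠ t :=
    fun t ht e he => (hcl t ht e he).2.no_tgt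
  have hfix := hcs.con.fix
  obtain ⟨𝓛, hL1, hL2, hL3⟩ := perfect ht0 (hPar.cut_con hcs.con) hWF
  have hP : ∀ L : Finset (E × V × V), L ∈ 𝓛 → ∃ (P : G.Path) (h k : E), G.IsTPath P ∧
      h ∈ cut G.I Set.univ {v | φ v = P.first} ∧ k ∈ cut G.I Set.univ {v | φ v = P.last} ∧
      h ∈ ed L ∧ k ∈ ed L ∧ (∀ e ∈ P.edges, e ∈ ed (p P.first h) ∪ ed L ∪ ed (p P.last k)) ∧
      (∀ σ ∈ G.T, ∀ g ∈ ed L, g ∈ cut G.I Set.univ {v | φ v = σ} → (g = h ∧ σ = P.first) ∨ (g = k ∧ σ = P.last)) ∧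
      (∀ σ ∈ G.T, ∀ g ∈ ed L, g ∉ Ins G.I Set.univ {v | φ v = σ}) := by
    intro L hL
    obtain ⟨t, τ, hl⟩ := hL1 L hL
    obtain ⟨M, h, k, hM, h1, h2, h3, h4, h5, h6, h7⟩ := lift_TLink hcs hnt hl
    obtain ⟨P, hPT, rfl, rfl, hPe⟩ := hM.path
    exact ⟨P, h, k, hPT, h1, h2, h3, h4, fun e he => h5 ▸ hPe e he, h6, h7⟩
  have hsub : ∀ t ∈ G.T, ∀ h ∈ cut G.I Set.univ {v | φ v = t}, ed (p t h) ⊆ Ins G.I Set.univ {v | φ v = t} :=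
    fun t ht h hh => ((hcs.wave t ht).link.flow h hh).ed_sub
  have hpd : ∀ t ∈ G.T, ∀ h ∈ cut G.I Set.univ {v | φ v = t}, ∀ t' ∈ G.T, ∀ h' ∈ cut G.I Set.univ {v | φ v = t'},
      ∀ e, e ∈ ed (p t h) → e ∈ ed (p t' h') → h = h' := by
    intro t ht h hh t' ht' h' hh' e he he'
    by_cases htt : t = t'
    · subst htt
      exact (hcs.wave t ht).link.uniq hh hh' he he'
    · exfalso
      obtain ⟨a, b, hab⟩ := Sym2_ex (G.I e)
      have h1 : φ a = t := (hsub t ht h hh he).2 a (by rw [hab]; simp)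
      have h2 : φ a = t' := (hsub t' ht' h' hh' he').2 a (by rw [hab]; simp)
      exact htt (h1.symm.trans h2)
  have hIC : ∀ t t' e, e ∈ Ins G.I Set.univ {v | φ v = t} → e ∉ cut G.I Set.univ {v | φ v = t'} := by
    rintro t t' e ⟨-, h1⟩ ⟨-, a, b, hab, h2, h3⟩
    have h4 : φ a = t := h1 a (by rw [hab]; simp)
    have h5 : φ b = t := h1 b (by rw [hab]; simp)
    have h2 : φ a = t' := h2
    exact h3 (h5.trans (h4.symm.trans h2))
  rcases isEmpty_or_nonempty E with hE | hE
  · refine ⟨∅, fun t => {t}, ⟨fun P hP => absurd hP (Set.notMem_empty _), fun P hP => absurd hP (Set.notMem_empty _)⟩,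
      fun t _ => rfl, fun t _ t' _ hne => by simpa using hne, fun t ht => ⟨?_, ?_, fun e => hE.elim e⟩⟩
    · rintro Q ⟨h1, h2, -⟩
      refine walk_cross Q.isWalk Q.first Q.last Q.head_eq Q.getLast_eq ?_
      exact fun h4 => h2.2 (h4.1 h1)
    · rintro P ⟨h1, -⟩
      exact absurd h1 (Set.notMem_empty _)
  have hNP : Nonempty G.Path := ⟨⟨t0, t0, [t0], [], Grapht.IsWalk.nil t0, by simp, rfl, rfl⟩⟩
  choose! P h k hPT hh hk hhL hkL hPe hcut hins using hP
  have hone : ∀ L ∈ 𝓛, ∀ σ ∈ G.T, ∀ e ∈ (P L).edges, e ∈ cut G.I Set.univ {v | φ v = σ} →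
      (e = h L ∧ σ = (P L).first) ∨ (e = k L ∧ σ = (P L).last) := by
    intro L hL σ hσ e he hec
    rcases hPe L hL e he with (h1 | h1) | h1
    · exact absurd hec (hIC _ _ _ (hsub _ (hPT L hL).1 _ (hh L hL) h1))
    · exact hcut L hL σ hσ e h1 hec
    · exact absurd hec (hIC _ _ _ (hsub _ (hPT L hL).2.1 _ (hk L hL) h1))
  have hcross : ∀ (Q : G.Path) (σ : V), G.IsTPath Q → (Q.first = σ ∨ Q.last = σ) →
      ∃ e ∈ G.edgeCut {v | φ v = σ}, e ∈ Q.edges := by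
    intro Q σ hQ hσ
    refine walk_cross Q.isWalk Q.first Q.last Q.head_eq Q.getLast_eq ?_
    have h1 := hfix _ hQ.1
    have h2 := hfix _ hQ.2.1
    have h3 := hQ.2.2.1
    intro h4
    have h4 : φ Q.first = σ ↔ φ Q.last = σ := h4
    rw [h1, h2] at h4
    rcases hσ with h5 | h5
    · exact h3 (h5.trans (h4.1 h5).symm)
    · exact h3 ((h4.2 h5).trans h5.symm)
  refine ⟨P '' 𝓛, fun t => {v | φ v = t}, ⟨?_, ?_⟩, fun t ht => hfix t ht, ?_, ?_⟩
  · rintro _ ⟨L, hL, rfl⟩ _ ⟨L', hL', rfl⟩ hne e he he'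
    have hLL : L ≠ L' := fun h => hne (by rw [h])
    have hd := Set.disjoint_left.1 (hL2 L hL L' hL' hLL)
    have aux : ∀ L ∈ 𝓛, ∀ e ∈ (P L).edges, e ∈ ed L ∨
        ∃ t ∈ G.T, ∃ g ∈ cut G.I Set.univ {v | φ v = t}, g ∈ ed L ∧ e ∈ ed (p t g) := by
      intro L hL e he
      rcases hPe L hL e he with (h1 | h1) | h1
      · exact Or.inr ⟨_, (hPT L hL).1, _, hh L hL, hhL L hL, h1⟩
      · exact Or.inl h1
      · exact Or.inr ⟨_, (hPT L hL).2.1, _, hk L hL, hkL L hL, h1⟩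
    rcases aux L hL e he with h1 | ⟨t, ht, g, hg, hgL, h1⟩ <;>
      rcases aux L' hL' e he' with h1' | ⟨t', ht', g', hg', hgL', h1'⟩
    · exact hd h1 h1'
    · exact hins L hL t' ht' e h1 (hsub _ ht' _ hg' h1')
    · exact hins L' hL' t ht e h1' (hsub _ ht _ hg h1)
    · have := hpd t ht g hg t' ht' g' hg' e h1 h1'
      subst this
      exact hd hgL hgL'
  · rintro _ ⟨L, hL, rfl⟩
    exact hPT L hL
  · intro t ht t' ht' hne
    rw [Set.disjoint_left]
    intro v hv hv'
    exact hne (Eq.trans (Eq.symm hv) hv')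
  · intro t ht
    refine ⟨?_, ?_, ?_⟩
    · rintro Q ⟨h1, h2, -⟩
      have h1 : Q.first = t := h1
      refine walk_cross Q.isWalk Q.first Q.last Q.head_eq Q.getLast_eq ?_
      intro h4
      have h4 : φ Q.first = t ↔ φ Q.last = t := h4
      rw [h1, hfix t ht, hfix _ h2.1] at h4
      exact h2.2 (h4.1 rfl)
    · rintro _ ⟨⟨L, hL, rfl⟩, ho⟩
      obtain ⟨e, he, he'⟩ := hcross (P L) t (hPT L hL) ho
      refine ⟨e, ⟨he, he'⟩, ?_⟩
      rintro g ⟨hg, hg'⟩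
      have hne := (hPT L hL).2.2.1
      rw [← cut_univ] at he hg
      rcases hone L hL t ht e he' he with ⟨h1, h2⟩ | ⟨h1, h2⟩ <;>
        rcases hone L hL t ht g hg' hg with ⟨h3, h4⟩ | ⟨h3, h4⟩
      · rw [h1, h3]
      · exact absurd (h2.symm.trans h4) hne
      · exact absurd (h4.symm.trans h2) hne
      · rw [h1, h3]
    · intro e he
      have hec : e ∈ cut G.I Set.univ {v | φ v = t} := by rw [cut_univ]; exact he
      obtain ⟨a, b, hab, ha, hb⟩ := he
      have ha : φ a = t := ha
      have hb : φ b ≠ t := hb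
      obtain ⟨L, hL, heL⟩ := hL3 e trivial ⟨t, ht, φ b, by rw [con_eq hab, ha], hb⟩
      have ho := hcut L hL t ht e heL hec
      have ho' : (P L).first = t ∨ (P L).last = t := by
        rcases ho with ⟨-, h2⟩ | ⟨-, h2⟩
        · exact Or.inl h2.symm
        · exact Or.inr h2.symm
      refine ⟨P L, ⟨⟨L, hL, rfl⟩, ho'⟩, ?_⟩
      obtain ⟨g, hg, hg'⟩ := hcross (P L) t (hPT L hL) ho'
      rw [← cut_univ] at hg
      have hne := (hPT L hL).2.2.1
      have : e = g := by
        rcases ho with ⟨h1, h2⟩ | ⟨h1, h2⟩ <;>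
          rcases hone L hL t ht g hg' hg with ⟨h3, h4⟩ | ⟨h3, h4⟩
        · rw [h1, h3]
        · exact absurd (h2.symm.trans h4) hne
        · exact absurd (h4.symm.trans h2) hne
        · rw [h1, h3]
      rw [this]; exact hg'

end LC

/-- The infinite Lovász–Cherkassky theorem with nested witnessing cuts: the cuts can be
chosen as `δ(X t)` for a family of pairwise disjoint vertex sets `X t ∋ t`. -/
theorem infinite_lovasz_cherkassky_nested {V : Type u} {E : Type v} (G : Grapht V E)
    (hG : G.InnerEulerian) :
    ∃ (Ps : Set G.Path) (X : V → Set V), G.IsTPathSystem Ps ∧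
      (∀ t ∈ G.T, t ∈ X t) ∧
      (∀ t ∈ G.T, ∀ t' ∈ G.T, t ≠ t' → Disjoint (X t) (X t')) ∧
      ∀ t ∈ G.T, G.Separates (G.edgeCut (X t)) {t} (G.T \ {t}) ∧
        G.Orthogonal (G.edgeCut (X t)) {P ∈ Ps | P.first = t ∨ P.last = t} := by
  exact LC.main G hG
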